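/- Let Σ ⊆ ℝ² be a planar domain that is not simply connected. Then there exist an open set Ω ⊆ 𝔻 and a minimal graph u on Ω with u > 0 everywhere such that, setting S = closure in 𝔻 × ℝ of {(x, u(x)) : x ∈ Ω} ∪ {(x, −u(x)) : x ∈ Ω}, the set S is homeomorphic to Σ, S ∩ (𝔻 × (0, +∞)) = {(x, u(x)) : x ∈ Ω}, S is invariant under (x, t) ↦ (x, −t), and moreover for any two distinct ends E₁ ≠ E₂ of S, the limit sets L(E₁) and L(E₂) in ∂∞(𝔻 × ℝ) are disjoint. -/

import Mathlib

noncomputable section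

open Filter MeasureTheory Set Topology
open scoped RealInnerProductSpace Topology

/-- The Euclidean plane, as a Euclidean space. -/
abbrev E2 : Type := EuclideanSpace ℝ (Fin 2)

/-- The Poincaré disk. -/
def Disk : Set E2 := {p : E2 | ‖p‖ < 1}

/-- Conformal factor of the hyperbolic metric. -/
def lam (p : E2) : ℝ := 2 / (1 - ‖p‖ ^ 2)

/-- Inverse hyperbolic cosine. -/
def arcosh (x : ℝ) : ℝ := Real.log (x + Real.sqrt (x ^ 2 - 1))

/-- Hyperbolic distance on the Poincaré disk. -/
def hDist (p q : E2) : ℝ :=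
  arcosh (1 + 2 * ‖p - q‖ ^ 2 / ((1 - ‖p‖ ^ 2) * (1 - ‖q‖ ^ 2)))

/-- Hyperbolic distance from a point to a set. -/
def hDistSet (a : E2) (S : Set E2) : ℝ := sInf (hDist a '' S)

/-- Hyperbolic length of a subset of the disk, via the 1-dimensional Hausdorff measure. -/
def hLen (S : Set E2) : ℝ := ∫ p in S, lam p ∂(μH[1])

/-- Hyperbolic length of a parametrized curve. -/
def hLength (γ : ℝ → E2) (a b : ℝ) : ℝ := ∫ t in a..b, lam (γ t) * ‖deriv γ t‖

/-- The Poincaré-to-Klein point transfer map. -/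
def toKlein (p : E2) : E2 := (2 / (1 + ‖p‖ ^ 2)) • p

/-- The geodesic arc of the Poincaré disk joining two points of the closed disk:
the preimage in the disk of the Euclidean segment joining the corresponding Klein-model
points.  (It contains its endpoints when these are interior, and an ideal endpoint is
automatically excluded.) -/
def geodArc (a b : E2) : Set E2 :=
  {p : E2 | p ∈ Disk ∧ ∃ t ∈ Icc (0:ℝ) 1, toKlein p = (1 - t) • toKlein a + t • toKlein b}

/-- Hyperbolic convexity. -/
def HypConvex (S : Set E2) : Prop := ∀ a ∈ S, ∀ b ∈ S, geodArc a b ⊆ S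

/-- The open hyperbolic disk of radius `R` centered at the origin. -/
def hBall (R : ℝ) : Set E2 := {p ∈ Disk | hDist 0 p < R}

/-- The normalized horizontal projection of the downward normal of the graph of `u`:
`X_u = ∇₀u / √(1 + λ⁻²·|∇₀u|²)`. -/
def Xfield (u : E2 → ℝ) (p : E2) : E2 :=
  (Real.sqrt (1 + ((lam p)⁻¹) ^ 2 * ‖gradient u p‖ ^ 2))⁻¹ • gradient u p

/-- Euclidean divergence of a planar vector field. -/
def div0 (X : E2 → E2) (p : E2) : ℝ :=
  ∑ i : Fin 2, fderiv ℝ X p (EuclideanSpace.single i 1) i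

/-- `u` is a minimal graph on `Ω`: smooth and satisfying the minimal surface equation
`div₀(∇₀u / √(1 + λ⁻²·|∇₀u|²)) = 0`. -/
def IsMinimalGraph (Ω : Set E2) (u : E2 → ℝ) : Prop :=
  ContDiffOn ℝ (⊤ : ℕ∞) u Ω ∧ ∀ p ∈ Ω, div0 (Xfield u) p = 0

/-- Rotation by `-90°`, turning a tangent vector into a normal vector of the same length. -/
def Jrot (v : E2) : E2 :=
  v 1 • EuclideanSpace.single (0 : Fin 2) (1:ℝ) - v 0 • EuclideanSpace.single (1 : Fin 2) (1:ℝ)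

/-- Flux of the vector field `X` along the curve `γ : [a,b] → E2`, with respect to the
normal `Jrot (γ')`:  `∫ ⟨X, η₀⟩ ds₀`. -/
def fluxV (X : E2 → E2) (γ : ℝ → E2) (a b : ℝ) : ℝ :=
  ∫ t in a..b, ⟪X (γ t), Jrot (deriv γ t)⟫

/-- A piecewise `C¹` curve on `[a,b]`. -/
def PiecewiseC1On (γ : ℝ → E2) (a b : ℝ) : Prop :=
  ContinuousOn γ (Icc a b) ∧
  ∃ s : Finset ℝ, ∀ t ∈ Icc a b, t ∉ s → DifferentiableAt ℝ γ t ∧ ContinuousAt (deriv γ) t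

/-- `η` points outward from `Ω` at the boundary point `x`. -/
def OutwardNormalAt (Ω : Set E2) (x η : E2) : Prop :=
  ∀ᶠ ε : ℝ in 𝓝[>] (0:ℝ), x - ε • η ∈ Ω ∧ x + ε • η ∉ closure Ω

/-- A horocycle at an ideal point: a Euclidean circle tangent to the unit circle
from inside at `pt`, with Euclidean radius `r`. -/
structure Horocycle where
  pt : E2
  r : ℝ
  hpt : ‖pt‖ = 1
  hr0 : 0 < r
  hr1 : r < 1

/-- The horocycle as a subset of the disk (the circle itself). -/
def Horocycle.circle (H : Horocycle) : Set E2 := {p : E2 | ‖p - (1 - H.r) • H.pt‖ = H.r}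

/-- The open horodisk bounded by a horocycle. -/
def Horocycle.horodisk (H : Horocycle) : Set E2 := {p : E2 | ‖p - (1 - H.r) • H.pt‖ < H.r}

/-- A semi-ideal polygonal domain with `k` ideal vertices `pI i` and `k` interior
vertices `pB i`, cyclically ordered as `pI 0, pB 0, pI 1, pB 1, …`; its edges are
`A i = geodArc (pI i) (pB i)` and `B i = geodArc (pB i) (pI (i+1))`, and its boundary
inside the disk is exactly the union of the edges. -/
structure SemiIdealDomain (k : ℕ) where
  Ω : Set E2
  pI : ZMod k → E2
  pB : ZMod k → E2
  k_pos : 0 < k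
  isOpen : IsOpen Ω
  conn : IsConnected Ω
  subset : Ω ⊆ Disk
  ideal : ∀ i, ‖pI i‖ = 1
  inter : ∀ i, pB i ∈ Disk
  injI : Function.Injective pI
  injB : Function.Injective pB
  boundary : frontier Ω ∩ Disk =
    (⋃ i, geodArc (pI i) (pB i)) ∪ (⋃ i, geodArc (pB i) (pI (i + 1)))

/-- The edge `A i` of a semi-ideal domain. -/
def SemiIdealDomain.edgeA {k : ℕ} (D : SemiIdealDomain k) (i : ZMod k) : Set E2 :=
  geodArc (D.pI i) (D.pB i)

/-- The edge `B i` of a semi-ideal domain. -/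
def SemiIdealDomain.edgeB {k : ℕ} (D : SemiIdealDomain k) (i : ZMod k) : Set E2 :=
  geodArc (D.pB i) (D.pI (i + 1))

/-- The open edge `A i` (without its endpoints). -/
def SemiIdealDomain.intEdgeA {k : ℕ} (D : SemiIdealDomain k) (i : ZMod k) : Set E2 :=
  D.edgeA i \ {D.pI i, D.pB i}

/-- The open edge `B i` (without its endpoints). -/
def SemiIdealDomain.intEdgeB {k : ℕ} (D : SemiIdealDomain k) (i : ZMod k) : Set E2 :=
  D.edgeB i \ {D.pB i, D.pI (i + 1)}

/-- A general polygonal domain in the Poincaré disk, with cyclically ordered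
vertices `q j` (interior or ideal) and geodesic edges. -/
structure PolygonalDomain where
  P : Set E2
  m : ℕ
  q : ZMod m → E2
  m_pos : 0 < m
  isOpen : IsOpen P
  conn : IsConnected P
  subset : P ⊆ Disk
  vtx : ∀ j, ‖q j‖ ≤ 1
  boundary : frontier P ∩ Disk = ⋃ j, geodArc (q j) (q (j + 1))

/-- A polygonal domain inscribed in a semi-ideal domain: contained in it and all of its
vertices are vertices of the ambient domain. -/
def InscribedIn {k : ℕ} (Q : PolygonalDomain) (D : SemiIdealDomain k) : Prop :=
  Q.P ⊆ D.Ω ∧ ∀ j, Q.q j ∈ Set.range D.pI ∪ Set.range D.pB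

/-- `Γ(𝒫)`: the part of `∂𝒫` (inside the disk) lying outside the horodisks. -/
def GammaSet {k : ℕ} (Q : PolygonalDomain) (H : ZMod k → Horocycle) : Set E2 :=
  (frontier Q.P ∩ Disk) \ ⋃ i, (H i).horodisk

/-- `|Γ(𝒫)|`. -/
def gammaLen {k : ℕ} (Q : PolygonalDomain) (H : ZMod k → Horocycle) : ℝ :=
  hLen (GammaSet Q H)

/-- `α(𝒫) = Σ_i |A_i ∩ Γ(𝒫)|`. -/
def alphaVal {k : ℕ} (D : SemiIdealDomain k) (H : ZMod k → Horocycle)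
    (Q : PolygonalDomain) : ℝ :=
  letI : NeZero k := ⟨D.k_pos.ne'⟩
  ∑ i : ZMod k, hLen (D.edgeA i ∩ GammaSet Q H)

/-- `β(𝒫) = Σ_i |B_i ∩ Γ(𝒫)|`. -/
def betaVal {k : ℕ} (D : SemiIdealDomain k) (H : ZMod k → Horocycle)
    (Q : PolygonalDomain) : ℝ :=
  letI : NeZero k := ⟨D.k_pos.ne'⟩
  ∑ i : ZMod k, hLen (D.edgeB i ∩ GammaSet Q H)

/-- An admissible domain. -/
def Admissible {k : ℕ} (D : SemiIdealDomain k) : Prop :=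
  HypConvex D.Ω ∧
  ∃ H : ZMod k → Horocycle,
    (∀ i, (H i).pt = D.pI i) ∧
    (∀ i j, i ≠ j → Disjoint (H i).circle (H j).circle) ∧
    (∀ i, hDistSet (D.pB (i - 1)) (H i).circle = hDistSet (D.pB i) (H i).circle) ∧
    (∀ Q : PolygonalDomain, InscribedIn Q D → Q.P ≠ D.Ω →
      2 * alphaVal D H Q < gammaLen Q H ∧ 2 * betaVal D H Q < gammaLen Q H)

/-- The Jenkins–Serrin boundary conditions: `u → +∞` on the interior of each edge `A i`,
and `u → −∞` on the interior of each edge `B i`. -/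
def JSBoundary {k : ℕ} (D : SemiIdealDomain k) (u : E2 → ℝ) : Prop :=
  (∀ i, ∀ x ∈ D.intEdgeA i, Tendsto u (𝓝[D.Ω] x) atTop) ∧
  (∀ i, ∀ x ∈ D.intEdgeB i, Tendsto u (𝓝[D.Ω] x) atBot)

/-- An admissible pair. -/
def AdmissiblePair {k : ℕ} (D : SemiIdealDomain k) (u : E2 → ℝ) : Prop :=
  Admissible D ∧ (0 : E2) ∈ D.Ω ∧ u 0 = 0 ∧ IsMinimalGraph D.Ω u ∧ JSBoundary D u

/-- The divergence set of a sequence of minimal graphs. -/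
def DivergenceSet (Ω : Set E2) (u : ℕ → E2 → ℝ) : Set E2 :=
  {p ∈ Ω | ¬ ∃ C : ℝ, ∀ k, ‖gradient (u k) p‖ ≤ C}

/-- The symmetric bigraph surface obtained by doubling the graph of `u : Ω → ℝ`:
the closure, inside `𝔻 × ℝ`, of the union of the graphs of `u` and `−u`. -/
def bigraphS (Ω : Set E2) (u : E2 → ℝ) : Set (E2 × ℝ) :=
  closure {z : E2 × ℝ | z.1 ∈ Ω ∧ (z.2 = u z.1 ∨ z.2 = -u z.1)} ∩ (Disk ×ˢ univ)

/-- An end of a subset `S` of a topological space: a choice, for every compact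
`K ⊆ S`, of a connected component of `S ∖ K` with non-compact closure (closure taken
in `S`), compatible with inclusions. -/
structure SetEnd {X : Type*} [TopologicalSpace X] (S : Set X) where
  sel : Set X → Set X
  isCC : ∀ K : Set X, IsCompact K → K ⊆ S →
    ∃ x ∈ S \ K, sel K = connectedComponentIn (S \ K) x
  noncpt : ∀ K : Set X, IsCompact K → K ⊆ S → ¬ IsCompact (closure (sel K) ∩ S)
  mono : ∀ K K' : Set X, IsCompact K → IsCompact K' → K ⊆ S → K' ⊆ S → K ⊆ K' →
    sel K' ⊆ sel K

/-- Embedding of `𝔻 × ℝ` in the compactification `𝔻̄ × [−∞, +∞]` (we realize the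
latter inside `E2 × EReal`). -/
def toBar (z : E2 × ℝ) : E2 × EReal := (z.1, (z.2 : EReal))

/-- The ideal boundary `∂∞(𝔻 × ℝ) = (𝔻̄ × [−∞, +∞]) ∖ (𝔻 × ℝ)`. -/
def idealBoundary : Set (E2 × EReal) :=
  {w : E2 × EReal | ‖w.1‖ ≤ 1} \ {w : E2 × EReal | ‖w.1‖ < 1 ∧ w.2 ≠ ⊤ ∧ w.2 ≠ ⊥}

/-- The limit set of an end `E` of a closed subset `S ⊆ 𝔻 × ℝ`: the part of
`⋂_K closure(E(K))` lying on the ideal boundary, closures taken in `𝔻̄ × [−∞, +∞]`. -/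
def limitSet {S : Set (E2 × ℝ)} (E : SetEnd S) : Set (E2 × EReal) :=
  (⋂ (K : Set (E2 × ℝ)) (_ : IsCompact K ∧ K ⊆ S), closure (toBar '' E.sel K)) ∩
    idealBoundary

/-- A homeomorphism of the plane is supported in `U` if it fixes every point outside `U`. -/
def SuppIn (f : ℝ × ℝ ≃ₜ ℝ × ℝ) (U : Set (ℝ × ℝ)) : Prop := ∀ p, p ∉ U → f p = p

lemma SuppIn.mono {f : ℝ × ℝ ≃ₜ ℝ × ℝ} {U V : Set (ℝ × ℝ)} (h : SuppIn f U) (hUV : U ⊆ V) :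
    SuppIn f V := fun p hp => h p fun h' => hp (hUV h')

lemma SuppIn.trans {f g : ℝ × ℝ ≃ₜ ℝ × ℝ} {U : Set (ℝ × ℝ)} (hf : SuppIn f U)
    (hg : SuppIn g U) : SuppIn (f.trans g) U := fun p hp => by
  simp [hf p hp, hg p hp]

lemma SuppIn.symm {f : ℝ × ℝ ≃ₜ ℝ × ℝ} {U : Set (ℝ × ℝ)} (hf : SuppIn f U) :
    SuppIn f.symm U := fun p hp => by
  rw [Homeomorph.symm_apply_eq, hf p hp]

lemma SuppIn.refl (U : Set (ℝ × ℝ)) : SuppIn (Homeomorph.refl _) U := fun _ _ => rfl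

lemma SuppIn.mapsTo {f : ℝ × ℝ ≃ₜ ℝ × ℝ} {U : Set (ℝ × ℝ)} (hf : SuppIn f U) :
    MapsTo f U U := fun p hp => by
  by_contra h
  have := hf _ h
  rw [f.injective this] at h
  exact h hp

/-- The tent function with peak value `1` at `p` and support `[A, B]`. -/
def tent (A B p y : ℝ) : ℝ := max 0 (min ((y - A) / (p - A)) ((B - y) / (B - p)))

lemma tent_of_le_left {A B p y : ℝ} (hA : A < p) (h : y ≤ A) :
    tent A B p y = 0 := by
  unfold tent
  refine max_eq_left (min_le_iff.2 (Or.inl ?_))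
  exact div_nonpos_of_nonpos_of_nonneg (by linarith) (by linarith)

lemma tent_of_right_le {A B p y : ℝ} (hB : p < B) (h : B ≤ y) :
    tent A B p y = 0 := by
  unfold tent
  refine max_eq_left (min_le_iff.2 (Or.inr ?_))
  exact div_nonpos_of_nonpos_of_nonneg (by linarith) (by linarith)

lemma tent_of_mem_left {A B p y : ℝ} (hA : A < p) (hB : p < B) (h : A ≤ y) (h' : y ≤ p) :
    tent A B p y = (y - A) / (p - A) := by
  unfold tent
  have h1 : (y - A) / (p - A) ≤ 1 := by rw [div_le_one (by linarith)]; linarith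
  have h2 : 1 ≤ (B - y) / (B - p) := by rw [le_div_iff₀ (by linarith)]; linarith
  rw [min_eq_left (h1.trans h2), max_eq_right (div_nonneg (by linarith) (by linarith))]

lemma tent_of_mem_right {A B p y : ℝ} (hA : A < p) (hB : p < B) (h : p ≤ y) (h' : y ≤ B) :
    tent A B p y = (B - y) / (B - p) := by
  unfold tent
  have h1 : (B - y) / (B - p) ≤ 1 := by rw [div_le_one (by linarith)]; linarith
  have h2 : 1 ≤ (y - A) / (p - A) := by rw [le_div_iff₀ (by linarith)]; linarith
  rw [min_eq_right (h1.trans h2), max_eq_right (div_nonneg (by linarith) (by linarith))]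

/-- The piecewise linear map fixing everything outside `[A, B]` and sending `p` to `q`. -/
def plMap (A B p q y : ℝ) : ℝ := y + (q - p) * tent A B p y

lemma plMap_of_le_left {A B p q y : ℝ} (hA : A < p) (h : y ≤ A) : plMap A B p q y = y := by
  simp [plMap, tent_of_le_left hA h]

lemma plMap_of_right_le {A B p q y : ℝ} (hB : p < B) (h : B ≤ y) : plMap A B p q y = y := by
  simp [plMap, tent_of_right_le hB h]

lemma plMap_of_mem_left {A B p q y : ℝ} (hA : A < p) (hB : p < B) (h : A ≤ y) (h' : y ≤ p) :
    plMap A B p q y = A + (q - A) * ((y - A) / (p - A)) := by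
  have : p - A ≠ 0 := by linarith
  rw [plMap, tent_of_mem_left hA hB h h']; field_simp; ring

lemma plMap_of_mem_right {A B p q y : ℝ} (hA : A < p) (hB : p < B) (h : p ≤ y) (h' : y ≤ B) :
    plMap A B p q y = B - (B - q) * ((B - y) / (B - p)) := by
  have : B - p ≠ 0 := by linarith
  rw [plMap, tent_of_mem_right hA hB h h']; field_simp; ring

lemma plMap_self {A B p q : ℝ} (hA : A < p) (hB : p < B) : plMap A B p q p = q := by
  rw [plMap_of_mem_left hA hB hA.le le_rfl, div_self (by linarith)]; ring

lemma plMap_leftInverse {A B p q : ℝ} (hA : A < p) (hB : p < B) (hA' : A < q) (hB' : q < B)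
    (y : ℝ) : plMap A B q p (plMap A B p q y) = y := by
  have n1 : p - A ≠ 0 := by linarith
  have n2 : B - p ≠ 0 := by linarith
  have n3 : q - A ≠ 0 := by linarith
  have n4 : B - q ≠ 0 := by linarith
  rcases le_total y A with h | h
  · rw [plMap_of_le_left hA h, plMap_of_le_left hA' h]
  rcases le_total B y with h' | h'
  · rw [plMap_of_right_le hB h', plMap_of_right_le hB' h']
  rcases le_total y p with h2 | h2
  · rw [plMap_of_mem_left hA hB h h2]
    have h0 : 0 ≤ (y - A) / (p - A) := div_nonneg (by linarith) (by linarith)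
    have h1 : (y - A) / (p - A) ≤ 1 := by rw [div_le_one (by linarith)]; linarith
    rw [plMap_of_mem_left hA' hB' (by nlinarith) (by nlinarith)]
    field_simp; ring
  · rw [plMap_of_mem_right hA hB h2 h']
    have h0 : 0 ≤ (B - y) / (B - p) := div_nonneg (by linarith) (by linarith)
    have h1 : (B - y) / (B - p) ≤ 1 := by rw [div_le_one (by linarith)]; linarith
    rw [plMap_of_mem_right hA' hB' (by nlinarith) (by nlinarith)]
    field_simp; ring

lemma plMap_mono {A B p q : ℝ} (hA : A < p) (hB : p < B) (hA' : A < q) (hB' : q < B) :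
    StrictMono (plMap A B p q) := by
  have hc : Continuous (plMap A B p q) := by
    unfold plMap tent; fun_prop
  have hi : Function.Injective (plMap A B p q) :=
    Function.LeftInverse.injective (g := plMap A B q p) (plMap_leftInverse hA hB hA' hB')
  rcases hc.strictMono_of_inj hi with h | h
  · exact h
  · exfalso
    have := h hA
    rw [plMap_of_le_left hA le_rfl, plMap_self hA hB] at this
    linarith

/-- The vertical move carrying the graph of `p` to the graph of `q` and fixing everything
outside `ℝ × [A, B]`. -/
def vMove (A B : ℝ) (p q : ℝ → ℝ) (hp : Continuous p) (hq : Continuous q)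
    (hpI : ∀ x, p x ∈ Ioo A B) (hqI : ∀ x, q x ∈ Ioo A B) : ℝ × ℝ ≃ₜ ℝ × ℝ where
  toFun z := (z.1, plMap A B (p z.1) (q z.1) z.2)
  invFun z := (z.1, plMap A B (q z.1) (p z.1) z.2)
  left_inv z := by
    simp [plMap_leftInverse (hpI z.1).1 (hpI z.1).2 (hqI z.1).1 (hqI z.1).2]
  right_inv z := by
    simp [plMap_leftInverse (hqI z.1).1 (hqI z.1).2 (hpI z.1).1 (hpI z.1).2]
  continuous_toFun := by
    have h1 : ∀ z : ℝ × ℝ, p z.1 - A ≠ 0 := fun z => (sub_pos.2 (hpI z.1).1).ne'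
    have h2 : ∀ z : ℝ × ℝ, B - p z.1 ≠ 0 := fun z => (sub_pos.2 (hpI z.1).2).ne'
    unfold plMap tent
    fun_prop (disch := assumption)
  continuous_invFun := by
    have h1 : ∀ z : ℝ × ℝ, q z.1 - A ≠ 0 := fun z => (sub_pos.2 (hqI z.1).1).ne'
    have h2 : ∀ z : ℝ × ℝ, B - q z.1 ≠ 0 := fun z => (sub_pos.2 (hqI z.1).2).ne'
    unfold plMap tent
    fun_prop (disch := assumption)

/-- A trapezoid cutoff: `1` on `[a, b]`, `0` outside `(a - e, b + e)`. -/
def trap (a b e x : ℝ) : ℝ := max 0 (min 1 (min ((x - a + e) / e) ((b + e - x) / e)))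

lemma trap_continuous (a b e : ℝ) : Continuous (trap a b e) := by unfold trap; fun_prop

lemma trap_nonneg (a b e x : ℝ) : 0 ≤ trap a b e x := le_max_left _ _

lemma trap_le_one (a b e x : ℝ) : trap a b e x ≤ 1 := max_le zero_le_one (min_le_left _ _)

lemma trap_eq_one {a b e x : ℝ} (he : 0 < e) (ha : a ≤ x) (hb : x ≤ b) : trap a b e x = 1 := by
  unfold trap
  have h1 : 1 ≤ (x - a + e) / e := by rw [le_div_iff₀ he]; linarith
  have h2 : 1 ≤ (b + e - x) / e := by rw [le_div_iff₀ he]; linarith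
  rw [min_eq_left (le_min h1 h2), max_eq_right zero_le_one]

lemma trap_eq_zero_left {a b e x : ℝ} (he : 0 < e) (h : x ≤ a - e) : trap a b e x = 0 := by
  unfold trap
  refine max_eq_left (min_le_iff.2 (Or.inr (min_le_iff.2 (Or.inl ?_))))
  exact div_nonpos_of_nonpos_of_nonneg (by linarith) he.le

lemma trap_eq_zero_right {a b e x : ℝ} (he : 0 < e) (h : b + e ≤ x) : trap a b e x = 0 := by
  unfold trap
  refine max_eq_left (min_le_iff.2 (Or.inr (min_le_iff.2 (Or.inr ?_))))
  exact div_nonpos_of_nonpos_of_nonneg (by linarith) he.le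

/-- Vertical move: over `[a, b]` it sends height `p` to height `q` by the piecewise linear map;
it is supported in `(a - e, b + e) × (A, B)` and moves points on vertical lines
monotonically. -/
lemma exists_vMove {A B p q a b e : ℝ} (hA : A < p) (hB : p < B) (hA' : A < q) (hB' : q < B)
    (he : 0 < e) :
    ∃ f : ℝ × ℝ ≃ₜ ℝ × ℝ, SuppIn f (Ioo (a - e) (b + e) ×ˢ Ioo A B) ∧
      (∀ z, (f z).1 = z.1) ∧ (∀ x y y', y ≤ y' → (f (x, y)).2 ≤ (f (x, y')).2) ∧
      (∀ x ∈ Icc a b, f (x, p) = (x, q)) ∧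
      (p ≤ q → ∀ z, z.2 ≤ (f z).2) ∧ (q ≤ p → ∀ z, (f z).2 ≤ z.2) := by
  set r : ℝ → ℝ := fun x => p + trap a b e x * (q - p) with hr
  have hrI : ∀ x, r x ∈ Ioo A B := by
    intro x
    have h0 := trap_nonneg a b e x
    have h1 := trap_le_one a b e x
    have := convex_Ioo A B (⟨hA, hB⟩ : p ∈ Ioo A B) (⟨hA', hB'⟩ : q ∈ Ioo A B)
      (sub_nonneg.2 h1) h0 (by ring)
    convert this using 1
    simp only [hr, smul_eq_mul]; ring
  have hrc : Continuous r := by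
    have := trap_continuous a b e
    fun_prop
  have hte : ∀ y, 0 ≤ tent A B p y := fun y => le_max_left _ _
  refine ⟨vMove A B (fun _ => p) r continuous_const hrc (fun _ => ⟨hA, hB⟩) hrI, ?_, ?_, ?_, ?_,
    ?_, ?_⟩
  · rintro ⟨x, y⟩ hz
    change (x, plMap A B p (r x) y) = (x, y)
    by_cases hx : x ∈ Ioo (a - e) (b + e)
    · have hy : y ∉ Ioo A B := fun h => hz ⟨hx, h⟩
      rw [mem_Ioo, not_and_or, not_lt, not_lt] at hy
      rcases hy with hy | hy
      · rw [plMap_of_le_left hA hy]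
      · rw [plMap_of_right_le hB hy]
    · have : trap a b e x = 0 := by
        rw [mem_Ioo, not_and_or, not_lt, not_lt] at hx
        rcases hx with hx | hx
        · exact trap_eq_zero_left he hx
        · exact trap_eq_zero_right he hx
      simp [plMap, hr, this]
  · intro z; rfl
  · intro x y y' hy
    exact (plMap_mono hA hB (hrI x).1 (hrI x).2).monotone hy
  · intro x hx
    change (x, plMap A B p (r x) p) = (x, q)
    rw [plMap_self hA hB]
    simp [hr, trap_eq_one he hx.1 hx.2]
  · rintro h ⟨x, y⟩
    change y ≤ plMap A B p (r x) y
    simp only [plMap, hr]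
    have := mul_nonneg (mul_nonneg (trap_nonneg a b e x) (sub_nonneg.2 h)) (hte y)
    linarith
  · rintro h ⟨x, y⟩
    change plMap A B p (r x) y ≤ y
    simp only [plMap, hr]
    have := mul_nonneg (mul_nonneg (trap_nonneg a b e x) (sub_nonneg.2 h)) (hte y)
    linarith

/-- Conjugation by the coordinate swap. -/
def swapConj (f : ℝ × ℝ ≃ₜ ℝ × ℝ) : ℝ × ℝ ≃ₜ ℝ × ℝ :=
  ((Homeomorph.prodComm ℝ ℝ).trans f).trans (Homeomorph.prodComm ℝ ℝ)

lemma swapConj_apply (f : ℝ × ℝ ≃ₜ ℝ × ℝ) (z : ℝ × ℝ) : swapConj f z = (f z.swap).swap := rfl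

/-- Horizontal version of `exists_vMove`. -/
lemma exists_hMove {A B p q a b e : ℝ} (hA : A < p) (hB : p < B) (hA' : A < q) (hB' : q < B)
    (he : 0 < e) :
    ∃ f : ℝ × ℝ ≃ₜ ℝ × ℝ, SuppIn f (Ioo A B ×ˢ Ioo (a - e) (b + e)) ∧
      (∀ z, (f z).2 = z.2) ∧ (∀ x x' y, x ≤ x' → (f (x, y)).1 ≤ (f (x', y)).1) ∧
      (∀ y ∈ Icc a b, f (p, y) = (q, y)) ∧
      (p ≤ q → ∀ z, z.1 ≤ (f z).1) ∧ (q ≤ p → ∀ z, (f z).1 ≤ z.1) := by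
  obtain ⟨f, h1, h2, h3, h4, h5, h6⟩ := exists_vMove (a := a) (b := b) hA hB hA' hB' he
  refine ⟨swapConj f, ?_, ?_, ?_, ?_, ?_, ?_⟩
  · rintro ⟨x, y⟩ hz
    rw [swapConj_apply, h1 _ (fun h => hz ⟨h.2, h.1⟩)]; rfl
  · rintro ⟨x, y⟩; rw [swapConj_apply]; exact h2 _
  · intro x x' y hx; exact h3 y x x' hx
  · intro y hy; rw [swapConj_apply]; simp only [Prod.swap_prod_mk]; rw [h4 y hy]; rfl
  · rintro h ⟨x, y⟩; exact h5 h (y, x)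
  · rintro h ⟨x, y⟩; exact h6 h (y, x)

/-- Adjacency of cells in the hexagonal (brick) tiling. -/
def HexAdj (c d : ℤ × ℤ) : Prop :=
  (d.1 = c.1 ∧ (d.2 = c.2 + 1 ∨ c.2 = d.2 + 1)) ∨
    (d.1 = c.1 + 1 ∧ (d.2 = c.2 ∨ d.2 = c.2 - 1)) ∨
    (c.1 = d.1 + 1 ∧ (c.2 = d.2 ∨ c.2 = d.2 - 1))

/-- The set of cells `X` is connected with respect to hexagonal adjacency. -/
def HexConnected (X : Set (ℤ × ℤ)) : Prop :=
  ∀ A ⊆ X, A.Nonempty → (∀ c ∈ A, ∀ d ∈ X, HexAdj c d → d ∈ A) → A = X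

/-- A maximal vertical run of cells of `X`: column `β.1`, from height `β.2.1` to `β.2.2`. -/
def IsBar (X : Set (ℤ × ℤ)) (β : ℤ × ℤ × ℤ) : Prop :=
  β.2.1 ≤ β.2.2 ∧ (∀ i, β.2.1 ≤ i → i ≤ β.2.2 → (β.1, i) ∈ X) ∧
    (β.1, β.2.1 - 1) ∉ X ∧ (β.1, β.2.2 + 1) ∉ X

/-- `γ` is in the column to the right of `β` and touches it. -/
def BarRight (β γ : ℤ × ℤ × ℤ) : Prop :=
  γ.1 = β.1 + 1 ∧ γ.2.1 ≤ β.2.2 ∧ β.2.1 ≤ γ.2.2 + 1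

/-- Adjacency of bars. -/
def BarAdj (β γ : ℤ × ℤ × ℤ) : Prop := BarRight β γ ∨ BarRight γ β

/-- In the same column, distinct bars are separated. -/
lemma IsBar.lt_or_lt {X : Set (ℤ × ℤ)} {β γ : ℤ × ℤ × ℤ} (hβ : IsBar X β) (hγ : IsBar X γ)
    (hc : β.1 = γ.1) (hne : β ≠ γ) : β.2.2 + 1 < γ.2.1 ∨ γ.2.2 + 1 < β.2.1 := by
  obtain ⟨j, a, b⟩ := β
  obtain ⟨j', a', b'⟩ := γ
  simp only [IsBar] at *
  subst hc
  by_contra! h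
  obtain ⟨h1, h2⟩ := h
  have e1 : ¬ (a' ≤ b + 1 ∧ b + 1 ≤ b') := fun h => hβ.2.2.2 (hγ.2.1 _ h.1 h.2)
  have e2 : ¬ (a ≤ b' + 1 ∧ b' + 1 ≤ b) := fun h => hγ.2.2.2 (hβ.2.1 _ h.1 h.2)
  have e3 : ¬ (a' ≤ a - 1 ∧ a - 1 ≤ b') := fun h => hβ.2.2.1 (hγ.2.1 _ h.1 h.2)
  have e4 : ¬ (a ≤ a' - 1 ∧ a' - 1 ≤ b) := fun h => hγ.2.2.1 (hβ.2.1 _ h.1 h.2)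
  have := hβ.1
  have := hγ.1
  apply hne
  have h1 : a = a' := by omega
  have h2 : b = b' := by omega
  rw [h1, h2]

lemma IsBar.lt_or_gt_of_notMem {X : Set (ℤ × ℤ)} {β : ℤ × ℤ × ℤ} (hβ : IsBar X β) {i : ℤ}
    (hi : (β.1, i) ∉ X) : i < β.2.1 ∨ β.2.2 < i := by
  by_contra! h
  exact hi (hβ.2.1 i h.1 h.2)

/-- A finite graph all of whose vertices have two distinct neighbours contains a nonempty
subgraph all of whose vertices have exactly two neighbours. -/
lemma exists_two_regular_subgraph {V : Type*} [Finite V] [Nonempty V] (G : SimpleGraph V)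
    (h : ∀ v, ∃ a b, a ≠ b ∧ G.Adj v a ∧ G.Adj v b) :
    ∃ S : G.Subgraph, S.verts.Nonempty ∧ ∀ v ∈ S.verts, (S.neighborSet v).ncard = 2 := by
  classical
  have : ¬ G.IsAcyclic := by
    intro hG
    obtain ⟨v⟩ := ‹Nonempty V›
    set c := G.connectedComponentMk v
    have hT := hG.isTree_connectedComponent c
    have hadj : ∀ w ∈ c.supp, ∀ a, G.Adj w a → a ∈ c.supp := by
      intro w hw a ha
      rw [SimpleGraph.ConnectedComponent.mem_supp_iff] at *
      rw [← hw, eq_comm]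
      exact SimpleGraph.ConnectedComponent.sound ha.reachable
    have hv : v ∈ c.supp := rfl
    have : Fintype c := Fintype.ofFinite _
    obtain ⟨a, b, hab, ha, hb⟩ := h v
    have : Nontrivial c := ⟨⟨⟨a, hadj v hv a ha⟩, ⟨b, hadj v hv b hb⟩, by simpa using hab⟩⟩
    obtain ⟨⟨w, hw⟩, hdeg⟩ := hT.exists_vert_degree_one_of_nontrivial
    obtain ⟨a, b, hab, ha, hb⟩ := h w
    rw [SimpleGraph.degree_eq_one_iff_existsUnique_adj] at hdeg
    have := hdeg.unique (y₁ := ⟨a, hadj w hw a ha⟩) (y₂ := ⟨b, hadj w hw b hb⟩)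
      (show G.Adj w a from ha) (show G.Adj w b from hb)
    exact hab (congrArg Subtype.val this)
  rw [SimpleGraph.IsAcyclic] at this
  push Not at this
  obtain ⟨v, p, hp⟩ := this
  refine ⟨p.toSubgraph, ⟨v, by simp⟩, fun w hw => ?_⟩
  exact hp.ncard_neighborSet_toSubgraph_eq_two (by simpa using hw)

/-- If the complement of a finite set of cells is connected, then every nonempty finite family
of its bars has a bar with at most one neighbour in the family. -/
theorem exists_leaf_bar {X : Set (ℤ × ℤ)} (hX : X.Finite)
    (hW : HexConnected Xᶜ)
    (B : Finset (ℤ × ℤ × ℤ)) (hB : ∀ β ∈ B, IsBar X β) (hne : B.Nonempty) :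
    ∃ β ∈ B, ∀ β₁ ∈ B, ∀ β₂ ∈ B, BarAdj β β₁ → BarAdj β β₂ → β₁ = β₂ := by
  classical
  by_contra! hcon
  have : Nonempty B := hne.to_subtype
  let G : SimpleGraph B :=
    { Adj := fun β γ => BarAdj β.1 γ.1
      symm := ⟨fun β γ h => Or.symm h⟩
      loopless := ⟨fun β h => by rcases h with h | h <;> (have := h.1; omega)⟩ }
  obtain ⟨S, ⟨v₀, hv₀⟩, hS⟩ := exists_two_regular_subgraph G (by
    rintro ⟨β, hβ⟩
    obtain ⟨β₁, h₁, β₂, h₂, a₁, a₂, hn⟩ := hcon β hβ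
    exact ⟨⟨β₁, h₁⟩, ⟨β₂, h₂⟩, by simpa using hn, a₁, a₂⟩)
  let R : Finset (B × B) := Finset.univ.filter fun e => S.Adj e.1 e.2 ∧ BarRight e.1.1 e.2.1
  let nR : ℤ × ℤ → ℕ := fun c => (R.filter fun e => e.1.1.1 = c.1 ∧ c.2 < e.1.1.2.1).card
  let nL : ℤ × ℤ → ℕ := fun c => (R.filter fun e => e.2.1.1 = c.1 ∧ c.2 < e.2.1.2.1).card
  have heven : ∀ c, Even (nR c + nL c) := by
    intro c
    let Q : Finset B := Finset.univ.filter fun β => β.1.1 = c.1 ∧ c.2 < β.1.2.1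
    have h1 : nR c + nL c = ∑ β ∈ Q, (Finset.univ.filter fun γ => S.Adj β γ).card := by
      have h2 : ∑ β ∈ Q, (Finset.univ.filter fun γ => S.Adj β γ).card =
          ((Finset.univ : Finset (B × B)).filter fun e => e.1 ∈ Q ∧ S.Adj e.1 e.2).card := by
        rw [Finset.card_eq_sum_card_fiberwise (f := Prod.fst) (t := Q)]
        · refine Finset.sum_congr rfl fun β hβ => ?_
          refine Finset.card_bij (fun γ _ => (β, γ)) ?_ ?_ ?_
          · intro γ hγ; simp at hγ ⊢; exact ⟨hβ, hγ⟩
          · intro γ _ γ' _ h; simpa using h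
          · rintro ⟨β', γ⟩ h; simp at h
            obtain ⟨⟨-, h⟩, rfl⟩ := h
            exact ⟨γ, by simpa using h, rfl⟩
        · intro e he; simp at he ⊢; exact he.1
      rw [h2]
      have h3 : ((Finset.univ : Finset (B × B)).filter fun e => e.1 ∈ Q ∧ S.Adj e.1 e.2) =
          (R.filter fun e => e.1.1.1 = c.1 ∧ c.2 < e.1.1.2.1) ∪
            ((R.filter fun e => e.2.1.1 = c.1 ∧ c.2 < e.2.1.2.1).image Prod.swap) := by
        ext ⟨β, γ⟩
        simp only [Q, R, Finset.mem_filter, Finset.mem_univ, true_and, Finset.mem_union,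
          Finset.mem_image, Prod.exists, Prod.swap_prod_mk, Prod.mk.injEq]
        constructor
        · rintro ⟨h, hadj⟩
          have : BarAdj β.1 γ.1 := S.adj_sub hadj
          rcases this with h' | h'
          · exact Or.inl ⟨⟨hadj, h'⟩, h⟩
          · exact Or.inr ⟨γ, β, ⟨⟨hadj.symm, h'⟩, h⟩, rfl, rfl⟩
        · rintro (⟨⟨hadj, -⟩, h⟩ | ⟨γ', β', ⟨⟨hadj, -⟩, h⟩, rfl, rfl⟩)
          · exact ⟨h, hadj⟩
          · exact ⟨h, hadj.symm⟩
      rw [h3, Finset.card_union_of_disjoint, Finset.card_image_of_injective _ Prod.swap_injective]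
      rw [Finset.disjoint_left]
      rintro ⟨β, γ⟩ h h'
      simp only [R, Finset.mem_filter, Finset.mem_univ, true_and, Finset.mem_image, Prod.exists,
          Prod.swap_prod_mk, Prod.mk.injEq] at h h'
      obtain ⟨γ', β', ⟨⟨-, h2⟩, -⟩, rfl, rfl⟩ := h'
      have e1 := h.1.2.1
      have e2 := h2.1
      omega
    rw [h1]
    refine Finset.even_sum _ fun β _ => ?_
    have h4 : (Finset.univ.filter fun γ => S.Adj β γ).card = (S.neighborSet β).ncard := by
      rw [← Set.ncard_coe_finset]; congr 1; ext; simp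
    rw [h4]
    by_cases hβ : β ∈ S.verts
    · rw [hS β hβ]; exact even_two
    · have : S.neighborSet β = ∅ := by
        ext γ; simp only [SimpleGraph.Subgraph.mem_neighborSet, mem_empty_iff_false, iff_false]
        exact fun h => hβ (S.edge_vert h)
      simp [this]
  have hparity : ∀ c, Even (nR c) ↔ Even (nL c) := fun c => by
    have := heven c; rwa [Nat.even_add] at this
  -- crossing a vertical interface
  have hcross : ∀ c ∈ Xᶜ, ∀ d ∈ Xᶜ, d.1 = c.1 + 1 → (d.2 = c.2 ∨ d.2 = c.2 - 1) →
      nR c = nL d := by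
    intro c hc d hd h1 h2
    simp only [nR, nL]
    congr 1
    ext ⟨β, γ⟩
    simp only [R, Finset.mem_filter, Finset.mem_univ, true_and]
    refine and_congr_right fun h => ?_
    obtain ⟨-, h3, h4, h5⟩ := h
    obtain ⟨j, i⟩ := c
    obtain ⟨j', i'⟩ := d
    simp only at h1 h2 ⊢
    constructor
    · rintro ⟨e1, e2⟩
      refine ⟨by omega, ?_⟩
      have := (hB _ γ.2).lt_or_gt_of_notMem (i := i') (by
        rw [h3, e1, ← h1]; exact hd)
      omega
    · rintro ⟨e1, e2⟩
      have e3 : β.1.1 = j := by omega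
      refine ⟨e3, ?_⟩
      have := (hB _ β.2).lt_or_gt_of_notMem (i := i) (by rw [e3]; exact hc)
      omega
  have hvert : ∀ c ∈ Xᶜ, ∀ d ∈ Xᶜ, d.1 = c.1 → d.2 = c.2 + 1 → nR c = nR d := by
    intro c hc d hd h1 h2
    simp only [nR]
    congr 1
    ext ⟨β, γ⟩
    simp only [Finset.mem_filter]
    refine and_congr_right fun _ => ?_
    rw [h1]
    refine and_congr_right fun e => ?_
    have := (hB _ β.2).lt_or_gt_of_notMem (i := c.2) (by rw [e]; exact hc)
    have := (hB _ β.2).lt_or_gt_of_notMem (i := d.2) (by rw [e, ← h1]; exact hd)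
    have := (hB _ β.2).1
    omega
  -- hence the parity is constant on the complement
  have hconst : ∀ c ∈ Xᶜ, Even (nR c) → {c | c ∈ Xᶜ ∧ Even (nR c)} = Xᶜ := by
    intro c hc hev
    refine hW _ (fun _ h => h.1) ⟨c, hc, hev⟩ ?_
    rintro c ⟨hc, hev⟩ d hd h
    refine ⟨hd, ?_⟩
    rcases h with ⟨h1, h2 | h2⟩ | ⟨h1, h2⟩ | ⟨h1, h2⟩
    · rw [← hvert c hc d hd h1 h2]; exact hev
    · rw [hvert d hd c hc h1.symm h2]; exact hev
    · rw [hparity, ← hcross c hc d hd h1 h2]; exact hev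
    · rw [hcross d hd c hc h1 h2, ← hparity]; exact hev
  -- the extremal bar
  have hfin : (S.verts).Finite := Set.toFinite _
  obtain ⟨v₁, hv₁, hmin⟩ := Set.exists_min_image S.verts (fun β => β.1.1) hfin ⟨v₀, hv₀⟩
  obtain ⟨K, ⟨hK, hKc⟩, hKmax⟩ := Set.exists_max_image {β | β ∈ S.verts ∧ β.1.1 = v₁.1.1}
    (fun β => β.1.2.1) (Set.toFinite _) ⟨v₁, hv₁, rfl⟩
  obtain ⟨K₁, K₂, hK12, hnb⟩ := Set.ncard_eq_two.1 (hS K hK)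
  have hadj : ∀ γ, S.Adj K γ ↔ γ = K₁ ∨ γ = K₂ := fun γ => by
    rw [← SimpleGraph.Subgraph.mem_neighborSet, hnb]; simp
  have hright : ∀ γ, S.Adj K γ → BarRight K.1 γ.1 := by
    intro γ h
    rcases (S.adj_sub h : BarAdj K.1 γ.1) with h' | h'
    · exact h'
    · have := hmin γ (S.edge_vert h.symm)
      have e := h'.1
      omega
  have main : ∀ K₁ K₂ : B, (∀ γ, S.Adj K γ ↔ γ = K₁ ∨ γ = K₂) → K₁.1.2.2 + 1 < K₂.1.2.1 →
      False := by
    intro K₁ K₂ hadj hlt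
    obtain ⟨a1, a2, a3⟩ := hright K₁ ((hadj _).2 (Or.inl rfl))
    obtain ⟨b1, b2, b3⟩ := hright K₂ ((hadj _).2 (Or.inr rfl))
    have hω : (K₁.1.1, K₁.1.2.2 + 1) ∈ Xᶜ := (hB _ K₁.2).2.2.2
    have hone : nL (K₁.1.1, K₁.1.2.2 + 1) = 1 := by
      simp only [nL, Finset.card_eq_one]
      refine ⟨(K, K₂), ?_⟩
      ext ⟨β, γ⟩
      simp only [R, Finset.mem_filter, Finset.mem_univ, true_and, Finset.mem_singleton,
        Prod.mk.injEq]
      constructor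
      · rintro ⟨⟨h1, h2, h3, h4⟩, h5, h6⟩
        have hβ : β = K := by
          by_contra hne
          have hβc : β.1.1 = K.1.1 := by omega
          have := hKmax β ⟨S.edge_vert h1, by omega⟩
          have := (hB _ β.2).lt_or_lt (hB _ K.2) hβc (fun h => hne (Subtype.ext h))
          have := (hB _ β.2).1
          have := (hB _ K.2).1
          omega
        subst hβ
        refine ⟨rfl, ?_⟩
        rcases (hadj γ).1 h1 with rfl | rfl
        · have := (hB _ γ.2).1
          omega
        · rfl
      · rintro ⟨rfl, rfl⟩
        exact ⟨⟨(hadj _).2 (Or.inr rfl), b1, b2, b3⟩, by omega, hlt⟩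
    -- a far away cell
    obtain ⟨N, hN⟩ : ∃ N : ℤ, ∀ β ∈ B, β.2.1 < N ∧ β.2.2 < N := by
      obtain ⟨N, hN⟩ := (B.image fun β => max β.2.1 β.2.2).bddAbove
      refine ⟨N + 1, fun β hβ => ?_⟩
      have := hN (Finset.mem_coe.2 (Finset.mem_image_of_mem _ hβ))
      simp only [max_le_iff] at this
      omega
    obtain ⟨M, hM⟩ : ∃ M : ℤ, N ≤ M ∧ (K₁.1.1, M) ∉ X := by
      obtain ⟨M, hM⟩ := (hX.image Prod.snd).bddAbove
      refine ⟨max N (M + 1), le_max_left _ _, fun h => ?_⟩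
      have : max N (M + 1) ≤ M := hM (mem_image_of_mem _ h)
      have := le_max_right N (M + 1)
      omega
    have hzero : nR (K₁.1.1, M) = 0 := by
      simp only [nR, Finset.card_eq_zero]
      ext ⟨β, γ⟩
      simp only [Finset.mem_filter, Finset.notMem_empty, iff_false, not_and, not_lt]
      intro _ _
      have := hN _ β.2
      omega
    have := hconst _ hM.2 (by rw [hzero]; exact Even.zero)
    have h7 : (K₁.1.1, K₁.1.2.2 + 1) ∈ Xᶜ := hω
    rw [← this] at h7
    have h8 := (hparity _).1 h7.2
    rw [hone] at h8
    exact absurd h8 (by decide)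
  have hc1 := (hright K₁ ((hadj _).2 (Or.inl rfl))).1
  have hc2 := (hright K₂ ((hadj _).2 (Or.inr rfl))).1
  rcases (hB _ K₁.2).lt_or_lt (hB _ K₂.2) (by omega)
    (fun h => hK12 (Subtype.ext h)) with h | h
  · exact main K₁ K₂ hadj h
  · exact main K₂ K₁ (fun γ => by rw [hadj, or_comm]) h

/-- Every rectangle in an open set has a uniform margin inside the open set. -/
lemma exists_margin {U : Set (ℝ × ℝ)} (hU : IsOpen U) {x₀ x₁ c d : ℝ}
    (hL : Icc x₀ x₁ ×ˢ Icc c d ⊆ U) (hx : x₀ ≤ x₁) (hc : c ≤ d) :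
    ∃ e > 0, Icc (x₀ - e) (x₁ + e) ×ˢ Icc (c - e) (d + e) ⊆ U := by
  obtain ⟨δ, hδ, h⟩ := (isCompact_Icc.prod isCompact_Icc).exists_cthickening_subset_open hU hL
  refine ⟨δ, hδ, fun z hz => h ?_⟩
  refine Metric.mem_cthickening_of_dist_le z (max x₀ (min x₁ z.1), max c (min d z.2)) δ _ ?_ ?_
  · exact ⟨⟨le_max_left _ _, max_le hx (min_le_left _ _)⟩,
      ⟨le_max_left _ _, max_le hc (min_le_left _ _)⟩⟩
  · obtain ⟨⟨h1, h2⟩, h3, h4⟩ := hz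
    rw [Prod.dist_eq, Real.dist_eq, Real.dist_eq, max_le_iff, abs_le, abs_le]
    refine ⟨⟨?_, ?_⟩, ?_, ?_⟩
    · have : max x₀ (min x₁ z.1) ≤ z.1 + δ := by
        apply max_le
        · linarith
        · linarith [min_le_right x₁ z.1]
      linarith
    · have : z.1 - δ ≤ max x₀ (min x₁ z.1) :=
        le_max_of_le_right (le_min (by linarith) (by linarith))
      linarith
    · have : max c (min d z.2) ≤ z.2 + δ := by
        apply max_le
        · linarith
        · linarith [min_le_right d z.2]
      linarith
    · have : z.2 - δ ≤ max c (min d z.2) :=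
        le_max_of_le_right (le_min (by linarith) (by linarith))
      linarith

lemma exists_vSqueeze {x₀ x₁ c m₁ m m₂ d e : ℝ} (h1 : c < m₁) (h2 : m₁ < m) (h3 : m < m₂)
    (h4 : m₂ < d) (he : 0 < e) :
    ∃ f : ℝ × ℝ ≃ₜ ℝ × ℝ, SuppIn f (Ioo (x₀ - e) (x₁ + e) ×ˢ Ioo (c - e) (d + e)) ∧
      (∀ z, (f z).1 = z.1) ∧ (∀ z, z.2 ≤ m → z.2 ≤ (f z).2 ∧ (f z).2 ≤ m) ∧
      (∀ z, m ≤ z.2 → m ≤ (f z).2 ∧ (f z).2 ≤ z.2) ∧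
      (∀ z, z.1 ∈ Icc x₀ x₁ → z.2 ∈ Icc c d → (f z).2 ∈ Icc m₁ m₂) := by
  obtain ⟨f, f1, f2, f3, f4, -, f6⟩ := exists_vMove (A := m) (B := d + e) (p := d) (q := m₂)
    (a := x₀) (b := x₁) (e := e) (by linarith) (by linarith) (by linarith) (by linarith) he
  obtain ⟨g, g1, g2, g3, g4, g5, -⟩ := exists_vMove (A := c - e) (B := m) (p := c) (q := m₁)
    (a := x₀) (b := x₁) (e := e) (by linarith) (by linarith) (by linarith) (by linarith) he
  have hf : ∀ z : ℝ × ℝ, z.2 ≤ m → f z = z := fun z hz => f1 z fun h => by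
    have := h.2.1; linarith
  have hg : ∀ z : ℝ × ℝ, m ≤ z.2 → g z = z := fun z hz => g1 z fun h => by
    have := h.2.2; linarith
  have hf' : ∀ z : ℝ × ℝ, m ≤ z.2 → m ≤ (f z).2 ∧ (f z).2 ≤ z.2 := fun z hz => by
    refine ⟨?_, f6 (by linarith) z⟩
    have := f3 z.1 m z.2 hz
    rwa [hf (z.1, m) le_rfl] at this
  have hg' : ∀ z : ℝ × ℝ, z.2 ≤ m → z.2 ≤ (g z).2 ∧ (g z).2 ≤ m := fun z hz => by
    refine ⟨g5 (by linarith) z, ?_⟩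
    have := g3 z.1 z.2 m hz
    rwa [hg (z.1, m) le_rfl] at this
  refine ⟨f.trans g, ?_, ?_, ?_, ?_, ?_⟩
  · refine (f1.mono ?_).trans (g1.mono ?_)
    · exact prod_mono le_rfl (Ioo_subset_Ioo_left (by linarith))
    · exact prod_mono le_rfl (Ioo_subset_Ioo_right (by linarith))
  · intro z; simp [f2, g2]
  · intro z hz; simpa [hf z hz] using hg' z hz
  · intro z hz; simpa [hg (f z) (hf' z hz).1] using hf' z hz
  · intro z hz1 hz2
    rcases le_total z.2 m with h | h
    · have := hg' z h
      have h5 := g3 z.1 c z.2 hz2.1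
      rw [g4 _ hz1] at h5
      simp only [Homeomorph.trans_apply, hf z h]
      exact ⟨h5, by linarith⟩
    · have := hf' z h
      have h5 := f3 z.1 z.2 d hz2.2
      rw [f4 _ hz1] at h5
      simp only [Homeomorph.trans_apply, hg (f z) this.1]
      exact ⟨by linarith, h5⟩

lemma exists_hSqueeze {y₀ y₁ c m₁ m m₂ d e : ℝ} (h1 : c < m₁) (h2 : m₁ < m) (h3 : m < m₂)
    (h4 : m₂ < d) (he : 0 < e) :
    ∃ f : ℝ × ℝ ≃ₜ ℝ × ℝ, SuppIn f (Ioo (c - e) (d + e) ×ˢ Ioo (y₀ - e) (y₁ + e)) ∧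
      (∀ z, (f z).2 = z.2) ∧
      (∀ z, z.2 ∈ Icc y₀ y₁ → z.1 ∈ Icc c d → (f z).1 ∈ Icc m₁ m₂) := by
  obtain ⟨f, f1, f2, -, -, f5⟩ := exists_vSqueeze (x₀ := y₀) (x₁ := y₁) h1 h2 h3 h4 he
  refine ⟨swapConj f, ?_, fun z => f2 z.swap, fun z => f5 z.swap⟩
  rintro ⟨x, y⟩ hz
  rw [swapConj_apply, f1 _ (fun h => hz ⟨h.2, h.1⟩)]; rfl

/-- A rectangle can be shrunk, inside a neighbourhood, to a neighbourhood of a given interior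
point. -/
lemma exists_shrink_rect {U V : Set (ℝ × ℝ)} (hU : IsOpen U) (hV : IsOpen V) {x₀ x₁ c d : ℝ}
    (hL : Icc x₀ x₁ ×ˢ Icc c d ⊆ U) {p : ℝ × ℝ} (hp : p ∈ Ioo x₀ x₁ ×ˢ Ioo c d) (hpV : p ∈ V) :
    ∃ k : ℝ × ℝ ≃ₜ ℝ × ℝ, SuppIn k U ∧ k '' (Icc x₀ x₁ ×ˢ Icc c d) ⊆ V := by
  obtain ⟨⟨p1, p2⟩, p3, p4⟩ := hp
  obtain ⟨e, he, hm⟩ := exists_margin hU hL (p1.trans p2).le (p3.trans p4).le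
  obtain ⟨r, hr, hrV⟩ := Metric.isOpen_iff.1 hV p hpV
  set s := min (r / 2) (min (min ((p.1 - x₀) / 2) ((x₁ - p.1) / 2))
    (min ((p.2 - c) / 2) ((d - p.2) / 2))) with hs
  have hs0 : 0 < s := by
    simp only [hs, lt_min_iff]
    refine ⟨by linarith, ⟨by linarith, by linarith⟩, by linarith, by linarith⟩
  have hsr : s ≤ r / 2 := min_le_left _ _
  have hs1 : s ≤ (p.1 - x₀) / 2 := (min_le_right _ _).trans ((min_le_left _ _).trans (min_le_left _ _))
  have hs2 : s ≤ (x₁ - p.1) / 2 := (min_le_right _ _).trans ((min_le_left _ _).trans (min_le_right _ _))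
  have hs3 : s ≤ (p.2 - c) / 2 := (min_le_right _ _).trans ((min_le_right _ _).trans (min_le_left _ _))
  have hs4 : s ≤ (d - p.2) / 2 := (min_le_right _ _).trans ((min_le_right _ _).trans (min_le_right _ _))
  obtain ⟨f, f1, f2, -, -, f5⟩ := exists_vSqueeze (x₀ := x₀) (x₁ := x₁) (c := c) (m₁ := p.2 - s)
    (m := p.2) (m₂ := p.2 + s) (d := d) (e := e) (by linarith) (by linarith) (by linarith)
    (by linarith) he
  obtain ⟨g, g1, g2, g5⟩ := exists_hSqueeze (y₀ := c) (y₁ := d) (c := x₀) (m₁ := p.1 - s)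
    (m := p.1) (m₂ := p.1 + s) (d := x₁) (e := e) (by linarith) (by linarith) (by linarith)
    (by linarith) he
  have hsub : Ioo (x₀ - e) (x₁ + e) ×ˢ Ioo (c - e) (d + e) ⊆ U :=
    (Set.prod_mono Ioo_subset_Icc_self Ioo_subset_Icc_self).trans hm
  refine ⟨f.trans g, (f1.mono hsub).trans (g1.mono hsub), ?_⟩
  rintro _ ⟨z, ⟨hz1, hz2⟩, rfl⟩
  apply hrV
  have h1 := f5 z hz1 hz2
  have h2 := g5 (f z) ⟨by linarith [h1.1], by linarith [h1.2]⟩ (by rw [f2]; exact hz1)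
  rw [Metric.mem_ball, Homeomorph.trans_apply, Prod.dist_eq, max_lt_iff, Real.dist_eq,
    Real.dist_eq, g2, abs_lt, abs_lt]
  refine ⟨⟨?_, ?_⟩, ?_, ?_⟩
  · linarith [h2.1]
  · linarith [h2.2]
  · linarith [h1.1]
  · linarith [h1.2]

/-- A rectangle touching another rectangle on its right along a nondegenerate interval can be
absorbed into it. -/
lemma exists_absorb_right {U : Set (ℝ × ℝ)} (hU : IsOpen U) {x₀ x₁ x₂ a b c d : ℝ}
    (hL : Icc x₀ x₁ ×ˢ Icc c d ⊆ U) (hx : x₀ < x₁) (hx' : x₁ < x₂) (hJ : max a c < min b d) :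
    ∃ k : ℝ × ℝ ≃ₜ ℝ × ℝ, SuppIn k U ∧
      k '' (Icc x₀ x₁ ×ˢ Icc c d ∪ Icc x₁ x₂ ×ˢ Icc a b) ⊆ Icc x₁ x₂ ×ˢ Icc a b := by
  obtain ⟨m, hm1, hm2⟩ := exists_between hJ
  obtain ⟨hma, hmc⟩ := max_lt_iff.1 hm1
  obtain ⟨hmb, hmd⟩ := lt_min_iff.1 hm2
  obtain ⟨e', he', hme⟩ := exists_margin hU hL hx.le (hmc.trans hmd).le
  set e := min e' (x₂ - x₁) with hee
  have he : 0 < e := lt_min he' (by linarith)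
  have hex : e ≤ x₂ - x₁ := min_le_right _ _
  have hm : Icc (x₀ - e) (x₁ + e) ×ˢ Icc (c - e) (d + e) ⊆ U := by
    have : e ≤ e' := min_le_left _ _
    exact (Set.prod_mono (Icc_subset_Icc (by linarith) (by linarith))
      (Icc_subset_Icc (by linarith) (by linarith))).trans hme
  have ha2 : max a c < m := hm1
  set m₁ := (max a c + m) / 2 with hm₁
  set m₂ := (min b d + m) / 2 with hm₂
  set s := min ((m - max a c) / 2) ((min b d - m) / 2) with hs
  have hs0 : 0 < s := lt_min (by linarith) (by linarith)
  have hs1 : s ≤ (m - max a c) / 2 := min_le_left _ _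
  have hs2 : s ≤ (min b d - m) / 2 := min_le_right _ _
  have i1 := le_max_left a c
  have i2 := le_max_right a c
  have i3 := min_le_left b d
  have i4 := min_le_right b d
  obtain ⟨f, f1, f2, f3, f4, f5⟩ := exists_vSqueeze (x₀ := x₀) (x₁ := x₁) (c := c) (m₁ := m₁)
    (m := m) (m₂ := m₂) (d := d) (e := e) (by linarith) (by linarith) (by linarith)
    (by linarith) he
  obtain ⟨g, g1, g2, g3, g4, g5, -⟩ := exists_hMove (A := x₀ - e) (B := x₁ + e) (p := x₀)
    (q := x₁) (a := m₁) (b := m₂) (e := s) (by linarith) (by linarith) (by linarith)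
    (by linarith) hs0
  refine ⟨f.trans g, (f1.mono ?_).trans (g1.mono ?_), ?_⟩
  · exact (Set.prod_mono Ioo_subset_Icc_self Ioo_subset_Icc_self).trans hm
  · exact (Set.prod_mono Ioo_subset_Icc_self ((Ioo_subset_Ioo (by linarith) (by linarith)).trans
      Ioo_subset_Icc_self)).trans hm
  · have gfix : ∀ z : ℝ × ℝ, x₁ + e ≤ z.1 → g z = z := fun z hz => g1 z fun h => by
      have := h.1.2; linarith
    rintro _ ⟨z, hz | hz, rfl⟩
    · have h1 := f5 z hz.1 hz.2
      have hfz : f z = (z.1, (f z).2) := Prod.ext (f2 z) rfl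
      rw [Homeomorph.trans_apply]
      refine ⟨⟨?_, ?_⟩, ?_⟩
      · have := g3 x₀ z.1 (f z).2 hz.1.1
        rw [g4 _ h1, ← hfz] at this
        exact this
      · have := g3 z.1 x₂ (f z).2 (hz.1.2.trans hx'.le)
        rw [gfix (x₂, (f z).2) (by linarith), ← hfz] at this
        exact this
      · rw [g2]; exact ⟨by linarith [h1.1], by linarith [h1.2]⟩
    · have hfz : f z = (z.1, (f z).2) := Prod.ext (f2 z) rfl
      rw [Homeomorph.trans_apply]
      refine ⟨⟨?_, ?_⟩, ?_⟩
      · have := g5 hx.le (f z)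
        rw [f2] at this
        exact hz.1.1.trans this
      · have := g3 z.1 x₂ (f z).2 hz.1.2
        rw [gfix (x₂, (f z).2) (by linarith), ← hfz] at this
        exact this
      · rw [g2]
        rcases le_total z.2 m with h | h
        · have := f3 z h; exact ⟨by linarith [hz.2.1], by linarith⟩
        · have := f4 z h; exact ⟨by linarith, by linarith [hz.2.2]⟩

/-- Reflection in the first coordinate. -/
def reflX : ℝ × ℝ ≃ₜ ℝ × ℝ := (Homeomorph.neg ℝ).prodCongr (Homeomorph.refl ℝ)

lemma reflX_apply (z : ℝ × ℝ) : reflX z = (-z.1, z.2) := rfl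

lemma exists_absorb_left {U : Set (ℝ × ℝ)} (hU : IsOpen U) {x₀ x₁ x₂ a b c d : ℝ}
    (hL : Icc x₁ x₂ ×ˢ Icc c d ⊆ U) (hx : x₀ < x₁) (hx' : x₁ < x₂) (hJ : max a c < min b d) :
    ∃ k : ℝ × ℝ ≃ₜ ℝ × ℝ, SuppIn k U ∧
      k '' (Icc x₁ x₂ ×ˢ Icc c d ∪ Icc x₀ x₁ ×ˢ Icc a b) ⊆ Icc x₀ x₁ ×ˢ Icc a b := by
  obtain ⟨k, k1, k2⟩ := exists_absorb_right (U := reflX ⁻¹' U) (hU.preimage reflX.continuous)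
    (x₀ := -x₂) (x₁ := -x₁) (x₂ := -x₀) (a := a) (b := b) (c := c) (d := d) (by
      rintro z ⟨⟨h1, h2⟩, h3⟩
      exact hL ⟨⟨by rw [reflX_apply]; linarith, by rw [reflX_apply]; linarith⟩, h3⟩)
    (by linarith) (by linarith) hJ
  refine ⟨(reflX.trans k).trans reflX, ?_, ?_⟩
  · intro z hz
    have : reflX z ∉ reflX ⁻¹' U := by
      simpa [reflX_apply] using hz
    rw [Homeomorph.trans_apply, Homeomorph.trans_apply, k1 _ this]
    simp [reflX_apply]
  · rintro _ ⟨z, hz, rfl⟩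
    have := k2 (mem_image_of_mem k (x := reflX z) (by
      rcases hz with hz | hz
      · left; exact ⟨⟨by rw [reflX_apply]; linarith [hz.1.2], by rw [reflX_apply]; linarith [hz.1.1]⟩, hz.2⟩
      · right; exact ⟨⟨by rw [reflX_apply]; linarith [hz.1.2], by rw [reflX_apply]; linarith [hz.1.1]⟩, hz.2⟩))
    obtain ⟨⟨h1, h2⟩, h3⟩ := this
    refine ⟨⟨?_, ?_⟩, h3⟩
    · simp only [Homeomorph.trans_apply, reflX_apply] at *; linarith
    · simp only [Homeomorph.trans_apply, reflX_apply] at *; linarith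

/-- `P` can be pushed, by homeomorphisms supported in `U`, into any neighbourhood of a finite
set of points of `U` with distinct abscissae. -/
def Compressible (U P : Set (ℝ × ℝ)) : Prop :=
  ∃ A : Finset (ℝ × ℝ), (A : Set (ℝ × ℝ)) ⊆ U ∧ InjOn Prod.fst (A : Set (ℝ × ℝ)) ∧
    ∀ V : Set (ℝ × ℝ), IsOpen V → (A : Set (ℝ × ℝ)) ⊆ V →
      ∃ k : ℝ × ℝ ≃ₜ ℝ × ℝ, SuppIn k U ∧ k '' P ⊆ V

lemma Compressible.of_image {U P P' : Set (ℝ × ℝ)} (h : Compressible U P')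
    {k : ℝ × ℝ ≃ₜ ℝ × ℝ} (hk : SuppIn k U) (hP : k '' P ⊆ P') : Compressible U P := by
  obtain ⟨A, h1, h2, h3⟩ := h
  refine ⟨A, h1, h2, fun V hV hA => ?_⟩
  obtain ⟨k', hk', h'⟩ := h3 V hV hA
  refine ⟨k.trans k', hk.trans hk', ?_⟩
  rintro _ ⟨z, hz, rfl⟩
  exact h' (mem_image_of_mem k' (hP (mem_image_of_mem k hz)))

/-- The rectangle covered by a bar, for cells of size `h`. -/
def barRect (h : ℝ) (β : ℤ × ℤ × ℤ) : Set (ℝ × ℝ) :=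
  Icc (β.1 * h) ((β.1 + 1) * h) ×ˢ Icc ((β.2.1 + β.1 / 2) * h) ((β.2.2 + 1 + β.1 / 2) * h)

lemma barRect_disjoint {X : Set (ℤ × ℤ)} {h : ℝ} (hh : 0 < h) {β γ : ℤ × ℤ × ℤ}
    (hβ : IsBar X β) (hγ : IsBar X γ) (hne : β ≠ γ) (hadj : ¬ BarAdj β γ) :
    Disjoint (barRect h β) (barRect h γ) := by
  rw [Set.disjoint_left]
  rintro z ⟨⟨h1, h2⟩, h3, h4⟩ ⟨⟨h5, h6⟩, h7, h8⟩
  have k1 := le_of_mul_le_mul_right (h1.trans h6) hh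
  have k2 := le_of_mul_le_mul_right (h5.trans h2) hh
  have k3 := le_of_mul_le_mul_right (h3.trans h8) hh
  have k4 := le_of_mul_le_mul_right (h7.trans h4) hh
  have k1' : β.1 ≤ γ.1 + 1 := by exact_mod_cast k1
  have k2' : γ.1 ≤ β.1 + 1 := by exact_mod_cast k2
  have key : β.1 = γ.1 ∨ γ.1 = β.1 + 1 ∨ β.1 = γ.1 + 1 := by omega
  rcases key with e | e | e
  · rw [e] at k3 k4
    have k3' : β.2.1 ≤ γ.2.2 + 1 := by
      have : (β.2.1 : ℝ) ≤ γ.2.2 + 1 := by linarith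
      exact_mod_cast this
    have k4' : γ.2.1 ≤ β.2.2 + 1 := by
      have : (γ.2.1 : ℝ) ≤ β.2.2 + 1 := by linarith
      exact_mod_cast this
    have := hβ.lt_or_lt hγ e hne
    omega
  · apply hadj; left
    rw [e] at k3 k4
    push_cast at k3 k4
    refine ⟨e, ?_, ?_⟩
    · have : (γ.2.1 : ℝ) < β.2.2 + 1 := by linarith
      have : γ.2.1 < β.2.2 + 1 := by exact_mod_cast this
      omega
    · have : (β.2.1 : ℝ) < γ.2.2 + 2 := by linarith
      have : β.2.1 < γ.2.2 + 2 := by exact_mod_cast this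
      omega
  · apply hadj; right
    rw [e] at k3 k4
    push_cast at k3 k4
    refine ⟨e, ?_, ?_⟩
    · have : (β.2.1 : ℝ) < γ.2.2 + 1 := by linarith
      have : β.2.1 < γ.2.2 + 1 := by exact_mod_cast this
      omega
    · have : (γ.2.1 : ℝ) < β.2.2 + 2 := by linarith
      have : γ.2.1 < β.2.2 + 2 := by exact_mod_cast this
      omega

lemma BarRight.overlap {X : Set (ℤ × ℤ)} {h : ℝ} (hh : 0 < h) {β γ : ℤ × ℤ × ℤ}
    (hβ : IsBar X β) (hγ : IsBar X γ) (hadj : BarRight β γ) :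
    max ((γ.2.1 + γ.1 / 2) * h) ((β.2.1 + β.1 / 2) * h) <
      min ((γ.2.2 + 1 + γ.1 / 2) * h) ((β.2.2 + 1 + β.1 / 2) * h) := by
  obtain ⟨h1, h2, h3⟩ := hadj
  have h4 : (γ.2.1 : ℝ) ≤ β.2.2 := by exact_mod_cast h2
  have h5 : (β.2.1 : ℝ) ≤ γ.2.2 + 1 := by exact_mod_cast h3
  have h6 : (γ.2.1 : ℝ) ≤ γ.2.2 := by exact_mod_cast hγ.1
  have h7 : (β.2.1 : ℝ) ≤ β.2.2 := by exact_mod_cast hβ.1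
  have h8 : (γ.1 : ℝ) = β.1 + 1 := by exact_mod_cast h1
  rw [max_lt_iff, lt_min_iff, lt_min_iff]
  refine ⟨⟨?_, ?_⟩, ?_, ?_⟩ <;> refine mul_lt_mul_of_pos_right ?_ hh <;> linarith

lemma isClosed_barRect (h : ℝ) (β : ℤ × ℤ × ℤ) : IsClosed (barRect h β) :=
  isClosed_Icc.prod isClosed_Icc

/-- A finite union of bars of a finite set of cells with connected complement is compressible
in each of its neighbourhoods. -/
theorem compressible_bars {X : Set (ℤ × ℤ)} (hX : X.Finite) (hW : HexConnected Xᶜ) {h : ℝ}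
    (hh : 0 < h) (n : ℕ) : ∀ (B : Finset (ℤ × ℤ × ℤ)), B.card = n → (∀ β ∈ B, IsBar X β) →
    ∀ U : Set (ℝ × ℝ), IsOpen U → (⋃ β ∈ B, barRect h β) ⊆ U →
      Compressible U (⋃ β ∈ B, barRect h β) := by
  classical
  induction n with
  | zero =>
    intro B hB _ U _ _
    rw [Finset.card_eq_zero] at hB
    subst hB
    exact ⟨∅, by simp, by simp, fun V _ _ => ⟨Homeomorph.refl _, SuppIn.refl _, by simp⟩⟩
  | succ n ih =>
    intro B hB hbar U hU hBU
    have hne : B.Nonempty := by rw [← Finset.card_pos]; omega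
    obtain ⟨β, hβ, hleaf⟩ := exists_leaf_bar hX hW B hbar hne
    have hcard : (B.erase β).card = n := by rw [Finset.card_erase_of_mem hβ, hB]; rfl
    have hbar' : ∀ γ ∈ B.erase β, IsBar X γ := fun γ hγ => hbar γ (Finset.mem_of_mem_erase hγ)
    have hunion : (⋃ γ ∈ B, barRect h γ) = barRect h β ∪ ⋃ γ ∈ B.erase β, barRect h γ := by
      conv_lhs => rw [← Finset.insert_erase hβ]
      rw [Finset.set_biUnion_insert]
    have hβU : barRect h β ⊆ U := by
      refine (subset_union_left.trans hunion.ge).trans hBU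
    have hrest : (⋃ γ ∈ B.erase β, barRect h γ) ⊆ U :=
      (subset_union_right.trans hunion.ge).trans hBU
    have hβbar := hbar β hβ
    have hx : (β.1 : ℝ) * h < (β.1 + 1) * h := mul_lt_mul_of_pos_right (by linarith) hh
    have hy : ((β.2.1 : ℝ) + β.1 / 2) * h < (β.2.2 + 1 + β.1 / 2) * h := by
      have : (β.2.1 : ℝ) ≤ β.2.2 := by exact_mod_cast hβbar.1
      exact mul_lt_mul_of_pos_right (by linarith) hh
    have hcl : ∀ s : Finset (ℤ × ℤ × ℤ), IsClosed (⋃ γ ∈ s, barRect h γ) := fun s =>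
      s.finite_toSet.isClosed_biUnion fun γ _ => isClosed_barRect h γ
    by_cases hnb : ∃ γ ∈ B, BarAdj β γ
    · obtain ⟨γ, hγ, hadj⟩ := hnb
      have hγβ : γ ≠ β := by
        rintro rfl; rcases hadj with h | h <;> (have := h.1; omega)
      have hγ' : γ ∈ B.erase β := Finset.mem_erase.2 ⟨hγβ, hγ⟩
      set Q := ⋃ δ ∈ (B.erase β).erase γ, barRect h δ with hQ
      have hdisj : Disjoint (barRect h β) Q := by
        rw [hQ, Set.disjoint_iUnion₂_right]
        intro δ hδ
        rw [Finset.mem_erase, Finset.mem_erase] at hδ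
        refine barRect_disjoint hh hβbar (hbar δ hδ.2.2) hδ.2.1.symm fun h' => ?_
        exact hδ.1 (hleaf δ hδ.2.2 γ hγ h' hadj)
      have hsplit : (⋃ δ ∈ B.erase β, barRect h δ) = barRect h γ ∪ Q := by
        conv_lhs => rw [← Finset.insert_erase hγ']
        rw [Finset.set_biUnion_insert]
      have hU1 : IsOpen (U ∩ Qᶜ) := hU.inter (hcl _).isOpen_compl
      have hβU1 : barRect h β ⊆ U ∩ Qᶜ := fun z hz => ⟨hβU hz, Set.disjoint_left.1 hdisj hz⟩
      obtain ⟨k, hk, hkim⟩ : ∃ k : ℝ × ℝ ≃ₜ ℝ × ℝ, SuppIn k (U ∩ Qᶜ) ∧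
          k '' (barRect h β ∪ barRect h γ) ⊆ barRect h γ := by
        rcases hadj with h' | h'
        · have hov := h'.overlap hh hβbar (hbar γ hγ)
          have e : (γ.1 : ℝ) = β.1 + 1 := by exact_mod_cast h'.1
          unfold barRect at hβU1 ⊢
          rw [e] at hov ⊢
          exact exists_absorb_right hU1 hβU1 hx (mul_lt_mul_of_pos_right (by linarith) hh) hov
        · have hov := h'.overlap hh (hbar γ hγ) hβbar
          rw [max_comm, min_comm] at hov
          have e : (γ.1 : ℝ) + 1 = β.1 := by exact_mod_cast h'.1.symm
          unfold barRect at hβU1 ⊢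
          rw [e]
          exact exists_absorb_left hU1 hβU1 (mul_lt_mul_of_pos_right (by linarith) hh) hx hov
      refine (ih _ hcard hbar' U hU hrest).of_image (k := k) (hk.mono inter_subset_left) ?_
      rw [hunion, hsplit]
      rintro _ ⟨z, hz | hz | hz, rfl⟩
      · exact Or.inl (hkim (mem_image_of_mem k (Or.inl hz)))
      · exact Or.inl (hkim (mem_image_of_mem k (Or.inr hz)))
      · right; rw [hk z (fun h' => h'.2 hz)]; exact hz
    · push Not at hnb
      set Q := ⋃ γ ∈ B.erase β, barRect h γ with hQ
      have hdisj : Disjoint (barRect h β) Q := by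
        rw [hQ, Set.disjoint_iUnion₂_right]
        intro δ hδ
        rw [Finset.mem_erase] at hδ
        exact barRect_disjoint hh hβbar (hbar δ hδ.2) hδ.1.symm (hnb δ hδ.2)
      have hU1 : IsOpen (U ∩ (barRect h β)ᶜ) := hU.inter (isClosed_barRect h β).isOpen_compl
      obtain ⟨A, hAU, hAinj, hA⟩ := ih _ hcard hbar' (U ∩ (barRect h β)ᶜ) hU1 fun z hz =>
        ⟨hrest hz, fun hz' => Set.disjoint_left.1 hdisj hz' hz⟩
      obtain ⟨x, hxI, hxA⟩ := (Ioo_infinite hx).exists_notMem_finset (A.image Prod.fst)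
      obtain ⟨y, hyI⟩ := nonempty_Ioo.2 hy
      have hpI : (x, y) ∈ Ioo ((β.1 : ℝ) * h) ((β.1 + 1) * h) ×ˢ
        Ioo (((β.2.1 : ℝ) + β.1 / 2) * h) ((β.2.2 + 1 + β.1 / 2) * h) := ⟨hxI, hyI⟩
      refine ⟨insert (x, y) A, ?_, ?_, fun V hV hAV => ?_⟩
      · rw [Finset.coe_insert, insert_subset_iff]
        refine ⟨hβU ⟨Ioo_subset_Icc_self hxI, Ioo_subset_Icc_self hyI⟩,
          hAU.trans inter_subset_left⟩
      · rw [Finset.coe_insert, Set.injOn_insert]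
        · refine ⟨hAinj, fun h' => hxA ?_⟩
          rw [← Finset.coe_image] at h'
          exact h'
        · exact fun h' => hxA (Finset.mem_image_of_mem Prod.fst (Finset.mem_coe.1 h'))
      · rw [Finset.coe_insert, insert_subset_iff] at hAV
        obtain ⟨k₁, hk₁, hk₁'⟩ := exists_shrink_rect (U := U ∩ Qᶜ)
          (V := V ∩ (Ioo ((β.1 : ℝ) * h) ((β.1 + 1) * h) ×ˢ
            Ioo (((β.2.1 : ℝ) + β.1 / 2) * h) ((β.2.2 + 1 + β.1 / 2) * h)))
          (hU.inter (hcl _).isOpen_compl) (hV.inter (isOpen_Ioo.prod isOpen_Ioo))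
          (x₀ := β.1 * h) (x₁ := (β.1 + 1) * h) (c := (β.2.1 + β.1 / 2) * h)
          (d := (β.2.2 + 1 + β.1 / 2) * h)
          (fun z hz => ⟨hβU hz, Set.disjoint_left.1 hdisj hz⟩) hpI ⟨hAV.1, hpI⟩
        obtain ⟨k₂, hk₂, hk₂'⟩ := hA V hV hAV.2
        refine ⟨k₁.trans k₂, (hk₁.mono inter_subset_left).trans (hk₂.mono inter_subset_left), ?_⟩
        rw [hunion]
        rintro _ ⟨z, hz | hz, rfl⟩
        · have := hk₁' (mem_image_of_mem k₁ hz)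
          rw [Homeomorph.trans_apply, hk₂]
          · exact this.1
          · exact fun h' => h'.2 ⟨Ioo_subset_Icc_self this.2.1, Ioo_subset_Icc_self this.2.2⟩
        · rw [Homeomorph.trans_apply, hk₁ z (fun h' => h'.2 hz)]
          exact hk₂' (mem_image_of_mem k₂ hz)

/-- Finitely many points with distinct abscissae can be moved vertically to the axis. -/
theorem exists_move_to_axis (A : Finset (ℝ × ℝ)) (hA : InjOn Prod.fst (A : Set (ℝ × ℝ)))
    {V : Set (ℝ × ℝ)} (hV : IsOpen V)
    (hAV : ∀ a ∈ A, Icc a.1 a.1 ×ˢ Icc (min a.2 0) (max a.2 0) ⊆ V) :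
    ∃ m : ℝ × ℝ ≃ₜ ℝ × ℝ, SuppIn m V ∧ ∀ a ∈ A, m a = (a.1, 0) := by
  classical
  suffices H : ∀ A' : Finset (ℝ × ℝ), A' ⊆ A → ∃ m : ℝ × ℝ ≃ₜ ℝ × ℝ, SuppIn m V ∧
      (∀ a ∈ A', m a = (a.1, 0)) ∧ ∀ a ∈ A, a ∉ A' → m a = a by
    obtain ⟨m, h1, h2, -⟩ := H A le_rfl
    exact ⟨m, h1, h2⟩
  intro A'
  induction A' using Finset.induction_on with
  | empty => exact fun _ => ⟨Homeomorph.refl _, SuppIn.refl _, by simp, by simp⟩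
  | insert a s has ih =>
    intro hs
    have haA : a ∈ A := hs (Finset.mem_insert_self _ _)
    obtain ⟨m, h1, h2, h3⟩ := ih ((Finset.subset_insert _ _).trans hs)
    obtain ⟨e₀, he₀, hm⟩ := exists_margin hV (hAV a haA) le_rfl
      ((min_le_right _ _).trans (le_max_right _ _))
    obtain ⟨e₁, he₁, hsep⟩ : ∃ e > 0, ∀ b ∈ A, b ≠ a → e ≤ |b.1 - a.1| := by
      have hc : IsClosed (((A.erase a).image Prod.fst : Finset ℝ) : Set ℝ) :=
        (Finset.finite_toSet _).isClosed
      have hn : a.1 ∉ (((A.erase a).image Prod.fst : Finset ℝ) : Set ℝ) := by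
        intro h
        simp only [Finset.coe_image, mem_image, Finset.mem_coe, Finset.mem_erase] at h
        obtain ⟨b, ⟨hb1, hb2⟩, hb3⟩ := h
        exact hb1 (hA hb2 haA hb3)
      obtain ⟨e, he, hball⟩ := Metric.isOpen_iff.1 hc.isOpen_compl a.1 hn
      refine ⟨e, he, fun b hb hba => ?_⟩
      by_contra! hlt
      have := hball (show b.1 ∈ Metric.ball a.1 e by rwa [Metric.mem_ball, Real.dist_eq])
      exact this (by
        simp only [Finset.coe_image, mem_image, Finset.mem_coe, Finset.mem_erase]
        exact ⟨b, ⟨hba, hb⟩, rfl⟩)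
    obtain ⟨f, f1, -, -, f4, -⟩ := exists_vMove (A := min a.2 0 - e₀) (B := max a.2 0 + e₀)
      (p := a.2) (q := 0) (a := a.1) (b := a.1) (e := min e₀ e₁)
      (by linarith [min_le_left a.2 0]) (by linarith [le_max_left a.2 0])
      (by linarith [min_le_right a.2 0]) (by linarith [le_max_right a.2 0]) (lt_min he₀ he₁)
    have hother : ∀ b ∈ A, b ≠ a → ∀ y, f (b.1, y) = (b.1, y) := by
      intro b hb hba y
      refine f1 _ fun h => ?_
      have := hsep b hb hba
      have h4 : |b.1 - a.1| < min e₀ e₁ := by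
        rw [abs_lt]; constructor <;> linarith [h.1.1, h.1.2]
      linarith [min_le_right e₀ e₁]
    refine ⟨m.trans f, h1.trans (f1.mono ?_), ?_, ?_⟩
    · refine (Set.prod_mono (Ioo_subset_Icc_self.trans ?_) Ioo_subset_Icc_self).trans hm
      have := min_le_left e₀ e₁
      exact Icc_subset_Icc (by linarith) (by linarith)
    · intro b hb
      rw [Homeomorph.trans_apply]
      rcases Finset.mem_insert.1 hb with rfl | hb
      · rw [h3 b haA has]
        exact f4 b.1 ⟨le_rfl, le_rfl⟩
      · rw [h2 b hb]
        exact hother b (hs (Finset.mem_insert_of_mem hb)) (fun h => has (h ▸ hb)) 0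
    · intro b hb hbs
      rw [Finset.mem_insert, not_or] at hbs
      rw [Homeomorph.trans_apply, h3 b hb hbs.2]
      exact hother b hb hbs.1 b.2

/-- The closed brick of a cell, for cells of size `h`. -/
def brick (h : ℝ) (c : ℤ × ℤ) : Set (ℝ × ℝ) :=
  Icc (c.1 * h) ((c.1 + 1) * h) ×ˢ Icc ((c.2 + c.1 / 2) * h) ((c.2 + 1 + c.1 / 2) * h)

lemma isClosed_brick (h : ℝ) (c : ℤ × ℤ) : IsClosed (brick h c) := isClosed_Icc.prod isClosed_Icc

lemma exists_mem_brick {h : ℝ} (hh : 0 < h) (z : ℝ × ℝ) : ∃ c, z ∈ brick h c := by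
  refine ⟨(⌊z.1 / h⌋, ⌊z.2 / h - (⌊z.1 / h⌋ : ℝ) / 2⌋), ⟨?_, ?_⟩, ?_, ?_⟩
  · rw [← le_div_iff₀ hh]; exact Int.floor_le _
  · rw [← div_le_iff₀ hh]; exact (Int.lt_floor_add_one _).le
  · rw [← le_div_iff₀ hh]; linarith [Int.floor_le (z.2 / h - (⌊z.1 / h⌋ : ℝ) / 2)]
  · rw [← div_le_iff₀ hh]; linarith [Int.lt_floor_add_one (z.2 / h - (⌊z.1 / h⌋ : ℝ) / 2)]

lemma dist_le_of_mem_brick {h : ℝ} {c : ℤ × ℤ} {z w : ℝ × ℝ} (hz : z ∈ brick h c)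
    (hw : w ∈ brick h c) : dist z w ≤ h := by
  obtain ⟨⟨h1, h2⟩, h3, h4⟩ := hz
  obtain ⟨⟨h5, h6⟩, h7, h8⟩ := hw
  rw [Prod.dist_eq, max_le_iff, Real.dist_eq, Real.dist_eq, abs_le, abs_le]
  refine ⟨⟨?_, ?_⟩, ?_, ?_⟩ <;> linarith

lemma hexAdj_of_mem_brick {h : ℝ} (hh : 0 < h) {c d : ℤ × ℤ} {z : ℝ × ℝ} (hc : z ∈ brick h c)
    (hd : z ∈ brick h d) (hne : c ≠ d) : HexAdj c d := by
  obtain ⟨⟨h1, h2⟩, h3, h4⟩ := hc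
  obtain ⟨⟨h5, h6⟩, h7, h8⟩ := hd
  have k1 := le_of_mul_le_mul_right (h1.trans h6) hh
  have k2 := le_of_mul_le_mul_right (h5.trans h2) hh
  have k3 := le_of_mul_le_mul_right (h3.trans h8) hh
  have k4 := le_of_mul_le_mul_right (h7.trans h4) hh
  obtain ⟨j, i⟩ := c
  obtain ⟨j', i'⟩ := d
  simp only at k1 k2 k3 k4
  have k1' : j ≤ j' + 1 := by exact_mod_cast k1
  have k2' : j' ≤ j + 1 := by exact_mod_cast k2
  have key : j = j' ∨ j' = j + 1 ∨ j = j' + 1 := by omega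
  unfold HexAdj
  rcases key with rfl | rfl | rfl
  · have k3' : i ≤ i' + 1 := by
      have : (i : ℝ) ≤ i' + 1 := by linarith
      exact_mod_cast this
    have k4' : i' ≤ i + 1 := by
      have : (i' : ℝ) ≤ i + 1 := by linarith
      exact_mod_cast this
    have : i ≠ i' := fun h => hne (by rw [h])
    left; exact ⟨rfl, by grind⟩
  · push_cast at k3 k4
    have : i < i' + 2 := by
      have : (i : ℝ) < i' + 2 := by linarith
      exact_mod_cast this
    have : i' < i + 1 := by
      have : (i' : ℝ) < i + 1 := by linarith
      exact_mod_cast this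
    grind
  · push_cast at k3 k4
    have : i' < i + 2 := by
      have : (i' : ℝ) < i + 2 := by linarith
      exact_mod_cast this
    have : i < i' + 1 := by
      have : (i : ℝ) < i' + 1 := by linarith
      exact_mod_cast this
    grind

lemma finite_bricks_meeting {h : ℝ} (hh : 0 < h) (R : ℝ) :
    {c | (brick h c ∩ Metric.closedBall 0 R).Nonempty}.Finite := by
  set T := R / h + 1 with hT
  set M : ℤ := ⌈2 * T⌉ with hM
  have hM' : 2 * T ≤ M := Int.le_ceil _
  refine ((finite_Icc (-M) M).prod (finite_Icc (-M) M)).subset ?_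
  rintro ⟨j, i⟩ ⟨z, ⟨⟨h1, h2⟩, h3, h4⟩, hz⟩
  rw [mem_closedBall_zero_iff, Prod.norm_def, max_le_iff, Real.norm_eq_abs, Real.norm_eq_abs,
    abs_le, abs_le] at hz
  obtain ⟨⟨z1, z2⟩, z3, z4⟩ := hz
  have hR : R = (T - 1) * h := by rw [hT]; field_simp; ring
  rw [hR] at z1 z2 z3 z4
  have k1 := le_of_mul_le_mul_right (h1.trans z2) hh
  have k2 := le_of_mul_le_mul_right ((neg_mul _ _).le.trans (z1.trans h2)) hh
  have k3 := le_of_mul_le_mul_right (h3.trans z4) hh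
  have k4 := le_of_mul_le_mul_right ((neg_mul _ _).le.trans (z3.trans h4)) hh
  simp only at k1 k2 k3 k4
  refine ⟨⟨?_, ?_⟩, ?_, ?_⟩
  · have : ((-M : ℤ) : ℝ) ≤ j := by push_cast; linarith
    exact_mod_cast this
  · have : (j : ℝ) ≤ M := by linarith
    exact_mod_cast this
  · have : ((-M : ℤ) : ℝ) ≤ i := by push_cast; linarith
    exact_mod_cast this
  · have : (i : ℝ) ≤ M := by linarith
    exact_mod_cast this

lemma locallyFinite_brick {h : ℝ} (hh : 0 < h) : LocallyFinite (brick h) := by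
  intro z
  refine ⟨Metric.ball z 1, Metric.ball_mem_nhds z one_pos,
    (finite_bricks_meeting hh (‖z‖ + 1)).subset ?_⟩
  rintro c ⟨w, hw, hwz⟩
  refine ⟨w, hw, ?_⟩
  rw [mem_closedBall_zero_iff]
  rw [mem_ball_iff_norm] at hwz
  have : ‖w‖ ≤ ‖z‖ + ‖w - z‖ := by
    simpa using norm_add_le z (w - z)
  linarith

lemma isClosed_biUnion_brick {h : ℝ} (hh : 0 < h) (A : Set (ℤ × ℤ)) :
    IsClosed (⋃ c ∈ A, brick h c) := by
  rw [biUnion_eq_iUnion]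
  exact ((locallyFinite_brick hh).comp_injective Subtype.val_injective).isClosed_iUnion
    fun c => isClosed_brick h c

/-- The cells meeting a connected set are connected. -/
lemma hexConnected_meeting {h : ℝ} (hh : 0 < h) {W : Set (ℝ × ℝ)} (hW : IsPreconnected W) :
    HexConnected {c | (brick h c ∩ W).Nonempty} := by
  intro A hA hne hcl
  by_contra hAne
  obtain ⟨d₀, hd₀, hd₀A⟩ := exists_of_ssubset (hA.ssubset_of_ne hAne)
  set D := {c | (brick h c ∩ W).Nonempty} \ A with hD
  obtain ⟨z, hzW, hzA, hzD⟩ := isPreconnected_closed_iff.1 hW (⋃ c ∈ A, brick h c)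
    (⋃ c ∈ D, brick h c) (isClosed_biUnion_brick hh A) (isClosed_biUnion_brick hh D) (by
      intro z hz
      obtain ⟨c, hc⟩ := exists_mem_brick hh z
      by_cases hcA : c ∈ A
      · exact Or.inl (mem_biUnion hcA hc)
      · exact Or.inr (mem_biUnion (⟨⟨z, hc, hz⟩, hcA⟩ : c ∈ D) hc))
    (by
      obtain ⟨c, hc⟩ := hne
      obtain ⟨z, hz, hzW⟩ := hA hc
      exact ⟨z, hzW, mem_biUnion hc hz⟩)
    (by
      obtain ⟨z, hz, hzW⟩ := hd₀
      exact ⟨z, hzW, mem_biUnion (⟨⟨z, hz, hzW⟩, hd₀A⟩ : d₀ ∈ D) hz⟩)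
  simp only [mem_iUnion] at hzA hzD
  obtain ⟨c, hc, hzc⟩ := hzA
  obtain ⟨d, hd, hzd⟩ := hzD
  exact hd.2 (hcl c hc d hd.1 (hexAdj_of_mem_brick hh hzc hzd fun e => hd.2 (e ▸ hc)))

/-- The complement of a connected-complement compact set can be exhausted by connected sets at
positive distance. -/
lemma exists_connected_far {C N : Set (ℝ × ℝ)} (hC : IsCompact C) (hCne : C.Nonempty)
    (hCc : IsPreconnected Cᶜ) (hN : IsOpen N) (hCN : C ⊆ N) :
    ∃ W : Set (ℝ × ℝ), ∃ δ > 0, IsPreconnected W ∧ (∀ z ∈ W, δ < Metric.infDist z C) ∧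
      Nᶜ ⊆ W ∧ Bornology.IsBounded Wᶜ := by
  obtain ⟨R, hR0, hR⟩ : ∃ R > 0, C ⊆ Metric.closedBall 0 R := by
    obtain ⟨R, hR⟩ := hC.isBounded.subset_closedBall 0
    exact ⟨max R 1, by positivity, hR.trans (Metric.closedBall_subset_closedBall (le_max_left _ _))⟩
  set z₀ : ℝ × ℝ := (R + 1, 0) with hz₀
  have hz₀n : ‖z₀‖ = R + 1 := by
    rw [hz₀, Prod.norm_def]; simp only [norm_zero, Real.norm_eq_abs]
    rw [abs_of_pos (by linarith), max_eq_left (by linarith)]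
  have hfar : ∀ z : ℝ × ℝ, R + 1 ≤ ‖z‖ → 1 ≤ Metric.infDist z C := by
    intro z hz
    rw [Metric.le_infDist hCne]
    intro y hy
    have h1 : ‖y‖ ≤ R := by simpa using hR hy
    rw [dist_eq_norm]
    have := norm_sub_norm_le z y
    linarith
  have hz₀C : z₀ ∈ Cᶜ := fun h => by
    have h1 : ‖z₀‖ ≤ R := by simpa using hR h
    linarith
  let Wd : ℕ → Set (ℝ × ℝ) := fun n => {z | 1 / ((n : ℝ) + 2) < Metric.infDist z C}
  have hWd : ∀ n, IsOpen (Wd n) := fun n =>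
    isOpen_lt continuous_const (Metric.continuous_infDist_pt C)
  let Wc : ℕ → Set (ℝ × ℝ) := fun n => connectedComponentIn (Wd n) z₀
  have hlt1 : ∀ n : ℕ, 1 / ((n : ℝ) + 2) < 1 := fun n => by
    rw [div_lt_one (by positivity)]; linarith [(n.cast_nonneg : (0 : ℝ) ≤ n)]
  have hz₀W : ∀ n, z₀ ∈ Wd n := fun n => (hlt1 n).trans_le (hfar z₀ hz₀n.ge)
  have hmono : Monotone Wc := by
    intro n m hnm
    refine connectedComponentIn_mono _ fun z (hz : 1 / ((n : ℝ) + 2) < Metric.infDist z C) =>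
      (lt_of_le_of_lt ?_ hz : 1 / ((m : ℝ) + 2) < Metric.infDist z C)
    have : (n : ℝ) ≤ m := by exact_mod_cast hnm
    exact one_div_le_one_div_of_le (by positivity) (by linarith)
  have hcover : ∀ z ∈ Cᶜ, ∃ n, z ∈ Wc n := by
    intro z hz
    have hpc : IsPathConnected Cᶜ :=
      (hC.isClosed.isOpen_compl).isConnected_iff_isPathConnected.1 ⟨⟨z₀, hz₀C⟩, hCc⟩
    obtain ⟨γ, hγ⟩ := hpc.joinedIn z₀ hz₀C z hz
    have hcomp : IsCompact (range γ) := isCompact_range γ.continuous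
    obtain ⟨w, hw, hmin⟩ := hcomp.exists_isMinOn (range_nonempty γ)
      (Metric.continuous_infDist_pt C).continuousOn
    have hpos : 0 < Metric.infDist w C := by
      obtain ⟨t, rfl⟩ := hw
      exact (hC.isClosed.notMem_iff_infDist_pos hCne).1 (hγ t)
    obtain ⟨n, hn⟩ := exists_nat_one_div_lt hpos
    refine ⟨n, ?_⟩
    have hsub : range γ ⊆ Wd n := fun x hx => by
      have h1 : Metric.infDist w C ≤ Metric.infDist x C := hmin hx
      refine lt_of_le_of_lt ?_ (hn.trans_le h1)
      exact one_div_le_one_div_of_le (by positivity) (by linarith)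
    have := (isPreconnected_range γ.continuous).subset_connectedComponentIn
      (⟨0, γ.source⟩ : z₀ ∈ range γ) hsub
    exact this ⟨1, γ.target⟩
  set N' := N ∩ Metric.ball 0 (R + 1) with hN'
  have hCN' : C ⊆ N' := fun z hz => ⟨hCN hz, by
    have h1 : ‖z‖ ≤ R := by simpa using hR hz
    rw [mem_ball_zero_iff]; linarith⟩
  have hKc : IsCompact (Metric.closedBall (0 : ℝ × ℝ) (R + 1) \ N') :=
    (isCompact_closedBall 0 (R + 1)).diff (hN.inter Metric.isOpen_ball)
  obtain ⟨n, hn⟩ := hKc.elim_directed_cover Wc (fun n => (hWd n).connectedComponentIn)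
    (fun z hz => mem_iUnion.2 (hcover z fun h => hz.2 (hCN' h))) hmono.directed_le
  have houter : ∀ z : ℝ × ℝ, R + 1 ≤ ‖z‖ → z ∈ Wc n := by
    intro z hz
    have hzpos : 0 < ‖z‖ := by linarith
    set w : ℝ × ℝ := ((R + 1) / ‖z‖) • z with hw
    have hwn : ‖w‖ = R + 1 := by
      rw [hw, norm_smul, Real.norm_of_nonneg (by positivity)]; field_simp
    have hwW : w ∈ Wc n := hn ⟨by simp [hwn], fun h => by
      have := h.2; rw [mem_ball_zero_iff] at this; linarith⟩
    have hseg : segment ℝ w z ⊆ Wd n := by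
      rintro x ⟨a, b, ha, hb, hab, rfl⟩
      refine (hlt1 n).trans_le (hfar _ ?_)
      have : a • w + b • z = (a * ((R + 1) / ‖z‖) + b) • z := by
        rw [hw, smul_smul, ← add_smul]
      rw [this, norm_smul, Real.norm_of_nonneg (by positivity)]
      have h2 : (a * ((R + 1) / ‖z‖) + b) * ‖z‖ = a * (R + 1) + b * ‖z‖ := by field_simp
      rw [h2]
      calc R + 1 = a * (R + 1) + b * (R + 1) := by rw [← add_mul, hab, one_mul]
        _ ≤ _ := by gcongr
    have h3 := ((convex_segment w z).isPreconnected).subset_connectedComponentIn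
      (left_mem_segment ℝ w z) hseg
    have h4 : connectedComponentIn (Wd n) w = Wc n := (connectedComponentIn_eq hwW).symm
    rw [← h4]
    exact h3 (right_mem_segment ℝ w z)
  have hall : ∀ z, z ∉ N' → z ∈ Wc n := by
    intro z hz
    by_cases h : R + 1 ≤ ‖z‖
    · exact houter z h
    · exact hn ⟨by rw [mem_closedBall_zero_iff]; linarith, hz⟩
  refine ⟨Wc n, 1 / ((n : ℝ) + 2), by positivity, isPreconnected_connectedComponentIn,
    fun z hz => (connectedComponentIn_subset (Wd n) z₀ hz : z ∈ Wd n), fun z hz => hall z fun h => hz h.1, ?_⟩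
  refine (Metric.isBounded_ball (x := (0 : ℝ × ℝ)) (r := R + 1)).subset fun z hz => ?_
  by_contra h
  exact hz (hall z fun h' => h h'.2)

lemma exists_bar_of_mem {X : Set (ℤ × ℤ)} (hX : X.Finite) {c : ℤ × ℤ} (hc : c ∈ X) :
    ∃ β, IsBar X β ∧ β.1 = c.1 ∧ β.2.1 ≤ c.2 ∧ c.2 ≤ β.2.2 := by
  obtain ⟨M, hM⟩ := (hX.image Prod.snd).bddAbove
  obtain ⟨m, hm⟩ := (hX.image Prod.snd).bddBelow
  obtain ⟨b, ⟨hb1, hb2⟩, hb3⟩ := Int.exists_greatest_of_bdd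
    (P := fun b => c.2 ≤ b ∧ ∀ k, c.2 ≤ k → k ≤ b → (c.1, k) ∈ X)
    ⟨M, fun b hb => hM (mem_image_of_mem Prod.snd (hb.2 b hb.1 le_rfl))⟩
    ⟨c.2, le_rfl, fun k h1 h2 => by rw [le_antisymm h2 h1]; exact hc⟩
  obtain ⟨a, ⟨ha1, ha2⟩, ha3⟩ := Int.exists_least_of_bdd
    (P := fun a => a ≤ c.2 ∧ ∀ k, a ≤ k → k ≤ c.2 → (c.1, k) ∈ X)
    ⟨m, fun a ha => hm (mem_image_of_mem Prod.snd (ha.2 a le_rfl ha.1))⟩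
    ⟨c.2, le_rfl, fun k h1 h2 => by rw [le_antisymm h2 h1]; exact hc⟩
  refine ⟨(c.1, a, b), ⟨ha1.trans hb1, fun i h1 h2 => ?_, fun h => ?_, fun h => ?_⟩, rfl, ha1, hb1⟩
  · rcases le_total i c.2 with h | h
    · exact ha2 i h1 h
    · exact hb2 i h h2
  · have := ha3 (a - 1) ⟨by omega, fun k h1 h2 => by
      rcases eq_or_lt_of_le h1 with rfl | h3
      · exact h
      · exact ha2 k (by omega) h2⟩
    omega
  · have := hb3 (b + 1) ⟨by omega, fun k h1 h2 => by
      rcases eq_or_lt_of_le h2 with rfl | h3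
      · exact h
      · exact hb2 k h1 (by omega)⟩
    omega

/-- A compact set with connected complement has arbitrarily close neighbourhoods which are
finite unions of bars of a finite set of cells with connected complement; such unions are
compressible. -/
theorem exists_compressible_between {C N : Set (ℝ × ℝ)} (hC : IsCompact C) (hCne : C.Nonempty)
    (hCc : IsPreconnected Cᶜ) (hN : IsOpen N) (hCN : C ⊆ N) :
    ∃ P, C ⊆ P ∧ Compressible N P := by
  classical
  obtain ⟨W, δ, hδ, hW, hWδ, hNW, hbdd⟩ := exists_connected_far hC hCne hCc hN hCN
  set h := δ / 2 with hh
  have hh0 : 0 < h := by positivity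
  set X : Set (ℤ × ℤ) := {c | (brick h c ∩ W).Nonempty}ᶜ with hX
  have hXW : ∀ c ∈ X, brick h c ⊆ Wᶜ := fun c hc z hz hzW => hc ⟨z, hz, hzW⟩
  have hXfin : X.Finite := by
    obtain ⟨R, hR⟩ := hbdd.subset_closedBall 0
    refine (finite_bricks_meeting hh0 R).subset fun c hc => ?_
    have hmem : ((c.1 : ℝ) * h, ((c.2 : ℝ) + c.1 / 2) * h) ∈ brick h c :=
      ⟨⟨le_rfl, by nlinarith⟩, le_rfl, by nlinarith⟩
    exact ⟨_, hmem, hR (hXW c hc hmem)⟩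
  have hXc : HexConnected Xᶜ := by rw [hX, compl_compl]; exact hexConnected_meeting hh0 hW
  have hBfin : {β | IsBar X β}.Finite := by
    refine Set.Finite.of_finite_image (f := fun β : ℤ × ℤ × ℤ => ((β.1, β.2.1), (β.1, β.2.2)))
      ((hXfin.prod hXfin).subset ?_) ?_
    · rintro _ ⟨β, hβ, rfl⟩
      exact ⟨hβ.2.1 _ le_rfl hβ.1, hβ.2.1 _ hβ.1 le_rfl⟩
    · rintro ⟨j, a, b⟩ - ⟨j', a', b'⟩ - e
      simp only [Prod.mk.injEq] at e ⊢
      tauto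
  set B := hBfin.toFinset with hB
  have hbar : ∀ β ∈ B, IsBar X β := fun β hβ => by simpa [hB] using hβ
  refine ⟨⋃ β ∈ B, barRect h β, ?_, compressible_bars hXfin hXc hh0 _ B rfl hbar N hN ?_⟩
  · intro z hz
    obtain ⟨c, hc⟩ := exists_mem_brick hh0 z
    have hcX : c ∈ X := by
      rintro ⟨w, hwc, hwW⟩
      have h1 := hWδ w hwW
      have h2 := Metric.infDist_le_dist_of_mem (x := w) hz
      have h3 := dist_le_of_mem_brick hwc hc
      linarith
    obtain ⟨β, hβ, e1, e2, e3⟩ := exists_bar_of_mem hXfin hcX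
    refine mem_biUnion (by simpa [hB] using hβ : β ∈ (B : Set (ℤ × ℤ × ℤ))) ?_
    have e2' : (β.2.1 : ℝ) ≤ c.2 := by exact_mod_cast e2
    have e3' : (c.2 : ℝ) ≤ β.2.2 := by exact_mod_cast e3
    obtain ⟨h1, h3, h4⟩ := hc
    unfold barRect
    rw [e1]
    refine ⟨h1, le_trans ?_ h3, h4.trans ?_⟩ <;> gcongr
  · simp only [iUnion_subset_iff]
    intro β hβ z hz
    obtain ⟨h1, h2, h3⟩ := hz
    have hβ' := hbar β hβ
    have key : ∃ i, β.2.1 ≤ i ∧ i ≤ β.2.2 ∧ z ∈ brick h (β.1, i) := by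
      rcases le_total ⌊z.2 / h - (β.1 : ℝ) / 2⌋ β.2.2 with hle | hle
      · refine ⟨_, ?_, hle, h1, ?_, ?_⟩
        · rw [Int.le_floor]
          rw [← le_div_iff₀ hh0] at h2
          linarith
        · rw [← le_div_iff₀ hh0]; simp only; linarith [Int.floor_le (z.2 / h - (β.1 : ℝ) / 2)]
        · rw [← div_le_iff₀ hh0]; simp only
          linarith [Int.lt_floor_add_one (z.2 / h - (β.1 : ℝ) / 2)]
      · refine ⟨β.2.2, hβ'.1, le_rfl, h1, ?_, h3⟩
        rw [Int.le_floor] at hle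
        rw [← le_div_iff₀ hh0]; simp only; linarith
    obtain ⟨i, hi1, hi2, hi3⟩ := key
    by_contra hzN
    exact hXW _ (hβ'.2.1 i hi1 hi2) hi3 (hNW hzN)

/-- A union of open squares centred on the axis. -/
def axisBalls (A : Finset ℝ) (r : ℝ) : Set (ℝ × ℝ) := ⋃ x ∈ A, Metric.ball (x, 0) r

/-- A union of closed squares centred on the axis. -/
def axisClosedBalls (A : Finset ℝ) (r : ℝ) : Set (ℝ × ℝ) := ⋃ x ∈ A, Metric.closedBall (x, 0) r

lemma mem_axisBalls {A : Finset ℝ} {r : ℝ} {z : ℝ × ℝ} :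
    z ∈ axisBalls A r ↔ ∃ x ∈ A, |z.1 - x| < r ∧ |z.2| < r := by
  simp only [axisBalls, mem_iUnion, Metric.mem_ball, Prod.dist_eq, Real.dist_eq, sub_zero,
    max_lt_iff, exists_prop]

lemma mem_axisClosedBalls {A : Finset ℝ} {r : ℝ} {z : ℝ × ℝ} :
    z ∈ axisClosedBalls A r ↔ ∃ x ∈ A, |z.1 - x| ≤ r ∧ |z.2| ≤ r := by
  simp only [axisClosedBalls, mem_iUnion, Metric.mem_closedBall, Prod.dist_eq, Real.dist_eq,
    sub_zero, max_le_iff, exists_prop]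

lemma isOpen_axisBalls (A : Finset ℝ) (r : ℝ) : IsOpen (axisBalls A r) :=
  isOpen_biUnion fun _ _ => Metric.isOpen_ball

lemma isCompact_axisClosedBalls (A : Finset ℝ) (r : ℝ) : IsCompact (axisClosedBalls A r) :=
  A.finite_toSet.isCompact_biUnion fun _ _ => isCompact_closedBall _ _

lemma axisBalls_subset (A : Finset ℝ) (r : ℝ) : axisBalls A r ⊆ axisClosedBalls A r :=
  iUnion₂_mono fun _ _ => Metric.ball_subset_closedBall

theorem exists_concentrating_step {C N : Set (ℝ × ℝ)} (hC : IsCompact C) (hCne : C.Nonempty)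
    (hCc : IsPreconnected Cᶜ) {A : Finset ℝ} {r : ℝ} (hCA : C ⊆ axisBalls A r) (hN : IsOpen N)
    (hCN : C ⊆ N) {η : ℝ} (hη : 0 < η) :
    ∃ (g : ℝ × ℝ ≃ₜ ℝ × ℝ) (A' : Finset ℝ) (r' : ℝ), SuppIn g (axisBalls A r) ∧ 0 < r' ∧ r' < η ∧
      (∀ x ∈ A', ∀ x' ∈ A', x ≠ x' → 2 * r' < |x - x'|) ∧ g '' C ⊆ axisBalls A' r' ∧
      axisClosedBalls A' r' ⊆ axisBalls A r ∧ axisClosedBalls A' r' ⊆ g '' N := by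
  classical
  set V := axisBalls A r with hV
  have hVo : IsOpen V := isOpen_axisBalls A r
  obtain ⟨P, hCP, A0, hA0, hinj, hk⟩ :=
    exists_compressible_between hC hCne hCc (hN.inter hVo) (subset_inter hCN hCA)
  obtain ⟨m, hmV, hm⟩ := exists_move_to_axis A0 hinj hVo (by
    rintro a ha ⟨z1, z2⟩ ⟨⟨h1, h2⟩, h3, h4⟩
    obtain ⟨x, hx, h5, h6⟩ := mem_axisBalls.1 (hA0 ha).2
    have e : z1 = a.1 := le_antisymm h2 h1
    refine mem_axisBalls.2 ⟨x, hx, by simpa [e] using h5, ?_⟩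
    rw [abs_lt] at h6 ⊢
    simp only [min_le_iff, le_max_iff] at h3 h4
    grind)
  set W := m '' (N ∩ V) with hW
  have hWo : IsOpen W := m.isOpenMap _ (hN.inter hVo)
  set A' := A0.image Prod.fst with hA'
  have hA'W : ∀ x ∈ A', ((x, 0) : ℝ × ℝ) ∈ W := by
    intro x hx
    obtain ⟨a, ha, rfl⟩ := Finset.mem_image.1 hx
    exact ⟨a, hA0 ha, hm a ha⟩
  have e1 : ∀ᶠ ρ : ℝ in 𝓝[>] 0, ∀ x ∈ A', Metric.closedBall ((x, 0) : ℝ × ℝ) ρ ⊆ W := by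
    rw [Filter.eventually_all_finset]
    intro x hx
    obtain ⟨ρ, hρ, hsub⟩ := Metric.nhds_basis_closedBall.mem_iff.1 (hWo.mem_nhds (hA'W x hx))
    filter_upwards [Ioo_mem_nhdsGT hρ] with s hs
    exact (Metric.closedBall_subset_closedBall hs.2.le).trans hsub
  have e2 : ∀ᶠ ρ : ℝ in 𝓝[>] 0, ∀ x ∈ A', ∀ x' ∈ A', x ≠ x' → 2 * ρ < |x - x'| := by
    rw [Filter.eventually_all_finset]
    intro x hx
    rw [Filter.eventually_all_finset]
    intro x' hx'
    by_cases h : x = x'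
    · exact Eventually.of_forall fun ρ h' => absurd h h'
    · have : 0 < |x - x'| / 2 := by have := abs_pos.2 (sub_ne_zero.2 h); positivity
      filter_upwards [Ioo_mem_nhdsGT this] with s hs _
      linarith [hs.2]
  obtain ⟨r', h1, h2, hr'⟩ := (e1.and (e2.and (Ioo_mem_nhdsGT hη))).exists
  obtain ⟨k, hkU, hkP⟩ := hk (m ⁻¹' axisBalls A' r') ((isOpen_axisBalls A' r').preimage m.continuous)
    (fun a ha => by
      rw [mem_preimage, hm a ha]
      exact mem_axisBalls.2 ⟨a.1, Finset.mem_image_of_mem _ ha, by simpa using hr'.1,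
        by simpa using hr'.1⟩)
  have hcl : axisClosedBalls A' r' ⊆ W := iUnion₂_subset h1
  refine ⟨k.trans m, A', r', (hkU.mono inter_subset_right).trans hmV, hr'.1, hr'.2, h2, ?_, ?_, ?_⟩
  · rintro _ ⟨c, hc, rfl⟩
    exact hkP ⟨c, hCP hc, rfl⟩
  · refine hcl.trans ?_
    rintro _ ⟨z, hz, rfl⟩
    exact hmV.mapsTo hz.2
  · intro z hz
    obtain ⟨w, hw, rfl⟩ := hcl hz
    exact ⟨k.symm w, (hkU.symm.mapsTo hw).1, by simp⟩

section LimitHomeo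

variable {X : Type*} [TopologicalSpace X] {G : ℕ → X ≃ₜ X} {D U : ℕ → Set X}

lemma eventually_const_of_notMem (hUD : ∀ n, U n ⊆ D n) (hDU : ∀ n, D (n + 1) ⊆ U n)
    (hG : ∀ n z, G n z ∉ U n → G (n + 1) z = G n z) {n : ℕ} {z : X} (hz : G n z ∉ U n) {m : ℕ}
    (hm : n ≤ m) : G m z = G n z ∧ G n z ∉ U m := by
  induction m, hm using Nat.le_induction with
  | base => exact ⟨rfl, hz⟩
  | succ m _ ih =>
    refine ⟨?_, fun h => ih.2 (hDU m (hUD _ h))⟩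
    rw [hG m z (ih.1 ▸ ih.2), ih.1]

/-- A sequence of homeomorphisms which stabilises away from a shrinking sequence of sets
converges to a homeomorphism of the complements of the intersections. -/
lemma exists_limit_homeo (hD : ∀ n, IsClosed (D n)) (hUD : ∀ n, U n ⊆ D n)
    (hDU : ∀ n, D (n + 1) ⊆ U n) (hG : ∀ n z, G n z ∉ U n → G (n + 1) z = G n z)
    {C F : Set X} (hC : C = ⋂ n, G n ⁻¹' U n) (hF : F = ⋂ n, U n) :
    ∃ Φ : ↥Cᶜ ≃ₜ ↥Fᶜ, ∀ (z : ↥Cᶜ) n, G n z ∉ U n → (Φ z : X) = G n z := by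
  have stab := @eventually_const_of_notMem X _ G D U hUD hDU hG
  have hCn : ∀ z : ↥Cᶜ, ∃ n, G n z ∉ U n := fun ⟨z, hz⟩ => by
    rw [hC] at hz; simpa using hz
  have hFn : ∀ z : ↥Fᶜ, ∃ n, (z : X) ∉ U n := fun ⟨z, hz⟩ => by
    rw [hF] at hz; simpa using hz
  choose a ha using hCn
  choose b hb using hFn
  have key : ∀ (z : X) n m, G n z ∉ U n → G m z ∉ U m → G n z = G m z := by
    intro z n m hn hm
    rcases le_total n m with h | h
    · exact (stab hn h).1.symm
    · exact (stab hm h).1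
  have hf : ∀ z : ↥Cᶜ, G (a z) z ∈ Fᶜ := fun z h => ha z (by rw [hF] at h; exact mem_iInter.1 h _)
  have hg : ∀ z : ↥Fᶜ, (G (b z)).symm z ∈ Cᶜ := fun z h => hb z (by
    rw [hC] at h; simpa using mem_iInter.1 h (b z))
  have keyf : ∀ (z : ↥Cᶜ) n, G n z ∉ U n → G (a z) z = G n z := fun z n hn => key z _ n (ha z) hn
  have keyg : ∀ (z : ↥Fᶜ) n, (z : X) ∉ U n → (G (b z)).symm z = (G n).symm z := by
    intro z n hn
    have hb' := hb z
    rcases le_total n (b z) with h | h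
    · rw [(G (b z)).symm_apply_eq, (stab (z := (G n).symm z) (by simpa using hn) h).1]; simp
    · rw [eq_comm, (G n).symm_apply_eq,
        (stab (z := (G (b z)).symm z) (by simpa using hb') h).1]; simp
  refine ⟨⟨⟨fun z => ⟨_, hf z⟩, fun z => ⟨_, hg z⟩, fun z => ?_, fun z => ?_⟩, ?_, ?_⟩, keyf⟩
  · apply Subtype.ext
    simp only
    rw [keyg ⟨_, hf z⟩ (a z) (ha z)]; simp
  · apply Subtype.ext
    simp only
    rw [keyf ⟨_, hg z⟩ (b z) (by simpa using hb z)]; simp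
  · refine Continuous.subtype_mk (continuous_iff_continuousAt.2 fun z => ?_) _
    have h1 : ∀ᶠ w : ↥Cᶜ in 𝓝 z, G (a z + 1) w ∉ D (a z + 1) := by
      refine (((hD _).preimage ((G _).continuous.comp continuous_subtype_val)).isOpen_compl).mem_nhds
        fun h => ha z ?_
      have h2 := (stab (ha z) (Nat.le_succ (a z))).1
      exact hDU _ (h2 ▸ h)
    refine ContinuousAt.congr (f := fun w : ↥Cᶜ => G (a z + 1) w)
      (((G _).continuous.comp continuous_subtype_val).continuousAt) ?_
    filter_upwards [h1] with w hw
    exact (keyf w _ fun h => hw (hUD _ h)).symm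
  · refine Continuous.subtype_mk (continuous_iff_continuousAt.2 fun z => ?_) _
    have h1 : ∀ᶠ w : ↥Fᶜ in 𝓝 z, (w : X) ∉ D (b z + 1) :=
      (((hD _).preimage continuous_subtype_val).isOpen_compl).mem_nhds fun h => hb z (hDU _ h)
    refine ContinuousAt.congr (f := fun w : ↥Fᶜ => (G (b z + 1)).symm w)
      (((G _).symm.continuous.comp continuous_subtype_val).continuousAt) ?_
    filter_upwards [h1] with w hw
    exact (keyg w _ fun h => hw (hUD _ h)).symm

end LimitHomeo

lemma exists_notMem_axisClosedBalls {A : Finset ℝ} {r a b : ℝ}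
    (hA : ∀ x ∈ A, ∀ x' ∈ A, x ≠ x' → 2 * r < |x - x'|) (hab : 2 * r < b - a) (hr : 0 < r) :
    ∃ s ∈ Ioo a b, ((s, 0) : ℝ × ℝ) ∉ axisClosedBalls A r := by
  by_contra! hcon
  obtain ⟨x, hx, hax, -⟩ := mem_axisClosedBalls.1 (hcon (a + (b - a - 2 * r) / 2)
    ⟨by linarith, by linarith⟩)
  simp only [abs_le] at hax
  have e1 : ∀ᶠ d : ℝ in 𝓝[>] 0, ∀ x' ∈ A, r < |x + r + d - x'| := by
    rw [Filter.eventually_all_finset]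
    intro x' hx'
    rcases le_or_gt x' x with h | h
    · filter_upwards [self_mem_nhdsWithin] with d (hd : 0 < d)
      rw [lt_abs]; left; linarith
    · have h1 := hA x hx x' hx' h.ne
      rw [abs_sub_comm, abs_of_pos (sub_pos.2 h)] at h1
      filter_upwards [Ioo_mem_nhdsGT (sub_pos.2 h1)] with d hd
      rw [lt_abs]; right; linarith [hd.2]
  obtain ⟨d, hd, hd'⟩ := (e1.and (Ioo_mem_nhdsGT
    (show (0 : ℝ) < (b - a - 2 * r) / 2 by linarith))).exists
  obtain ⟨x', hx', h1, -⟩ := mem_axisClosedBalls.1 (hcon (x + r + d)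
    ⟨by linarith [hd'.1], by linarith [hd'.2]⟩)
  exact absurd (hd x' hx') (not_lt.2 h1)

/-- A compact set with connected complement can be replaced by a compact subset of the axis with
empty interior. -/
theorem exists_homeo_compl_axis {C : Set (ℝ × ℝ)} (hC : IsCompact C) (hCne : C.Nonempty)
    (hCc : IsPreconnected Cᶜ) :
    ∃ F : Set ℝ, IsCompact F ∧ F.Nonempty ∧ interior F = ∅ ∧
      ∃ Φ : ↥Cᶜ ≃ₜ ↥{p : ℝ × ℝ | p.2 = 0 ∧ p.1 ∈ F}ᶜ, ∃ R : ℝ, ∀ z : ↥Cᶜ,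
        R < ‖(z : ℝ × ℝ)‖ → (Φ z : ℝ × ℝ) = z := by
  obtain ⟨R, hR0, hR⟩ : ∃ R > 0, C ⊆ Metric.ball 0 R := by
    obtain ⟨R, hR⟩ := hC.isBounded.subset_ball 0
    exact ⟨max R 1, by positivity, hR.trans (Metric.ball_subset_ball (le_max_left _ _))⟩
  let Good : (ℝ × ℝ ≃ₜ ℝ × ℝ) × Finset ℝ × ℝ → Prop := fun s =>
    s.1 '' C ⊆ axisBalls s.2.1 s.2.2
  have step : ∀ (n : ℕ) (s : {s // Good s}), ∃ t : {s // Good s},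
      (∀ z, s.1.1 z ∉ axisBalls s.1.2.1 s.1.2.2 → t.1.1 z = s.1.1 z) ∧
      0 < t.1.2.2 ∧ t.1.2.2 < 1 / ((n : ℝ) + 1) ∧
      (∀ x ∈ t.1.2.1, ∀ x' ∈ t.1.2.1, x ≠ x' → 2 * t.1.2.2 < |x - x'|) ∧
      axisClosedBalls t.1.2.1 t.1.2.2 ⊆ axisBalls s.1.2.1 s.1.2.2 ∧
      t.1.1 ⁻¹' axisClosedBalls t.1.2.1 t.1.2.2 ⊆ Metric.thickening (1 / ((n : ℝ) + 1)) C := by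
    rintro n ⟨⟨G, A, r⟩, hs⟩
    obtain ⟨g, A', r', h1, h2, h3, h4, h5, h6, h7⟩ := exists_concentrating_step
      (hC.image G.continuous) (hCne.image G) (by
        rw [← image_compl_eq G.bijective]; exact hCc.image _ G.continuous.continuousOn) hs
      (G.isOpenMap _ (Metric.isOpen_thickening (δ := 1 / ((n : ℝ) + 1)) (E := C)))
      (image_mono (Metric.self_subset_thickening (by positivity) C))
      (show (0 : ℝ) < 1 / ((n : ℝ) + 1) by positivity)
    refine ⟨⟨(G.trans g, A', r'), ?_⟩, fun z hz => h1 _ hz, h2, h3, h4, h6, ?_⟩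
    · rw [image_image] at h5; exact h5
    · intro z hz
      obtain ⟨_, ⟨w, hw, rfl⟩, e⟩ := h7 hz
      have : w = z := G.injective (g.injective e)
      exact this ▸ hw
  choose nxt hnxt using step
  have hinit : Good (Homeomorph.refl _, {0}, R) := by
    rintro z ⟨w, hw, rfl⟩
    exact mem_biUnion (Finset.mem_singleton_self (0 : ℝ)) (hR hw)
  obtain ⟨s, hs0, hs⟩ : ∃ s : ℕ → {s // Good s}, s 0 = ⟨_, hinit⟩ ∧ ∀ n, s (n + 1) = nxt n (s n) :=
    ⟨fun n => Nat.rec ⟨_, hinit⟩ (fun n s => nxt n s) n, rfl, fun n => rfl⟩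
  have hs' := fun n => hnxt n (s n)
  simp only [← hs] at hs'
  set G : ℕ → (ℝ × ℝ ≃ₜ ℝ × ℝ) := fun n => (s n).1.1 with hGdef
  set U : ℕ → Set (ℝ × ℝ) := fun n => axisBalls (s n).1.2.1 (s n).1.2.2 with hUdef
  set D : ℕ → Set (ℝ × ℝ) := fun n => axisClosedBalls (s n).1.2.1 (s n).1.2.2 with hDdef
  have hDc : ∀ n, IsCompact (D n) := fun n => isCompact_axisClosedBalls _ _
  have hUD : ∀ n, U n ⊆ D n := fun n => axisBalls_subset _ _
  have hDU : ∀ n, D (n + 1) ⊆ U n := fun n => (hs' n).2.2.2.2.1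
  have hCU : ∀ n, C ⊆ G n ⁻¹' U n := fun n z hz => (s n).2 ⟨z, hz, rfl⟩
  have hCeq : C = ⋂ n, G n ⁻¹' U n := by
    refine subset_antisymm (subset_iInter hCU) fun z hz => ?_
    rw [mem_iInter] at hz
    rw [← hC.isClosed.closure_eq, Metric.mem_closure_iff_infEDist_zero,
      ← nonpos_iff_eq_zero]
    refine le_of_forall_gt fun c hc => ?_
    obtain ⟨n, hn⟩ := ENNReal.exists_inv_nat_lt (by simpa using hc.ne' : c ≠ 0)
    have h1 := (hs' n).2.2.2.2.2 (hUD _ (hz (n + 1)))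
    rw [Metric.mem_thickening_iff_infEDist_lt] at h1
    refine h1.trans (lt_of_le_of_lt ?_ hn)
    rw [one_div, ENNReal.ofReal_inv_of_pos (by positivity)]
    refine ENNReal.inv_le_inv.2 ?_
    rw [← ENNReal.ofReal_natCast]
    exact ENNReal.ofReal_le_ofReal (by linarith)
  have haxis : ∀ p : ℝ × ℝ, p ∈ ⋂ n, U n → p.2 = 0 := by
    intro p hp
    rw [mem_iInter] at hp
    by_contra h
    obtain ⟨n, hn⟩ := exists_nat_one_div_lt (abs_pos.2 h)
    obtain ⟨x, -, -, h2⟩ := mem_axisBalls.1 (hp (n + 1))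
    linarith [(hs' n).2.2.1]
  set F : Set ℝ := {x | ((x, 0) : ℝ × ℝ) ∈ ⋂ n, U n} with hF
  have hFU : {p : ℝ × ℝ | p.2 = 0 ∧ p.1 ∈ F} = ⋂ n, U n := by
    ext ⟨p1, p2⟩
    constructor
    · rintro ⟨h, h'⟩
      simp only at h h'
      subst h
      exact h'
    · intro h
      have h0 := haxis _ h
      simp only at h0
      subst h0
      exact ⟨rfl, h⟩
  have hUDeq : ⋂ n, U n = ⋂ n, D n := by
    refine subset_antisymm (iInter_mono hUD) fun z hz => ?_
    rw [mem_iInter] at hz ⊢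
    exact fun n => hDU n (hz _)
  have hUc : IsCompact (⋂ n, U n) := by
    rw [hUDeq]
    exact (hDc 0).of_isClosed_subset (isClosed_iInter fun n => (hDc n).isClosed) (iInter_subset _ 0)
  have hFeq : F = Prod.fst '' ⋂ n, U n := by
    ext x
    constructor
    · exact fun h => ⟨_, h, rfl⟩
    · rintro ⟨⟨a, b⟩, h, rfl⟩
      have h0 := haxis _ h
      simp only at h0
      subst h0
      exact h
  obtain ⟨Φ, hΦ⟩ := exists_limit_homeo (fun n => (hDc n).isClosed) hUD hDU
    (fun n => (hs' n).1) hCeq hFU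
  refine ⟨F, hFeq ▸ hUc.image continuous_fst, ?_, ?_, Φ, R, ?_⟩
  · rw [hFeq, image_nonempty, hUDeq]
    refine IsCompact.nonempty_iInter_of_sequence_nonempty_isCompact_isClosed D
      (fun n => (hDU n).trans (hUD n)) (fun n => ?_) (hDc 0) fun n => (hDc n).isClosed
    obtain ⟨c, hc⟩ := hCne
    exact ⟨_, hUD n (hCU n hc)⟩
  · by_contra h
    obtain ⟨x, hx⟩ := nonempty_iff_ne_empty.2 h
    obtain ⟨ρ, hρ, hsub⟩ := Metric.isOpen_iff.1 isOpen_interior x hx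
    obtain ⟨n, hn⟩ := exists_nat_one_div_lt hρ
    obtain ⟨t, ht, ht'⟩ := exists_notMem_axisClosedBalls (a := x - ρ) (b := x + ρ)
      (hs' n).2.2.2.1 (by linarith [(hs' n).2.2.1]) (hs' n).2.1
    have h1 : t ∈ F := interior_subset (hsub (by rwa [Real.ball_eq_Ioo]))
    exact ht' (hUD (n + 1) (mem_iInter.1 h1 (n + 1)))
  · intro z hz
    have hG0 : G 0 = Homeomorph.refl _ := by rw [hGdef]; simp only [hs0]
    have hU0 : U 0 = axisBalls {0} R := by rw [hUdef]; simp only [hs0]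
    rw [hΦ z 0 ?_]
    · change G 0 z = z
      rw [hG0]; rfl
    change G 0 z ∉ U 0
    rw [hG0, hU0]
    intro h
    obtain ⟨x, hx, h1, h2⟩ := mem_axisBalls.1 h
    have hx0 : x = 0 := Finset.mem_singleton.1 hx
    subst hx0
    have h1' : |(z : ℝ × ℝ).1 - 0| < R := h1
    have h2' : |(z : ℝ × ℝ).2| < R := h2
    rw [sub_zero] at h1'
    rw [Prod.norm_def, lt_max_iff] at hz
    simp only [Real.norm_eq_abs] at hz
    rcases hz with hz | hz <;> linarith

lemma isPreconnected_punctured_ball (p : ℝ × ℝ) (r : ℝ) :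
    IsPreconnected (Metric.ball p r \ {p}) := by
  have hs : IsPreconnected (Metric.sphere (0 : ℝ × ℝ) 1 ×ˢ Ioo (0 : ℝ) r) :=
    (isPreconnected_sphere (by simp [one_add_one_eq_two]) 0 1).prod isPreconnected_Ioo
  have hf : Continuous fun z : (ℝ × ℝ) × ℝ => p + z.2 • z.1 := by fun_prop
  convert hs.image _ hf.continuousOn using 1
  ext x
  constructor
  · rintro ⟨h1, h2⟩
    have h3 : 0 < ‖x - p‖ := norm_pos_iff.2 (sub_ne_zero.2 h2)
    refine ⟨(‖x - p‖⁻¹ • (x - p), ‖x - p‖), ⟨?_, h3, by rwa [← mem_ball_iff_norm]⟩, ?_⟩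
    · rw [mem_sphere_zero_iff_norm, norm_smul, norm_inv, norm_norm, inv_mul_cancel₀ h3.ne']
    · simp only
      rw [smul_smul, mul_inv_cancel₀ h3.ne', one_smul, add_sub_cancel]
  · rintro ⟨⟨v, s⟩, ⟨hv, hs1, hs2⟩, rfl⟩
    rw [mem_sphere_zero_iff_norm] at hv
    simp only at hs1 hs2 hv ⊢
    have : ‖s • v‖ = s := by rw [norm_smul, hv, mul_one, Real.norm_of_nonneg hs1.le]
    refine ⟨by rw [mem_ball_iff_norm, add_sub_cancel_left, this]; exact hs2, fun h => ?_⟩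
    rw [mem_singleton_iff, add_eq_left] at h
    rw [h, norm_zero] at this
    exact hs1.ne this

lemma isPreconnected_diff_singleton {S : Set (ℝ × ℝ)} (hS : IsOpen S) (hc : IsPreconnected S)
    {p : ℝ × ℝ} (hp : p ∈ S) : IsPreconnected (S \ {p}) := by
  obtain ⟨r, hr, hB⟩ := Metric.isOpen_iff.1 hS p hp
  have hO : IsOpen (S \ {p}) := hS.sdiff isClosed_singleton
  have key : ∀ u v : Set (ℝ × ℝ), IsOpen u → IsOpen v → S \ {p} ⊆ u ∪ v →
      S \ {p} ∩ (u ∩ v) = ∅ → Metric.ball p r \ {p} ⊆ u → S \ {p} ⊆ u := by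
    intro u v hu hv huv hd hBu
    rcases isPreconnected_iff_subset_of_disjoint.1 hc ((u ∩ (S \ {p})) ∪ Metric.ball p r)
      (v ∩ (S \ {p})) ((hu.inter hO).union Metric.isOpen_ball) (hv.inter hO)
      (fun x hx => by
        by_cases h : x = p
        · exact Or.inl (Or.inr (h ▸ Metric.mem_ball_self hr))
        · rcases huv ⟨hx, h⟩ with h1 | h1
          · exact Or.inl (Or.inl ⟨h1, hx, h⟩)
          · exact Or.inr ⟨h1, hx, h⟩)
      (by
        rw [eq_empty_iff_forall_notMem] at hd ⊢
        rintro x ⟨hx, h1 | h1, h2⟩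
        · exact hd x ⟨h1.2, h1.1, h2.1⟩
        · exact hd x ⟨h2.2, hBu ⟨h1, h2.2.2⟩, h2.1⟩) with h | h
    · rintro x ⟨hx, hxp⟩
      rcases h hx with h1 | h1
      · exact h1.1
      · exact hBu ⟨h1, hxp⟩
    · exact absurd rfl (h hp).2.2
  rw [isPreconnected_iff_subset_of_disjoint]
  intro u v hu hv huv hd
  rcases isPreconnected_iff_subset_of_disjoint.1 (isPreconnected_punctured_ball p r) u v hu hv
    ((sdiff_subset_sdiff_left hB).trans huv) (by
      rw [← subset_empty_iff, ← hd]
      exact inter_subset_inter_left _ (sdiff_subset_sdiff_left hB)) with h | h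
  · exact Or.inl (key u v hu hv huv hd h)
  · exact Or.inr (key v u hv hu (by rwa [union_comm]) (by rwa [inter_comm v u]) h)

/-- Inversion in the unit sphere of the norm. -/
def invN (v : ℝ × ℝ) : ℝ × ℝ := (‖v‖ ^ 2)⁻¹ • v

lemma norm_invN (v : ℝ × ℝ) : ‖invN v‖ = ‖v‖⁻¹ := by
  rcases eq_or_ne v 0 with rfl | h
  · simp [invN]
  · have : 0 < ‖v‖ := norm_pos_iff.2 h
    rw [invN, norm_smul, norm_inv, norm_pow, norm_norm]
    field_simp

lemma invN_invN (v : ℝ × ℝ) : invN (invN v) = v := by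
  rcases eq_or_ne v 0 with rfl | h
  · simp [invN]
  · have h1 : 0 < ‖v‖ := norm_pos_iff.2 h
    rw [invN, norm_invN, invN, smul_smul]
    rw [show ((‖v‖⁻¹ ^ 2)⁻¹ * (‖v‖ ^ 2)⁻¹ : ℝ) = 1 by field_simp, one_smul]

lemma invN_ne_zero {v : ℝ × ℝ} (h : v ≠ 0) : invN v ≠ 0 := fun h' => h (by
  rw [← invN_invN v, h']; simp [invN])

lemma continuousAt_invN {v : ℝ × ℝ} (h : v ≠ 0) : ContinuousAt invN v := by
  have h1 : ‖v‖ ^ 2 ≠ 0 := by simpa using h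
  unfold invN
  fun_prop (disch := assumption)

/-- The part of the inverted plane lying over `S`. -/
def invDom (S : Set (ℝ × ℝ)) : Set (ℝ × ℝ) := {v | v ≠ 0 ∧ invN v ∈ S}

lemma invN_mem_invDom {S : Set (ℝ × ℝ)} {v : ℝ × ℝ} (hv : v ≠ 0) (h : v ∈ S) :
    invN v ∈ invDom S := ⟨invN_ne_zero hv, by rwa [invN_invN]⟩

open Classical in
/-- Extension over the origin of a map between inverted domains. -/
def invMap {S T : Set (ℝ × ℝ)} (hT : (0 : ℝ × ℝ) ∈ T) (h : invDom S → invDom T) (v : S) : T :=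
  if hv : (v : ℝ × ℝ) = 0 then ⟨0, hT⟩
  else ⟨invN (h ⟨invN v, invN_mem_invDom hv v.2⟩), (h _).2.2⟩

lemma invMap_of_ne {S T : Set (ℝ × ℝ)} (hT : (0 : ℝ × ℝ) ∈ T) (h : invDom S → invDom T) {v : S}
    (hv : (v : ℝ × ℝ) ≠ 0) :
    (invMap hT h v : ℝ × ℝ) = invN (h ⟨invN v, invN_mem_invDom hv v.2⟩) := by
  simp [invMap, hv]

lemma invMap_zero {S T : Set (ℝ × ℝ)} (hT : (0 : ℝ × ℝ) ∈ T) (h : invDom S → invDom T) {v : S}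
    (hv : (v : ℝ × ℝ) = 0) : (invMap hT h v : ℝ × ℝ) = 0 := by
  simp [invMap, hv]

lemma continuous_invMap {S T : Set (ℝ × ℝ)} (hT : (0 : ℝ × ℝ) ∈ T) {h : invDom S → invDom T}
    (hc : Continuous h) (hinf : ∀ M, ∃ R, ∀ v : invDom S, R < ‖(v : ℝ × ℝ)‖ → M < ‖(h v : ℝ × ℝ)‖) :
    Continuous (invMap hT h) := by
  rw [continuous_induced_rng, continuous_iff_continuousAt]
  intro v
  by_cases hv : (v : ℝ × ℝ) = 0
  · rw [Metric.continuousAt_iff]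
    intro ε hε
    obtain ⟨R, hR⟩ := hinf ε⁻¹
    refine ⟨(max R 1)⁻¹, by positivity, fun w hw => ?_⟩
    simp only [Function.comp_apply]
    rw [invMap_zero hT h hv, dist_zero_right]
    rw [Subtype.dist_eq, hv, dist_zero_right] at hw
    by_cases hw0 : (w : ℝ × ℝ) = 0
    · rw [invMap_zero hT h hw0]; simpa using hε
    · rw [invMap_of_ne hT h hw0, norm_invN]
      have h1 : 0 < ‖(w : ℝ × ℝ)‖ := norm_pos_iff.2 hw0
      have h2 := hR ⟨invN w, invN_mem_invDom hw0 w.2⟩ (by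
        simp only
        rw [norm_invN]
        exact (le_max_left R 1).trans_lt ((lt_inv_comm₀ h1 (by positivity)).1 hw))
      exact inv_lt_of_inv_lt₀ hε h2
  · have hO : IsOpen {w : S | (w : ℝ × ℝ) ≠ 0} := isOpen_ne.preimage continuous_subtype_val
    refine ContinuousOn.continuousAt (s := {w : S | (w : ℝ × ℝ) ≠ 0}) ?_ (hO.mem_nhds hv)
    rw [continuousOn_iff_continuous_domRestrict, continuous_iff_continuousAt]
    intro w
    have e : domRestrict {w : S | (w : ℝ × ℝ) ≠ 0} (Subtype.val ∘ invMap hT h) =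
        fun w => invN (h ⟨invN w.1, invN_mem_invDom w.2 w.1.2⟩) :=
      funext fun w => invMap_of_ne hT h w.2
    rw [e]
    refine ContinuousAt.comp (g := invN) (continuousAt_invN (h _).2.1)
      (continuous_subtype_val.continuousAt.comp (hc.continuousAt.comp ?_))
    refine IsInducing.subtypeVal.continuousAt_iff.2 ?_
    exact ContinuousAt.comp (g := invN) (continuousAt_invN w.2)
      (continuous_subtype_val.comp continuous_subtype_val).continuousAt

lemma mem_invDom_axis {F : Set ℝ} (hF : (0 : ℝ) ∈ F) (w : ℝ × ℝ) :
    w ∈ invDom {p : ℝ × ℝ | ¬ (p.2 = 0 ∧ p.1 ≠ 0 ∧ p.1⁻¹ ∈ F)} ↔ ¬ (w.2 = 0 ∧ w.1 ∈ F) := by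
  rcases eq_or_ne w 0 with rfl | hw
  · exact ⟨fun h => absurd rfl h.1, fun h => absurd ⟨rfl, hF⟩ h⟩
  · obtain ⟨a, b⟩ := w
    have hn : 0 < ‖(a, b)‖ := norm_pos_iff.2 hw
    change (_ ∧ ¬ _) ↔ _
    simp only [invN, Prod.smul_mk, smul_eq_mul]
    refine ⟨fun h h' => h.2 ?_, fun h => ⟨hw, fun h' => h ?_⟩⟩
    · obtain ⟨rfl, h2⟩ := h'
      have ha : a ≠ 0 := fun h => hw (by rw [h]; rfl)
      have hna : ‖(a, (0 : ℝ))‖ ^ 2 = a ^ 2 := by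
        rw [Prod.norm_def]; simp
      rw [hna]
      refine ⟨by simp, by positivity, ?_⟩
      rw [show ((a ^ 2)⁻¹ * a)⁻¹ = a by field_simp]
      exact h2
    · obtain ⟨h1, h2, h3⟩ := h'
      have hb : b = 0 := by
        rcases mul_eq_zero.1 h1 with h | h
        · exact absurd h (by positivity)
        · exact h
      subst hb
      have ha : a ≠ 0 := fun h => hw (by rw [h]; rfl)
      have hna : ‖(a, (0 : ℝ))‖ ^ 2 = a ^ 2 := by
        rw [Prod.norm_def]; simp
      rw [hna, show ((a ^ 2)⁻¹ * a)⁻¹ = a by field_simp] at h3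
      exact ⟨rfl, h3⟩

/-- A homeomorphism of inverted domains preserving infinity extends over the origin. -/
lemma nonempty_homeo_of_invDom {S T : Set (ℝ × ℝ)} (hS : (0 : ℝ × ℝ) ∈ S) (hT : (0 : ℝ × ℝ) ∈ T)
    (h : invDom S ≃ₜ invDom T) (hinf : ∀ M, ∃ R, ∀ v : invDom S, R < ‖(v : ℝ × ℝ)‖ → M < ‖(h v : ℝ × ℝ)‖)
    (hinf' : ∀ M, ∃ R, ∀ v : invDom T, R < ‖(v : ℝ × ℝ)‖ →
      M < ‖(h.symm v : ℝ × ℝ)‖) :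
    Nonempty (S ≃ₜ T) := by
  have hl : ∀ {S T : Set (ℝ × ℝ)} (hS : (0 : ℝ × ℝ) ∈ S) (hT : (0 : ℝ × ℝ) ∈ T)
      (h : invDom S ≃ₜ invDom T) (v : S), invMap hS h.symm (invMap hT h v) = v := by
    intro S T hS hT h v
    apply Subtype.ext
    by_cases hv : (v : ℝ × ℝ) = 0
    · rw [invMap_zero _ _ (invMap_zero _ _ hv), hv]
    · have h1 := invMap_of_ne hT h hv
      have h2 : (invMap hT h v : ℝ × ℝ) ≠ 0 := by
        rw [h1]; exact invN_ne_zero (h _).2.1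
      rw [invMap_of_ne _ _ h2]
      have h3 : (⟨invN (invMap hT h v), invN_mem_invDom h2 (invMap hT h v).2⟩ : invDom T) =
          h ⟨invN v, invN_mem_invDom hv v.2⟩ := by
        apply Subtype.ext
        simp only
        rw [h1, invN_invN]
      rw [h3, h.symm_apply_apply]
      simp only
      rw [invN_invN]
  exact ⟨⟨⟨invMap hT h, invMap hS h.symm, hl hS hT h, hl hT hS h.symm⟩,
    continuous_invMap hT h.continuous hinf, continuous_invMap hS h.symm.continuous hinf'⟩⟩

/-- A planar domain which is not simply connected is homeomorphic to the complement of a closed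
totally disconnected subset of the axis. -/
theorem planar_domain_homeo (Sg : Set (ℝ × ℝ)) (hne : Sg.Nonempty) (hop : IsOpen Sg)
    (hconn : IsConnected Sg) (hnsc : ¬ SimplyConnectedSpace Sg) :
    ∃ F : Set ℝ, IsCompact F ∧ F ⊆ Icc 0 1 ∧ 0 ∈ F ∧ 1 ∈ F ∧ interior F = ∅ ∧
      Nonempty (Sg ≃ₜ {p : ℝ × ℝ | ¬ (p.2 = 0 ∧ p.1 ≠ 0 ∧ p.1⁻¹ ∈ F)}) := by
  obtain ⟨p₀, hp₀⟩ := hne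
  set S : Set (ℝ × ℝ) := {v | v + p₀ ∈ Sg} with hS
  have hSo : IsOpen S := hop.preimage (by fun_prop)
  have hS0 : (0 : ℝ × ℝ) ∈ S := by simpa [hS] using hp₀
  have hSc : IsPreconnected S := by
    have : S = (fun v => v - p₀) '' Sg := by
      ext v
      exact ⟨fun h => ⟨_, h, by simp⟩, by rintro ⟨w, hw, rfl⟩; simpa [hS] using hw⟩
    rw [this]
    exact hconn.isPreconnected.image _ (by fun_prop)
  have eS : Sg ≃ₜ S := (Homeomorph.subtype (Homeomorph.addRight p₀) fun v => Iff.rfl).symm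
  obtain ⟨ρ, hρ, hball⟩ := Metric.isOpen_iff.1 hSo 0 hS0
  set C : Set (ℝ × ℝ) := (invDom S)ᶜ with hC
  have hCC : Cᶜ = invDom S := compl_compl _
  have hIo : invDom S = invN '' (S \ {0}) := by
    ext v
    refine ⟨fun h => ⟨invN v, ⟨h.2, invN_ne_zero h.1⟩, invN_invN v⟩, ?_⟩
    rintro ⟨w, hw, rfl⟩
    exact invN_mem_invDom hw.2 hw.1
  have hCbd : C ⊆ Metric.closedBall 0 ρ⁻¹ := by
    intro v hv
    by_contra h
    rw [mem_closedBall_zero_iff, not_le] at h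
    have hρ' : 0 < ρ⁻¹ := by positivity
    refine hv ⟨norm_pos_iff.1 (hρ'.trans h), hball ?_⟩
    rw [mem_ball_zero_iff, norm_invN]
    exact inv_lt_of_inv_lt₀ hρ h
  have hCcl : IsClosed C := by
    rw [← isOpen_compl_iff, hCC, isOpen_iff_mem_nhds]
    intro v hv
    filter_upwards [isOpen_ne.mem_nhds hv.1, (continuousAt_invN hv.1) (hSo.mem_nhds hv.2)]
      with w h1 h2
    exact ⟨h1, h2⟩
  have hCcomp : IsCompact C := (isCompact_closedBall _ _).of_isClosed_subset hCcl hCbd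
  obtain ⟨F, hF, hFne, hFint, Φ, R, hΦ⟩ := exists_homeo_compl_axis hCcomp
    ⟨0, fun h => h.1 rfl⟩ (by
      rw [hCC, hIo]
      exact (isPreconnected_diff_singleton hSo hSc hS0).image _ fun v hv =>
        (continuousAt_invN hv.2).continuousWithinAt)
  set f₀ := sInf F with hf₀
  set f₁ := sSup F with hf₁
  have hf₀F : f₀ ∈ F := hF.sInf_mem hFne
  have hf₁F : f₁ ∈ F := hF.sSup_mem hFne
  have hle : ∀ f ∈ F, f₀ ≤ f ∧ f ≤ f₁ := fun f hf =>
    ⟨csInf_le hF.bddBelow hf, le_csSup hF.bddAbove hf⟩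
  -- normalisation
  obtain ⟨L, hL, hL'⟩ : ∃ L : ℝ, 0 < L ∧ (f₀ < f₁ → L = f₁ - f₀) := by
    by_cases h : f₀ < f₁
    · exact ⟨_, sub_pos.2 h, fun _ => rfl⟩
    · exact ⟨1, one_pos, fun h' => absurd h' h⟩
  set F' : Set ℝ := {x | f₀ + L * x ∈ F} with hF'
  set affL : ℝ ≃ₜ ℝ := (Homeomorph.mulLeft₀ L hL.ne').trans (Homeomorph.addLeft f₀)
  have h0F' : (0 : ℝ) ∈ F' := by simpa [hF'] using hf₀F
  set T : Set (ℝ × ℝ) := {p | ¬ (p.2 = 0 ∧ p.1 ≠ 0 ∧ p.1⁻¹ ∈ F')} with hT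
  have hT0 : (0 : ℝ × ℝ) ∈ T := fun h => h.2.1 rfl
  set A : ℝ × ℝ ≃ₜ ℝ × ℝ := (Homeomorph.addRight (-(f₀, 0) : ℝ × ℝ)).trans
    (Homeomorph.smulOfNeZero L⁻¹ (by positivity)) with hA
  have hAap : ∀ z, A z = L⁻¹ • (z - (f₀, 0)) := fun z => by
    rw [sub_eq_add_neg]; rfl
  have hAT : ∀ z, (z ∈ {p : ℝ × ℝ | p.2 = 0 ∧ p.1 ∈ F}ᶜ) ↔ A z ∈ invDom T := by
    rintro ⟨x, y⟩
    rw [hT, mem_invDom_axis h0F', hAap, mem_compl_iff, not_iff_not]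
    change (y = 0 ∧ x ∈ F) ↔ (L⁻¹ * (y - 0) = 0 ∧ f₀ + L * (L⁻¹ * (x - f₀)) ∈ F)
    rw [← mul_assoc, mul_inv_cancel₀ hL.ne', one_mul, add_sub_cancel]
    simp [hL.ne']
  set h : invDom S ≃ₜ invDom T := (Homeomorph.setCongr hCC.symm).trans
    (Φ.trans (Homeomorph.subtype A hAT)) with hh
  have hhz : ∀ z : invDom S, R < ‖(z : ℝ × ℝ)‖ → (h z : ℝ × ℝ) = A z := fun z hz => by
    change A (Φ ⟨z, _⟩) = A z
    rw [hΦ _ hz]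
  have hAn : ∀ z, ‖z‖ ≤ L * ‖A z‖ + ‖((f₀, 0) : ℝ × ℝ)‖ := fun z => by
    have : z = L • A z + (f₀, 0) := by rw [hAap, smul_smul, mul_inv_cancel₀ hL.ne', one_smul]; simp
    calc ‖z‖ = ‖L • A z + (f₀, 0)‖ := by rw [← this]
      _ ≤ ‖L • A z‖ + ‖((f₀, 0) : ℝ × ℝ)‖ := norm_add_le _ _
      _ = _ := by rw [norm_smul, Real.norm_of_nonneg hL.le]
  have hAn' : ∀ z, L * ‖A z‖ ≤ ‖z‖ + ‖((f₀, 0) : ℝ × ℝ)‖ := fun z => by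
    rw [hAap, norm_smul, norm_inv, Real.norm_of_nonneg hL.le, ← mul_assoc, mul_inv_cancel₀ hL.ne',
      one_mul]
    exact norm_sub_le _ _
  obtain ⟨e⟩ := nonempty_homeo_of_invDom hS0 hT0 h (fun M =>
    ⟨max R (L * M + ‖((f₀, 0) : ℝ × ℝ)‖), fun v hv => by
      rw [hhz v ((le_max_left _ _).trans_lt hv)]
      have h1 := (le_max_right _ _).trans_lt hv
      have h2 := hAn v
      exact lt_of_mul_lt_mul_left (by linarith) hL.le⟩) (fun M =>
    ⟨(max (max R ρ⁻¹) M + ‖((f₀, 0) : ℝ × ℝ)‖) / L, fun w hw => by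
      rw [div_lt_iff₀ hL] at hw
      set z := A.symm w with hz
      have hzn : max (max R ρ⁻¹) M < ‖z‖ := by
        have := hAn' z
        rw [hz, A.apply_symm_apply] at this
        linarith
      simp only [max_lt_iff] at hzn
      have hzS : z ∈ invDom S := by
        by_contra h
        have := hCbd h
        rw [mem_closedBall_zero_iff] at this
        linarith
      have : h.symm w = ⟨z, hzS⟩ := by
        rw [h.symm_apply_eq]
        apply Subtype.ext
        rw [hhz _ hzn.1.1]
        simp [hz]
      rw [this]; exact hzn.2⟩)
  have hlt : f₀ < f₁ := by
    by_contra hnot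
    apply hnsc
    have hTu : T = univ := by
      refine eq_univ_of_forall fun p hp => hp.2.1 ?_
      have h1 := hle _ hp.2.2
      have h2 : L * p.1⁻¹ = 0 := by linarith
      simpa [hL.ne'] using h2
    have e' : Sg ≃ₜ (ℝ × ℝ) := ((eS.trans e).trans (Homeomorph.setCongr hTu)).trans
      (Homeomorph.Set.univ _)
    have : ContractibleSpace Sg := e'.contractibleSpace
    infer_instance
  have hLe := hL' hlt
  refine ⟨F', ?_, ?_, h0F', ?_, ?_, ⟨eS.trans e⟩⟩
  · rw [show F' = affL ⁻¹' F from rfl]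
    exact affL.isClosedEmbedding.isCompact_preimage hF
  · intro x hx
    obtain ⟨h1, h2⟩ := hle _ hx
    exact ⟨nonneg_of_mul_nonneg_right (by linarith) hL, le_of_mul_le_mul_left (by linarith) hL⟩
  · show f₀ + L * 1 ∈ F
    rw [hLe]; simpa using hf₁F
  · rw [show F' = affL ⁻¹' F from rfl, ← affL.preimage_interior, hFint, preimage_empty]

/-- Profiles in the transverse variable. -/
abbrev Prof := C(Icc (0:ℝ) 1, ℝ)

/-- Summable sequences of profiles, indexed by the frequency. -/
abbrev FSeq : Type := lp (fun _ : ℤ => Prof) 1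

namespace FSeq

lemma summable_norm (F : FSeq) : Summable fun k => ‖F k‖ := by
  simpa using (lp.memℓp F).summable (by norm_num)

lemma norm_eq (F : FSeq) : ‖F‖ = ∑' k, ‖F k‖ := by
  simpa using lp.norm_eq_tsum_rpow (p := 1) (by norm_num) F

/-- The element with prescribed summable coefficients. -/
def mk (f : ℤ → Prof) (h : Summable fun k => ‖f k‖) : FSeq :=
  ⟨f, memℓp_gen (by simpa using h)⟩

@[simp] lemma mk_apply (f : ℤ → Prof) (h) (k : ℤ) : mk f h k = f k := rfl

lemma abs_apply_le (F : FSeq) (k : ℤ) (y : Icc (0:ℝ) 1) : |F k y| ≤ ‖F k‖ :=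
  (F k).norm_coe_le_norm y

/-- Diagonal operators. -/
def diag (M : ℤ → Prof →ₗ[ℝ] Prof) (C : ℝ) (h : ∀ k v, ‖M k v‖ ≤ C * ‖v‖) : FSeq →L[ℝ] FSeq :=
  LinearMap.mkContinuous
    { toFun := fun F => mk (fun k => M k (F k))
        (((summable_norm F).mul_left C).of_nonneg_of_le (fun _ => norm_nonneg _) fun k => h k (F k))
      map_add' := fun F G => by ext k : 2; simp
      map_smul' := fun c F => by ext k : 2; simp }
    C fun F => by
      rw [norm_eq, norm_eq, ← tsum_mul_left]
      refine Summable.tsum_le_tsum (fun k => h k (F k)) ?_ ((summable_norm F).mul_left C)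
      exact ((summable_norm F).mul_left C).of_nonneg_of_le (fun _ => norm_nonneg _)
        fun k => h k (F k)

@[simp] lemma diag_apply (M : ℤ → Prof →ₗ[ℝ] Prof) (C h) (F : FSeq) (k : ℤ) :
    diag M C h F k = M k (F k) := rfl

/-- Frequency reversal. -/
def rev : FSeq →L[ℝ] FSeq :=
  LinearMap.mkContinuous
    { toFun := fun F => mk (fun k => F (-k)) ((Equiv.neg ℤ).summable_iff.2 (summable_norm F))
      map_add' := fun F G => by ext k : 2; rfl
      map_smul' := fun c F => by ext k : 2; rfl }
    1 fun F => by
      rw [norm_eq, norm_eq, one_mul]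
      exact ((Equiv.neg ℤ).tsum_eq fun k => ‖F k‖).le

@[simp] lemma rev_apply (F : FSeq) (k : ℤ) : rev F k = F (-k) := rfl

/-- The exponential profile `e^{-a|k|y}` with `a = 1/2`. -/
def wt (k : ℤ) (y : ℝ) : ℝ := Real.exp (-(|(k:ℝ)| * y / 2))

lemma wt_pos (k : ℤ) (y : ℝ) : 0 < wt k y := Real.exp_pos _

lemma wt_le_one (k : ℤ) {y : ℝ} (hy : 0 ≤ y) : wt k y ≤ 1 := by
  unfold wt; rw [Real.exp_le_one_iff]; have := abs_nonneg (k:ℝ); nlinarith [mul_nonneg this hy]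

lemma continuous_wt (k : ℤ) : Continuous (wt k) := by unfold wt; fun_prop

@[simp] lemma wt_neg (k : ℤ) (y : ℝ) : wt (-k) y = wt k y := by simp [wt]

lemma wt_mul_le (j l : ℤ) {y : ℝ} (hy : 0 ≤ y) : wt j y * wt l y ≤ wt (j + l) y := by
  unfold wt; rw [← Real.exp_add, Real.exp_le_exp]; push_cast
  nlinarith [mul_le_mul_of_nonneg_right (abs_add_le (j:ℝ) l) hy]

/-- The ratio of weights appearing in products. -/
def kap (j l : ℤ) : Prof :=
  ⟨fun y => wt j y * wt l y / wt (j + l) y, by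
    refine Continuous.div ?_ ?_ fun y => (wt_pos _ _).ne'
    · exact ((continuous_wt j).mul (continuous_wt l)).comp continuous_subtype_val
    · exact (continuous_wt _).comp continuous_subtype_val⟩

lemma norm_kap_le (j l : ℤ) : ‖kap j l‖ ≤ 1 := by
  refine (ContinuousMap.norm_le _ zero_le_one).2 fun y => ?_
  have h1 := wt_pos j y; have h2 := wt_pos l y; have h3 := wt_pos (j + l) y
  rw [Real.norm_of_nonneg (by simp only [kap, ContinuousMap.coe_mk]; positivity)]
  simp only [kap, ContinuousMap.coe_mk]
  exact (div_le_one h3).2 (wt_mul_le j l y.2.1)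

/-- Summands of the product. -/
def mulTerm (F G : FSeq) (p : ℤ × ℤ) : FSeq :=
  lp.single 1 (p.1 + p.2) (kap p.1 p.2 * F p.1 * G p.2)

lemma norm_mulTerm_le (F G : FSeq) (p : ℤ × ℤ) : ‖mulTerm F G p‖ ≤ ‖F p.1‖ * ‖G p.2‖ := by
  unfold mulTerm
  rw [lp.norm_single (by norm_num)]
  refine (norm_mul_le _ _).trans (mul_le_mul_of_nonneg_right ?_ (norm_nonneg _))
  refine (norm_mul_le _ _).trans ?_
  nlinarith [norm_kap_le p.1 p.2, norm_nonneg (F p.1)]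

lemma summable_mulTerm (F G : FSeq) : Summable (mulTerm F G) :=
  Summable.of_norm_bounded (g := fun p : ℤ × ℤ => ‖F p.1‖ * ‖G p.2‖)
    ((summable_norm F).mul_of_nonneg (summable_norm G) (fun _ => norm_nonneg _)
      fun _ => norm_nonneg _) (norm_mulTerm_le F G)

lemma norm_tsum_mulTerm_le (F G : FSeq) : ‖∑' p, mulTerm F G p‖ ≤ ‖F‖ * ‖G‖ := by
  rw [norm_eq F, norm_eq G]
  have hs := (summable_norm F).mul_of_nonneg (summable_norm G) (fun _ => norm_nonneg _)
    fun _ => norm_nonneg _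
  rw [(summable_norm F).tsum_mul_tsum (summable_norm G) hs]
  exact tsum_of_norm_bounded hs.hasSum (norm_mulTerm_le F G)

/-- The product corresponding to pointwise multiplication of the represented functions. -/
def conv : FSeq →L[ℝ] FSeq →L[ℝ] FSeq :=
  LinearMap.mkContinuous₂
    (LinearMap.mk₂ ℝ (fun F G => ∑' p, mulTerm F G p)
      (fun F F' G => by
        rw [← (summable_mulTerm F G).tsum_add (summable_mulTerm F' G)]
        refine tsum_congr fun p => ?_
        simp only [mulTerm, ← lp.single_add]; congr 1
        rw [lp.coeFn_add, Pi.add_apply]; ring)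
      (fun c F G => by
        rw [← tsum_const_smul'']
        refine tsum_congr fun p => ?_
        simp only [mulTerm, ← lp.single_smul]; congr 1
        rw [lp.coeFn_smul, Pi.smul_apply]; simp)
      (fun F G G' => by
        rw [← (summable_mulTerm F G).tsum_add (summable_mulTerm F G')]
        refine tsum_congr fun p => ?_
        simp only [mulTerm, ← lp.single_add]; congr 1
        rw [lp.coeFn_add, Pi.add_apply]; ring)
      (fun c F G => by
        rw [← tsum_const_smul'']
        refine tsum_congr fun p => ?_
        simp only [mulTerm, ← lp.single_smul]; congr 1
        rw [lp.coeFn_smul, Pi.smul_apply]; simp))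
    1 fun F G => by
      rw [one_mul]; exact norm_tsum_mulTerm_le F G

lemma conv_apply (F G : FSeq) : conv F G = ∑' p, mulTerm F G p := rfl

lemma norm_conv_le (F G : FSeq) : ‖conv F G‖ ≤ ‖F‖ * ‖G‖ :=
  norm_tsum_mulTerm_le F G

lemma rev_single (k : ℤ) (v : Prof) :
    rev (lp.single 1 k v) = lp.single 1 (-k) v := by
  ext j : 2
  rw [rev_apply, lp.single_apply, lp.single_apply]
  by_cases h : j = -k
  · subst h; simp
  · rw [Pi.single_eq_of_ne, Pi.single_eq_of_ne h]; omega

lemma conv_rev (F G : FSeq) : conv (rev F) (rev G) = rev (conv F G) := by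
  rw [conv_apply, conv_apply, rev.map_tsum (summable_mulTerm F G),
    ← ((Equiv.neg ℤ).prodCongr (Equiv.neg ℤ)).tsum_eq]
  refine tsum_congr fun p => ?_
  simp only [mulTerm, rev_single, Equiv.prodCongr_apply, Prod.map, Equiv.neg_apply, rev_apply,
    neg_neg]
  rw [show -p.1 + -p.2 = -(p.1 + p.2) by ring]
  congr 3
  ext y
  have h := wt_neg (p.1 + p.2) y
  rw [show -(p.1 + p.2) = -p.1 + -p.2 by ring] at h
  simp [kap, h]

/-- Evaluation terms. -/
def evTerm (x : ℝ) (y : Icc (0:ℝ) 1) (F : FSeq) (k : ℤ) : ℂ :=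
  ((F k y * wt k y : ℝ) : ℂ) * Complex.exp (k * x * Complex.I)

lemma norm_evTerm (x : ℝ) (y : Icc (0:ℝ) 1) (F : FSeq) (k : ℤ) :
    ‖evTerm x y F k‖ = |F k y| * wt k y := by
  unfold evTerm
  have : ‖Complex.exp (k * x * Complex.I)‖ = 1 := by
    have := Complex.norm_exp_ofReal_mul_I ((k:ℝ) * x); push_cast at this; exact this
  rw [norm_mul, this, mul_one, Complex.norm_real, Real.norm_eq_abs, abs_mul, abs_of_pos (wt_pos _ _)]

lemma norm_evTerm_le (x : ℝ) (y : Icc (0:ℝ) 1) (F : FSeq) (k : ℤ) :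
    ‖evTerm x y F k‖ ≤ ‖F k‖ := by
  rw [norm_evTerm]
  have := abs_apply_le F k y
  nlinarith [wt_le_one k y.2.1, wt_pos k y, abs_nonneg (F k y)]

lemma summable_evTerm (x : ℝ) (y : Icc (0:ℝ) 1) (F : FSeq) : Summable (evTerm x y F) :=
  Summable.of_norm_bounded (summable_norm F) (norm_evTerm_le x y F)

/-- Evaluation of the represented function. -/
def ev (x : ℝ) (y : Icc (0:ℝ) 1) : FSeq →L[ℝ] ℂ :=
  LinearMap.mkContinuous
    { toFun := fun F => ∑' k, evTerm x y F k
      map_add' := fun F G => by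
        rw [← (summable_evTerm x y F).tsum_add (summable_evTerm x y G)]
        refine tsum_congr fun k => ?_
        simp only [evTerm, lp.coeFn_add, Pi.add_apply, ContinuousMap.add_apply]; push_cast; ring
      map_smul' := fun c F => by
        rw [RingHom.id_apply, ← tsum_const_smul'']
        refine tsum_congr fun k => ?_
        simp only [evTerm, lp.coeFn_smul, Pi.smul_apply, ContinuousMap.smul_apply, smul_eq_mul,
          Complex.real_smul]
        push_cast; ring }
    1 fun F => by
      rw [one_mul, norm_eq]
      exact tsum_of_norm_bounded (summable_norm F).hasSum (norm_evTerm_le x y F)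

lemma ev_apply (x : ℝ) (y : Icc (0:ℝ) 1) (F : FSeq) : ev x y F = ∑' k, evTerm x y F k := rfl

lemma ev_single (x : ℝ) (y : Icc (0:ℝ) 1) (k : ℤ) (v : Prof) :
    ev x y (lp.single 1 k v) = ((v y * wt k y : ℝ) : ℂ) * Complex.exp (k * x * Complex.I) := by
  rw [ev_apply, tsum_eq_single k]
  · simp [evTerm]
  · intro j hj
    simp [evTerm, lp.single_apply, Pi.single_eq_of_ne hj]

lemma ev_conv (x : ℝ) (y : Icc (0:ℝ) 1) (F G : FSeq) :
    ev x y (conv F G) = ev x y F * ev x y G := by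
  rw [conv_apply, (ev x y).map_tsum (summable_mulTerm F G), ev_apply x y F, ev_apply x y G,
    tsum_mul_tsum_of_summable_norm (summable_evTerm x y F).norm (summable_evTerm x y G).norm]
  refine tsum_congr fun p => ?_
  have h3 := (wt_pos (p.1 + p.2) y).ne'
  rw [mulTerm, ev_single, evTerm, evTerm, mul_mul_mul_comm, ← Complex.exp_add]
  congr 1
  · rw [← Complex.ofReal_mul]; congr 1
    simp only [ContinuousMap.mul_apply, kap, ContinuousMap.coe_mk]
    field_simp
  · push_cast; ring_nf

end FSeq

namespace Green
open FSeq

/-- The absolute frequency. -/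
abbrev fr (k : ℤ) : ℝ := |(k:ℝ)|

lemma one_le_fr {k : ℤ} (hk : k ≠ 0) : 1 ≤ fr k := by
  unfold fr; exact_mod_cast Int.one_le_abs hk

/-- The source term with the weight restored. -/
def src (k : ℤ) (F : Prof) (y : ℝ) : ℝ := wt k y * F (projIcc 0 1 zero_le_one y)

lemma continuous_src (k : ℤ) (F : Prof) : Continuous (src k F) :=
  (continuous_wt k).mul (F.continuous.comp continuous_projIcc)

lemma src_of_mem (k : ℤ) (F : Prof) (y : Icc (0:ℝ) 1) : src k F y = F y * wt k y := by
  simp [src, mul_comm]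

lemma abs_src_le (k : ℤ) (F : Prof) (y : ℝ) : |src k F y| ≤ ‖F‖ * Real.exp (-(fr k * y / 2)) := by
  unfold src
  rw [abs_mul, abs_of_pos (wt_pos _ _), mul_comm]
  exact mul_le_mul_of_nonneg_right (F.norm_coe_le_norm _) (wt_pos _ _).le

/-- The lower integral. -/
def int0 (k : ℤ) (F : Prof) (y : ℝ) : ℝ := ∫ t in (0:ℝ)..y, Real.sinh (fr k * t) * src k F t

/-- The upper integral. -/
def int1 (k : ℤ) (F : Prof) (y : ℝ) : ℝ := ∫ t in y..(1:ℝ), Real.sinh (fr k * (1 - t)) * src k F t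

lemma cont0 (k : ℤ) (F : Prof) : Continuous fun t => Real.sinh (fr k * t) * src k F t :=
  (Real.continuous_sinh.comp (by fun_prop)).mul (continuous_src k F)

lemma cont1 (k : ℤ) (F : Prof) : Continuous fun t => Real.sinh (fr k * (1 - t)) * src k F t :=
  (Real.continuous_sinh.comp (by fun_prop)).mul (continuous_src k F)

lemma hasDerivAt_int0 (k : ℤ) (F : Prof) (y : ℝ) :
    HasDerivAt (int0 k F) (Real.sinh (fr k * y) * src k F y) y :=
  intervalIntegral.integral_hasDerivAt_right ((cont0 k F).intervalIntegrable _ _)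
    ((cont0 k F).stronglyMeasurableAtFilter _ _) (cont0 k F).continuousAt

lemma hasDerivAt_int1 (k : ℤ) (F : Prof) (y : ℝ) :
    HasDerivAt (int1 k F) (-(Real.sinh (fr k * (1 - y)) * src k F y)) y :=
  intervalIntegral.integral_hasDerivAt_left ((cont1 k F).intervalIntegrable _ _)
    ((cont1 k F).stronglyMeasurableAtFilter _ _) (cont1 k F).continuousAt

lemma abs_int0_le {k : ℤ} (hk : k ≠ 0) (F : Prof) {y : ℝ} (hy : 0 ≤ y) :
    |int0 k F y| ≤ ‖F‖ * Real.exp (fr k * y / 2) / fr k := by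
  have hK := one_le_fr hk
  set K := fr k
  have hd : ∀ t ∈ uIcc 0 y, HasDerivAt (fun t => ‖F‖ * Real.exp (K * t / 2) / K)
      (‖F‖ * (Real.exp (K * t / 2) / 2)) t := fun t _ => by
    have := (((((hasDerivAt_id t).const_mul K).div_const 2).exp).const_mul ‖F‖).div_const K
    refine this.congr_deriv ?_
    simp only [id]; field_simp
  have hi : IntervalIntegrable (fun t => ‖F‖ * (Real.exp (K * t / 2) / 2)) volume 0 y :=
    Continuous.intervalIntegrable (by fun_prop) _ _
  have h := intervalIntegral.norm_integral_le_of_norm_le (f := fun t => Real.sinh (K * t) * src k F t)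
    hy (Eventually.of_forall fun t ht => ?_) hi
  · rw [intervalIntegral.integral_eq_sub_of_hasDerivAt hd hi] at h
    refine h.trans ?_
    simp only [mul_zero, zero_div, Real.exp_zero]
    have : 0 ≤ ‖F‖ * 1 / K := by positivity
    linarith
  · rw [norm_mul, Real.norm_eq_abs, Real.norm_eq_abs]
    have hs : |Real.sinh (K * t)| ≤ Real.exp (K * t) / 2 := by
      rw [abs_of_nonneg (Real.sinh_nonneg_iff.2 (mul_nonneg (by positivity) ht.1.le)),
        Real.sinh_eq]
      linarith [Real.exp_pos (-(K * t))]
    refine (mul_le_mul hs (abs_src_le k F t) (abs_nonneg _) (by positivity)).trans_eq ?_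
    rw [show Real.exp (K * t / 2) = Real.exp (K * t) * Real.exp (-(K * t / 2)) by
      rw [← Real.exp_add]; ring_nf]
    ring

lemma abs_int1_le {k : ℤ} (hk : k ≠ 0) (F : Prof) {y : ℝ} (hy : y ≤ 1) :
    |int1 k F y| ≤ ‖F‖ * Real.exp (fr k) * Real.exp (-(3 * fr k * y / 2)) / (3 * fr k) := by
  have hK := one_le_fr hk
  set K := fr k
  have hd : ∀ t ∈ uIcc y 1, HasDerivAt
      (fun t => -(‖F‖ * Real.exp K * Real.exp (-(3 * K * t / 2)) / (3 * K)))
      (‖F‖ * Real.exp K * (Real.exp (-(3 * K * t / 2)) / 2)) t := fun t _ => by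
    have := ((((((hasDerivAt_id t).const_mul (3 * K)).div_const 2).neg.exp).const_mul
      (‖F‖ * Real.exp K)).div_const (3 * K)).neg
    refine this.congr_deriv ?_
    simp only [id, Pi.neg_apply]; field_simp
  have hi : IntervalIntegrable (fun t => ‖F‖ * Real.exp K * (Real.exp (-(3 * K * t / 2)) / 2))
      volume y 1 := Continuous.intervalIntegrable (by fun_prop) _ _
  have h := intervalIntegral.norm_integral_le_of_norm_le
    (f := fun t => Real.sinh (K * (1 - t)) * src k F t)
    hy (Eventually.of_forall fun t ht => ?_) hi
  · rw [intervalIntegral.integral_eq_sub_of_hasDerivAt hd hi] at h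
    refine h.trans ?_
    have : 0 ≤ ‖F‖ * Real.exp K * Real.exp (-(3 * K * 1 / 2)) / (3 * K) := by positivity
    linarith
  · rw [norm_mul, Real.norm_eq_abs, Real.norm_eq_abs]
    have hs : |Real.sinh (K * (1 - t))| ≤ Real.exp (K * (1 - t)) / 2 := by
      rw [abs_of_nonneg (Real.sinh_nonneg_iff.2 (mul_nonneg (by positivity) (by linarith [ht.2]))),
        Real.sinh_eq]
      linarith [Real.exp_pos (-(K * (1 - t)))]
    refine (mul_le_mul hs (abs_src_le k F t) (abs_nonneg _) (by positivity)).trans_eq ?_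
    rw [show Real.exp (-(3 * K * t / 2)) = Real.exp (-(K * t)) * Real.exp (-(K * t / 2)) by
      rw [← Real.exp_add]; ring_nf,
      show Real.exp (K * (1 - t)) = Real.exp K * Real.exp (-(K * t)) by
      rw [← Real.exp_add]; ring_nf]
    ring

/-- The solution of `w'' = k² w + φ`, `w 0 = w 1 = 0`. -/
def sol (k : ℤ) (F : Prof) (y : ℝ) : ℝ :=
  -((Real.sinh (fr k * (1 - y)) * int0 k F y + Real.sinh (fr k * y) * int1 k F y) /
    (fr k * Real.sinh (fr k)))

/-- The derivative of `sol`. -/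
def sol' (k : ℤ) (F : Prof) (y : ℝ) : ℝ :=
  -((-(Real.cosh (fr k * (1 - y)) * int0 k F y) + Real.cosh (fr k * y) * int1 k F y) /
    Real.sinh (fr k))

lemma sol_zero_freq (F : Prof) (y : ℝ) : sol 0 F y = 0 := by simp [sol, fr]

lemma sol'_zero_freq (F : Prof) (y : ℝ) : sol' 0 F y = 0 := by simp [sol', fr]

lemma sinh_fr_ne {k : ℤ} (hk : k ≠ 0) : Real.sinh (fr k) ≠ 0 :=
  (Real.sinh_pos_iff.2 (by linarith [one_le_fr hk])).ne'

lemma hasDerivAt_sinh_mul (K y : ℝ) :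
    HasDerivAt (fun y => Real.sinh (K * y)) (K * Real.cosh (K * y)) y := by
  refine (((hasDerivAt_id y).const_mul K).sinh).congr_deriv ?_
  simp only [id]; ring

lemma hasDerivAt_cosh_mul (K y : ℝ) :
    HasDerivAt (fun y => Real.cosh (K * y)) (K * Real.sinh (K * y)) y := by
  refine (((hasDerivAt_id y).const_mul K).cosh).congr_deriv ?_
  simp only [id]; ring

lemma hasDerivAt_sinh_rev (K y : ℝ) :
    HasDerivAt (fun y => Real.sinh (K * (1 - y))) (-(K * Real.cosh (K * (1 - y)))) y := by
  refine ((((hasDerivAt_id y).const_sub 1).const_mul K).sinh).congr_deriv ?_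
  simp only [id]; ring

lemma hasDerivAt_cosh_rev (K y : ℝ) :
    HasDerivAt (fun y => Real.cosh (K * (1 - y))) (-(K * Real.sinh (K * (1 - y)))) y := by
  refine ((((hasDerivAt_id y).const_sub 1).const_mul K).cosh).congr_deriv ?_
  simp only [id]; ring

lemma hasDerivAt_sol (k : ℤ) (F : Prof) (y : ℝ) : HasDerivAt (sol k F) (sol' k F y) y := by
  rcases eq_or_ne k 0 with rfl | hk
  · have : sol 0 F = fun _ => 0 := by funext y; simp [sol]
    rw [this, sol'_zero_freq]; exact hasDerivAt_const y (0:ℝ)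
  have hK : fr k ≠ 0 := by linarith [one_le_fr hk]
  have hs := sinh_fr_ne hk
  refine (((((hasDerivAt_sinh_rev (fr k) y).mul (hasDerivAt_int0 k F y)).add
    ((hasDerivAt_sinh_mul (fr k) y).mul (hasDerivAt_int1 k F y))).div_const
    (fr k * Real.sinh (fr k))).neg).congr_deriv ?_
  unfold sol'
  field_simp
  ring

lemma hasDerivAt_sol' {k : ℤ} (hk : k ≠ 0) (F : Prof) (y : ℝ) :
    HasDerivAt (sol' k F) ((k:ℝ) ^ 2 * sol k F y + src k F y) y := by
  have hK : fr k ≠ 0 := by linarith [one_le_fr hk]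
  have hs := sinh_fr_ne hk
  refine ((((((hasDerivAt_cosh_rev (fr k) y).mul (hasDerivAt_int0 k F y)).neg).add
    ((hasDerivAt_cosh_mul (fr k) y).mul (hasDerivAt_int1 k F y))).div_const
    (Real.sinh (fr k))).neg).congr_deriv ?_
  have hW : Real.sinh (fr k) = Real.sinh (fr k * (1 - y)) * Real.cosh (fr k * y) +
      Real.cosh (fr k * (1 - y)) * Real.sinh (fr k * y) := by
    rw [← Real.sinh_add]; ring_nf
  unfold sol
  rw [← sq_abs (k:ℝ)]
  change _ = fr k ^ 2 * _ + _
  generalize hS : Real.sinh (fr k) = S at *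
  field_simp
  rw [hW]; ring

lemma sol_left (k : ℤ) (F : Prof) : sol k F 0 = 0 := by simp [sol, int0]
lemma sol_right (k : ℤ) (F : Prof) : sol k F 1 = 0 := by simp [sol, int1]

lemma exp_le_sinh {k : ℤ} (hk : k ≠ 0) : Real.exp (fr k) ≤ 3 * Real.sinh (fr k) := by
  have hK := one_le_fr hk
  rw [Real.sinh_eq]
  have h1 : Real.exp (fr k) * Real.exp (-fr k) = 1 := by rw [← Real.exp_add]; simp
  have h2 : 2 ≤ Real.exp (fr k) := by linarith [Real.add_one_le_exp (fr k)]
  have h3 := Real.exp_pos (-fr k)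
  nlinarith

lemma cosh_le_exp {x : ℝ} (hx : 0 ≤ x) : Real.cosh x ≤ Real.exp x := by
  rw [Real.cosh_eq]
  have : Real.exp (-x) ≤ Real.exp x := Real.exp_le_exp.2 (by linarith)
  linarith

/-- The common bound behind the estimates of `sol` and `sol'`. -/
lemma abs_comb_le {k : ℤ} (hk : k ≠ 0) (F : Prof) {y : ℝ} (hy : y ∈ Icc (0:ℝ) 1) {a b : ℝ}
    (ha : |a| ≤ Real.cosh (fr k * (1 - y))) (hb : |b| ≤ Real.cosh (fr k * y)) :
    |(a * int0 k F y + b * int1 k F y) / Real.sinh (fr k)| * fr k ≤ 4 * ‖F‖ * wt k y := by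
  have hK := one_le_fr hk
  have hS : 0 < Real.sinh (fr k) := Real.sinh_pos_iff.2 (by linarith)
  have hE := exp_le_sinh hk
  have h0 := abs_int0_le hk F hy.1
  have h1 := abs_int1_le hk F hy.2
  have ha' := ha.trans (cosh_le_exp (mul_nonneg (by linarith) (by linarith [hy.2])))
  have hb' := hb.trans (cosh_le_exp (mul_nonneg (by linarith) hy.1))
  rw [abs_div, abs_of_pos hS, div_mul_eq_mul_div, div_le_iff₀ hS]
  set K := fr k with hKdef
  have e1 : Real.exp (K * (1 - y)) * Real.exp (K * y / 2) = Real.exp K * wt k y := by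
    unfold wt; rw [← Real.exp_add, ← Real.exp_add]; congr 1; ring_nf; simp only [hKdef, fr]; ring
  have e2 : Real.exp (K * y) * (Real.exp K * Real.exp (-(3 * K * y / 2))) = Real.exp K * wt k y := by
    unfold wt; rw [← Real.exp_add, ← Real.exp_add, ← Real.exp_add]; congr 1
    simp only [hKdef, fr]; ring
  calc |a * int0 k F y + b * int1 k F y| * K
      ≤ (|a| * |int0 k F y| + |b| * |int1 k F y|) * K := by
        rw [← abs_mul a, ← abs_mul b]
        exact mul_le_mul_of_nonneg_right (abs_add_le _ _) (zero_le_one.trans hK)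
    _ ≤ (Real.exp (K * (1 - y)) * (‖F‖ * Real.exp (K * y / 2) / K) + Real.exp (K * y) *
          (‖F‖ * Real.exp K * Real.exp (-(3 * K * y / 2)) / (3 * K))) * K := by
        gcongr
    _ = ‖F‖ * (Real.exp (K * (1 - y)) * Real.exp (K * y / 2)) + ‖F‖ *
        (Real.exp (K * y) * (Real.exp K * Real.exp (-(3 * K * y / 2)))) / 3 := by
        field_simp
    _ = (4 / 3) * ‖F‖ * wt k y * Real.exp K := by rw [e1, e2]; ring
    _ ≤ (4 / 3) * ‖F‖ * wt k y * (3 * Real.sinh K) := by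
        have := wt_pos k y
        gcongr
    _ = _ := by ring

lemma abs_sol'_le (k : ℤ) (F : Prof) {y : ℝ} (hy : y ∈ Icc (0:ℝ) 1) :
    fr k * |sol' k F y| ≤ 4 * ‖F‖ * wt k y := by
  rcases eq_or_ne k 0 with rfl | hk
  · have := wt_pos 0 y
    rw [sol'_zero_freq]; simp; positivity
  have := abs_comb_le hk F hy (a := -Real.cosh (fr k * (1 - y))) (b := Real.cosh (fr k * y))
    (by rw [abs_neg, abs_of_pos (Real.cosh_pos _)]) (by rw [abs_of_pos (Real.cosh_pos _)])
  rw [mul_comm, sol', abs_neg]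
  simpa only [neg_mul] using this

lemma abs_sol_le (k : ℤ) (F : Prof) {y : ℝ} (hy : y ∈ Icc (0:ℝ) 1) :
    fr k ^ 2 * |sol k F y| ≤ 4 * ‖F‖ * wt k y := by
  rcases eq_or_ne k 0 with rfl | hk
  · have := wt_pos 0 y
    rw [sol_zero_freq]; simp; positivity
  have hK := one_le_fr hk
  have hsc : ∀ x : ℝ, |Real.sinh x| ≤ Real.cosh x := fun x =>
    abs_le.2 ⟨by rw [neg_le, ← Real.sinh_neg, ← Real.cosh_neg]; exact (Real.sinh_lt_cosh _).le,
      (Real.sinh_lt_cosh _).le⟩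
  have := abs_comb_le hk F hy (hsc (fr k * (1 - y))) (hsc (fr k * y))
  refine le_of_eq_of_le ?_ this
  rw [sol, abs_neg, abs_div, abs_div, abs_mul, abs_of_pos (show 0 < fr k by linarith)]
  field_simp

end Green

namespace Green
open FSeq

lemma src_add (k : ℤ) (F G : Prof) (y : ℝ) : src k (F + G) y = src k F y + src k G y := by
  simp [src, mul_add]

lemma src_smul (k : ℤ) (c : ℝ) (F : Prof) (y : ℝ) : src k (c • F) y = c * src k F y := by
  simp [src]; ring

lemma int0_add (k : ℤ) (F G : Prof) (y : ℝ) : int0 k (F + G) y = int0 k F y + int0 k G y := by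
  unfold int0
  rw [← intervalIntegral.integral_add ((cont0 k F).intervalIntegrable _ _)
    ((cont0 k G).intervalIntegrable _ _)]
  simp only [src_add, mul_add]

lemma int1_add (k : ℤ) (F G : Prof) (y : ℝ) : int1 k (F + G) y = int1 k F y + int1 k G y := by
  unfold int1
  rw [← intervalIntegral.integral_add ((cont1 k F).intervalIntegrable _ _)
    ((cont1 k G).intervalIntegrable _ _)]
  simp only [src_add, mul_add]

lemma int0_smul (k : ℤ) (c : ℝ) (F : Prof) (y : ℝ) : int0 k (c • F) y = c * int0 k F y := by
  unfold int0
  rw [← intervalIntegral.integral_const_mul]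
  simp only [src_smul, mul_left_comm]

lemma int1_smul (k : ℤ) (c : ℝ) (F : Prof) (y : ℝ) : int1 k (c • F) y = c * int1 k F y := by
  unfold int1
  rw [← intervalIntegral.integral_const_mul]
  simp only [src_smul, mul_left_comm]

lemma continuous_sol (k : ℤ) (F : Prof) : Continuous (sol k F) :=
  continuous_iff_continuousAt.2 fun y => (hasDerivAt_sol k F y).continuousAt

lemma continuous_sol' (k : ℤ) (F : Prof) : Continuous (sol' k F) := by
  rcases eq_or_ne k 0 with rfl | hk
  · rw [show sol' 0 F = fun _ => 0 from funext (sol'_zero_freq F)]; exact continuous_const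
  · exact continuous_iff_continuousAt.2 fun y => (hasDerivAt_sol' hk F y).continuousAt

/-- Division by the weight. -/
def unwt (k : ℤ) (g : ℝ → ℝ) (hg : Continuous g) : Prof :=
  ⟨fun y => g y / wt k y, ((hg.div (continuous_wt k) fun y => (wt_pos k y).ne').comp
    continuous_subtype_val)⟩

lemma norm_unwt_le (k : ℤ) (g : ℝ → ℝ) (hg : Continuous g) {C : ℝ} (hC : 0 ≤ C)
    (h : ∀ y ∈ Icc (0:ℝ) 1, |g y| ≤ C * wt k y) : ‖unwt k g hg‖ ≤ C := by
  refine (ContinuousMap.norm_le _ hC).2 fun y => ?_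
  have hw := wt_pos k y
  simp only [unwt, ContinuousMap.coe_mk, Real.norm_eq_abs, abs_div, abs_of_pos hw]
  exact (div_le_iff₀ hw).2 (h y y.2)

/-- The solution operator on profiles. -/
def solL (k : ℤ) : Prof →ₗ[ℝ] Prof where
  toFun F := unwt k (sol k F) (continuous_sol k F)
  map_add' F G := by ext y; simp [unwt, sol, int0_add, int1_add]; ring
  map_smul' c F := by ext y; simp [unwt, sol, int0_smul, int1_smul]; ring

/-- The derivative of the solution operator on profiles. -/
def solL' (k : ℤ) : Prof →ₗ[ℝ] Prof where
  toFun F := unwt k (sol' k F) (continuous_sol' k F)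
  map_add' F G := by ext y; simp [unwt, sol', int0_add, int1_add]; ring
  map_smul' c F := by ext y; simp [unwt, sol', int0_smul, int1_smul]; ring

lemma norm_solL_le (k : ℤ) (F : Prof) {c : ℝ} (hc : |c| ≤ fr k ^ 2) :
    ‖(c • solL k) F‖ ≤ 4 * ‖F‖ := by
  rw [LinearMap.smul_apply, norm_smul, Real.norm_eq_abs]
  refine (mul_le_mul_of_nonneg_right hc (norm_nonneg _)).trans ?_
  rw [← abs_of_nonneg (sq_nonneg (fr k)), ← Real.norm_eq_abs, ← norm_smul]
  refine (ContinuousMap.norm_le _ (by positivity)).2 fun y => ?_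
  have hw := wt_pos k y
  have := abs_sol_le k F y.2
  simp only [solL, unwt, LinearMap.coe_mk, AddHom.coe_mk, ContinuousMap.smul_apply,
    ContinuousMap.coe_mk, smul_eq_mul, Real.norm_eq_abs, abs_mul, abs_div, abs_of_pos hw]
  rw [abs_of_nonneg (sq_nonneg (fr k)), ← mul_div_assoc, div_le_iff₀ hw]
  exact this

lemma norm_solL'_le (k : ℤ) (F : Prof) {c : ℝ} (hc : k ≠ 0 → |c| ≤ fr k) :
    ‖(c • solL' k) F‖ ≤ 4 * ‖F‖ := by
  refine (ContinuousMap.norm_le _ (by positivity)).2 fun y => ?_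
  have hw := wt_pos k y
  have := abs_sol'_le k F y.2
  simp only [LinearMap.smul_apply, solL', unwt, LinearMap.coe_mk, AddHom.coe_mk,
    ContinuousMap.smul_apply, ContinuousMap.coe_mk, smul_eq_mul, Real.norm_eq_abs, abs_mul,
    abs_div, abs_of_pos hw]
  rw [← mul_div_assoc, div_le_iff₀ hw]
  rcases eq_or_ne k 0 with rfl | hk
  · rw [sol'_zero_freq]; simp; positivity
  · exact (mul_le_mul_of_nonneg_right (hc hk) (abs_nonneg _)).trans this

/-- Harmonic profiles. -/
def har (k : ℤ) (y : ℝ) : ℝ := Real.sinh (fr k * (1 - y)) / Real.sinh (fr k)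

/-- Derivative of the harmonic profiles. -/
def har' (k : ℤ) (y : ℝ) : ℝ := -(fr k * Real.cosh (fr k * (1 - y))) / Real.sinh (fr k)

lemma hasDerivAt_har (k : ℤ) (y : ℝ) : HasDerivAt (har k) (har' k y) y :=
  (hasDerivAt_sinh_rev (fr k) y).div_const _

lemma hasDerivAt_har' (k : ℤ) (y : ℝ) : HasDerivAt (har' k) ((k:ℝ) ^ 2 * har k y) y := by
  refine (((hasDerivAt_cosh_rev (fr k) y).const_mul (fr k)).neg.div_const _).congr_deriv ?_
  rw [← sq_abs (k:ℝ)]; unfold har fr; ring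

lemma continuous_har (k : ℤ) : Continuous (har k) :=
  continuous_iff_continuousAt.2 fun y => (hasDerivAt_har k y).continuousAt

lemma continuous_har' (k : ℤ) : Continuous (har' k) :=
  continuous_iff_continuousAt.2 fun y => (hasDerivAt_har' k y).continuousAt

lemma cosh_ratio_le {k : ℤ} (hk : k ≠ 0) {y : ℝ} (hy : y ∈ Icc (0:ℝ) 1) :
    Real.cosh (fr k * (1 - y)) / Real.sinh (fr k) ≤ 3 * Real.exp (-(fr k * y)) := by
  have hK := one_le_fr hk
  have hS : 0 < Real.sinh (fr k) := Real.sinh_pos_iff.2 (by linarith)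
  rw [div_le_iff₀ hS]
  calc _ ≤ Real.exp (fr k * (1 - y)) :=
        cosh_le_exp (mul_nonneg (zero_le_one.trans hK) (by linarith [hy.2]))
    _ = Real.exp (-(fr k * y)) * Real.exp (fr k) := by rw [← Real.exp_add]; ring_nf
    _ ≤ Real.exp (-(fr k * y)) * (3 * Real.sinh (fr k)) := by gcongr; exact exp_le_sinh hk
    _ = _ := by ring

lemma exp_le_wt (k : ℤ) {y : ℝ} (hy : 0 ≤ y) : Real.exp (-(fr k * y)) ≤ wt k y := by
  unfold wt; rw [Real.exp_le_exp]
  have := mul_nonneg (abs_nonneg (k:ℝ)) hy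
  change -(|(k:ℝ)| * y) ≤ _
  linarith

lemma abs_har_le (k : ℤ) {y : ℝ} (hy : y ∈ Icc (0:ℝ) 1) :
    |har k y| ≤ 3 * Real.exp (-(fr k * y)) := by
  rcases eq_or_ne k 0 with rfl | hk
  · simp [har, fr]
  refine le_trans ?_ (cosh_ratio_le hk hy)
  have hK := one_le_fr hk
  have hS : 0 < Real.sinh (fr k) := Real.sinh_pos_iff.2 (by linarith)
  unfold har
  rw [abs_div, abs_of_pos hS, abs_of_nonneg (Real.sinh_nonneg_iff.2
    (mul_nonneg (zero_le_one.trans hK) (by linarith [hy.2])))]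
  gcongr; exact (Real.sinh_lt_cosh _).le

lemma abs_har'_le (k : ℤ) {y : ℝ} (hy : y ∈ Icc (0:ℝ) 1) :
    |har' k y| ≤ 3 * fr k * Real.exp (-(fr k * y)) := by
  rcases eq_or_ne k 0 with rfl | hk
  · simp [har', fr]
  have hK := one_le_fr hk
  have hS : 0 < Real.sinh (fr k) := Real.sinh_pos_iff.2 (by linarith)
  unfold har'
  rw [abs_div, abs_of_pos hS, abs_neg, abs_of_pos (mul_pos (by linarith) (Real.cosh_pos _)),
    mul_div_assoc]
  calc _ ≤ fr k * (3 * Real.exp (-(fr k * y))) :=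
        mul_le_mul_of_nonneg_left (cosh_ratio_le hk hy) (zero_le_one.trans hK)
    _ = _ := by ring

/-- Boundary data: an odd sequence with two summable moments. -/
structure Data where
  d : ℤ → ℝ
  odd : ∀ k, d (-k) = -d k
  summable : Summable fun k : ℤ => fr k ^ 2 * |d k|

variable (D : Data)

lemma Data.zero : D.d 0 = 0 := by have := D.odd 0; simp at this; linarith

/-- A frequency multiplier of order at most two. -/
structure Mult where
  c : ℤ → ℝ
  le : ∀ k, |c k| ≤ fr k ^ 2

/-- A frequency multiplier of order at most one. -/
structure Mult' where
  c : ℤ → ℝ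
  le : ∀ k, k ≠ 0 → |c k| ≤ fr k

/-- The harmonic profile as an element of the profile space. -/
def harP (k : ℤ) : Prof := unwt k (har k) (continuous_har k)

lemma summable_harS (m : Mult) :
    Summable fun k => ‖(m.c k * D.d k) • harP k‖ := by
    refine Summable.of_nonneg_of_le (fun k => norm_nonneg _) (fun k => ?_) (D.summable.mul_left 3)
    have h1 : ‖harP k‖ ≤ 3 := norm_unwt_le _ _ _ (by norm_num)
      fun y hy => (abs_har_le k hy).trans (by linarith [exp_le_wt k hy.1])
    rw [norm_smul, Real.norm_eq_abs, abs_mul]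
    have h2 := mul_le_mul_of_nonneg_right (m.le k) (abs_nonneg (D.d k))
    have h3 := mul_le_mul h2 h1 (norm_nonneg _)
      (mul_nonneg (sq_nonneg (fr k)) (abs_nonneg (D.d k)))
    linarith

/-- The harmonic extension. -/
def harS (m : Mult) : FSeq :=
  FSeq.mk (fun k => (m.c k * D.d k) • harP k) (summable_harS D m)

/-- The derivative of the harmonic extension. -/
def harS' (m : Mult') : FSeq :=
  mk (fun k => (m.c k * D.d k) • unwt k (har' k) (continuous_har' k)) <| by
    refine (D.summable.mul_left 3).of_nonneg_of_le (fun _ => norm_nonneg _) fun k => ?_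
    have h1 : ‖unwt k (har' k) (continuous_har' k)‖ ≤ 3 * fr k :=
      norm_unwt_le _ _ _ (by positivity)
        fun y hy => (abs_har'_le k hy).trans (mul_le_mul_of_nonneg_left (exp_le_wt k hy.1)
          (by positivity))
    rw [norm_smul, Real.norm_eq_abs, abs_mul]
    rcases eq_or_ne k 0 with rfl | hk
    · simp [D.zero]
    calc _ ≤ fr k * |D.d k| * (3 * fr k) := by gcongr; exact m.le k hk
      _ = _ := by ring

/-- Coefficients of the solution. -/
def coef (p : ℝ × FSeq) (k : ℤ) (y : ℝ) : ℝ := p.1 * D.d k * har k y + sol k (p.2 k) y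

/-- Normal derivatives of the coefficients. -/
def coef' (p : ℝ × FSeq) (k : ℤ) (y : ℝ) : ℝ := p.1 * D.d k * har' k y + sol' k (p.2 k) y

/-- The element representing a multiplier applied to the solution. -/
def solS (m : Mult) : ℝ × FSeq →L[ℝ] FSeq :=
  (ContinuousLinearMap.fst ℝ ℝ FSeq).smulRight (harS D m) +
    (diag (fun k => m.c k • solL k) 4 fun k F => norm_solL_le k F (m.le k)).comp
      (ContinuousLinearMap.snd ℝ ℝ FSeq)

/-- The element representing a multiplier applied to the normal derivative. -/
def solS' (m : Mult') : ℝ × FSeq →L[ℝ] FSeq :=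
  (ContinuousLinearMap.fst ℝ ℝ FSeq).smulRight (harS' D m) +
    (diag (fun k => m.c k • solL' k) 4 fun k F => norm_solL'_le k F (m.le k)).comp
      (ContinuousLinearMap.snd ℝ ℝ FSeq)

lemma FSeq_add_apply (F G : FSeq) (k : ℤ) : (F + G) k = F k + G k := rfl

lemma FSeq_smul_apply (c : ℝ) (F : FSeq) (k : ℤ) : (c • F) k = c • F k := rfl

lemma solS_apply (m : Mult) (p : ℝ × FSeq) (k : ℤ) (y : Icc (0:ℝ) 1) :
    solS D m p k y = m.c k * coef D p k y / wt k y := by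
  rw [solS, add_apply, FSeq_add_apply, ContinuousLinearMap.smulRight_apply,
    FSeq_smul_apply, ContinuousLinearMap.comp_apply, diag_apply, harS, mk_apply]
  simp [coef, solL, unwt, harP]; ring

lemma solS'_apply (m : Mult') (p : ℝ × FSeq) (k : ℤ) (y : Icc (0:ℝ) 1) :
    solS' D m p k y = m.c k * coef' D p k y / wt k y := by
  rw [solS', add_apply, FSeq_add_apply, ContinuousLinearMap.smulRight_apply,
    FSeq_smul_apply, ContinuousLinearMap.comp_apply, diag_apply, harS', mk_apply]
  simp [coef', solL', unwt]; ring

end Green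

namespace Green
open FSeq

variable (D : Data)

lemma fr_le_sq {k : ℤ} : fr k ≤ fr k ^ 2 := by
  rcases eq_or_ne k 0 with rfl | hk
  · simp [fr]
  · nlinarith [one_le_fr hk]

/-- The multiplier `k`. -/
def mulK : Mult := ⟨fun k => k, fun _ => fr_le_sq⟩
/-- The multiplier `k²`. -/
def mulK2 : Mult := ⟨fun k => k ^ 2, fun k => by simp [fr]⟩
/-- The multiplier `1`. -/
def mulOne : Mult' := ⟨fun _ => 1, fun k hk => by simpa using one_le_fr hk⟩
/-- The multiplier `k`. -/
def mulK' : Mult' := ⟨fun k => k, fun _ _ => le_rfl⟩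

/-- Multiplication by the transverse variable. -/
def mulY : FSeq →L[ℝ] FSeq :=
  diag (fun _ => LinearMap.mulLeft ℝ (⟨fun y => y, continuous_subtype_val⟩ : Prof)) 1 fun k v => by
    refine (norm_mul_le _ _).trans (mul_le_mul_of_nonneg_right ?_ (norm_nonneg _))
    refine (ContinuousMap.norm_le _ zero_le_one).2 fun y => ?_
    change ‖(y:ℝ)‖ ≤ 1
    rw [Real.norm_of_nonneg y.2.1]; exact y.2.2

lemma mulY_apply (F : FSeq) (k : ℤ) (y : Icc (0:ℝ) 1) : mulY F k y = y * F k y := rfl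

lemma ev_mulY (x : ℝ) (y : Icc (0:ℝ) 1) (F : FSeq) : ev x y (mulY F) = (y:ℝ) * ev x y F := by
  rw [ev_apply, ev_apply, ← tsum_mul_left]
  refine tsum_congr fun k => ?_
  rw [evTerm, evTerm, mulY_apply]
  push_cast; ring

lemma mulY_rev (F : FSeq) : mulY (rev F) = rev (mulY F) := by
  ext k : 2; rfl

/-- The nonlinearity in terms of its five arguments. -/
def cubic (a b p q r : FSeq) : FSeq :=
  mulY (conv b (conv a a - conv b b)) -
    mulY (mulY (conv a (conv a r) - conv b (conv b p) - (2:ℝ) • conv a (conv b q)))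

/-- The nonlinearity. -/
def nonlin (p : ℝ × FSeq) : FSeq :=
  cubic (solS D mulK p) (solS' D mulOne p) (-solS D mulK2 p) (solS' D mulK' p)
    (solS D mulK2 p + p.2)

lemma contDiff_conv {f g : ℝ × FSeq → FSeq} (hf : ContDiff ℝ 1 f) (hg : ContDiff ℝ 1 g) :
    ContDiff ℝ 1 fun p => conv (f p) (g p) := by
  have hb : IsBoundedBilinearMap ℝ fun p : FSeq × FSeq => conv p.1 p.2 :=
    { add_left := fun a b c => by simp
      smul_left := fun a b c => by simp
      add_right := fun a b c => by simp
      smul_right := fun a b c => by simp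
      bound := ⟨1, one_pos, fun x y => by rw [one_mul]; exact norm_conv_le x y⟩ }
  exact hb.contDiff.comp (hf.prodMk hg)

lemma contDiff_nonlin : ContDiff ℝ 1 (nonlin D) := by
  unfold nonlin cubic
  have h1 := (solS D mulK).contDiff (n := 1)
  have h2 := (solS' D mulOne).contDiff (n := 1)
  have h3 := (solS D mulK2).contDiff (n := 1)
  have h4 := (solS' D mulK').contDiff (n := 1)
  have h5 := h3.add (contDiff_snd (n := 1))
  refine (mulY.contDiff.comp (contDiff_conv h2 ((contDiff_conv h1 h1).sub (contDiff_conv h2 h2)))).sub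
    (mulY.contDiff.comp (mulY.contDiff.comp ((((contDiff_conv h1 (contDiff_conv h1 h5)).sub
      (contDiff_conv h2 (contDiff_conv h2 h3.neg)))).sub
      ((contDiff_conv h1 (contDiff_conv h2 h4)).const_smul (2:ℝ)))))

lemma nonlin_smul (t : ℝ) (p : ℝ × FSeq) : nonlin D (t • p) = t ^ 3 • nonlin D p := by
  simp only [nonlin, cubic, map_smul, Prod.smul_snd, ← smul_add, ← smul_neg, smul_apply,
    ← smul_sub, smul_smul, pow_succ, pow_zero, one_mul]
  simp only [smul_sub, map_sub, map_smul, smul_smul]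
  module

lemma hasStrictFDerivAt_nonlin : HasStrictFDerivAt (nonlin D) (0 : ℝ × FSeq →L[ℝ] FSeq) 0 := by
  have h := (contDiff_nonlin D).contDiffAt (x := 0).hasStrictFDerivAt one_ne_zero
  suffices hz : fderiv ℝ (nonlin D) 0 = 0 by rwa [hz] at h
  refine ContinuousLinearMap.ext fun v => ?_
  have h0 : HasDerivAt (fun t : ℝ => nonlin D (t • v)) (fderiv ℝ (nonlin D) 0 v) 0 := by
    have hl : HasDerivAt (fun t : ℝ => t • v) v 0 := by
      simpa using (hasDerivAt_id (0:ℝ)).smul_const v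
    have h' : HasFDerivAt (nonlin D) (fderiv ℝ (nonlin D) 0) ((0:ℝ) • v) := by
      rw [zero_smul]; exact h.hasFDerivAt
    exact h'.comp_hasDerivAt (0:ℝ) hl
  have h1 : HasDerivAt (fun t : ℝ => nonlin D (t • v)) (0 : FSeq) 0 := by
    simp only [nonlin_smul]
    simpa using ((hasDerivAt_pow 3 (0:ℝ)).smul_const (nonlin D v))
  exact h0.unique h1

/-- The reflection symmetry of the problem. -/
def sym (p : ℝ × FSeq) : ℝ × FSeq := (p.1, -rev p.2)

lemma sol_neg (k : ℤ) (F : Prof) (y : ℝ) : sol k (-F) y = -sol k F y := by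
  have h0 := int0_smul k (-1) F y
  have h1 := int1_smul k (-1) F y
  rw [neg_one_smul] at h0 h1
  unfold sol; rw [h0, h1]; ring

lemma sol'_neg (k : ℤ) (F : Prof) (y : ℝ) : sol' k (-F) y = -sol' k F y := by
  have h0 := int0_smul k (-1) F y
  have h1 := int1_smul k (-1) F y
  rw [neg_one_smul] at h0 h1
  unfold sol'; rw [h0, h1]; ring

lemma sol_neg_freq (k : ℤ) (F : Prof) (y : ℝ) : sol (-k) F y = sol k F y := by
  simp [sol, int0, int1, fr, src]

lemma sol'_neg_freq (k : ℤ) (F : Prof) (y : ℝ) : sol' (-k) F y = sol' k F y := by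
  simp [sol', int0, int1, fr, src]

lemma coef_sym (p : ℝ × FSeq) (k : ℤ) (y : ℝ) : coef D (sym p) k y = -coef D p (-k) y := by
  have : (sym p).2 k = -p.2 (-k) := rfl
  rw [coef, coef, this, sol_neg, sol_neg_freq, D.odd]
  simp [sym, har, fr]; ring

lemma coef'_sym (p : ℝ × FSeq) (k : ℤ) (y : ℝ) : coef' D (sym p) k y = -coef' D p (-k) y := by
  have : (sym p).2 k = -p.2 (-k) := rfl
  rw [coef', coef', this, sol'_neg, sol'_neg_freq, D.odd]
  simp [sym, har', fr]; ring

lemma solS_sym_even (m : Mult) (hm : ∀ k, m.c (-k) = m.c k) (p : ℝ × FSeq) :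
    solS D m (sym p) = -rev (solS D m p) := by
  ext k y
  change solS D m (sym p) k y = -(solS D m p (-k) y)
  rw [solS_apply, solS_apply, coef_sym, hm, wt_neg]; ring

lemma solS_sym_odd (m : Mult) (hm : ∀ k, m.c (-k) = -m.c k) (p : ℝ × FSeq) :
    solS D m (sym p) = rev (solS D m p) := by
  ext k y
  change solS D m (sym p) k y = (solS D m p (-k) y)
  rw [solS_apply, solS_apply, coef_sym, hm, wt_neg]; ring

lemma solS'_sym_even (m : Mult') (hm : ∀ k, m.c (-k) = m.c k) (p : ℝ × FSeq) :
    solS' D m (sym p) = -rev (solS' D m p) := by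
  ext k y
  change solS' D m (sym p) k y = -(solS' D m p (-k) y)
  rw [solS'_apply, solS'_apply, coef'_sym, hm, wt_neg]; ring

lemma solS'_sym_odd (m : Mult') (hm : ∀ k, m.c (-k) = -m.c k) (p : ℝ × FSeq) :
    solS' D m (sym p) = rev (solS' D m p) := by
  ext k y
  change solS' D m (sym p) k y = (solS' D m p (-k) y)
  rw [solS'_apply, solS'_apply, coef'_sym, hm, wt_neg]; ring

lemma cubic_rev (a b p q r : FSeq) :
    cubic (rev a) (-rev b) (-rev p) (rev q) (-rev r) = -rev (cubic a b p q r) := by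
  simp only [cubic, map_neg, map_sub, neg_apply, neg_neg, conv_rev, map_smul, mulY_rev]
  module

lemma nonlin_sym (p : ℝ × FSeq) : nonlin D (sym p) = -rev (nonlin D p) := by
  unfold nonlin
  rw [solS_sym_odd D mulK (fun k => by simp [mulK]), solS'_sym_even D mulOne (fun k => rfl),
    solS_sym_even D mulK2 (fun k => by simp [mulK2]), solS'_sym_odd D mulK' (fun k => by simp [mulK'])]
  change cubic (rev _) (-rev _) (- -rev _) (rev _) (-rev _ + -rev _) = _
  rw [← neg_add, ← map_add, ← map_neg rev (solS D mulK2 p)]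
  exact cubic_rev _ _ _ _ _

/-- Small solutions of the nonlinear problem. -/
lemma exists_small_solution {δ : ℝ} (hδ : 0 < δ) :
    ∃ p : ℝ × FSeq, 0 < p.1 ∧ p.1 < δ ∧ ‖p.2‖ ≤ δ * p.1 ∧ sym p = p ∧ p.2 = nonlin D p := by
  set Φ : ℝ × FSeq → ℝ × FSeq := fun p => (p.1, p.2 - nonlin D p) with hΦ
  have hst : HasStrictFDerivAt Φ
      ((ContinuousLinearEquiv.refl ℝ (ℝ × FSeq) : (ℝ × FSeq) ≃L[ℝ] (ℝ × FSeq)) :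
        ℝ × FSeq →L[ℝ] ℝ × FSeq) 0 := by
    have := (hasStrictFDerivAt_fst (𝕜 := ℝ) (p := (0 : ℝ × FSeq))).prodMk
      ((hasStrictFDerivAt_snd (𝕜 := ℝ) (p := (0 : ℝ × FSeq))).sub (hasStrictFDerivAt_nonlin D))
    refine this.congr_fderiv (ContinuousLinearMap.ext fun v => Prod.ext rfl ?_)
    simp
  have hΦ0 : Φ 0 = 0 := by
    have := nonlin_smul D 0 0
    simp only [zero_smul, ne_eq, OfNat.ofNat_ne_zero, not_false_eq_true, zero_pow] at this
    simp [hΦ, this]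
  set g := hst.localInverse
  have hg0 : g 0 = 0 := by
    have := hst.localInverse_apply_image; rwa [hΦ0] at this
  have hgd := hst.to_localInverse.hasFDerivAt
  have hr := hst.eventually_right_inverse
  have hl := hst.eventually_left_inverse
  rw [hΦ0] at hgd hr
  have hgc : ContinuousAt g 0 := hgd.continuousAt
  have hline : Tendsto (fun e : ℝ => (e, (0:FSeq))) (𝓝 0) (𝓝 (0 : ℝ × FSeq)) :=
    (by fun_prop : Continuous fun e : ℝ => (e, (0:FSeq))).tendsto' 0 0 rfl
  have hp0 : Tendsto (fun e : ℝ => g (e, 0)) (𝓝 0) (𝓝 0) := by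
    have := hgc.tendsto.comp hline; rwa [hg0] at this
  have hsymc : Continuous sym := by
    unfold sym; exact continuous_fst.prodMk (rev.continuous.comp continuous_snd).neg
  have hs0 : Tendsto (fun e : ℝ => sym (g (e, 0))) (𝓝 0) (𝓝 0) := by
    have := (hsymc.tendsto 0).comp hp0
    rwa [show sym 0 = 0 by simp [sym]] at this
  have hsmall : ∀ᶠ e : ℝ in 𝓝 0, ‖g (e, 0) - (e, 0)‖ ≤ δ * ‖e‖ := by
    have h1 := (hgd.isLittleO.comp_tendsto hline).def hδ
    filter_upwards [h1] with e he
    change ‖g (e, 0) - g 0 - ((e, (0:FSeq)) - 0)‖ ≤ δ * ‖((e, (0:FSeq)) - 0)‖ at he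
    rw [hg0, sub_zero, sub_zero] at he
    refine he.trans_eq ?_
    simp [Prod.norm_def]
  obtain ⟨e, ⟨h1, h2, h3, h4⟩, he0, heδ⟩ := ((((hline.eventually hr).and ((hp0.eventually hl).and
    ((hs0.eventually hl).and hsmall))).filter_mono nhdsWithin_le_nhds).and
      (Ioo_mem_nhdsGT hδ)).exists (f := 𝓝[>] (0:ℝ))
  have hfst : (g (e, 0)).1 = e := congrArg Prod.fst h1
  have hsnd : (g (e, 0)).2 - nonlin D (g (e, 0)) = 0 := congrArg Prod.snd h1
  refine ⟨g (e, 0), by rwa [hfst], by rwa [hfst], ?_, ?_, sub_eq_zero.1 hsnd⟩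
  · rw [hfst]
    have : ‖(g (e, 0)).2‖ ≤ ‖g (e, 0) - (e, 0)‖ := by
      have := norm_snd_le (g (e, 0) - (e, (0:FSeq)))
      rwa [Prod.snd_sub, sub_zero] at this
    rw [Real.norm_of_nonneg he0.le] at h4
    exact this.trans h4
  · have : Φ (sym (g (e, 0))) = (e, 0) := by
      simp only [hΦ, nonlin_sym]
      refine Prod.ext hfst ?_
      change -rev (g (e, 0)).2 - -rev (nonlin D (g (e, 0))) = 0
      rw [sub_eq_zero.1 hsnd, sub_self]
    rw [this] at h3
    exact h3.symm

end Green

namespace Series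
open FSeq

/-- The `a`-th tangential derivative of the sine series with coefficients `V`. -/
def S (a : ℕ) (V : ℤ → ℝ → ℝ) (z : ℝ × ℝ) : ℝ :=
  ∑' k : ℤ, (k:ℝ) ^ a * V k z.2 * Real.sin (k * z.1 + a * (Real.pi / 2))

/-- Coefficients controlled by a summable sequence and the exponential weight. -/
structure Bdd (B : ℤ → ℝ) (V : ℤ → ℝ → ℝ) : Prop where
  summable : Summable B
  le : ∀ k, ∀ y ∈ Icc (0:ℝ) 1, |V k y| ≤ B k * wt k y

variable {B : ℤ → ℝ} {V V' : ℤ → ℝ → ℝ}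

lemma Bdd.nonneg (h : Bdd B V) (k : ℤ) : 0 ≤ B k := by
  have := (abs_nonneg _).trans (h.le k 0 (by simp))
  exact nonneg_of_mul_nonneg_left this (wt_pos _ _)

lemma exists_pow_mul_wt_le (a : ℕ) {y : ℝ} (hy : 0 < y) :
    ∃ C : ℝ, 0 ≤ C ∧ ∀ k : ℤ, ∀ y', y ≤ y' → |(k:ℝ)| ^ a * wt k y' ≤ C := by
  refine ⟨a.factorial / (y / 2) ^ a, by positivity, fun k y' hy' => ?_⟩
  rw [le_div_iff₀ (by positivity)]
  have h1 : |(k:ℝ)| * y / 2 ≤ |(k:ℝ)| * y' / 2 := by gcongr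
  have h2 := Real.pow_div_factorial_le_exp (|(k:ℝ)| * y' / 2)
    (by have := hy.trans_le hy'; positivity) a
  have h3 : (|(k:ℝ)| * y / 2) ^ a ≤ (|(k:ℝ)| * y' / 2) ^ a := by gcongr
  rw [div_le_iff₀ (by positivity)] at h2
  unfold wt; rw [Real.exp_neg]
  calc |(k:ℝ)| ^ a * (Real.exp (|(k:ℝ)| * y' / 2))⁻¹ * (y / 2) ^ a
      = (|(k:ℝ)| * y / 2) ^ a / Real.exp (|(k:ℝ)| * y' / 2) := by
        have : (|(k:ℝ)| * y / 2) ^ a = |(k:ℝ)| ^ a * (y / 2) ^ a := by rw [mul_div_assoc, mul_pow]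
        rw [this, div_eq_mul_inv]; ring
    _ ≤ _ := by rw [div_le_iff₀ (Real.exp_pos _)]; linarith

lemma abs_term_le (h : Bdd B V) (a : ℕ) {y : ℝ} (hy : 0 < y) :
    ∃ C : ℝ, ∀ k : ℤ, ∀ x y' : ℝ, y ≤ y' → y' ≤ 1 →
      |(k:ℝ) ^ a * V k y' * Real.sin x| ≤ C * B k := by
  obtain ⟨C, hC0, hC⟩ := exists_pow_mul_wt_le a hy
  refine ⟨C, fun k x y' h1 h2 => ?_⟩
  have hb := h.nonneg k
  rw [abs_mul, abs_mul, abs_pow]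
  calc |(k:ℝ)| ^ a * |V k y'| * |Real.sin x| ≤ |(k:ℝ)| ^ a * (B k * wt k y') * 1 := by
        have := wt_pos k y'
        gcongr
        · exact h.le k y' ⟨hy.le.trans h1, h2⟩
        · exact Real.abs_sin_le_one x
    _ = (|(k:ℝ)| ^ a * wt k y') * B k := by ring
    _ ≤ _ := mul_le_mul_of_nonneg_right (hC k y' h1) hb

lemma summable_term (h : Bdd B V) (a : ℕ) {y : ℝ} (hy : 0 < y) (hy1 : y ≤ 1) (x : ℤ → ℝ) :
    Summable fun k : ℤ => (k:ℝ) ^ a * V k y * Real.sin (x k) := by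
  obtain ⟨C, hC⟩ := abs_term_le h a hy
  exact Summable.of_norm_bounded (h.summable.mul_left C) fun k => hC k _ y le_rfl hy1

lemma hasDerivAt_sin_term (k : ℤ) (a : ℕ) (x : ℝ) :
    HasDerivAt (fun x : ℝ => Real.sin (k * x + a * (Real.pi / 2)))
      (k * Real.sin (k * x + (a + 1 : ℕ) * (Real.pi / 2))) x := by
  refine ((((hasDerivAt_id x).const_mul (k:ℝ)).add_const (a * (Real.pi / 2))).sin).congr_deriv ?_
  rw [show (k:ℝ) * x + (a + 1 : ℕ) * (Real.pi / 2) = k * x + a * (Real.pi / 2) + Real.pi / 2 by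
    push_cast; ring, Real.sin_add_pi_div_two]
  simp only [id]; ring

/-- The linear form with given partial derivatives. -/
def form (p q : ℝ) : ℝ × ℝ →L[ℝ] ℝ :=
  p • ContinuousLinearMap.fst ℝ ℝ ℝ + q • ContinuousLinearMap.snd ℝ ℝ ℝ

lemma norm_form_le (p q : ℝ) : ‖form p q‖ ≤ |p| + |q| := by
  unfold form
  refine (norm_add_le _ _).trans ?_
  rw [norm_smul, norm_smul, Real.norm_eq_abs, Real.norm_eq_abs]
  have h1 := ContinuousLinearMap.norm_fst_le ℝ ℝ ℝ
  have h2 := ContinuousLinearMap.norm_snd_le ℝ ℝ ℝ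
  nlinarith [abs_nonneg p, abs_nonneg q]

lemma hasFDerivAt_S (h : Bdd B V) (h' : Bdd B V') (hd : ∀ k y, HasDerivAt (V k) (V' k y) y)
    (a : ℕ) {z : ℝ × ℝ} (hz : z.2 ∈ Ioo (0:ℝ) 1) :
    HasFDerivAt (S a V) (form (S (a + 1) V z) (S a V' z)) z := by
  set y0 := z.2 / 2
  have hy0 : 0 < y0 := half_pos hz.1
  obtain ⟨C1, hC1⟩ := abs_term_le h (a + 1) hy0
  obtain ⟨C2, hC2⟩ := abs_term_le h' a hy0
  have hzs : z ∈ (univ : Set ℝ) ×ˢ Ioo y0 1 := ⟨trivial, half_lt_self hz.1, hz.2⟩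
  have key := hasFDerivAt_tsum_of_isPreconnected (𝕜 := ℝ)
    (f := fun (k : ℤ) (z : ℝ × ℝ) => (k:ℝ) ^ a * V k z.2 * Real.sin (k * z.1 + a * (Real.pi / 2)))
    (f' := fun k z => form ((k:ℝ) ^ (a + 1) * V k z.2 *
      Real.sin (k * z.1 + (a + 1 : ℕ) * (Real.pi / 2)))
      ((k:ℝ) ^ a * V' k z.2 * Real.sin (k * z.1 + a * (Real.pi / 2))))
    (u := fun k => C1 * B k + C2 * B k) (s := univ ×ˢ Ioo y0 1)
    ((h.summable.mul_left C1).add (h.summable.mul_left C2)) (isOpen_univ.prod isOpen_Ioo)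
    ((convex_univ.prod (convex_Ioo _ _)).isPreconnected)
    (fun k w _ => ?_)
    (fun k w hw => (norm_form_le _ _).trans
      (add_le_add (hC1 k _ _ hw.2.1.le hw.2.2.le) (hC2 k _ _ hw.2.1.le hw.2.2.le)))
    hzs (summable_term h a hz.1 hz.2.le _) hzs
  · refine key.congr_fderiv ?_
    have s1 := summable_term h (a + 1) hz.1 hz.2.le
      fun k : ℤ => (k:ℝ) * z.1 + (a + 1 : ℕ) * (Real.pi / 2)
    have s2 := summable_term h' a hz.1 hz.2.le fun k : ℤ => (k:ℝ) * z.1 + a * (Real.pi / 2)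
    simp only [form]
    rw [(s1.smul_const _).tsum_add (s2.smul_const _), s1.tsum_smul_const, s2.tsum_smul_const]
    rfl
  · have e1 : HasFDerivAt (fun z : ℝ × ℝ => z.2) (ContinuousLinearMap.snd ℝ ℝ ℝ) w := hasFDerivAt_snd
    have e2 : HasFDerivAt (fun z : ℝ × ℝ => z.1) (ContinuousLinearMap.fst ℝ ℝ ℝ) w := hasFDerivAt_fst
    have h1 := ((hd k w.2).comp_hasFDerivAt w e1).const_mul ((k:ℝ) ^ a)
    have h2 := (hasDerivAt_sin_term k a w.1).comp_hasFDerivAt w e2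
    refine (h1.mul h2).congr_fderiv ?_
    ext <;> simp [form, pow_succ] <;> ring

lemma continuousOn_S_zero (h : Bdd B V) (hc : ∀ k, Continuous (V k)) :
    ContinuousOn (S 0 V) (univ ×ˢ Icc 0 1) := by
  refine continuousOn_tsum (u := B) (fun k => ?_) h.summable fun k z hz => ?_
  · have := hc k
    exact Continuous.continuousOn (by fun_prop)
  · rw [pow_zero, one_mul, norm_mul]
    have h1 := h.le k z.2 hz.2
    have h2 := wt_le_one k hz.2.1
    have h3 := h.nonneg k
    have h4 : ‖Real.sin (k * z.1 + (0:ℕ) * (Real.pi / 2))‖ ≤ 1 := Real.abs_sin_le_one _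
    calc _ ≤ (B k * 1) * 1 := by
          gcongr
          exact h1.trans (by gcongr)
      _ = _ := by ring

/-- A solution of the minimal surface equation given by a sine series. -/
structure Sol where
  B : ℤ → ℝ
  U : ℤ → ℝ → ℝ
  U' : ℤ → ℝ → ℝ
  U'' : ℤ → ℝ → ℝ
  bU : Bdd B U
  bU' : Bdd B U'
  bU'' : Bdd B U''
  hU : ∀ k y, HasDerivAt (U k) (U' k y) y
  hU' : ∀ k y, HasDerivAt (U' k) (U'' k y) y
  pde : ∀ z : ℝ × ℝ, z.2 ∈ Ioo (0:ℝ) 1 →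
    S 2 U z + S 0 U'' z = z.2 * (S 0 U' z * (S 1 U z ^ 2 + S 0 U' z ^ 2)) - z.2 ^ 2 *
      (S 0 U' z ^ 2 * S 2 U z + S 1 U z ^ 2 * S 0 U'' z - 2 * S 1 U z * S 0 U' z * S 1 U' z)

variable (s : Sol)

/-- The algebra of functions generated by the derivatives of the solution. -/
inductive Gen : (ℝ × ℝ → ℝ) → Prop
  | const (c : ℝ) : Gen fun _ => c
  | snd : Gen fun z => z.2
  | U (a : ℕ) : Gen (S a s.U)
  | U' (a : ℕ) : Gen (S a s.U')
  | inv : Gen fun z => (1 + z.2 ^ 2 * S 1 s.U z ^ 2)⁻¹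
  | add {f g : ℝ × ℝ → ℝ} : Gen f → Gen g → Gen fun z => f z + g z
  | mul {f g : ℝ × ℝ → ℝ} : Gen f → Gen g → Gen fun z => f z * g z

lemma hasDerivAt_of_form {f : ℝ × ℝ → ℝ} {p q : ℝ} {z : ℝ × ℝ} (h : HasFDerivAt f (form p q) z) :
    HasDerivAt (fun x => f (x, z.2)) p z.1 := by
  have h' : HasFDerivAt f (form p q) (z.1, z.2) := h
  have := h'.comp_hasDerivAt z.1 ((hasDerivAt_id z.1).prodMk (hasDerivAt_const z.1 z.2))
  refine this.congr_deriv ?_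
  simp [form]

lemma inv_ne {y p : ℝ} : 1 + y ^ 2 * p ^ 2 ≠ 0 := by positivity

lemma Gen.hasDerivAt {f : ℝ × ℝ → ℝ} (hf : Gen s f) :
    ∃ g, Gen s g ∧ ∀ z : ℝ × ℝ, z.2 ∈ Ioo (0:ℝ) 1 → HasDerivAt (fun x => f (x, z.2)) (g z) z.1 := by
  induction hf with
  | const c => exact ⟨_, .const 0, fun z _ => hasDerivAt_const _ _⟩
  | snd => exact ⟨_, .const 0, fun z _ => hasDerivAt_const _ _⟩
  | U a => exact ⟨_, .U (a + 1), fun z hz => hasDerivAt_of_form (hasFDerivAt_S s.bU s.bU' s.hU a hz)⟩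
  | U' a =>
    exact ⟨_, .U' (a + 1), fun z hz => hasDerivAt_of_form (hasFDerivAt_S s.bU' s.bU'' s.hU' a hz)⟩
  | inv =>
    refine ⟨_, .mul (.const (-2)) (.mul (.mul .inv .inv) (.mul (.mul .snd .snd)
      (.mul (.U 1) (.U 2)))), fun z hz => ?_⟩
    have h := hasDerivAt_of_form (hasFDerivAt_S s.bU s.bU' s.hU 1 hz)
    refine ((((h.pow 2).const_mul (z.2 ^ 2)).const_add 1).inv inv_ne).congr_deriv ?_
    have : 1 + z.2 ^ 2 * S 1 s.U z ^ 2 ≠ 0 := inv_ne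
    simp only [Prod.mk.eta, Pi.pow_apply]
    field_simp; ring
  | add _ _ h1 h2 =>
    obtain ⟨g1, k1, h1⟩ := h1
    obtain ⟨g2, k2, h2⟩ := h2
    exact ⟨_, .add k1 k2, fun z hz => (h1 z hz).add (h2 z hz)⟩
  | mul k1' k2' h1 h2 =>
    obtain ⟨g1, k1, h1⟩ := h1
    obtain ⟨g2, k2, h2⟩ := h2
    exact ⟨_, .add (.mul k1 k2') (.mul k1' k2), fun z hz => (h1 z hz).mul (h2 z hz)⟩

lemma hasDerivAt_S {B : ℤ → ℝ} {V : ℤ → ℝ → ℝ} (h : Bdd B V) (a : ℕ) {z : ℝ × ℝ}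
    (hz : z.2 ∈ Ioo (0:ℝ) 1) : HasDerivAt (fun x => S a V (x, z.2)) (S (a + 1) V z) z.1 := by
  obtain ⟨C, hC⟩ := abs_term_le h (a + 1) hz.1
  refine hasDerivAt_tsum (u := fun k => C * B k) (h.summable.mul_left C)
    (g := fun k x => (k:ℝ) ^ a * V k z.2 * Real.sin (k * x + a * (Real.pi / 2)))
    (g' := fun k x => (k:ℝ) ^ (a + 1) * V k z.2 *
      Real.sin (k * x + (a + 1 : ℕ) * (Real.pi / 2))) (fun k x => ?_)
    (fun k x => hC k _ _ le_rfl hz.2.le) (y₀ := z.1)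
    (summable_term h a hz.1 hz.2.le fun k => k * z.1 + a * (Real.pi / 2)) z.1
  refine ((hasDerivAt_sin_term k a x).const_mul _).congr_deriv ?_
  ring

lemma exists_gen_U'' (a : ℕ) : ∃ g, Gen s g ∧ ∀ z : ℝ × ℝ, z.2 ∈ Ioo (0:ℝ) 1 → S a s.U'' z = g z := by
  induction a with
  | zero =>
    refine ⟨_, .mul .inv (.add (.mul (.const (-1)) (.U 2)) (.add (.mul .snd (.mul (.U' 0)
      (.add (.mul (.U 1) (.U 1)) (.mul (.U' 0) (.U' 0))))) (.mul (.mul .snd .snd)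
      (.add (.mul (.const (-1)) (.mul (.mul (.U' 0) (.U' 0)) (.U 2)))
        (.mul (.const 2) (.mul (.mul (.U 1) (.U' 0)) (.U' 1))))))), fun z hz => ?_⟩
    have h := s.pde z hz
    have : 1 + z.2 ^ 2 * S 1 s.U z ^ 2 ≠ 0 := inv_ne
    rw [eq_inv_mul_iff_mul_eq₀ this]
    linear_combination h
  | succ a ih =>
    obtain ⟨g, hg, h⟩ := ih
    obtain ⟨g', hg', h'⟩ := hg.hasDerivAt
    refine ⟨g', hg', fun z hz => ?_⟩
    have h1 := hasDerivAt_S s.bU'' a hz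
    have h2 := h' z hz
    have : (fun x => S a s.U'' (x, z.2)) = fun x => g (x, z.2) := funext fun x => h (x, z.2) hz
    rw [this] at h1
    exact h1.unique h2

lemma Gen.hasFDerivAt {f : ℝ × ℝ → ℝ} (hf : Gen s f) :
    ∃ p q, Gen s p ∧ Gen s q ∧
      ∀ z : ℝ × ℝ, z.2 ∈ Ioo (0:ℝ) 1 → HasFDerivAt f (form (p z) (q z)) z := by
  induction hf with
  | const c =>
    refine ⟨_, _, .const 0, .const 0, fun z _ => ?_⟩
    simpa [form] using hasFDerivAt_const c z
  | snd =>
    refine ⟨_, _, .const 0, .const 1, fun z _ => ?_⟩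
    simpa [form] using hasFDerivAt_snd (𝕜 := ℝ) (p := z)
  | U a => exact ⟨_, _, .U (a + 1), .U' a, fun z hz => hasFDerivAt_S s.bU s.bU' s.hU a hz⟩
  | U' a =>
    obtain ⟨g, hg, h⟩ := exists_gen_U'' s a
    exact ⟨_, _, .U' (a + 1), hg, fun z hz => by
      rw [← h z hz]; exact hasFDerivAt_S s.bU' s.bU'' s.hU' a hz⟩
  | inv =>
    refine ⟨_, _, .mul (.const (-2)) (.mul (.mul .inv .inv) (.mul (.mul .snd .snd)
      (.mul (.U 1) (.U 2)))), .mul (.const (-2)) (.mul (.mul .inv .inv) (.add (.mul .snd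
      (.mul (.U 1) (.U 1))) (.mul (.mul .snd .snd) (.mul (.U 1) (.U' 1))))), fun z hz => ?_⟩
    have h := hasFDerivAt_S s.bU s.bU' s.hU 1 hz
    have hne : 1 + z.2 ^ 2 * S 1 s.U z ^ 2 ≠ 0 := inv_ne
    have h2 := (((hasFDerivAt_snd (𝕜 := ℝ) (p := z)).pow 2).mul (h.pow 2)).const_add 1
    refine ((hasDerivAt_inv hne).comp_hasFDerivAt z h2).congr_fderiv ?_
    ext <;> simp [form] <;> field_simp
    ring
  | add _ _ h1 h2 =>
    obtain ⟨p1, q1, k1, l1, h1⟩ := h1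
    obtain ⟨p2, q2, k2, l2, h2⟩ := h2
    refine ⟨_, _, .add k1 k2, .add l1 l2, fun z hz => ((h1 z hz).add (h2 z hz)).congr_fderiv ?_⟩
    ext <;> simp [form]
  | mul g1 g2 h1 h2 =>
    obtain ⟨p1, q1, k1, l1, h1⟩ := h1
    obtain ⟨p2, q2, k2, l2, h2⟩ := h2
    refine ⟨_, _, .add (.mul k1 g2) (.mul g1 k2), .add (.mul l1 g2) (.mul g1 l2),
      fun z hz => ((h1 z hz).mul (h2 z hz)).congr_fderiv ?_⟩
    ext <;> simp [form] <;> ring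

lemma isOpen_strip : IsOpen {z : ℝ × ℝ | z.2 ∈ Ioo (0:ℝ) 1} := isOpen_Ioo.preimage continuous_snd

lemma Gen.contDiffOn {f : ℝ × ℝ → ℝ} (hf : Gen s f) (n : ℕ) :
    ContDiffOn ℝ n f {z : ℝ × ℝ | z.2 ∈ Ioo (0:ℝ) 1} := by
  induction n generalizing f with
  | zero =>
    obtain ⟨p, q, -, -, h⟩ := hf.hasFDerivAt
    exact contDiffOn_zero.2 fun z hz => (h z hz).continuousAt.continuousWithinAt
  | succ n ih =>
    obtain ⟨p, q, hp, hq, h⟩ := hf.hasFDerivAt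
    push_cast
    refine (contDiffOn_succ_iff_fderiv_of_isOpen isOpen_strip).2
      ⟨fun z hz => (h z hz).differentiableAt.differentiableWithinAt, by simp, ?_⟩
    have : ContDiffOn ℝ n (fun z => form (p z) (q z)) {z : ℝ × ℝ | z.2 ∈ Ioo (0:ℝ) 1} :=
      ((ih hp).smul contDiffOn_const).add ((ih hq).smul contDiffOn_const)
    exact this.congr fun z hz => (h z hz).fderiv

lemma Sol.contDiffOn : ContDiffOn ℝ (⊤ : ℕ∞) (S 0 s.U) {z : ℝ × ℝ | z.2 ∈ Ioo (0:ℝ) 1} :=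
  contDiffOn_infty.2 fun n => Gen.contDiffOn s (Gen.U 0) n

end Series

namespace Green
open FSeq Series

lemma summable_mul_wt (F : FSeq) (y : Icc (0:ℝ) 1) : Summable fun k => F k y * wt k y := by
  refine Summable.of_norm_bounded (summable_norm F) fun k => ?_
  have h : ‖evTerm 0 y F k‖ = ‖F k y * wt k y‖ := by
    rw [norm_evTerm, norm_mul, Real.norm_eq_abs, Real.norm_of_nonneg (wt_pos k y).le]
  rw [← h]; exact norm_evTerm_le 0 y F k

lemma summable_mul_wt_mul (F : FSeq) (y : Icc (0:ℝ) 1) {t : ℤ → ℝ} (ht : ∀ k, |t k| ≤ 1) :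
    Summable fun k => F k y * wt k y * t k := by
  refine Summable.of_norm_bounded (summable_mul_wt F y).norm fun k => ?_
  rw [norm_mul]; exact mul_le_of_le_one_right (norm_nonneg _) (ht k)

lemma ev_eq (x : ℝ) (y : Icc (0:ℝ) 1) (F : FSeq) :
    ev x y F = ((∑' k : ℤ, F k y * wt k y * Real.cos (k * x) : ℝ) : ℂ) +
      ((∑' k : ℤ, F k y * wt k y * Real.sin (k * x) : ℝ) : ℂ) * Complex.I := by
  have h1 := summable_mul_wt_mul F y (t := fun k => Real.cos (k * x))
    fun k => Real.abs_cos_le_one _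
  have h2 := summable_mul_wt_mul F y (t := fun k => Real.sin (k * x))
    fun k => Real.abs_sin_le_one _
  have h1' := Complex.hasSum_ofReal.2 h1.hasSum
  have h2' := (Complex.hasSum_ofReal.2 h2.hasSum).mul_right Complex.I
  rw [ev_apply, ← (h1'.add h2').tsum_eq]
  refine tsum_congr fun k => ?_
  rw [evTerm, Complex.exp_mul_I]
  push_cast; ring

lemma tsum_eq_zero_of_odd {f : ℤ → ℝ} (h : ∀ k, f (-k) = -f k) : ∑' k, f k = 0 := by
  have := (Equiv.neg ℤ).tsum_eq f
  simp only [Equiv.neg_apply, h, tsum_neg] at this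
  linarith

lemma ev_odd (x : ℝ) (y : Icc (0:ℝ) 1) {F : FSeq} (h : ∀ k, F (-k) y = -F k y) :
    ev x y F = ((∑' k : ℤ, F k y * wt k y * Real.sin (k * x) : ℝ) : ℂ) * Complex.I := by
  rw [ev_eq, tsum_eq_zero_of_odd (f := fun k : ℤ => F k y * wt k y * Real.cos (k * x)) fun k => ?_]
  · simp
  · rw [h, wt_neg]; push_cast; rw [neg_mul (k:ℝ) x, Real.cos_neg]; ring

lemma ev_even (x : ℝ) (y : Icc (0:ℝ) 1) {F : FSeq} (h : ∀ k, F (-k) y = F k y) :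
    ev x y F = ((∑' k : ℤ, F k y * wt k y * Real.cos (k * x) : ℝ) : ℂ) := by
  rw [ev_eq, tsum_eq_zero_of_odd (f := fun k : ℤ => F k y * wt k y * Real.sin (k * x)) fun k => ?_]
  · simp
  · rw [h, wt_neg]; push_cast; rw [neg_mul (k:ℝ) x, Real.sin_neg]; ring

variable (D : Data)

/-- Second normal derivatives of the coefficients. -/
def coef'' (p : ℝ × FSeq) (k : ℤ) (y : ℝ) : ℝ := (k:ℝ) ^ 2 * coef D p k y + src k (p.2 k) y

/-- A summable bound for the coefficients and their derivatives. -/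
def bnd (p : ℝ × FSeq) (k : ℤ) : ℝ := 3 * (|p.1| * (fr k ^ 2 * |D.d k|)) + 5 * ‖p.2 k‖

lemma summable_bnd (p : ℝ × FSeq) : Summable (bnd D p) :=
  ((D.summable.mul_left _).mul_left _).add ((summable_norm p.2).mul_left _)

lemma coef_zero (p : ℝ × FSeq) (y : ℝ) : coef D p 0 y = 0 := by
  simp [coef, D.zero, sol_zero_freq]

lemma coef'_zero (p : ℝ × FSeq) (y : ℝ) : coef' D p 0 y = 0 := by
  simp [coef', D.zero, sol'_zero_freq]

lemma sq_mul_abs_coef_le (p : ℝ × FSeq) (k : ℤ) {y : ℝ} (hy : y ∈ Icc (0:ℝ) 1) :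
    fr k ^ 2 * |coef D p k y| ≤
      (3 * (|p.1| * (fr k ^ 2 * |D.d k|)) + 4 * ‖p.2 k‖) * wt k y := by
  have h1 := (abs_har_le k hy).trans (mul_le_mul_of_nonneg_left (exp_le_wt k hy.1) (by norm_num))
  have h2 := abs_sol_le k (p.2 k) hy
  have h3 : |coef D p k y| ≤ |p.1| * |D.d k| * |har k y| + |sol k (p.2 k) y| := by
    rw [← abs_mul, ← abs_mul]; exact abs_add_le _ _
  calc _ ≤ fr k ^ 2 * (|p.1| * |D.d k| * |har k y| + |sol k (p.2 k) y|) := by gcongr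
    _ = |p.1| * (fr k ^ 2 * |D.d k|) * |har k y| + fr k ^ 2 * |sol k (p.2 k) y| := by ring
    _ ≤ |p.1| * (fr k ^ 2 * |D.d k|) * (3 * wt k y) + 4 * ‖p.2 k‖ * wt k y := by gcongr
    _ = _ := by ring

lemma mul_abs_coef'_le (p : ℝ × FSeq) (k : ℤ) {y : ℝ} (hy : y ∈ Icc (0:ℝ) 1) :
    fr k * |coef' D p k y| ≤
      (3 * (|p.1| * (fr k ^ 2 * |D.d k|)) + 4 * ‖p.2 k‖) * wt k y := by
  have hf : 0 ≤ fr k := abs_nonneg _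
  have h1 := (abs_har'_le k hy).trans (mul_le_mul_of_nonneg_left (exp_le_wt k hy.1) (by positivity))
  have h2 := abs_sol'_le k (p.2 k) hy
  have h3 : |coef' D p k y| ≤ |p.1| * |D.d k| * |har' k y| + |sol' k (p.2 k) y| := by
    rw [← abs_mul, ← abs_mul]; exact abs_add_le _ _
  calc _ ≤ fr k * (|p.1| * |D.d k| * |har' k y| + |sol' k (p.2 k) y|) := by gcongr
    _ = |p.1| * (fr k * |D.d k|) * |har' k y| + fr k * |sol' k (p.2 k) y| := by ring
    _ ≤ |p.1| * (fr k * |D.d k|) * (3 * fr k * wt k y) + 4 * ‖p.2 k‖ * wt k y := by gcongr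
    _ = _ := by ring

lemma bnd_ge (p : ℝ × FSeq) (k : ℤ) :
    3 * (|p.1| * (fr k ^ 2 * |D.d k|)) + 4 * ‖p.2 k‖ ≤ bnd D p k := by
  unfold bnd; linarith [norm_nonneg (p.2 k)]

lemma bdd_coef (p : ℝ × FSeq) : Bdd (bnd D p) (coef D p) where
  summable := summable_bnd D p
  le k y hy := by
    have hw := wt_pos k y
    refine le_trans ?_ ((sq_mul_abs_coef_le D p k hy).trans
      (mul_le_mul_of_nonneg_right (bnd_ge D p k) hw.le))
    rcases eq_or_ne k 0 with rfl | hk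
    · simp [coef_zero]
    · exact le_mul_of_one_le_left (abs_nonneg _) (one_le_pow₀ (one_le_fr hk))

lemma bdd_coef' (p : ℝ × FSeq) : Bdd (bnd D p) (coef' D p) where
  summable := summable_bnd D p
  le k y hy := by
    have hw := wt_pos k y
    refine le_trans ?_ ((mul_abs_coef'_le D p k hy).trans
      (mul_le_mul_of_nonneg_right (bnd_ge D p k) hw.le))
    rcases eq_or_ne k 0 with rfl | hk
    · simp [coef'_zero]
    · exact le_mul_of_one_le_left (abs_nonneg _) (one_le_fr hk)

lemma bdd_coef'' (p : ℝ × FSeq) : Bdd (bnd D p) (coef'' D p) where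
  summable := summable_bnd D p
  le k y hy := by
    have h1 := sq_mul_abs_coef_le D p k hy
    have h2 : |src k (p.2 k) y| ≤ ‖p.2 k‖ * wt k y := abs_src_le k (p.2 k) y
    have h3 : |coef'' D p k y| ≤ fr k ^ 2 * |coef D p k y| + |src k (p.2 k) y| := by
      refine (abs_add_le _ _).trans_eq ?_
      rw [abs_mul, abs_pow, fr]
    unfold bnd; linarith

lemma hasDerivAt_coef (p : ℝ × FSeq) (k : ℤ) (y : ℝ) :
    HasDerivAt (coef D p k) (coef' D p k y) y :=
  ((hasDerivAt_har k y).const_mul _).add (hasDerivAt_sol k (p.2 k) y)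

lemma hasDerivAt_coef' {p : ℝ × FSeq} (h0 : p.2 0 = 0) (k : ℤ) (y : ℝ) :
    HasDerivAt (coef' D p k) (coef'' D p k y) y := by
  rcases eq_or_ne k 0 with rfl | hk
  · rw [show coef' D p 0 = fun _ => 0 from funext (coef'_zero D p), coef'', h0]
    simpa [src] using hasDerivAt_const y (0:ℝ)
  · refine (((hasDerivAt_har' k y).const_mul _).add (hasDerivAt_sol' hk (p.2 k) y)).congr_deriv ?_
    unfold coef'' coef; ring

lemma S_even_arg (V : ℤ → ℝ → ℝ) (x y : ℝ) :
    S 2 V (x, y) = ∑' k : ℤ, -((k:ℝ) ^ 2 * V k y) * Real.sin (k * x) := by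
  refine tsum_congr fun k => ?_
  rw [show (k:ℝ) * x + (2:ℕ) * (Real.pi / 2) = k * x + Real.pi by push_cast; ring, Real.sin_add_pi]
  ring

lemma S_one (V : ℤ → ℝ → ℝ) (x y : ℝ) :
    S 1 V (x, y) = ∑' k : ℤ, (k:ℝ) * V k y * Real.cos (k * x) := by
  refine tsum_congr fun k => ?_
  rw [show (k:ℝ) * x + (1:ℕ) * (Real.pi / 2) = k * x + Real.pi / 2 by push_cast; ring,
    Real.sin_add_pi_div_two, pow_one]

lemma S_zero (V : ℤ → ℝ → ℝ) (x y : ℝ) :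
    S 0 V (x, y) = ∑' k : ℤ, V k y * Real.sin (k * x) := by
  refine tsum_congr fun k => ?_
  simp

lemma solS_mul_wt {p : ℝ × FSeq} (m : Mult) (k : ℤ) (y : Icc (0:ℝ) 1) :
    solS D m p k y * wt k y = m.c k * coef D p k y := by
  rw [solS_apply, div_mul_cancel₀ _ (wt_pos _ _).ne']

lemma solS'_mul_wt {p : ℝ × FSeq} (m : Mult') (k : ℤ) (y : Icc (0:ℝ) 1) :
    solS' D m p k y * wt k y = m.c k * coef' D p k y := by
  rw [solS'_apply, div_mul_cancel₀ _ (wt_pos _ _).ne']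

section
variable {D} {p : ℝ × FSeq}

lemma coef_odd (hs : sym p = p) (k : ℤ) (y : ℝ) : coef D p (-k) y = -coef D p k y := by
  have := coef_sym D p k y; rw [hs] at this; linarith

lemma coef'_odd (hs : sym p = p) (k : ℤ) (y : ℝ) : coef' D p (-k) y = -coef' D p k y := by
  have := coef'_sym D p k y; rw [hs] at this; linarith

lemma snd_odd (hs : sym p = p) (k : ℤ) : p.2 (-k) = -p.2 k := by
  have : (sym p).2 k = -p.2 (-k) := rfl
  rw [hs] at this; rw [this, neg_neg]

lemma snd_zero (hs : sym p = p) : p.2 0 = 0 := by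
  have := snd_odd hs 0
  rw [neg_zero] at this
  ext y
  have h : p.2 0 y = -(p.2 0 y) := congrArg (fun f : Prof => f y) this
  change p.2 0 y = 0
  linarith

lemma ev_x (hs : sym p = p) (x : ℝ) (y : Icc (0:ℝ) 1) :
    ev x y (solS D mulK p) = (S 1 (coef D p) (x, y) : ℝ) := by
  rw [ev_even x y fun k => ?_, S_one]
  · simp only [solS_mul_wt]; rfl
  · rw [solS_apply, solS_apply, coef_odd hs, wt_neg]; simp [mulK]

lemma ev_y (hs : sym p = p) (x : ℝ) (y : Icc (0:ℝ) 1) :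
    ev x y (solS' D mulOne p) = (S 0 (coef' D p) (x, y) : ℝ) * Complex.I := by
  rw [ev_odd x y fun k => ?_, S_zero]
  · simp only [solS'_mul_wt]; simp [mulOne]
  · rw [solS'_apply, solS'_apply, coef'_odd hs, wt_neg]; simp [mulOne]; ring

lemma ev_xx (hs : sym p = p) (x : ℝ) (y : Icc (0:ℝ) 1) :
    ev x y (solS D mulK2 p) = -(S 2 (coef D p) (x, y) : ℝ) * Complex.I := by
  rw [ev_odd x y fun k => ?_, S_even_arg]
  · simp only [solS_mul_wt]
    simp only [neg_mul, tsum_neg, Complex.ofReal_neg, neg_neg]; rfl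
  · rw [solS_apply, solS_apply, coef_odd hs, wt_neg]; simp [mulK2]; ring

lemma ev_xy (hs : sym p = p) (x : ℝ) (y : Icc (0:ℝ) 1) :
    ev x y (solS' D mulK' p) = (S 1 (coef' D p) (x, y) : ℝ) := by
  rw [ev_even x y fun k => ?_, S_one]
  · simp only [solS'_mul_wt]; rfl
  · rw [solS'_apply, solS'_apply, coef'_odd hs, wt_neg]; simp [mulK']

lemma ev_yy (hs : sym p = p) (x : ℝ) (y : Icc (0:ℝ) 1) :
    ev x y (solS D mulK2 p + p.2) = (S 0 (coef'' D p) (x, y) : ℝ) * Complex.I := by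
  rw [ev_odd x y fun k => ?_, S_zero]
  · congr 2
    refine tsum_congr fun k => ?_
    rw [FSeq_add_apply, ContinuousMap.add_apply, add_mul, solS_mul_wt, coef'', src_of_mem]; rfl
  · rw [FSeq_add_apply, FSeq_add_apply, snd_odd hs, ContinuousMap.add_apply,
      ContinuousMap.add_apply, ContinuousMap.neg_apply, solS_apply, solS_apply, coef_odd hs, wt_neg]
    simp [mulK2]; ring

lemma pde_of_fixed (hs : sym p = p) (hp : p.2 = nonlin D p) {z : ℝ × ℝ}
    (hz : z.2 ∈ Ioo (0:ℝ) 1) :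
    S 2 (coef D p) z + S 0 (coef'' D p) z =
      z.2 * (S 0 (coef' D p) z * (S 1 (coef D p) z ^ 2 + S 0 (coef' D p) z ^ 2)) - z.2 ^ 2 *
      (S 0 (coef' D p) z ^ 2 * S 2 (coef D p) z + S 1 (coef D p) z ^ 2 * S 0 (coef'' D p) z -
        2 * S 1 (coef D p) z * S 0 (coef' D p) z * S 1 (coef' D p) z) := by
  obtain ⟨x, y0⟩ := z
  obtain ⟨y, rfl⟩ : ∃ y : Icc (0:ℝ) 1, (y:ℝ) = y0 := ⟨⟨y0, Ioo_subset_Icc_self hz⟩, rfl⟩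
  have h1 : ev x y p.2 = (S 2 (coef D p) (x, y) + S 0 (coef'' D p) (x, y) : ℝ) * Complex.I := by
    have := ev_yy (D := D) hs x y
    rw [map_add, ev_xx hs] at this
    push_cast; linear_combination this
  have h2 := congrArg (ev x y) hp
  rw [h1, nonlin, cubic] at h2
  simp only [map_sub, map_neg, map_smul, ev_mulY, ev_conv, ev_x hs, ev_y hs, ev_xx hs, ev_xy hs,
    ev_yy hs, Complex.real_smul] at h2
  refine Complex.ofReal_injective (mul_right_cancel₀ Complex.I_ne_zero ?_)
  have hI := Complex.I_sq
  push_cast at h2 ⊢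
  linear_combination h2 + (-(y:ℂ) * S 0 (coef' D p) (x, ↑y) ^ 3 +
    (y:ℂ) ^ 2 * S 0 (coef' D p) (x, ↑y) ^ 2 * S 2 (coef D p) (x, ↑y)) * Complex.I * hI

/-- The sine series solution associated with a fixed point. -/
def toSol (hs : sym p = p) (hp : p.2 = nonlin D p) : Sol where
  B := bnd D p
  U := coef D p
  U' := coef' D p
  U'' := coef'' D p
  bU := bdd_coef D p
  bU' := bdd_coef' D p
  bU'' := bdd_coef'' D p
  hU := hasDerivAt_coef D p
  hU' := hasDerivAt_coef' D (snd_zero hs)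
  pde _ hz := pde_of_fixed hs hp hz

end
end Green

namespace Base

/-- The harmonic profile of frequency `k`. -/
def prof (k y : ℝ) : ℝ := Real.sinh (k * (1 - y)) / Real.sinh k

/-- The derivative of the harmonic profile. -/
def prof' (k y : ℝ) : ℝ := -(k * Real.cosh (k * (1 - y))) / Real.sinh k

lemma hasDerivAt_prof (k y : ℝ) : HasDerivAt (prof k) (prof' k y) y := by
  refine (((((hasDerivAt_id y).const_sub 1).const_mul k).sinh).div_const _).congr_deriv ?_
  simp only [id, prof']; ring

/-- The base solution divided by `sin x`, as a function of `t = cos² x` and `y`. -/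
def base (t y : ℝ) : ℝ := (1 / 16) * ((2 * prof 1 y - 3 * prof 3 y + prof 5 y) +
  12 * t * (prof 3 y - prof 5 y) + 16 * t ^ 2 * prof 5 y)

/-- The normal derivative of the base solution divided by `sin x`. -/
def base' (t y : ℝ) : ℝ := (1 / 16) * ((2 * prof' 1 y - 3 * prof' 3 y + prof' 5 y) +
  12 * t * (prof' 3 y - prof' 5 y) + 16 * t ^ 2 * prof' 5 y)

lemma hasDerivAt_base (t y : ℝ) : HasDerivAt (base t) (base' t y) y := by
  have h1 := hasDerivAt_prof 1 y
  have h3 := hasDerivAt_prof 3 y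
  have h5 := hasDerivAt_prof 5 y
  exact (((((h1.const_mul 2).sub (h3.const_mul 3)).add h5).add
    ((h3.sub h5).const_mul (12 * t))).add (h5.const_mul (16 * t ^ 2))).const_mul (1 / 16)

lemma sinh_three (x : ℝ) : Real.sinh (3 * x) = Real.sinh x * (4 * Real.cosh x ^ 2 - 1) := by
  rw [Real.sinh_three_mul, Real.cosh_sq]; ring

lemma sinh_five (x : ℝ) : Real.sinh (5 * x) =
    Real.sinh x * ((4 * Real.cosh x ^ 2) ^ 2 - 3 * (4 * Real.cosh x ^ 2) + 1) := by
  rw [show 5 * x = 3 * x + 2 * x by ring, Real.sinh_add, Real.sinh_three_mul, Real.cosh_three_mul,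
    Real.sinh_two_mul, Real.cosh_two_mul, Real.sinh_sq]
  have : Real.sinh x ^ 3 = Real.sinh x * (Real.cosh x ^ 2 - 1) := by rw [Real.cosh_sq]; ring
  rw [this]; ring

lemma exists_base_lower : ∃ c > 0, ∀ t y : ℝ, 0 ≤ t → y ∈ Icc (0:ℝ) 1 →
    c * ((1 - y) * (y + t ^ 2)) ≤ base t y := by
  set Q := 4 * Real.cosh 1 ^ 2 with hQ
  have hQ4 : 4 < Q := by
    have := Real.one_lt_cosh.2 (one_ne_zero (α := ℝ))
    nlinarith
  have hs1 : 0 < Real.sinh 1 := Real.sinh_pos_iff.2 one_pos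
  have hA : 0 < Q - 1 := by linarith
  have hB : 0 < Q ^ 2 - 3 * Q + 1 := by nlinarith
  have hN : 0 < Q ^ 2 - 4 * Q := by nlinarith
  set c0 := 4 * (Q ^ 2 - 4 * Q) / ((Q - 1) * (Q ^ 2 - 3 * Q + 1)) / Real.sinh 1 with hc0
  have hc0p : 0 < c0 := by positivity
  have hs5 : 0 < Real.sinh 5 := Real.sinh_pos_iff.2 (by norm_num)
  refine ⟨min (c0 / 16) (5 / Real.sinh 5), by positivity, fun t y ht hy => ?_⟩
  obtain ⟨Y, rfl⟩ : ∃ Y, y = 1 - Y := ⟨1 - y, by ring⟩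
  have hY : 0 ≤ Y := by linarith [hy.2]
  have hY1 : Y ≤ 1 := by linarith [hy.1]
  set q := 4 * Real.cosh Y ^ 2 with hq
  have hq4 : 4 ≤ q := by have := Real.one_le_cosh Y; nlinarith
  have hsY : Y ≤ Real.sinh Y := Real.self_le_sinh_iff.2 hY
  have hQq : 4 * (1 - Y) ≤ Q - q := by
    have h1 : Q - q = 4 * (Real.sinh (1 + Y) * Real.sinh (1 - Y)) := by
      rw [Real.sinh_add, Real.sinh_sub, hQ, hq]
      have a := Real.cosh_sq 1
      have b := Real.cosh_sq Y
      linear_combination 4 * Real.cosh Y ^ 2 * a - 4 * Real.cosh 1 ^ 2 * b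
    have h2 : 1 + Y ≤ Real.sinh (1 + Y) := Real.self_le_sinh_iff.2 (by linarith)
    have h3 : 1 - Y ≤ Real.sinh (1 - Y) := Real.self_le_sinh_iff.2 (by linarith)
    rw [h1]; nlinarith
  have hqQ : q ≤ Q := by linarith
  set s := Real.sinh Y / Real.sinh 1 with hs
  have hsl : Y / Real.sinh 1 ≤ s := by rw [hs]; gcongr
  have hs0 : 0 ≤ s := le_trans (by positivity) hsl
  have e1 : prof 1 (1 - Y) = s := by simp [prof, hs]
  have e3 : prof 3 (1 - Y) = s * ((q - 1) / (Q - 1)) := by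
    have := sinh_three 1
    rw [mul_one] at this
    rw [prof, sub_sub_cancel, sinh_three, this, mul_div_mul_comm]
  have e5 : prof 5 (1 - Y) = s * ((q ^ 2 - 3 * q + 1) / (Q ^ 2 - 3 * Q + 1)) := by
    have := sinh_five 1
    rw [mul_one] at this
    rw [prof, sub_sub_cancel, sinh_five, this, mul_div_mul_comm]
  have l5 : 5 * Y / Real.sinh 5 ≤ prof 5 (1 - Y) := by
    rw [prof, sub_sub_cancel]; gcongr
    exact Real.self_le_sinh_iff.2 (by linarith)
  have l35 : 0 ≤ prof 3 (1 - Y) - prof 5 (1 - Y) := by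
    rw [e3, e5, ← mul_sub, div_sub_div _ _ hA.ne' hB.ne']
    have : 0 ≤ (Q - q) * ((q - 1) * (Q - 1) + 1) :=
      mul_nonneg (by linarith) (by nlinarith)
    refine mul_nonneg hs0 (div_nonneg ?_ (by positivity))
    linarith
  have lp : c0 * (Y * (1 - Y)) ≤ 2 * prof 1 (1 - Y) - 3 * prof 3 (1 - Y) + prof 5 (1 - Y) := by
    have h1 : 2 * prof 1 (1 - Y) - 3 * prof 3 (1 - Y) + prof 5 (1 - Y) =
        s * ((Q - q) * (2 * Q ^ 2 - 5 * Q - (Q - 1) * q) / ((Q - 1) * (Q ^ 2 - 3 * Q + 1))) := by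
      rw [e1, e3, e5]
      have hA' := hA.ne'
      have hB' := hB.ne'
      generalize hBd : Q ^ 2 - 3 * Q + 1 = B at hB'
      field_simp
      rw [← hBd]
      ring
    have h2 : Q ^ 2 - 4 * Q ≤ 2 * Q ^ 2 - 5 * Q - (Q - 1) * q := by nlinarith
    rw [h1]
    have hy' : 0 ≤ 1 - Y := hy.1
    calc c0 * (Y * (1 - Y)) = Y / Real.sinh 1 * ((4 * (1 - Y)) * (Q ^ 2 - 4 * Q) /
          ((Q - 1) * (Q ^ 2 - 3 * Q + 1))) := by rw [hc0]; field_simp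
      _ ≤ _ := by gcongr
  have hc1 : min (c0 / 16) (5 / Real.sinh 5) * (Y * (1 - Y)) ≤ c0 / 16 * (Y * (1 - Y)) :=
    mul_le_mul_of_nonneg_right (min_le_left _ _) (mul_nonneg hY hy.1)
  have hc2 : min (c0 / 16) (5 / Real.sinh 5) * (Y * t ^ 2) ≤ 5 / Real.sinh 5 * (Y * t ^ 2) :=
    mul_le_mul_of_nonneg_right (min_le_right _ _) (by positivity)
  have h5 : 5 / Real.sinh 5 * (Y * t ^ 2) ≤ t ^ 2 * prof 5 (1 - Y) := by
    rw [show 5 / Real.sinh 5 * (Y * t ^ 2) = t ^ 2 * (5 * Y / Real.sinh 5) by ring]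
    gcongr
  have h3 := mul_nonneg ht l35
  unfold base
  rw [sub_sub_cancel]
  nlinarith

lemma base_zero_zero (t : ℝ) : base t 0 = t ^ 2 := by
  have h (k : ℝ) (hk : 0 < k) : prof k 0 = 1 := by
    simp [prof, (Real.sinh_pos_iff.2 hk).ne']
  unfold base
  rw [h 1 one_pos, h 3 (by norm_num), h 5 (by norm_num)]; ring

lemma exists_base_deriv : ∃ c > 0, ∃ η > 0, ∀ t y : ℝ, |t| ≤ η → |y| ≤ η → c ≤ base' t y := by
  obtain ⟨c, hc, h⟩ := exists_base_lower
  have h0 : c ≤ base' 0 0 := by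
    have hd : HasDerivAt (fun y => base 0 y - c * ((1 - y) * y)) (base' 0 0 - c) 0 := by
      have h1 := ((((hasDerivAt_id (0:ℝ)).const_sub 1).mul (hasDerivAt_id (0:ℝ))).const_mul c)
      refine ((hasDerivAt_base 0 0).sub h1).congr_deriv ?_
      simp
    have h2 := hd.tendsto_slope_zero_right
    have h3 : 0 ≤ base' 0 0 - c := by
      refine ge_of_tendsto h2 ?_
      filter_upwards [Ioo_mem_nhdsGT (one_pos (α := ℝ))] with y hy
      have := h 0 y le_rfl ⟨hy.1.le, hy.2.le⟩
      have hy0 := hy.1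
      rw [base_zero_zero]
      simp only [zero_add, smul_eq_mul]
      refine mul_nonneg (by positivity) ?_
      simp only [ne_eq, OfNat.ofNat_ne_zero, not_false_eq_true, zero_pow, add_zero] at this
      linarith
    linarith
  have hcont : Continuous fun z : ℝ × ℝ => base' z.1 z.2 := by
    unfold base' prof'; fun_prop
  have hnear : ∀ᶠ z : ℝ × ℝ in 𝓝 0, c / 2 < base' z.1 z.2 :=
    hcont.continuousAt.eventually_const_lt (by change c / 2 < base' 0 0; linarith)
  obtain ⟨η, hη, hb⟩ := Metric.eventually_nhds_iff_ball.1 hnear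
  refine ⟨c / 2, by positivity, η / 2, by positivity, fun t y ht hy => (hb (t, y) ?_).le⟩
  rw [mem_ball_zero_iff, Prod.norm_def]
  exact max_lt (ht.trans_lt (half_lt_self hη)) (hy.trans_lt (half_lt_self hη))

end Base

namespace Fourier2Pi

instance fact_two_pi_pos : Fact (0 < 2 * Real.pi) := ⟨Real.two_pi_pos⟩

lemma lt_aux : (0:ℝ) < 0 + 2 * Real.pi := lt_add_of_pos_right 0 Real.two_pi_pos

def cf (f : ℝ → ℝ) (n : ℤ) : ℂ := fourierCoeffOn lt_aux (fun x => (f x : ℂ)) n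

lemma norm_cf_le {f : ℝ → ℝ} {M : ℝ} (h : ∀ x, |f x| ≤ M) (n : ℤ) : ‖cf f n‖ ≤ M := by
  rw [cf, fourierCoeffOn_eq_integral, norm_smul]
  have h1 : ‖∫ x in (0:ℝ)..(0 + 2 * Real.pi),
      fourier (-n) (x : AddCircle (0 + 2 * Real.pi - 0)) • (f x : ℂ)‖ ≤
      M * |0 + 2 * Real.pi - 0| := by
    refine intervalIntegral.norm_integral_le_of_norm_le_const fun x _ => ?_
    rw [norm_smul, Complex.norm_real, fourier_apply, Circle.norm_coe, one_mul]
    exact h x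
  have hp := Real.two_pi_pos
  rw [show (0:ℝ) + 2 * Real.pi - 0 = 2 * Real.pi by ring, abs_of_pos hp] at h1
  rw [show (0:ℝ) + 2 * Real.pi - 0 = 2 * Real.pi by ring, Real.norm_of_nonneg (by positivity)]
  calc 1 / (2 * Real.pi) * _ ≤ 1 / (2 * Real.pi) * (M * (2 * Real.pi)) := by gcongr
    _ = M := by field_simp

lemma norm_cf_eq {f f' : ℝ → ℝ} (hf : ∀ x, HasDerivAt f (f' x) x) (hf' : Continuous f')
    (hper : Function.Periodic f (2 * Real.pi)) {n : ℤ} (hn : n ≠ 0) :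
    ‖cf f n‖ = ‖cf f' n‖ / |(n:ℝ)| := by
  have h := fourierCoeffOn_of_hasDerivAt lt_aux (f := fun x => (f x : ℂ))
    (f' := fun x => (f' x : ℂ)) hn (fun x _ => (hf x).ofReal_comp)
    ((Complex.continuous_ofReal.comp hf').intervalIntegrable _ _)
  have h0 : f (0 + 2 * Real.pi) = f 0 := hper 0
  rw [cf, cf, h, h0, sub_self, mul_zero, zero_sub]
  have hp := Real.two_pi_pos
  simp only [norm_mul, norm_div, norm_neg, norm_one, Complex.norm_I, Complex.norm_intCast,
    Complex.norm_real, Complex.norm_ofNat]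
  have e : ‖((0 + 2 * Real.pi : ℝ) : ℂ) - ((0:ℝ) : ℂ)‖ = 2 * Real.pi := by
    rw [← Complex.ofReal_sub, Complex.norm_real, zero_add, sub_zero, Real.norm_of_nonneg hp.le]
  rw [e, Real.norm_of_nonneg Real.pi_pos.le]
  have : |(n:ℝ)| ≠ 0 := by simpa using hn
  field_simp

lemma hasSum_cf {f : ℝ → ℝ} (hf : Continuous f) (hper : Function.Periodic f (2 * Real.pi))
    (hs : Summable (cf f)) (x : ℝ) :
    HasSum (fun n : ℤ => cf f n * Complex.exp (n * x * Complex.I)) (f x : ℂ) := by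
  have hc : Continuous (AddCircle.liftIco (2 * Real.pi) 0 (fun x => (f x : ℂ))) :=
    AddCircle.liftIco_continuous (by have : f (0 + 2 * Real.pi) = f 0 := hper 0
                                     simp only [this])
      (Complex.continuous_ofReal.comp hf).continuousOn
  have he : ∀ n, fourierCoeff (AddCircle.liftIco (2 * Real.pi) 0 (fun x => (f x : ℂ))) n =
      cf f n := fun n => fourierCoeff_liftIco_eq _ n
  have h := has_pointwise_sum_fourier_series_of_summable (f := ⟨_, hc⟩)
    (by convert hs using 1; exact funext he) (x : AddCircle (2 * Real.pi))
  have hv : (⟨_, hc⟩ : C(AddCircle (2 * Real.pi), ℂ)) (x : AddCircle (2 * Real.pi)) = f x := by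
    set m := toIcoDiv Real.two_pi_pos 0 x
    have h1 : x - m • (2 * Real.pi) ∈ Ico 0 (0 + 2 * Real.pi) :=
      sub_toIcoDiv_zsmul_mem_Ico Real.two_pi_pos 0 x
    have h2 : ((x - m • (2 * Real.pi) : ℝ) : AddCircle (2 * Real.pi)) = x := by
      rw [AddCircle.coe_sub, AddCircle.coe_zsmul, AddCircle.coe_period, smul_zero, sub_zero]
    rw [← h2, ← hper.sub_zsmul_eq m]
    exact AddCircle.liftIco_coe_apply (f := fun x => (f x : ℂ)) h1
  rw [hv] at h
  refine h.congr_fun fun n => ?_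
  have hpi : (Real.pi : ℂ) ≠ 0 := by exact_mod_cast Real.pi_ne_zero
  rw [fourier_coe_apply, smul_eq_mul]
  refine congrArg₂ _ (he n).symm (congrArg Complex.exp ?_)
  push_cast
  field_simp

lemma periodic_iteratedDeriv {f : ℝ → ℝ} {c : ℝ} (h : Function.Periodic f c) (n : ℕ) :
    Function.Periodic (iteratedDeriv n f) c := fun x => by
  have : (fun z => f (z + c)) = f := funext h
  have h' := congrFun (iteratedDeriv_comp_add_const n f c) x
  rw [this] at h'
  exact h'.symm

lemma norm_cf_iteratedDeriv {g : ℝ → ℝ} (hg : ContDiff ℝ 4 g)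
    (hper : Function.Periodic g (2 * Real.pi)) {n : ℤ} (hn : n ≠ 0) (j : ℕ) (hj : j ≤ 4) :
    ‖cf g n‖ = ‖cf (iteratedDeriv j g) n‖ / |(n:ℝ)| ^ j := by
  induction j with
  | zero => simp [iteratedDeriv_zero]
  | succ j ih =>
    have hlt : ((j : ℕ) : WithTop ℕ∞) < 4 := by exact_mod_cast (by omega : j < 4)
    have hd : ∀ x, HasDerivAt (iteratedDeriv j g) (iteratedDeriv (j + 1) g x) x := fun x => by
      rw [iteratedDeriv_succ]
      exact (hg.differentiable_iteratedDeriv j hlt x).hasDerivAt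
    rw [ih (by omega), norm_cf_eq hd (hg.continuous_iteratedDeriv (j + 1) (by exact_mod_cast hj))
      (periodic_iteratedDeriv hper j) hn, pow_succ', div_div]

lemma exists_bound_of_periodic {f : ℝ → ℝ} (hf : Continuous f)
    (hper : Function.Periodic f (2 * Real.pi)) : ∃ M, ∀ x, |f x| ≤ M := by
  obtain ⟨M, hM⟩ := isCompact_Icc.exists_bound_of_continuousOn
    (hf.continuousOn (s := Icc 0 (2 * Real.pi)))
  refine ⟨M, fun x => ?_⟩
  obtain ⟨y, hy, hxy⟩ := hper.exists_mem_Ico₀ Real.two_pi_pos x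
  rw [hxy]
  exact hM y ⟨hy.1, hy.2.le⟩

/-- Sine expansion of a smooth odd periodic function, with cubic decay of the coefficients. -/
theorem exists_sine_series {g : ℝ → ℝ} (hg : ContDiff ℝ 4 g)
    (hper : Function.Periodic g (2 * Real.pi)) (hodd : ∀ x, g (-x) = -g x) {M : ℝ}
    (hM : ∀ x, |iteratedDeriv 3 g x| ≤ M) :
    ∃ D : Green.Data, (∀ x, HasSum (fun k : ℤ => D.d k * Real.sin (k * x)) (g x)) ∧
      ∀ k, k ≠ 0 → |D.d k| ≤ M / |(k:ℝ)| ^ 3 := by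
  have hcf : ∀ {N : ℝ} {j : ℕ}, j ≤ 4 → (∀ x, |iteratedDeriv j g x| ≤ N) →
      ∀ n : ℤ, n ≠ 0 → ‖cf g n‖ ≤ N / |(n:ℝ)| ^ j := by
    intro N j hj h n hn
    rw [norm_cf_iteratedDeriv hg hper hn j hj]
    gcongr
    exact norm_cf_le h n
  set d : ℤ → ℝ := fun k => ((cf g (-k)).im - (cf g k).im) / 2 with hd
  have hdb : ∀ {N : ℝ} {j : ℕ}, j ≤ 4 → (∀ x, |iteratedDeriv j g x| ≤ N) →
      ∀ k : ℤ, k ≠ 0 → |d k| ≤ N / |(k:ℝ)| ^ j := by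
    intro N j hj h k hk
    have h1 := hcf hj h k hk
    have h2 := hcf hj h (-k) (neg_ne_zero.2 hk)
    rw [Int.cast_neg, abs_neg] at h2
    have h3 := (Complex.abs_im_le_norm _).trans h1
    have h4 := (Complex.abs_im_le_norm _).trans h2
    rw [abs_le] at h3 h4 ⊢
    simp only [hd]
    constructor <;> linarith [h3.1, h3.2, h4.1, h4.2]
  have hsq : Summable fun n : ℤ => 1 / |(n:ℝ)| ^ 2 := by
    simpa using Real.summable_one_div_int_pow.2 (one_lt_two)
  obtain ⟨N, hN⟩ := exists_bound_of_periodic (hg.continuous_iteratedDeriv 4 le_rfl)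
    (periodic_iteratedDeriv hper 4)
  obtain ⟨N2, hN2⟩ := exists_bound_of_periodic (hg.continuous_iteratedDeriv 2 (by norm_num))
    (periodic_iteratedDeriv hper 2)
  have hodd' : ∀ k, d (-k) = -d k := fun k => by simp only [hd, neg_neg]; ring
  have hd0 : d 0 = 0 := by simp [hd]
  have hsum : Summable fun k : ℤ => Green.fr k ^ 2 * |d k| := by
    refine Summable.of_nonneg_of_le (fun k => by positivity) (fun k => ?_) (hsq.mul_left N)
    rcases eq_or_ne k 0 with rfl | hk
    · simp [hd0]
    · have := hdb le_rfl hN k hk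
      have hk' : 0 < |(k:ℝ)| := by simpa using hk
      calc Green.fr k ^ 2 * |d k| ≤ |(k:ℝ)| ^ 2 * (N / |(k:ℝ)| ^ 4) := by
            rw [Green.fr]; gcongr
        _ = N * (1 / |(k:ℝ)| ^ 2) := by field_simp
  have hs : Summable (cf g) := by
    refine Summable.of_norm_bounded_eventually (hsq.mul_left N2) ?_
    filter_upwards [(finite_singleton (0:ℤ)).compl_mem_cofinite] with k hk
    rw [mul_one_div]
    exact hcf (by norm_num) hN2 k hk
  refine ⟨⟨d, hodd', hsum⟩, fun x => ?_, fun k hk => hdb (by norm_num) hM k hk⟩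
  have key : ∀ x, HasSum (fun n : ℤ => (cf g n).re * Real.cos (n * x) -
      (cf g n).im * Real.sin (n * x)) (g x) := fun x => by
    have h := Complex.hasSum_re (hasSum_cf hg.continuous hper hs x)
    rw [Complex.ofReal_re] at h
    refine h.congr_fun fun n => ?_
    rw [Complex.mul_re, show ((n:ℂ) * x * Complex.I) = ((n * x : ℝ) : ℂ) * Complex.I by push_cast; rfl,
      Complex.exp_ofReal_mul_I_re, Complex.exp_ofReal_mul_I_im]
  have h1 := ((key x).sub (key (-x))).div_const 2
  have h2 : HasSum (fun n : ℤ => -(cf g n).im * Real.sin (n * x)) (g x) := by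
    rw [hodd] at h1
    have e : (g x - -g x) / 2 = g x := by ring
    rw [e] at h1
    refine h1.congr_fun fun n => ?_
    rw [mul_neg, Real.cos_neg, Real.sin_neg]; ring
  have h3 := (Equiv.neg ℤ).hasSum_iff.2 h2
  have h4 := (h2.add h3).div_const 2
  rw [show (g x + g x) / 2 = g x by ring] at h4
  refine h4.congr_fun fun n => ?_
  simp only [hd, Function.comp, Equiv.neg_apply, Int.cast_neg, neg_mul, Real.sin_neg]
  ring

end Fourier2Pi

namespace BdryData

lemma iteratedDeriv_three_sin_mul {R R1 R2 R3 : ℝ → ℝ} (h0 : ∀ s, HasDerivAt R (R1 s) s)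
    (h1 : ∀ s, HasDerivAt R1 (R2 s) s) (h2 : ∀ s, HasDerivAt R2 (R3 s) s) (x : ℝ) :
    iteratedDeriv 3 (fun x => Real.sin x * R (Real.cos x)) x =
      -Real.cos x * R (Real.cos x) + (4 * Real.sin x ^ 2 - 3 * Real.cos x ^ 2) * R1 (Real.cos x) +
        6 * Real.sin x ^ 2 * Real.cos x * R2 (Real.cos x) - Real.sin x ^ 4 * R3 (Real.cos x) := by
  have c {f f' : ℝ → ℝ} (h : ∀ s, HasDerivAt f (f' s) s) (x : ℝ) :
      HasDerivAt (fun x => f (Real.cos x)) (f' (Real.cos x) * -Real.sin x) x :=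
    (h _).comp x (Real.hasDerivAt_cos x)
  have S := Real.hasDerivAt_sin
  have C := Real.hasDerivAt_cos
  have e1 : deriv (fun x => Real.sin x * R (Real.cos x)) = fun x =>
      Real.cos x * R (Real.cos x) - Real.sin x ^ 2 * R1 (Real.cos x) := by
    funext x
    refine (((S x).mul (c h0 x)).congr_deriv ?_).deriv
    ring
  have e2 : deriv (fun x => Real.cos x * R (Real.cos x) - Real.sin x ^ 2 * R1 (Real.cos x)) =
      fun x => -Real.sin x * R (Real.cos x) - 3 * (Real.sin x * Real.cos x) * R1 (Real.cos x) +
        Real.sin x ^ 3 * R2 (Real.cos x) := by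
    funext x
    refine ((((C x).mul (c h0 x)).sub (((S x).pow 2).mul (c h1 x))).congr_deriv ?_).deriv
    simp; ring
  rw [iteratedDeriv_succ, iteratedDeriv_succ, iteratedDeriv_one, e1, e2]
  refine ((((((S x).neg).mul (c h0 x)).sub ((((S x).mul (C x)).const_mul 3).mul (c h1 x))).add
    (((S x).pow 3).mul (c h2 x))).congr_deriv ?_).deriv
  simp; ring

lemma abs_iteratedDeriv_three_le {R R1 R2 R3 : ℝ → ℝ} (h0 : ∀ s, HasDerivAt R (R1 s) s)
    (h1 : ∀ s, HasDerivAt R1 (R2 s) s) (h2 : ∀ s, HasDerivAt R2 (R3 s) s) {κ : ℝ}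
    (hb : ∀ s ∈ Icc (-1:ℝ) 1, |R s| ≤ κ ∧ |R1 s| ≤ κ ∧ |R2 s| ≤ κ ∧ |R3 s| ≤ κ) (x : ℝ) :
    |iteratedDeriv 3 (fun x => Real.sin x * R (Real.cos x)) x| ≤ 20 * κ := by
  rw [iteratedDeriv_three_sin_mul h0 h1 h2]
  obtain ⟨b0, b1, b2, b3⟩ := hb _ (Real.cos_mem_Icc x)
  have hs := Real.abs_sin_le_one x
  have hc := Real.abs_cos_le_one x
  have hs2 : Real.sin x ^ 2 ≤ 1 := Real.sin_sq_le_one x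
  have hc2 : Real.cos x ^ 2 ≤ 1 := Real.cos_sq_le_one x
  have hs0 := sq_nonneg (Real.sin x)
  have hc0 := sq_nonneg (Real.cos x)
  have hk : 0 ≤ κ := (abs_nonneg _).trans b0
  have m {a b A : ℝ} (ha : |a| ≤ A) (hb : |b| ≤ κ) : |a * b| ≤ A * κ := by
    rw [abs_mul]; exact mul_le_mul ha hb (abs_nonneg _) ((abs_nonneg _).trans ha)
  have t0 := m (a := -Real.cos x) (A := 1) (by rwa [abs_neg]) b0
  have t1 := m (a := 4 * Real.sin x ^ 2 - 3 * Real.cos x ^ 2) (A := 7)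
    (abs_le.2 ⟨by linarith, by linarith⟩) b1
  have t2 := m (a := 6 * Real.sin x ^ 2 * Real.cos x) (A := 6) (by
    rw [abs_mul, abs_of_nonneg (by positivity)]
    nlinarith [abs_nonneg (Real.cos x)]) b2
  have t3 := m (a := Real.sin x ^ 4) (A := 1) (by
    rw [abs_of_nonneg (by positivity)]; nlinarith) b3
  rw [abs_le] at *
  constructor <;> linarith [t0.1, t0.2, t1.1, t1.2, t2.1, t2.2, t3.1, t3.2]

/-- A quartic cut off outside the unit interval. -/
def rho (s : ℝ) : ℝ := s ^ 4 * (1 - Real.smoothTransition ((s ^ 2 - 1) / 3))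

lemma contDiff_rho : ContDiff ℝ (⊤ : ℕ∞) rho :=
  (contDiff_id.pow 4).mul (contDiff_const.sub
    (Real.smoothTransition.contDiff.comp (((contDiff_id.pow 2).sub contDiff_const).div_const 3)))

lemma rho_of_two_le {s : ℝ} (h : 2 ≤ |s|) : rho s = 0 := by
  have : 4 ≤ s ^ 2 := by rw [← sq_abs]; nlinarith
  rw [rho, Real.smoothTransition.one_of_one_le (by linarith), sub_self, mul_zero]

lemma rho_of_le_one {s : ℝ} (h : |s| ≤ 1) : rho s = s ^ 4 := by
  have : s ^ 2 ≤ 1 := by rw [← sq_abs]; nlinarith [abs_nonneg s]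
  rw [rho, Real.smoothTransition.zero_of_nonpos (by linarith), sub_zero, mul_one]

lemma rho_lt {s : ℝ} (h : 1 < |s|) : rho s < s ^ 4 := by
  have h2 : 1 < s ^ 2 := by rw [← sq_abs]; nlinarith
  have h3 := Real.smoothTransition.pos_of_pos (x := (s ^ 2 - 1) / 3) (by linarith)
  have h4 : 0 < s ^ 4 := by nlinarith
  unfold rho; nlinarith

lemma hasDerivAt_iteratedDeriv {f : ℝ → ℝ} (hf : ContDiff ℝ (⊤ : ℕ∞) f) (j : ℕ) (s : ℝ) :
    HasDerivAt (iteratedDeriv j f) (iteratedDeriv (j + 1) f s) s := by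
  rw [iteratedDeriv_succ]
  exact (hf.differentiable_iteratedDeriv j (by exact_mod_cast WithTop.coe_lt_top j) s).hasDerivAt

lemma exists_rho_bound : ∃ M > 0, ∀ j ≤ 3, ∀ s, |iteratedDeriv j rho s| ≤ M := by
  have hc : ∀ j, Continuous (iteratedDeriv j rho) := fun j =>
    contDiff_rho.continuous_iteratedDeriv j (by exact_mod_cast le_top)
  have hz : ∀ j, ∀ s, s ∉ Icc (-2:ℝ) 2 → iteratedDeriv j rho s = 0 := by
    intro j
    induction j with
    | zero =>
      intro s hs
      rw [iteratedDeriv_zero]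
      refine rho_of_two_le ?_
      by_contra! h
      exact hs (abs_le.1 h.le)
    | succ j ih =>
      intro s hs
      rw [iteratedDeriv_succ]
      have : iteratedDeriv j rho =ᶠ[𝓝 s] fun _ => 0 := by
        filter_upwards [isClosed_Icc.isOpen_compl.mem_nhds hs] with t ht using ih t ht
      rw [this.deriv_eq, deriv_const]
  have hb : ∀ j, ∃ M, ∀ s, |iteratedDeriv j rho s| ≤ M := fun j => by
    obtain ⟨M, hM⟩ := isCompact_Icc.exists_bound_of_continuousOn
      ((hc j).continuousOn (s := Icc (-2:ℝ) 2))
    refine ⟨max M 0, fun s => ?_⟩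
    by_cases hs : s ∈ Icc (-2:ℝ) 2
    · exact (hM s hs).trans (le_max_left _ _)
    · rw [hz j s hs, abs_zero]; exact le_max_right _ _
  choose M hM using hb
  refine ⟨1 + ∑ j ∈ Finset.range 4, |M j|, by positivity, fun j hj s => (hM j s).trans ?_⟩
  have := Finset.single_le_sum (f := fun j => |M j|) (fun i _ => abs_nonneg _)
    (Finset.mem_range.2 (by omega : j < 4))
  linarith [le_abs_self (M j)]

lemma exists_bound_on_Icc {f : ℝ → ℝ} (hf : ContDiff ℝ (⊤ : ℕ∞) f) :
    ∃ M > 0, ∀ j ≤ 3, ∀ s ∈ Icc (-1:ℝ) 1, |iteratedDeriv j f s| ≤ M := by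
  have hb : ∀ j, ∃ M, ∀ s ∈ Icc (-1:ℝ) 1, |iteratedDeriv j f s| ≤ M := fun j =>
    isCompact_Icc.exists_bound_of_continuousOn
      (hf.continuous_iteratedDeriv j (by exact_mod_cast le_top)).continuousOn
  choose M hM using hb
  refine ⟨1 + ∑ j ∈ Finset.range 4, |M j|, by positivity, fun j hj s hs => (hM j s hs).trans ?_⟩
  have := Finset.single_le_sum (f := fun j => |M j|) (fun i _ => abs_nonneg _)
    (Finset.mem_range.2 (by omega : j < 4))
  linarith [le_abs_self (M j)]

/-- Small odd boundary data whose sign pattern encodes a closed set. -/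
theorem exists_boundary_data {F : Set ℝ} (hF : IsClosed F) (h0 : (0:ℝ) ∈ F) (h1 : (1:ℝ) ∈ F)
    {κ τ₀ : ℝ} (hκ : 0 < κ) (hτ₀ : 0 < τ₀) :
    ∃ τ, 0 < τ ∧ τ < τ₀ ∧ τ < 1 ∧ ∃ (R : ℝ → ℝ) (D : Green.Data),
      (∀ x, HasSum (fun k : ℤ => D.d k * Real.sin (k * x)) (Real.sin x * R (Real.cos x))) ∧
      ∑' k, Green.fr k * |D.d k| ≤ κ ∧ (∀ s, τ < |s| → R s < s ^ 4) ∧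
      (∀ s, |s| ≤ τ → s ^ 4 ≤ R s) ∧
      ∀ s, |s| ≤ τ → (R s = s ^ 4 ↔ (s + τ) / (2 * τ) ∈ F) := by
  obtain ⟨M, hM0, hM⟩ := exists_rho_bound
  set Z := ∑' n : ℤ, 1 / |(n:ℝ)| ^ 2
  have hZs : Summable fun n : ℤ => 1 / |(n:ℝ)| ^ 2 := by
    simpa using Real.summable_one_div_int_pow.2 (one_lt_two)
  have hZ : 0 ≤ Z := tsum_nonneg fun n => by positivity
  set κ' := κ / (20 * (Z + 1)) with hκ'
  have hκ'0 : 0 < κ' := by positivity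
  obtain ⟨τ, hτ, hτ'⟩ : ∃ τ, 0 < τ ∧ τ < min (min τ₀ 1) (κ' / (2 * M)) :=
    exists_between (by positivity)
  have hτ1 : τ < 1 := hτ'.trans_le ((min_le_left _ _).trans (min_le_right _ _))
  have hτM : τ * M ≤ κ' / 2 := by
    have := (lt_div_iff₀ (by positivity)).1 (hτ'.trans_le (min_le_right _ _))
    linarith
  refine ⟨τ, hτ, hτ'.trans_le ((min_le_left _ _).trans (min_le_left _ _)), hτ1, ?_⟩
  set O : Set ℝ := {s | |s| < τ ∧ (s + τ) / (2 * τ) ∉ F} with hO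
  have hOo : IsOpen O :=
    (isOpen_lt continuous_abs continuous_const).inter
      (hF.isOpen_compl.preimage ((continuous_id.add continuous_const).div_const _))
  obtain ⟨Ψ, hΨs, hΨc, hΨr⟩ := hOo.exists_contDiff_support_eq (n := ⊤)
  obtain ⟨N, hN0, hN⟩ := exists_bound_on_Icc hΨc
  set δ := κ' / (2 * N) with hδ
  have hδ0 : 0 < δ := by positivity
  have hδN : δ * N = κ' / 2 := by rw [hδ]; field_simp
  set r : ℕ → ℝ → ℝ := fun j s =>
    τ ^ 4 * (iteratedDeriv j rho (s / τ) / τ ^ j) + δ * iteratedDeriv j Ψ s with hr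
  have hrd : ∀ j s, HasDerivAt (r j) (r (j + 1) s) s := fun j s => by
    have a := ((hasDerivAt_iteratedDeriv contDiff_rho j (s / τ)).comp s
      ((hasDerivAt_id s).div_const τ)).div_const (τ ^ j) |>.const_mul (τ ^ 4)
    refine (a.add ((hasDerivAt_iteratedDeriv hΨc j s).const_mul δ)).congr_deriv ?_
    simp only [hr, pow_succ]
    field_simp
  have hrb : ∀ j ≤ 3, ∀ s ∈ Icc (-1:ℝ) 1, |r j s| ≤ κ' := fun j hj s hs => by
    have a1 : |τ ^ 4 * (iteratedDeriv j rho (s / τ) / τ ^ j)| ≤ κ' / 2 := by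
      rw [abs_mul, abs_div, abs_of_pos (pow_pos hτ 4), abs_of_pos (pow_pos hτ j)]
      have e : τ ^ 4 = τ ^ (3 - j) * τ * τ ^ j := by
        rw [← pow_succ, ← pow_add]; congr 1; omega
      calc _ = τ ^ (3 - j) * τ * |iteratedDeriv j rho (s / τ)| := by
            rw [e]; field_simp
        _ ≤ 1 * τ * M := by
            gcongr
            · exact pow_le_one₀ hτ.le hτ1.le
            · exact hM j hj _
        _ ≤ κ' / 2 := by linarith
    have a2 : |δ * iteratedDeriv j Ψ s| ≤ κ' / 2 := by
      rw [abs_mul, abs_of_pos hδ0, ← hδN]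
      gcongr
      exact hN j hj s hs
    have := abs_add_le (τ ^ 4 * (iteratedDeriv j rho (s / τ) / τ ^ j)) (δ * iteratedDeriv j Ψ s)
    simp only [hr]; linarith
  have hr0 : ∀ s, r 0 s = τ ^ 4 * rho (s / τ) + δ * Ψ s := fun s => by
    simp [hr, iteratedDeriv_zero]
  have hrc : ContDiff ℝ 4 (r 0) := by
    have : r 0 = fun s => τ ^ 4 * rho (s / τ) + δ * Ψ s := funext hr0
    rw [this]
    exact ((contDiff_const.mul (contDiff_rho.comp (contDiff_id.div_const τ))).add
      (contDiff_const.mul hΨc)).of_le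
        (show ((4 : ℕ∞) : WithTop ℕ∞) ≤ _ from WithTop.coe_le_coe.2 le_top)
  obtain ⟨D, hD, hDb⟩ := Fourier2Pi.exists_sine_series
    (g := fun x => Real.sin x * r 0 (Real.cos x))
    (Real.contDiff_sin.mul (hrc.comp Real.contDiff_cos))
    (fun x => by simp only [Real.sin_add_two_pi, Real.cos_add_two_pi])
    (fun x => by simp only [Real.sin_neg, Real.cos_neg, neg_mul]) (M := 20 * κ')
    (abs_iteratedDeriv_three_le (hrd 0) (hrd 1) (hrd 2) fun s hs =>
      ⟨hrb 0 (by norm_num) s hs, hrb 1 (by norm_num) s hs, hrb 2 (by norm_num) s hs,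
        hrb 3 le_rfl s hs⟩)
  have hquart : ∀ s, τ ^ 4 * (s / τ) ^ 4 = s ^ 4 := fun s => by field_simp
  have hΨ0 : ∀ s, 0 ≤ Ψ s := fun s => (hΨr ⟨s, rfl⟩).1
  have hin : ∀ s, |s| ≤ τ → r 0 s = s ^ 4 + δ * Ψ s := fun s hs => by
    rw [hr0, rho_of_le_one, hquart]
    rw [abs_div, abs_of_pos hτ]
    exact (div_le_one hτ).2 hs
  refine ⟨r 0, D, hD, ?_, fun s hs => ?_, fun s hs => ?_, fun s hs => ?_⟩
  · have hle : ∀ k : ℤ, Green.fr k * |D.d k| ≤ 20 * κ' * (1 / |(k:ℝ)| ^ 2) := fun k => by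
      rcases eq_or_ne k 0 with rfl | hk
      · simp [Green.fr]
      · have hk' : 0 < |(k:ℝ)| := by simpa using hk
        calc Green.fr k * |D.d k| ≤ |(k:ℝ)| * (20 * κ' / |(k:ℝ)| ^ 3) := by
              rw [Green.fr]; gcongr; exact hDb k hk
          _ = _ := by field_simp
    have hs := hZs.mul_left (20 * κ')
    calc ∑' k, Green.fr k * |D.d k| ≤ ∑' k : ℤ, 20 * κ' * (1 / |(k:ℝ)| ^ 2) :=
          (Summable.of_nonneg_of_le (fun k => by unfold Green.fr; positivity) hle hs).tsum_le_tsum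
            hle hs
      _ = 20 * κ' * Z := tsum_mul_left
      _ ≤ 20 * κ' * (Z + 1) := by gcongr; linarith
      _ = κ := by rw [hκ']; field_simp
  · have : Ψ s = 0 := by
      by_contra h
      have : s ∈ O := hΨs ▸ h
      exact absurd this.1 (not_lt.2 hs.le)
    rw [hr0, this, mul_zero, add_zero, ← hquart s]
    refine mul_lt_mul_of_pos_left (rho_lt ?_) (by positivity)
    rw [abs_div, abs_of_pos hτ]
    exact (one_lt_div hτ).2 hs
  · rw [hin s hs]
    have := mul_nonneg hδ0.le (hΨ0 s)
    linarith
  · rw [hin s hs, add_eq_left, mul_eq_zero_iff_left hδ0.ne', ← Function.notMem_support, hΨs]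
    constructor
    · intro h
      by_contra hf
      rcases hs.lt_or_eq with h2 | h2
      · exact h ⟨h2, hf⟩
      · rcases (abs_eq hτ.le).1 h2 with rfl | rfl
        · refine hf ?_
          rw [← two_mul, div_self (by positivity)]; exact h1
        · refine hf ?_
          rw [neg_add_cancel, zero_div]; exact h0
    · exact fun h h2 => h2.2 h

end BdryData

namespace Green
open FSeq Series

/-- The sine coefficients of `sin x * cos x ^ 4`. -/
def quartCoef (k : ℤ) : ℝ :=
  if k = 1 then 1 / 16 else if k = -1 then -(1 / 16) else if k = 3 then 3 / 32
  else if k = -3 then -(3 / 32) else if k = 5 then 1 / 32 else if k = -5 then -(1 / 32) else 0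

lemma quartCoef_support {k : ℤ} (h : k ∉ ({1, -1, 3, -3, 5, -5} : Finset ℤ)) :
    quartCoef k = 0 := by
  simp only [Finset.mem_insert, Finset.mem_singleton, not_or] at h
  simp [quartCoef, h]

lemma quartCoef_neg (k : ℤ) : quartCoef (-k) = -quartCoef k := by
  by_cases h : k ∈ ({1, -1, 3, -3, 5, -5} : Finset ℤ)
  · simp only [Finset.mem_insert, Finset.mem_singleton] at h
    rcases h with rfl | rfl | rfl | rfl | rfl | rfl <;> norm_num [quartCoef]
  · have h' : -k ∉ ({1, -1, 3, -3, 5, -5} : Finset ℤ) := by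
      simp only [Finset.mem_insert, Finset.mem_singleton, not_or] at h ⊢
      omega
    rw [quartCoef_support h, quartCoef_support h', neg_zero]

lemma hasSum_quartCoef (H : ℝ → ℝ) (x : ℝ) :
    HasSum (fun k : ℤ => quartCoef k * H (fr k) * Real.sin (k * x))
      (Real.sin x * ((1 / 16) * ((2 * H 1 - 3 * H 3 + H 5) +
        12 * Real.cos x ^ 2 * (H 3 - H 5) + 16 * (Real.cos x ^ 2) ^ 2 * H 5))) := by
  have h : HasSum (fun k : ℤ => quartCoef k * H (fr k) * Real.sin (k * x)) _ :=
    hasSum_sum_of_ne_finset_zero (s := ({1, -1, 3, -3, 5, -5} : Finset ℤ))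
      fun k hk => by rw [quartCoef_support hk, zero_mul, zero_mul]
  convert h using 1
  have s3 : Real.sin (3 * x) = Real.sin x * (4 * Real.cos x ^ 2 - 1) := by
    rw [Real.sin_three_mul, Real.cos_sq']; ring
  have s5 : Real.sin (5 * x) =
      Real.sin x * (16 * (Real.cos x ^ 2) ^ 2 - 12 * Real.cos x ^ 2 + 1) := by
    rw [show 5 * x = 3 * x + 2 * x by ring, Real.sin_add, Real.sin_three_mul, Real.cos_three_mul,
      Real.sin_two_mul, Real.cos_two_mul,
      show Real.sin x ^ 3 = Real.sin x * (1 - Real.cos x ^ 2) by rw [← Real.sin_sq]; ring]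
    ring
  rw [Finset.sum_insert (by decide), Finset.sum_insert (by decide), Finset.sum_insert (by decide),
    Finset.sum_insert (by decide), Finset.sum_insert (by decide), Finset.sum_singleton]
  norm_num [quartCoef, fr]
  rw [s3, s5]
  ring

variable (D : Data)

/-- A summable bound for the derivatives of the coefficients. -/
def sbnd (p : ℝ × FSeq) (k : ℤ) : ℝ := 3 * (|p.1| * (fr k * |D.d k|)) + 4 * ‖p.2 k‖

lemma summable_fr_mul : Summable fun k => fr k * |D.d k| := by
  refine Summable.of_nonneg_of_le (fun k => by unfold fr; positivity) (fun k => ?_) D.summable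
  rcases eq_or_ne k 0 with rfl | hk
  · simp [fr]
  · have := one_le_fr hk
    gcongr
    nlinarith

lemma hasSum_sbnd (p : ℝ × FSeq) :
    HasSum (sbnd D p) (3 * (|p.1| * ∑' k, fr k * |D.d k|) + 4 * ‖p.2‖) := by
  rw [norm_eq]
  exact (((summable_fr_mul D).hasSum.mul_left _).mul_left _).add
    ((summable_norm p.2).hasSum.mul_left _)

lemma sbnd_nonneg (p : ℝ × FSeq) (k : ℤ) : 0 ≤ sbnd D p k := by unfold sbnd fr; positivity

lemma abs_coef'_le_sbnd (p : ℝ × FSeq) (k : ℤ) {y : ℝ} (hy : y ∈ Icc (0:ℝ) 1) :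
    |coef' D p k y| ≤ sbnd D p k := by
  rcases eq_or_ne k 0 with rfl | hk
  · rw [coef'_zero, abs_zero]; exact sbnd_nonneg D p 0
  have h1 := abs_har'_le k hy
  have h2 := abs_sol'_le k (p.2 k) hy
  have hK := one_le_fr hk
  have he : Real.exp (-(fr k * y)) ≤ 1 := by
    rw [Real.exp_le_one_iff]; have := mul_nonneg (zero_le_one.trans hK) hy.1; linarith
  have h3 : |sol' k (p.2 k) y| ≤ 4 * ‖p.2 k‖ := by
    have := mul_le_mul_of_nonneg_left (wt_le_one k hy.1) (by positivity : 0 ≤ 4 * ‖p.2 k‖)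
    nlinarith [abs_nonneg (sol' k (p.2 k) y)]
  have h4 : |har' k y| ≤ 3 * fr k := h1.trans (mul_le_of_le_one_right (by positivity) he)
  have h5 : |coef' D p k y| ≤ |p.1| * |D.d k| * |har' k y| + |sol' k (p.2 k) y| := by
    unfold coef'
    refine (abs_add_le _ _).trans_eq ?_
    rw [abs_mul, abs_mul]
  have h6 := mul_le_mul_of_nonneg_left h4 (by positivity : 0 ≤ |p.1| * |D.d k|)
  unfold sbnd; linarith

lemma fr_mul_abs_coef'_le (p : ℝ × FSeq) (k : ℤ) {y : ℝ} (hy : y ∈ Icc (1 / 2 : ℝ) 1) :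
    fr k * |coef' D p k y| ≤ sbnd D p k := by
  have hy' : y ∈ Icc (0:ℝ) 1 := ⟨by linarith [hy.1], hy.2⟩
  have hf : 0 ≤ fr k := abs_nonneg _
  have h1 := abs_har'_le k hy'
  have h2 := abs_sol'_le k (p.2 k) hy'
  have h3 := mul_le_mul_of_nonneg_left (wt_le_one k hy'.1) (by positivity : 0 ≤ 4 * ‖p.2 k‖)
  have he : fr k * Real.exp (-(fr k * y)) ≤ 1 := by
    have e1 : Real.exp (-(fr k * y)) ≤ Real.exp (-(fr k / 2)) :=
      Real.exp_le_exp.2 (by nlinarith [hy.1])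
    have e2 : fr k ≤ Real.exp (fr k / 2) := by
      have := Real.quadratic_le_exp_of_nonneg (x := fr k / 2) (by positivity)
      nlinarith [sq_nonneg (fr k / 2 - 1)]
    calc fr k * Real.exp (-(fr k * y)) ≤ Real.exp (fr k / 2) * Real.exp (-(fr k / 2)) :=
          mul_le_mul e2 e1 (Real.exp_pos _).le (Real.exp_pos _).le
      _ = 1 := by rw [← Real.exp_add, add_neg_cancel, Real.exp_zero]
  have h5 : |coef' D p k y| ≤ |p.1| * |D.d k| * |har' k y| + |sol' k (p.2 k) y| := by
    unfold coef'
    refine (abs_add_le _ _).trans_eq ?_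
    rw [abs_mul, abs_mul]
  calc fr k * |coef' D p k y| ≤ |p.1| * |D.d k| * (fr k * |har' k y|) + fr k * |sol' k (p.2 k) y| := by
        nlinarith
    _ ≤ |p.1| * |D.d k| * (fr k * (3 * fr k * Real.exp (-(fr k * y)))) + 4 * ‖p.2 k‖ * 1 :=
        add_le_add (by gcongr) (h2.trans h3)
    _ = |p.1| * |D.d k| * (3 * fr k) * (fr k * Real.exp (-(fr k * y))) + 4 * ‖p.2 k‖ := by ring
    _ ≤ |p.1| * |D.d k| * (3 * fr k) * 1 + 4 * ‖p.2 k‖ := by gcongr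
    _ = sbnd D p k := by unfold sbnd; ring

lemma coef_right (p : ℝ × FSeq) (k : ℤ) : coef D p k 1 = 0 := by
  simp [coef, har, sol_right]

lemma fr_mul_abs_coef_le (p : ℝ × FSeq) (k : ℤ) {y : ℝ} (hy : y ∈ Icc (0:ℝ) 1) :
    fr k * |coef D p k y| ≤ 2 * (1 - y) * sbnd D p k := by
  have hf : 0 ≤ fr k := abs_nonneg _
  have hb := sbnd_nonneg D p k
  rcases le_total (1 / 2) y with h | h
  · have hm := Convex.norm_image_sub_le_of_norm_hasDerivWithin_le (s := Icc (1 / 2 : ℝ) 1)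
      (f := fun y => fr k * coef D p k y) (f' := fun y => fr k * coef' D p k y) (C := sbnd D p k)
      (fun y _ => ((hasDerivAt_coef D p k y).const_mul (fr k)).hasDerivWithinAt)
      (fun y hy => by
        rw [norm_mul, Real.norm_of_nonneg hf]; exact fr_mul_abs_coef'_le D p k hy)
      (convex_Icc _ _) (x := 1) (y := y) ⟨by norm_num, le_rfl⟩ ⟨h, hy.2⟩
    rw [coef_right, mul_zero, sub_zero, norm_mul, Real.norm_of_nonneg hf, Real.norm_eq_abs,
      Real.norm_eq_abs, abs_sub_comm, abs_of_nonneg (by linarith [hy.2] : 0 ≤ 1 - y)] at hm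
    nlinarith [mul_nonneg hb (by linarith [hy.2] : 0 ≤ 1 - y)]
  · have h1 : fr k * |coef D p k y| ≤ sbnd D p k := by
      rcases eq_or_ne k 0 with rfl | hk
      · rw [coef_zero, abs_zero, mul_zero]; exact hb
      have hK := one_le_fr hk
      have h2 := abs_sol_le k (p.2 k) hy
      have h3 := mul_le_mul_of_nonneg_left (wt_le_one k hy.1) (by positivity : 0 ≤ 4 * ‖p.2 k‖)
      have h4 := abs_har_le k hy
      have he : Real.exp (-(fr k * y)) ≤ 1 := by
        rw [Real.exp_le_one_iff]; have := mul_nonneg (zero_le_one.trans hK) hy.1; linarith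
      have h5 : |coef D p k y| ≤ |p.1| * |D.d k| * |har k y| + |sol k (p.2 k) y| := by
        unfold coef
        refine (abs_add_le _ _).trans_eq ?_
        rw [abs_mul, abs_mul]
      have h6 : fr k * |sol k (p.2 k) y| ≤ fr k ^ 2 * |sol k (p.2 k) y| := by
        gcongr; nlinarith
      have h7 : |p.1| * |D.d k| * |har k y| ≤ |p.1| * |D.d k| * 3 := by gcongr; linarith
      calc fr k * |coef D p k y| ≤ fr k * (|p.1| * |D.d k| * 3 + |sol k (p.2 k) y|) := by
            gcongr; linarith
        _ ≤ sbnd D p k := by unfold sbnd; linarith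
    nlinarith

lemma abs_sin_int_mul_le (k : ℤ) {x : ℝ} (hx : 0 ≤ Real.sin x) :
    |Real.sin (k * x)| ≤ fr k * Real.sin x := by
  have hn : ∀ n : ℕ, |Real.sin (n * x)| ≤ n * Real.sin x := fun n => by
    induction n with
    | zero => simp
    | succ n ih =>
      push_cast
      rw [add_mul, one_mul, Real.sin_add]
      refine (abs_add_le _ _).trans ?_
      rw [abs_mul, abs_mul, abs_of_nonneg hx]
      nlinarith [Real.abs_cos_le_one x, Real.abs_cos_le_one (n * x), abs_nonneg (Real.sin (n * x)),
        abs_nonneg (Real.cos x), abs_nonneg (Real.cos (n * x))]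
  rcases Int.natAbs_eq k with h | h
  · have := hn k.natAbs
    rw [h]; unfold fr; simpa using this
  · have := hn k.natAbs
    rw [h]; unfold fr; simpa using this

lemma abs_S_coef_le (p : ℝ × FSeq) {x y : ℝ} (hx : 0 ≤ Real.sin x) (hy : y ∈ Icc (0:ℝ) 1) :
    |S 0 (coef D p) (x, y)| ≤
      2 * (1 - y) * (3 * (|p.1| * ∑' k, fr k * |D.d k|) + 4 * ‖p.2‖) * Real.sin x := by
  rw [S_zero, ← Real.norm_eq_abs]
  refine tsum_of_norm_bounded (((hasSum_sbnd D p).mul_left (2 * (1 - y))).mul_right (Real.sin x))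
    fun k => ?_
  rw [norm_mul]
  calc |coef D p k y| * |Real.sin (k * x)| ≤ |coef D p k y| * (fr k * Real.sin x) := by
        gcongr; exact abs_sin_int_mul_le k hx
    _ = fr k * |coef D p k y| * Real.sin x := by ring
    _ ≤ _ := mul_le_mul_of_nonneg_right (fr_mul_abs_coef_le D p k hy) hx

lemma abs_S_coef'_le (p : ℝ × FSeq) (x : ℝ) {y : ℝ} (hy : y ∈ Icc (0:ℝ) 1) :
    |S 0 (coef' D p) (x, y)| ≤ 3 * (|p.1| * ∑' k, fr k * |D.d k|) + 4 * ‖p.2‖ := by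
  rw [S_zero, ← Real.norm_eq_abs]
  refine tsum_of_norm_bounded (hasSum_sbnd D p) fun k => ?_
  rw [norm_mul]
  exact (mul_le_of_le_one_right (norm_nonneg _) (Real.abs_sin_le_one _)).trans
    (abs_coef'_le_sbnd D p k hy)

end Green

namespace Green
open FSeq Series

/-- The quartic boundary data with a perturbation subtracted. -/
def Data.quartSub (D : Data) : Data where
  d k := quartCoef k - D.d k
  odd k := by rw [quartCoef_neg, D.odd]; ring
  summable := by
    have h : Summable fun k : ℤ => fr k ^ 2 * |quartCoef k| :=
      summable_of_ne_finset_zero (s := ({1, -1, 3, -3, 5, -5} : Finset ℤ))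
        fun k hk => by rw [quartCoef_support hk, abs_zero, mul_zero]
    refine Summable.of_nonneg_of_le (fun k => by positivity) (fun k => ?_) (h.add D.summable)
    rw [← mul_add]
    gcongr
    exact abs_sub _ _

/-- The opposite boundary data. -/
def Data.negate (D : Data) : Data where
  d k := -D.d k
  odd k := by rw [D.odd]
  summable := by simpa using D.summable

variable (D : Data)

lemma summable_coef_sin {V : ℤ → ℝ → ℝ} {B : ℤ → ℝ} (h : Bdd B V) (x : ℝ) {y : ℝ}
    (hy : y ∈ Icc (0:ℝ) 1) : Summable fun k : ℤ => V k y * Real.sin (k * x) := by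
  refine Summable.of_norm_bounded h.summable fun k => ?_
  rw [norm_mul]
  have hB : 0 ≤ B k := by
    have := (abs_nonneg _).trans (h.le k y hy)
    exact nonneg_of_mul_nonneg_left this (wt_pos k y)
  calc ‖V k y‖ * ‖Real.sin (k * x)‖ ≤ ‖V k y‖ * 1 := by
        gcongr; exact Real.abs_sin_le_one _
    _ ≤ B k * wt k y := by rw [mul_one]; exact h.le k y hy
    _ ≤ B k := mul_le_of_le_one_right hB (wt_le_one k hy.1)

lemma S_quartSub (p : ℝ × FSeq) (x : ℝ) {y : ℝ} (hy : y ∈ Icc (0:ℝ) 1) :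
    S 0 (coef D.quartSub p) (x, y) =
      p.1 * (Real.sin x * Base.base (Real.cos x ^ 2) y) + S 0 (coef D.negate p) (x, y) := by
  rw [S_zero, S_zero]
  refine HasSum.tsum_eq ?_
  refine (((hasSum_quartCoef (fun k => Base.prof k y) x).mul_left p.1).add
    (summable_coef_sin (bdd_coef D.negate p) x hy).hasSum).congr_fun fun k => ?_
  simp only [coef, Data.quartSub, Data.negate, har, Base.prof]
  ring

lemma S'_quartSub (p : ℝ × FSeq) (x : ℝ) {y : ℝ} (hy : y ∈ Icc (0:ℝ) 1) :
    S 0 (coef' D.quartSub p) (x, y) =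
      p.1 * (Real.sin x * Base.base' (Real.cos x ^ 2) y) + S 0 (coef' D.negate p) (x, y) := by
  rw [S_zero, S_zero]
  refine HasSum.tsum_eq ?_
  refine (((hasSum_quartCoef (fun k => Base.prof' k y) x).mul_left p.1).add
    (summable_coef_sin (bdd_coef' D.negate p) x hy).hasSum).congr_fun fun k => ?_
  simp only [coef', Data.quartSub, Data.negate, har', Base.prof']
  ring

lemma coef_left (p : ℝ × FSeq) {k : ℤ} (hk : k ≠ 0) : coef D p k 0 = p.1 * D.d k := by
  have := sinh_fr_ne hk
  simp [coef, har, sol_left, this]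

lemma S_negate_left (p : ℝ × FSeq) {x v : ℝ}
    (h : HasSum (fun k : ℤ => D.d k * Real.sin (k * x)) v) :
    S 0 (coef D.negate p) (x, 0) = -(p.1 * v) := by
  rw [S_zero]
  refine HasSum.tsum_eq ?_
  rw [← mul_neg]
  refine (h.neg.mul_left p.1).congr_fun fun k => ?_
  rcases eq_or_ne k 0 with rfl | hk
  · simp [coef_zero]
  · rw [coef_left _ _ hk, Data.negate]; ring

lemma hasDerivAt_S_snd (p : ℝ × FSeq) (x : ℝ) {y : ℝ} (hy : y ∈ Ioo (0:ℝ) 1) :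
    HasDerivAt (fun y => S 0 (coef D p) (x, y)) (S 0 (coef' D p) (x, y)) y := by
  have h := hasFDerivAt_S (bdd_coef D p) (bdd_coef' D p) (hasDerivAt_coef D p) 0 (z := (x, y)) hy
  have h2 : HasDerivAt (fun y : ℝ => (x, y)) ((0:ℝ), (1:ℝ)) y :=
    (hasDerivAt_const y x).prodMk (hasDerivAt_id y)
  refine (h.comp_hasDerivAt y h2).congr_deriv ?_
  simp [form]

lemma continuousOn_S_coef (p : ℝ × FSeq) : ContinuousOn (S 0 (coef D p)) (univ ×ˢ Icc 0 1) :=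
  continuousOn_S_zero (bdd_coef D p) fun k =>
    continuous_iff_continuousAt.2 fun y => (hasDerivAt_coef D p k y).continuousAt

/-- A solution with prescribed sign pattern near the boundary: over every vertical line it is
either positive, or strictly increasing up to a level above which it is positive. -/
theorem exists_sign_solution {F : Set ℝ} (hF : IsClosed F) (h0 : (0:ℝ) ∈ F) (h1 : (1:ℝ) ∈ F) :
    ∃ τ, 0 < τ ∧ τ < 1 ∧ ∃ y₁ ∈ Ioo (0:ℝ) 1, ∃ s : Sol,
      ContinuousOn (S 0 s.U) (univ ×ˢ Icc 0 1) ∧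
      (∀ y, S 0 s.U (0, y) = 0) ∧ (∀ y, S 0 s.U (Real.pi, y) = 0) ∧ (∀ x, S 0 s.U (x, 1) = 0) ∧
      (∀ x ∈ Ioo 0 Real.pi, (∀ y ∈ Ico y₁ 1, 0 < S 0 s.U (x, y)) ∧
        ((∀ y ∈ Ico 0 1, 0 < S 0 s.U (x, y)) ∨
          StrictMonoOn (fun y => S 0 s.U (x, y)) (Icc 0 y₁))) ∧
      (∀ x ∈ Ioo 0 Real.pi, τ < |Real.cos x| → 0 < S 0 s.U (x, 0)) ∧
      (∀ x ∈ Ioo 0 Real.pi, |Real.cos x| ≤ τ → S 0 s.U (x, 0) ≤ 0 ∧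
        (S 0 s.U (x, 0) = 0 ↔ (Real.cos x + τ) / (2 * τ) ∈ F)) := by
  obtain ⟨c, hc, hbase⟩ := Base.exists_base_lower
  obtain ⟨c', hc', η, hη, hbase'⟩ := Base.exists_base_deriv
  obtain ⟨y₁, hy₁0, hy₁⟩ : ∃ y, 0 < y ∧ y < min η (1 / 2) := exists_between (by positivity)
  have hy₁η : y₁ < η := hy₁.trans_le (min_le_left _ _)
  have hy₁h : y₁ < 1 / 2 := hy₁.trans_le (min_le_right _ _)
  obtain ⟨κ, hκ0, hκ⟩ : ∃ κ, 0 < κ ∧ κ < min (c' / 2) (c * y₁ ^ 2 / 2) :=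
    exists_between (by positivity)
  have hκ1 : κ < c' / 2 := hκ.trans_le (min_le_left _ _)
  have hκ2 : 2 * κ < c * y₁ ^ 2 := by linarith [hκ.trans_le (min_le_right _ _)]
  obtain ⟨τ, hτ, hτ1, hτ2, R, D, hR, hDs, hR1, hR2, hR3⟩ :=
    BdryData.exists_boundary_data hF h0 h1 (κ := κ / 6) (τ₀ := y₁) (by positivity) hy₁0
  obtain ⟨p, hp0, -, hp2, hps, hpn⟩ := exists_small_solution D.quartSub
    (δ := κ / 8) (by positivity)
  have hsum : 3 * (|p.1| * ∑' k, fr k * |D.negate.d k|) + 4 * ‖p.2‖ ≤ p.1 * κ := by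
    have e : ∀ k, |D.negate.d k| = |D.d k| := fun k => abs_neg _
    simp only [e]
    rw [abs_of_pos hp0]
    have := mul_le_mul_of_nonneg_left hDs hp0.le
    linarith
  have hval : ∀ x, S 0 (coef D.quartSub p) (x, 0) =
      p.1 * (Real.sin x * (Real.cos x ^ 4 - R (Real.cos x))) := fun x => by
    rw [S_quartSub D p x ⟨le_rfl, zero_le_one⟩, S_negate_left D p (hR x), Base.base_zero_zero]
    ring
  have hpos : ∀ x ∈ Ioo 0 Real.pi, ∀ y ∈ Ico (0:ℝ) 1, y₁ ^ 2 ≤ y + (Real.cos x ^ 2) ^ 2 →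
      0 < S 0 (coef D.quartSub p) (x, y) := fun x hx y hy hyt => by
    have hs := Real.sin_pos_of_pos_of_lt_pi hx.1 hx.2
    have hy' : y ∈ Icc (0:ℝ) 1 := ⟨hy.1, hy.2.le⟩
    have hy1 : 0 < 1 - y := by linarith [hy.2]
    rw [S_quartSub D p x hy']
    have a1 := hbase (Real.cos x ^ 2) y (sq_nonneg _) hy'
    have a2 := (abs_le.1 (abs_S_coef_le D.negate p hs.le hy')).1
    have a3 : 2 * (1 - y) * (3 * (|p.1| * ∑' k, fr k * |D.negate.d k|) + 4 * ‖p.2‖) * Real.sin x ≤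
        2 * (1 - y) * (p.1 * κ) * Real.sin x := by gcongr
    have a4 : 2 * κ < c * (y + (Real.cos x ^ 2) ^ 2) :=
      hκ2.trans_le (mul_le_mul_of_nonneg_left hyt hc.le)
    have a5 : 2 * κ * (1 - y) < Base.base (Real.cos x ^ 2) y := by nlinarith
    have a6 := mul_lt_mul_of_pos_left a5 (mul_pos hp0 hs)
    linarith
  refine ⟨τ, hτ, hτ2, y₁, ⟨hy₁0, by linarith⟩, toSol hps hpn, continuousOn_S_coef _ p, ?_, ?_, ?_,
    ?_, ?_, ?_⟩
  · intro y
    change S 0 (coef D.quartSub p) (0, y) = 0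
    simp [S_zero]
  · intro y
    change S 0 (coef D.quartSub p) (Real.pi, y) = 0
    simp [S_zero, Real.sin_int_mul_pi]
  · intro x
    change S 0 (coef D.quartSub p) (x, 1) = 0
    simp [S_zero, coef_right]
  · intro x hx
    have hs := Real.sin_pos_of_pos_of_lt_pi hx.1 hx.2
    refine ⟨fun y hy => hpos x hx y ⟨hy₁0.le.trans hy.1, hy.2⟩ ?_, ?_⟩
    · nlinarith [hy.1, sq_nonneg (Real.cos x ^ 2)]
    rcases le_total y₁ (Real.cos x ^ 2) with ht | ht
    · refine Or.inl fun y hy => hpos x hx y hy ?_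
      have := pow_le_pow_left₀ hy₁0.le ht 2
      linarith [hy.1]
    · right
      refine strictMonoOn_of_deriv_pos (convex_Icc _ _) ?_ fun y hy => ?_
      · exact (continuousOn_S_coef D.quartSub p).comp (by fun_prop)
          fun y hy => ⟨mem_univ _, hy.1, by linarith [hy.2]⟩
      rw [interior_Icc] at hy
      have hy' : y ∈ Ioo (0:ℝ) 1 := ⟨hy.1, by linarith [hy.2]⟩
      have hyI : y ∈ Icc (0:ℝ) 1 := ⟨hy'.1.le, hy'.2.le⟩
      change 0 < deriv (fun y => S 0 (coef D.quartSub p) (x, y)) y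
      rw [(hasDerivAt_S_snd D.quartSub p x hy').deriv, S'_quartSub D p x hyI]
      have b1 := hbase' (Real.cos x ^ 2) y (by rw [abs_of_nonneg (sq_nonneg _)]; linarith)
        (by rw [abs_of_nonneg hyI.1]; linarith [hy.2])
      have b2 := (abs_le.1 (abs_S_coef'_le D.negate p x hyI)).1
      have b3 : 1 / 2 ≤ Real.sin x := by
        have := Real.sin_sq_add_cos_sq x
        nlinarith [Real.sin_le_one x]
      have b4 : c' / 2 ≤ Real.sin x * Base.base' (Real.cos x ^ 2) y := by nlinarith
      have b5 : p.1 * κ < p.1 * (Real.sin x * Base.base' (Real.cos x ^ 2) y) := by gcongr; linarith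
      linarith
  · intro x hx h
    change 0 < S 0 (coef D.quartSub p) (x, 0)
    rw [hval]
    have := hR1 _ h
    exact mul_pos hp0 (mul_pos (Real.sin_pos_of_pos_of_lt_pi hx.1 hx.2) (by linarith))
  · intro x hx h
    change S 0 (coef D.quartSub p) (x, 0) ≤ 0 ∧ (S 0 (coef D.quartSub p) (x, 0) = 0 ↔ _)
    have hs := Real.sin_pos_of_pos_of_lt_pi hx.1 hx.2
    rw [hval, ← hR3 _ h, mul_eq_zero_iff_left hp0.ne', mul_eq_zero_iff_left hs.ne', sub_eq_zero,
      eq_comm]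
    refine ⟨?_, Iff.rfl⟩
    have := mul_nonneg (mul_nonneg hp0.le hs.le) (sub_nonneg.2 (hR2 _ h))
    linarith

end Green

lemma exists_sign_change {f : ℝ → ℝ} (hf : ContinuousOn f (Icc 0 1)) {y₁ : ℝ} (hy₁ : y₁ ∈ Ioo (0:ℝ) 1)
    (hpos : ∀ y ∈ Ico y₁ 1, 0 < f y)
    (hmono : (∀ y ∈ Ico (0:ℝ) 1, 0 < f y) ∨ StrictMonoOn f (Icc 0 y₁)) :
    ∃ γ, 0 ≤ γ ∧ γ < 1 ∧ (∀ y ∈ Ioo (0:ℝ) 1, 0 < f y ↔ γ < y) ∧ (0 < γ → f γ = 0) ∧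
      (∀ y ∈ Ico 0 γ, f y < 0) ∧ (0 < γ ↔ f 0 < 0) := by
  rcases hmono with h | h
  · refine ⟨0, le_rfl, one_pos, fun y hy => ⟨fun _ => hy.1, fun _ => h y ⟨hy.1.le, hy.2⟩⟩,
      fun h' => absurd h' (lt_irrefl _), fun y hy => absurd hy.2 hy.1.not_gt, ?_⟩
    exact ⟨fun h' => absurd h' (lt_irrefl _), fun h' => absurd (h 0 ⟨le_rfl, one_pos⟩) h'.not_gt⟩
  have m0 : (0:ℝ) ∈ Icc 0 y₁ := ⟨le_rfl, hy₁.1.le⟩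
  have key : ∀ γ ∈ Ico 0 y₁, 0 ≤ f γ → (0 < γ → f γ = 0) → 
      ∃ γ, 0 ≤ γ ∧ γ < 1 ∧ (∀ y ∈ Ioo (0:ℝ) 1, 0 < f y ↔ γ < y) ∧ (0 < γ → f γ = 0) ∧
      (∀ y ∈ Ico 0 γ, f y < 0) ∧ (0 < γ ↔ f 0 < 0) := by
    intro γ hγ h0 hγ0
    have mγ : γ ∈ Icc 0 y₁ := ⟨hγ.1, hγ.2.le⟩
    have below : ∀ y ∈ Ico 0 γ, f y < 0 := fun y hy =>
      (h ⟨hy.1, by linarith [hy.2, hγ.2]⟩ mγ hy.2).trans_eq (hγ0 (hy.1.trans_lt hy.2))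
    refine ⟨γ, hγ.1, hγ.2.trans hy₁.2, fun y hy => ⟨fun hp => ?_, fun hp => ?_⟩, hγ0, below, ?_, ?_⟩
    · by_contra! hle
      rcases hle.lt_or_eq with h1 | h1
      · exact (below y ⟨hy.1.le, h1⟩).not_gt hp
      · exact hp.ne' (h1 ▸ hγ0 (h1 ▸ hy.1))
    · rcases lt_or_ge y y₁ with h1 | h1
      · exact h0.trans_lt (h mγ ⟨hy.1.le, h1.le⟩ hp)
      · exact hpos y ⟨h1, hy.2⟩
    · exact fun hg => below 0 ⟨le_rfl, hg⟩
    · intro h1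
      rcases hγ.1.lt_or_eq with h2 | h2
      · exact h2
      · subst h2
        exact absurd h1 h0.not_gt
  rcases le_or_gt 0 (f 0) with h0 | h0
  · exact key 0 ⟨le_rfl, hy₁.1⟩ h0 fun h' => absurd h' (lt_irrefl _)
  · obtain ⟨γ, hγ, h1⟩ := intermediate_value_Ioo hy₁.1.le (hf.mono (Icc_subset_Icc_right hy₁.2.le))
      (show (0:ℝ) ∈ Ioo (f 0) (f y₁) from ⟨h0, hpos y₁ ⟨le_rfl, hy₁.2⟩⟩)
    exact key γ ⟨hγ.1.le, hγ.2⟩ h1.ge fun _ => h1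

section profile
open Series

/-- A solution of the minimal surface equation in the upper half-plane model, vanishing on the
boundary of a domain bounded below by the graph of `g`. -/
structure Profile (F : Set ℝ) where
  τ : ℝ
  τ_pos : 0 < τ
  τ_lt : τ < 1
  s : Sol
  g : ℝ → ℝ
  cont : Continuous g
  nonneg : ∀ x, 0 ≤ g x
  lt_one : ∀ x, g x < 1
  contu : ContinuousOn (S 0 s.U) (univ ×ˢ Icc 0 1)
  left : ∀ y, S 0 s.U (0, y) = 0
  right : ∀ y, S 0 s.U (Real.pi, y) = 0
  top : ∀ x, S 0 s.U (x, 1) = 0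
  bot : ∀ x, 0 < g x → S 0 s.U (x, g x) = 0
  sgn : ∀ x ∈ Ioo 0 Real.pi, ∀ y ∈ Ioo (0:ℝ) 1, (0 < S 0 s.U (x, y) ↔ g x < y)
  zero : ∀ x ∈ Icc 0 Real.pi, (0 < g x ↔
    |Real.cos x| < τ ∧ (Real.cos x + τ) / (2 * τ) ∉ F)

theorem exists_profile {F : Set ℝ} (hF : IsClosed F) (h0 : (0:ℝ) ∈ F) (h1 : (1:ℝ) ∈ F) :
    Nonempty (Profile F) := by
  obtain ⟨τ, hτ, hτ1, y₁, hy₁, s, hc, hl, hr, ht, hsg, hpos, hneg⟩ :=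
    Green.exists_sign_solution hF h0 h1
  have hg : ∀ x, ∃ γ, 0 ≤ γ ∧ γ < 1 ∧ (x ∉ Ioo 0 Real.pi → γ = 0) ∧ (0 < γ → S 0 s.U (x, γ) = 0) ∧
      (x ∈ Ioo 0 Real.pi → (∀ y ∈ Ioo (0:ℝ) 1, 0 < S 0 s.U (x, y) ↔ γ < y) ∧
        (∀ y ∈ Ico 0 γ, S 0 s.U (x, y) < 0) ∧ (0 < γ ↔ S 0 s.U (x, 0) < 0)) := by
    intro x
    by_cases hx : x ∈ Ioo 0 Real.pi
    · obtain ⟨γ, a, b, c, d, e, f⟩ := exists_sign_change (f := fun y => S 0 s.U (x, y))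
        (hc.comp (by fun_prop) fun y hy => ⟨mem_univ _, hy⟩) hy₁ (hsg x hx).1 (hsg x hx).2
      exact ⟨γ, a, b, fun h => absurd hx h, d, fun _ => ⟨c, e, f⟩⟩
    · exact ⟨0, le_rfl, one_pos, fun _ => rfl, fun h => absurd h (lt_irrefl _), fun h => absurd h hx⟩
  choose g g0 g1 goff gbot gin using hg
  have hcx : ∀ y ∈ Icc (0:ℝ) 1, Continuous fun x => S 0 s.U (x, y) := fun y hy =>
    continuousOn_univ.1 (hc.comp (by fun_prop) fun x _ => ⟨mem_univ _, hy⟩)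
  have gz : ∀ x, τ < |Real.cos x| → g x = 0 := fun x hx => by
    by_cases h : x ∈ Ioo 0 Real.pi
    · have h2 := (gin x h).2.2
      have h3 := hpos x h hx
      by_contra h4
      exact h3.not_gt (h2.1 ((g0 x).lt_of_ne' h4))
    · exact goff x h
  refine ⟨⟨τ, hτ, hτ1, s, g, ?_, g0, g1, hc, hl, hr, ht, gbot, fun x hx => (gin x hx).1, ?_⟩⟩
  · rw [continuous_iff_continuousAt]
    intro x₀
    by_cases hx₀ : x₀ ∈ Ioo 0 Real.pi
    · have hev : ∀ᶠ x in 𝓝 x₀, x ∈ Ioo 0 Real.pi := isOpen_Ioo.mem_nhds hx₀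
      refine tendsto_order.2 ⟨fun a ha => ?_, fun b hb => ?_⟩
      · rcases lt_or_ge a 0 with h | h
        · exact Eventually.of_forall fun x => h.trans_le (g0 x)
        obtain ⟨a', h1, h2⟩ := exists_between ha
        have ha' : a' ∈ Ioo (0:ℝ) 1 := ⟨h.trans_lt h1, h2.trans (g1 x₀)⟩
        have h3 := (gin x₀ hx₀).2.1 a' ⟨ha'.1.le, h2⟩
        filter_upwards [hev, ((hcx a' ⟨ha'.1.le, ha'.2.le⟩).tendsto x₀).eventually_lt_const h3]
          with x hx h4
        exact h1.trans_le (not_lt.1 fun h5 => h4.not_gt (((gin x hx).1 a' ha').2 h5))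
      · obtain ⟨b', h1, h2⟩ := exists_between (lt_min hb (g1 x₀))
        have hb' : b' ∈ Ioo (0:ℝ) 1 := ⟨(g0 x₀).trans_lt h1, h2.trans_le (min_le_right _ _)⟩
        have h3 := ((gin x₀ hx₀).1 b' hb').2 h1
        filter_upwards [hev, ((hcx b' ⟨hb'.1.le, hb'.2.le⟩).tendsto x₀).eventually_const_lt h3]
          with x hx h4
        exact (((gin x hx).1 b' hb').1 h4).trans (h2.trans_le (min_le_left _ _))
    · have key : ∀ᶠ x in 𝓝 x₀, g x = 0 := by
        by_cases h : |Real.cos x₀| = 1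
        · have h2 : ∀ᶠ x in 𝓝 x₀, τ < |Real.cos x| :=
            (Real.continuous_cos.abs.tendsto x₀).eventually_const_lt (by rw [h]; exact hτ1)
          exact h2.mono gz
        · have h2 : x₀ ∉ Icc 0 Real.pi := by
            intro h3
            rcases h3.1.lt_or_eq with h4 | h4
            · rcases h3.2.lt_or_eq with h5 | h5
              · exact hx₀ ⟨h4, h5⟩
              · exact h (by rw [h5]; simp)
            · exact h (by rw [← h4]; simp)
          have h3 : ∀ᶠ x in 𝓝 x₀, x ∉ Icc 0 Real.pi := isClosed_Icc.isOpen_compl.mem_nhds h2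
          exact h3.mono fun x hx => goff x fun h' => hx (Ioo_subset_Icc_self h')
      have : ContinuousAt (fun _ : ℝ => (0:ℝ)) x₀ := continuousAt_const
      exact this.congr (key.mono fun x hx => hx.symm)
  · intro x hx
    by_cases h : x ∈ Ioo 0 Real.pi
    · rw [(gin x h).2.2]
      rcases lt_or_ge τ |Real.cos x| with h2 | h2
      · exact ⟨fun h3 => absurd (hpos x h h2) h3.not_gt, fun h3 => absurd h3.1 h2.not_gt⟩
      · obtain ⟨h3, h4⟩ := hneg x h h2
        rw [h3.lt_iff_ne, Ne, h4]
        refine ⟨fun h5 => ⟨h2.lt_of_ne fun h6 => h5 ?_, h5⟩, fun h5 => h5.2⟩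
        rcases eq_or_eq_neg_of_abs_eq h6 with h7 | h7
        · rw [h7, ← two_mul, div_self (by positivity)]
          exact h1
        · rw [h7]
          simpa using h0
    · rw [goff x h]
      refine ⟨fun h => absurd h (lt_irrefl _), fun h2 => ?_⟩
      have h3 : |Real.cos x| = 1 := by
        rcases hx.1.lt_or_eq with h4 | h4
        · rcases hx.2.lt_or_eq with h5 | h5
          · exact absurd ⟨h4, h5⟩ h
          · rw [h5]; simp
        · rw [← h4]; simp
      exact absurd h2.1 (by rw [h3]; exact hτ1.not_gt)

end profile

/-- `f` and `g` restrict to mutually inverse homeomorphisms between `s` and `t`. -/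
structure HomeoOn {X Y : Type*} [TopologicalSpace X] [TopologicalSpace Y] (f : X → Y) (g : Y → X)
    (s : Set X) (t : Set Y) : Prop where
  mapsTo : ∀ x ∈ s, f x ∈ t
  mapsTo' : ∀ y ∈ t, g y ∈ s
  left : ∀ x ∈ s, g (f x) = x
  right : ∀ y ∈ t, f (g y) = y
  cont : ContinuousOn f s
  cont' : ContinuousOn g t

namespace HomeoOn

variable {X Y Z : Type*} [TopologicalSpace X] [TopologicalSpace Y] [TopologicalSpace Z]
  {f : X → Y} {g : Y → X} {s : Set X} {t : Set Y} {f' : Y → Z} {g' : Z → Y} {r : Set Z}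

lemma trans (h : HomeoOn f g s t) (h' : HomeoOn f' g' t r) : HomeoOn (f' ∘ f) (g ∘ g') s r where
  mapsTo x hx := h'.mapsTo _ (h.mapsTo x hx)
  mapsTo' y hy := h.mapsTo' _ (h'.mapsTo' y hy)
  left x hx := by simp [h'.left _ (h.mapsTo x hx), h.left x hx]
  right y hy := by simp [h.right _ (h'.mapsTo' y hy), h'.right y hy]
  cont := h'.cont.comp h.cont h.mapsTo
  cont' := h.cont'.comp h'.cont' h'.mapsTo'

def toHomeomorph (h : HomeoOn f g s t) : s ≃ₜ t where
  toFun x := ⟨f x, h.mapsTo x x.2⟩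
  invFun y := ⟨g y, h.mapsTo' y y.2⟩
  left_inv x := Subtype.ext (h.left x x.2)
  right_inv y := Subtype.ext (h.right y y.2)
  continuous_toFun := (continuousOn_iff_continuous_domRestrict.1 h.cont).subtype_mk _
  continuous_invFun := (continuousOn_iff_continuous_domRestrict.1 h.cont').subtype_mk _

end HomeoOn

/-- The unit square with the points of `F` removed from its bottom side. -/
def sqDom (F : Set ℝ) : Set (ℝ × ℝ) :=
  {v | v.1 ∈ Icc (0:ℝ) 1 ∧ v.2 ∈ Icc (0:ℝ) 1 ∧ ¬ (v.2 = 0 ∧ v.1 ∈ F)}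

/-- The closed upper half-plane with the inverses of `F` removed from its boundary. -/
def halfDom (F : Set ℝ) : Set (ℝ × ℝ) :=
  {p | 0 ≤ p.2 ∧ ¬ (p.2 = 0 ∧ p.1 ≠ 0 ∧ p.1⁻¹ ∈ F)}

def foldQ (p : ℝ × ℝ) : ℝ × ℝ := (p.1 - p.2, min (min p.1 p.2) (max p.1 p.2 - 1))

def unfoldQ (p : ℝ × ℝ) : ℝ × ℝ :=
  (p.2 + max 0 (1 - |p.1|) + max p.1 0, p.2 + max 0 (1 - |p.1|) + max (-p.1) 0)

lemma foldQ_unfoldQ {p : ℝ × ℝ} (h : 0 ≤ p.2) : foldQ (unfoldQ p) = p := by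
  obtain ⟨a, b⟩ := p
  simp only at h
  simp only [foldQ, unfoldQ, Prod.mk.injEq]
  rcases le_total 0 a with ha | ha
  · rw [abs_of_nonneg ha, max_eq_left ha, max_eq_right (by linarith : -a ≤ 0)]
    constructor
    · ring
    rcases le_total 0 (1 - a) with h1 | h1
    · rw [max_eq_right h1]
      rw [min_eq_right (by linarith : b + (1 - a) + 0 ≤ b + (1 - a) + a), max_eq_left (by linarith),
        min_eq_right (by linarith)]
      ring
    · rw [max_eq_left h1]
      rw [min_eq_right (by linarith : b + 0 + 0 ≤ b + 0 + a), max_eq_left (by linarith),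
        min_eq_left (by linarith)]
      ring
  · rw [abs_of_nonpos ha, max_eq_right ha, max_eq_left (by linarith : 0 ≤ -a)]
    constructor
    · ring
    rcases le_total 0 (1 - -a) with h1 | h1
    · rw [max_eq_right h1]
      rw [min_eq_left (by linarith : b + (1 - -a) + 0 ≤ b + (1 - -a) + -a), max_eq_right (by linarith),
        min_eq_right (by linarith)]
      ring
    · rw [max_eq_left h1]
      rw [min_eq_left (by linarith : b + 0 + 0 ≤ b + 0 + -a), max_eq_right (by linarith),
        min_eq_left (by linarith)]
      ring

lemma unfoldQ_foldQ {p : ℝ × ℝ} : unfoldQ (foldQ p) = p := by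
  obtain ⟨a, b⟩ := p
  simp only [foldQ, unfoldQ, Prod.mk.injEq]
  rcases le_total b a with h | h
  · rw [abs_of_nonneg (by linarith : 0 ≤ a - b), min_eq_right h, max_eq_left h,
      max_eq_left (by linarith : 0 ≤ a - b), max_eq_right (by linarith : -(a - b) ≤ 0)]
    rcases le_total 0 (1 - (a - b)) with h1 | h1
    · rw [max_eq_right h1, min_eq_right (by linarith)]
      constructor <;> ring
    · rw [max_eq_left h1, min_eq_left (by linarith)]
      constructor <;> ring
  · rw [abs_of_nonpos (by linarith : a - b ≤ 0), min_eq_left h, max_eq_right h,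
      max_eq_right (by linarith : a - b ≤ 0), max_eq_left (by linarith : 0 ≤ -(a - b))]
    rcases le_total 0 (1 - -(a - b)) with h1 | h1
    · rw [max_eq_right h1, min_eq_right (by linarith)]
      constructor <;> ring
    · rw [max_eq_left h1, min_eq_left (by linarith)]
      constructor <;> ring

lemma unfoldQ_nonneg {p : ℝ × ℝ} (h : 0 ≤ p.2) : 0 ≤ (unfoldQ p).1 ∧ 0 ≤ (unfoldQ p).2 :=
  ⟨by unfold unfoldQ; positivity, by unfold unfoldQ; positivity⟩

lemma one_le_norm_unfoldQ {p : ℝ × ℝ} (h : 0 ≤ p.2) : 1 ≤ ‖unfoldQ p‖ := by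
  have h1 : (foldQ (unfoldQ p)).2 = p.2 := by rw [foldQ_unfoldQ h]
  have h2 : p.2 ≤ max (unfoldQ p).1 (unfoldQ p).2 - 1 := h1 ▸ min_le_right _ _
  rw [Prod.norm_def, Real.norm_eq_abs, Real.norm_eq_abs, abs_of_nonneg (unfoldQ_nonneg h).1,
    abs_of_nonneg (unfoldQ_nonneg h).2]
  linarith

def sqToHalf (v : ℝ × ℝ) : ℝ × ℝ := foldQ (invN v)

def halfToSq (p : ℝ × ℝ) : ℝ × ℝ := invN (unfoldQ p)

lemma sqToHalf_axis {f : ℝ} (h0 : 0 < f) (h1 : f ≤ 1) : sqToHalf (f, 0) = (f⁻¹, 0) := by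
  have h2 : 1 ≤ f⁻¹ := (one_le_inv₀ h0).2 h1
  have h3 : invN (f, 0) = (f⁻¹, 0) := by
    have : ‖((f, 0) : ℝ × ℝ)‖ = f := by simp [Prod.norm_def, abs_of_pos h0, h0.le]
    rw [invN, this]
    ext <;> simp
    field_simp
  rw [sqToHalf, h3, foldQ]
  ext
  · simp
  · simp only
    rw [min_eq_right (by linarith : (0:ℝ) ≤ f⁻¹), max_eq_left (by linarith : (0:ℝ) ≤ f⁻¹),
      min_eq_left (by linarith)]

lemma homeoOn_sqToHalf {F : Set ℝ} (hF : F ⊆ Icc 0 1) (h0 : (0:ℝ) ∈ F) :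
    HomeoOn sqToHalf halfToSq (sqDom F) (halfDom F) := by
  have ne0 : ∀ v ∈ sqDom F, v ≠ 0 := fun v hv h => hv.2.2 (by rw [h]; exact ⟨rfl, h0⟩)
  have une : ∀ p ∈ halfDom F, unfoldQ p ≠ 0 := fun p hp => norm_pos_iff.1
    (one_pos.trans_le (one_le_norm_unfoldQ hp.1))
  have hl : ∀ v, halfToSq (sqToHalf v) = v := fun v => by
    rw [halfToSq, sqToHalf, unfoldQ_foldQ, invN_invN]
  have hr : ∀ p, 0 ≤ p.2 → sqToHalf (halfToSq p) = p := fun v hv => by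
    rw [halfToSq, sqToHalf, invN_invN, foldQ_unfoldQ hv]
  refine ⟨fun v hv => ?_, fun p hp => ?_, fun v _ => hl v, fun p hp => hr p hp.1, ?_, ?_⟩
  · obtain ⟨h1, h2, h3⟩ := hv
    have hn : 0 < ‖v‖ := norm_pos_iff.2 (ne0 v ⟨h1, h2, h3⟩)
    have hn1 : ‖v‖ ≤ 1 := by
      rw [Prod.norm_def, Real.norm_eq_abs, Real.norm_eq_abs, abs_of_nonneg h1.1, abs_of_nonneg h2.1]
      exact max_le h1.2 h2.2
    have hi1 : 0 ≤ (invN v).1 := mul_nonneg (by positivity) h1.1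
    have hi2 : 0 ≤ (invN v).2 := mul_nonneg (by positivity) h2.1
    have hi : 1 ≤ max (invN v).1 (invN v).2 := by
      have := norm_invN v
      rw [Prod.norm_def, Real.norm_eq_abs, Real.norm_eq_abs, abs_of_nonneg hi1,
        abs_of_nonneg hi2] at this
      rw [this]
      exact (one_le_inv₀ hn).2 hn1
    refine ⟨le_min (le_min hi1 hi2) (by linarith), fun ⟨a1, a2, a3⟩ => ?_⟩
    set p := sqToHalf v with hp
    have a4 : 0 < p.1⁻¹ := (hF a3).1.lt_of_ne' (inv_ne_zero a2)
    have a5 : sqToHalf (p.1⁻¹, 0) = p := by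
      rw [sqToHalf_axis a4 (hF a3).2, inv_inv]
      exact Prod.ext rfl a1.symm
    have a6 : v = (p.1⁻¹, 0) := by
      rw [← hl v, ← hp]
      nth_rw 1 [← a5]
      exact hl _
    exact h3 (by rw [a6]; exact ⟨rfl, a3⟩)
  · obtain ⟨h1, h2⟩ := hp
    have hu := unfoldQ_nonneg h1
    have hu1 := one_le_norm_unfoldQ h1
    have hq1 : 0 ≤ (halfToSq p).1 := mul_nonneg (by positivity) hu.1
    have hq2 : 0 ≤ (halfToSq p).2 := mul_nonneg (by positivity) hu.2
    have hq : ‖halfToSq p‖ ≤ 1 := by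
      rw [halfToSq, norm_invN]
      exact inv_le_one_of_one_le₀ hu1
    refine ⟨⟨hq1, (le_abs_self _).trans ((norm_fst_le _).trans hq)⟩,
      ⟨hq2, (le_abs_self _).trans ((norm_snd_le _).trans hq)⟩, fun ⟨a1, a2⟩ => h2 ?_⟩
    have a3 : halfToSq p ≠ 0 := invN_ne_zero (une p ⟨h1, h2⟩)
    have a4 : 0 < (halfToSq p).1 := hq1.lt_of_ne' fun h => a3 (Prod.ext h a1)
    have a5 : sqToHalf ((halfToSq p).1, 0) = p := by
      rw [← a1]
      exact hr p h1
    rw [sqToHalf_axis a4 (hF a2).2] at a5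
    rw [← a5]
    refine ⟨rfl, inv_ne_zero a4.ne', ?_⟩
    simpa using a2
  · have : Continuous foldQ := by unfold foldQ; fun_prop
    exact this.comp_continuousOn fun v hv => (continuousAt_invN (ne0 v hv)).continuousWithinAt
  · have : Continuous unfoldQ := by unfold unfoldQ; fun_prop
    exact fun p hp => ((continuousAt_invN (une p hp)).comp this.continuousAt).continuousWithinAt

lemma sqToHalf_snd_eq_zero {F : Set ℝ} (h0 : (0:ℝ) ∈ F) {v : ℝ × ℝ} (hv : v ∈ sqDom F) :
    (sqToHalf v).2 = 0 ↔ v.1 = 0 ∨ v.1 = 1 ∨ v.2 = 0 ∨ v.2 = 1 := by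
  have hne : v ≠ 0 := fun h => hv.2.2 (by rw [h]; exact ⟨rfl, h0⟩)
  obtain ⟨⟨a0, a1⟩, ⟨b0, b1⟩, h3⟩ := hv
  have hn : 0 < ‖v‖ := norm_pos_iff.2 hne
  have hnorm : ‖v‖ = max v.1 v.2 := by
    rw [Prod.norm_def, Real.norm_eq_abs, Real.norm_eq_abs, abs_of_nonneg a0, abs_of_nonneg b0]
  have hk : 0 < (‖v‖ ^ 2)⁻¹ := by positivity
  have hi1 : (invN v).1 = (‖v‖ ^ 2)⁻¹ * v.1 := rfl
  have hi2 : (invN v).2 = (‖v‖ ^ 2)⁻¹ * v.2 := rfl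
  have hi : max (invN v).1 (invN v).2 = ‖v‖⁻¹ := by
    rw [hi1, hi2, ← mul_max_of_nonneg _ _ hk.le, ← hnorm]
    field_simp
  have hi' : ‖v‖⁻¹ - 1 = 0 ↔ ‖v‖ = 1 := by rw [sub_eq_zero, inv_eq_one]
  have hmin : min (invN v).1 (invN v).2 = (‖v‖ ^ 2)⁻¹ * min v.1 v.2 := by
    rw [hi1, hi2, mul_min_of_nonneg _ _ hk.le]
  have hle : 0 ≤ ‖v‖⁻¹ - 1 := by
    rw [sub_nonneg, one_le_inv₀ hn, hnorm]
    exact max_le a1 b1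
  have hmn : 0 ≤ min v.1 v.2 := le_min a0 b0
  change min (min (invN v).1 (invN v).2) (max (invN v).1 (invN v).2 - 1) = 0 ↔ _
  rw [hi, hmin]
  constructor
  · intro h
    rcases min_choice ((‖v‖ ^ 2)⁻¹ * min v.1 v.2) (‖v‖⁻¹ - 1) with h4 | h4 <;> rw [h4] at h
    · rcases mul_eq_zero.1 h with h5 | h5
      · exact absurd h5 hk.ne'
      · rcases min_choice v.1 v.2 with h6 | h6 <;> rw [h6] at h5 <;> tauto
    · rw [hi', hnorm] at h
      rcases max_choice v.1 v.2 with h6 | h6 <;> rw [h6] at h <;> tauto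
  · intro h
    have h7 : min v.1 v.2 = 0 ∨ ‖v‖ = 1 := by
      rcases h with h | h | h | h
      · exact Or.inl (by rw [h, min_eq_left b0])
      · exact Or.inr (by rw [hnorm, h, max_eq_left b1])
      · exact Or.inl (by rw [h, min_eq_right a0])
      · exact Or.inr (by rw [hnorm, h, max_eq_right a1])
    rcases h7 with h7 | h7
    · rw [h7, mul_zero, min_eq_left hle]
    · rw [hi'.2 h7, min_eq_right (by positivity)]

def clampI (x : ℝ) : ℝ := max 0 (min x 1)

lemma continuous_clampI : Continuous clampI := by unfold clampI; fun_prop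

lemma clampI_of_mem {x : ℝ} (h0 : 0 ≤ x) (h1 : x ≤ 1) : clampI x = x := by
  rw [clampI, min_eq_left h1, max_eq_right h0]

lemma clampI_of_nonpos {x : ℝ} (h : x ≤ 0) : clampI x = 0 := by
  rw [clampI, min_eq_left (by linarith), max_eq_left h]

lemma clampI_of_one_le {x : ℝ} (h : 1 ≤ x) : clampI x = 1 := by
  rw [clampI, min_eq_right h, max_eq_right zero_le_one]

lemma clampI_add_mul {a Y : ℝ} (hY : 0 ≤ Y) : clampI (clampI a + Y * (a - clampI a)) = clampI a := by
  rcases le_total a 0 with h | h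
  · rw [clampI_of_nonpos h, clampI_of_nonpos]
    nlinarith
  rcases le_total a 1 with h1 | h1
  · rw [clampI_of_mem h h1, sub_self, mul_zero, add_zero, clampI_of_mem h h1]
  · rw [clampI_of_one_le h1, clampI_of_one_le]
    nlinarith

/-- The rectangle of width `1 + 2 m` whose bottom side only keeps the points of `(0, 1) \ F`. -/
def rectDom (m : ℝ) (F : Set ℝ) : Set (ℝ × ℝ) :=
  {v | v.1 ∈ Icc (-m) (1 + m) ∧ v.2 ∈ Icc (0:ℝ) 1 ∧ (v.2 = 0 → v.1 ∈ Ioo (0:ℝ) 1 \ F)}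

def pinch (m : ℝ) (v : ℝ × ℝ) : ℝ × ℝ :=
  ((clampI v.1 + v.2 * (v.1 - clampI v.1) + m * v.2) / (1 + 2 * m * v.2), v.2)

def skew (m : ℝ) (v : ℝ × ℝ) : ℝ := v.1 * (1 + 2 * m * v.2) - m * v.2

def unpinch (m : ℝ) (v : ℝ × ℝ) : ℝ × ℝ :=
  (clampI (skew m v) + (skew m v - clampI (skew m v)) / v.2, v.2)

lemma pinch_bounds {m : ℝ} (hm : 0 < m) {v : ℝ × ℝ} (h1 : v.1 ∈ Icc (-m) (1 + m))
    (h2 : v.2 ∈ Icc (0:ℝ) 1) : -(m * v.2) ≤ clampI v.1 + v.2 * (v.1 - clampI v.1) ∧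
      clampI v.1 + v.2 * (v.1 - clampI v.1) ≤ 1 + m * v.2 := by
  obtain ⟨a, Y⟩ := v
  simp only at *
  have := h1.1
  have := h1.2
  have := h2.1
  have := h2.2
  have := mul_nonneg hm.le h2.1
  rcases le_total a 0 with h | h
  · rw [clampI_of_nonpos h]
    constructor <;> nlinarith
  rcases le_total a 1 with h1 | h1
  · rw [clampI_of_mem h h1]
    constructor <;> nlinarith
  · rw [clampI_of_one_le h1]
    constructor <;> nlinarith

lemma skew_pinch {m : ℝ} (hm : 0 < m) {v : ℝ × ℝ} (h2 : 0 ≤ v.2) :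
    skew m (pinch m v) = clampI v.1 + v.2 * (v.1 - clampI v.1) := by
  have : (0:ℝ) < 1 + 2 * m * v.2 := by positivity
  simp only [skew, pinch]
  field_simp
  ring

lemma homeoOn_pinch {m : ℝ} (hm : 0 < m) {F : Set ℝ} (h0 : (0:ℝ) ∈ F) (h1 : (1:ℝ) ∈ F) :
    HomeoOn (pinch m) (unpinch m) (rectDom m F) (sqDom F) where
  mapsTo v hv := by
    obtain ⟨a, b, c⟩ := hv
    have hb := pinch_bounds hm a b
    have : (0:ℝ) < 1 + 2 * m * v.2 := by have := b.1; positivity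
    refine ⟨⟨?_, ?_⟩, b, fun ⟨d, e⟩ => ?_⟩
    · exact div_nonneg (by linarith [hb.1]) this.le
    · rw [pinch, div_le_one this]
      linarith [hb.2]
    · have d : v.2 = 0 := d
      have h3 := c d
      apply h3.2
      have h4 : (pinch m v).1 = v.1 := by
        simp [pinch, d, clampI_of_mem h3.1.1.le h3.1.2.le]
      rwa [← h4]
  mapsTo' v hv := by
    obtain ⟨a, b, c⟩ := hv
    have h2 : 0 ≤ m * v.2 := mul_nonneg hm.le b.1
    rcases b.1.lt_or_eq with h3 | h3
    · refine ⟨?_, b, fun h => absurd h h3.ne'⟩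
      have hs1 : -(m * v.2) ≤ skew m v := by
        have := mul_nonneg a.1 (by linarith : 0 ≤ 1 + 2 * m * v.2)
        rw [skew]; linarith
      have hs2 : skew m v ≤ 1 + m * v.2 := by
        have := mul_nonneg (sub_nonneg.2 a.2) (by linarith : 0 ≤ 1 + 2 * m * v.2)
        rw [skew]; linarith
      change clampI (skew m v) + (skew m v - clampI (skew m v)) / v.2 ∈ _
      rcases le_total (skew m v) 0 with h | h
      · rw [clampI_of_nonpos h, zero_add, sub_zero]
        refine ⟨?_, (div_nonpos_of_nonpos_of_nonneg h h3.le).trans (by linarith)⟩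
        rw [le_div_iff₀ h3]; linarith
      rcases le_total (skew m v) 1 with h1 | h1
      · rw [clampI_of_mem h h1, sub_self, zero_div, add_zero]
        constructor <;> linarith
      · rw [clampI_of_one_le h1]
        have h5 : 0 ≤ (skew m v - 1) / v.2 := div_nonneg (by linarith) h3.le
        have h6 : (skew m v - 1) / v.2 ≤ m := by rw [div_le_iff₀ h3]; linarith
        constructor <;> linarith
    · have h3 := h3.symm
      have h4 : v.1 ∉ F := fun h => c ⟨h3, h⟩
      have h5 : v.1 ∈ Ioo (0:ℝ) 1 :=
        ⟨a.1.lt_of_ne' fun h => h4 (by rwa [h]), a.2.lt_of_ne fun h => h4 (by rwa [h])⟩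
      have h6 : (unpinch m v).1 = v.1 := by
        simp [unpinch, skew, h3, clampI_of_mem h5.1.le h5.2.le]
      have h7 : v.1 ∈ Icc (-m) (1 + m) := ⟨by linarith [h5.1], by linarith [h5.2]⟩
      exact ⟨by rwa [h6], b, fun _ => by rw [h6]; exact ⟨h5, h4⟩⟩
  left v hv := by
    obtain ⟨a, b, c⟩ := hv
    refine Prod.ext ?_ rfl
    change clampI (skew m (pinch m v)) + (skew m (pinch m v) - clampI (skew m (pinch m v))) / v.2 = _
    rw [skew_pinch hm b.1, clampI_add_mul b.1]
    rcases b.1.lt_or_eq with h3 | h3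
    · field_simp
      ring
    · have h4 := c h3.symm
      rw [clampI_of_mem h4.1.1.le h4.1.2.le]
      simp
  right v hv := by
    obtain ⟨a, b, c⟩ := hv
    refine Prod.ext ?_ rfl
    have : (0:ℝ) < 1 + 2 * m * v.2 := by have := b.1; positivity
    have key : clampI (unpinch m v).1 + v.2 * ((unpinch m v).1 - clampI (unpinch m v).1) = skew m v := by
      rcases b.1.lt_or_eq with h3 | h3
      · have h5 : clampI (unpinch m v).1 = clampI (skew m v) := by
          have := clampI_add_mul (a := skew m v) (Y := v.2⁻¹) (by positivity)
          rwa [inv_mul_eq_div] at this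
        rw [h5]
        simp only [unpinch]
        field_simp
        ring
      · have h3 := h3.symm
        have h4 : v.1 ∉ F := fun h => c ⟨h3, h⟩
        simp only [unpinch, skew, h3]
        simp [clampI_of_mem a.1 a.2]
    change (clampI (unpinch m v).1 + v.2 * ((unpinch m v).1 - clampI (unpinch m v).1) + m * v.2) /
      (1 + 2 * m * v.2) = _
    rw [key, skew, div_eq_iff this.ne']
    ring
  cont v hv := by
    have : (1 + 2 * m * v.2) ≠ 0 := by have := hv.2.1.1; positivity
    have hc := continuous_clampI
    have h1 : ContinuousAt (fun v : ℝ × ℝ => (clampI v.1 + v.2 * (v.1 - clampI v.1) + m * v.2) /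
        (1 + 2 * m * v.2)) v := ContinuousAt.div (by fun_prop) (by fun_prop) this
    exact (h1.prodMk continuousAt_snd).continuousWithinAt
  cont' v hv := by
    obtain ⟨a, b, c⟩ := hv
    have hc := continuous_clampI
    have hs : Continuous (skew m) := by unfold skew; fun_prop
    rcases eq_or_ne v.2 0 with h3 | h3
    · have h4 : v.1 ∉ F := fun h => c ⟨h3, h⟩
      have h5 : v.1 ∈ Ioo (0:ℝ) 1 :=
        ⟨a.1.lt_of_ne' fun h => h4 (by rwa [h]), a.2.lt_of_ne fun h => h4 (by rwa [h])⟩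
      have h6 : ∀ᶠ w in 𝓝 v, skew m w ∈ Ioo (0:ℝ) 1 :=
        hs.continuousAt.eventually_mem (isOpen_Ioo.mem_nhds (by simpa [skew, h3] using h5))
      have h7 : ContinuousAt (fun w : ℝ × ℝ => (skew m w, w.2)) v := by fun_prop
      refine (h7.congr (h6.mono fun w hw => ?_)).continuousWithinAt
      rw [unpinch, clampI_of_mem hw.1.le hw.2.le]
      simp
    · unfold unpinch
      exact ((ContinuousAt.add (by fun_prop) (ContinuousAt.div (by fun_prop) (by fun_prop) h3)).prodMk
        continuousAt_snd).continuousWithinAt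

lemma pinch_boundary {m : ℝ} (hm : 0 < m) {F : Set ℝ} {v : ℝ × ℝ} (hv : v ∈ rectDom m F) :
    ((pinch m v).1 = 0 ∨ (pinch m v).1 = 1 ∨ (pinch m v).2 = 0 ∨ (pinch m v).2 = 1) ↔
      (v.1 = -m ∨ v.1 = 1 + m ∨ v.2 = 0 ∨ v.2 = 1) := by
  obtain ⟨⟨a0, a1⟩, b, -⟩ := hv
  change (_ ∨ _ ∨ v.2 = 0 ∨ v.2 = 1) ↔ _
  rcases eq_or_ne v.2 0 with h | h
  · simp [h]
  have hY : 0 < v.2 := b.1.lt_of_ne' h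
  have hp := skew_pinch hm (v := v) b.1
  have h5 : (0:ℝ) < 1 + 2 * m * v.2 := by positivity
  have e : (pinch m v).1 * (1 + 2 * m * v.2) - m * v.2 = clampI v.1 + v.2 * (v.1 - clampI v.1) := hp
  have hmY : 0 < m * v.2 := by positivity
  have e0 : (pinch m v).1 = 0 ↔ v.1 = -m := by
    constructor
    · intro h0
      rw [h0] at e
      rcases le_total v.1 0 with h | h
      · rw [clampI_of_nonpos h] at e
        nlinarith
      · rcases le_total v.1 1 with h' | h'
        · rw [clampI_of_mem h h'] at e
          linarith
        · rw [clampI_of_one_le h'] at e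
          nlinarith
    · intro h0
      rw [h0, clampI_of_nonpos (by linarith)] at e
      have : (pinch m v).1 * (1 + 2 * m * v.2) = 0 := by linarith
      exact (mul_eq_zero.1 this).resolve_right h5.ne'
  have e1 : (pinch m v).1 = 1 ↔ v.1 = 1 + m := by
    constructor
    · intro h0
      rw [h0] at e
      rcases le_total v.1 0 with h | h
      · rw [clampI_of_nonpos h] at e
        nlinarith
      · rcases le_total v.1 1 with h' | h'
        · rw [clampI_of_mem h h'] at e
          linarith
        · rw [clampI_of_one_le h'] at e
          nlinarith
    · intro h0
      rw [h0, clampI_of_one_le (by linarith)] at e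
      have : ((pinch m v).1 - 1) * (1 + 2 * m * v.2) = 0 := by linarith
      exact sub_eq_zero.1 ((mul_eq_zero.1 this).resolve_right h5.ne')
  rw [e0, e1]

namespace Profile

variable {F : Set ℝ} (p : Profile F)

/-- The closed domain of the profile, in the open upper half-plane. -/
def M : Set (ℝ × ℝ) := {z | z.1 ∈ Icc 0 Real.pi ∧ z.2 ∈ Icc (p.g z.1) 1 ∧ 0 < z.2}

def m : ℝ := (1 - p.τ) / (2 * p.τ)

lemma m_pos : 0 < p.m := div_pos (sub_pos.2 p.τ_lt) (by linarith [p.τ_pos])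

def toRect (z : ℝ × ℝ) : ℝ × ℝ :=
  ((Real.cos z.1 + p.τ) / (2 * p.τ), (z.2 - p.g z.1) / (1 - p.g z.1))

def ofRect (v : ℝ × ℝ) : ℝ × ℝ :=
  (Real.arccos (2 * p.τ * v.1 - p.τ), p.g (Real.arccos (2 * p.τ * v.1 - p.τ)) +
    (1 - p.g (Real.arccos (2 * p.τ * v.1 - p.τ))) * v.2)

lemma cos_mem (x : ℝ) : (Real.cos x + p.τ) / (2 * p.τ) ∈ Icc (-p.m) (1 + p.m) := by
  have := p.τ_pos
  have h1 := Real.neg_one_le_cos x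
  have h2 := Real.cos_le_one x
  have e1 : -p.m = (-1 + p.τ) / (2 * p.τ) := by rw [m]; ring
  have e2 : 1 + p.m = (1 + p.τ) / (2 * p.τ) := by rw [m]; field_simp; ring
  rw [e1, e2]
  constructor <;> gcongr

lemma arg_mem {a : ℝ} (ha : a ∈ Icc (-p.m) (1 + p.m)) :
    -1 ≤ 2 * p.τ * a - p.τ ∧ 2 * p.τ * a - p.τ ≤ 1 := by
  have h0 := p.τ_pos
  have e1 : 2 * p.τ * p.m = 1 - p.τ := by rw [m]; field_simp
  have h1 := mul_le_mul_of_nonneg_left ha.1 (by positivity : 0 ≤ 2 * p.τ)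
  have h2 := mul_le_mul_of_nonneg_left ha.2 (by positivity : 0 ≤ 2 * p.τ)
  constructor <;> nlinarith

lemma cos_eq (x : ℝ) : 2 * p.τ * ((Real.cos x + p.τ) / (2 * p.τ)) - p.τ = Real.cos x := by
  have := p.τ_pos
  field_simp
  ring

lemma g_pos_iff {x : ℝ} (hx : x ∈ Icc 0 Real.pi) :
    0 < p.g x ↔ (Real.cos x + p.τ) / (2 * p.τ) ∈ Ioo (0:ℝ) 1 \ F := by
  have h0 := p.τ_pos
  rw [p.zero x hx, abs_lt, Set.mem_sdiff, mem_Ioo, div_lt_one (by positivity)]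
  refine and_congr_left fun _ => ⟨fun h => ⟨div_pos (by linarith) (by positivity), by linarith⟩,
    fun h => ⟨?_, by linarith⟩⟩
  have := (div_pos_iff_of_pos_right (by positivity : 0 < 2 * p.τ)).1 h.1
  linarith

lemma homeoOn_toRect : HomeoOn p.toRect p.ofRect p.M (rectDom p.m F) where
  mapsTo z hz := by
    obtain ⟨a, b, c⟩ := hz
    have h1 := sub_pos.2 (p.lt_one z.1)
    refine ⟨p.cos_mem _, ⟨div_nonneg (sub_nonneg.2 b.1) h1.le, ?_⟩, fun h => ?_⟩
    · rw [toRect, div_le_one h1]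
      linarith [b.2]
    · rw [toRect, div_eq_zero_iff, or_iff_left h1.ne', sub_eq_zero] at h
      exact (p.g_pos_iff a).1 (h ▸ c)
  mapsTo' v hv := by
    obtain ⟨a, b, c⟩ := hv
    obtain ⟨h1, h2⟩ := p.arg_mem a
    have hx : Real.arccos (2 * p.τ * v.1 - p.τ) ∈ Icc 0 Real.pi :=
      ⟨Real.arccos_nonneg _, Real.arccos_le_pi _⟩
    have h3 := sub_pos.2 (p.lt_one (Real.arccos (2 * p.τ * v.1 - p.τ)))
    have h4 := mul_nonneg h3.le b.1
    have h5 := mul_nonneg h3.le (sub_nonneg.2 b.2)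
    refine ⟨hx, ⟨?_, ?_⟩, ?_⟩
    · simp only [ofRect]; linarith
    · simp only [ofRect]; linarith
    · simp only [ofRect]
      rcases b.1.lt_or_eq with h | h
      · have := p.nonneg (Real.arccos (2 * p.τ * v.1 - p.τ))
        have := mul_pos h3 h
        linarith
      · have h6 : 0 < p.g (Real.arccos (2 * p.τ * v.1 - p.τ)) := by
          rw [p.g_pos_iff hx, Real.cos_arccos h1 h2]
          convert c h.symm using 1
          have := p.τ_pos
          field_simp
          ring
        linarith
  left z hz := by
    have h := sub_pos.2 (p.lt_one z.1)
    have e : Real.arccos (2 * p.τ * (p.toRect z).1 - p.τ) = z.1 := by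
      rw [toRect, p.cos_eq, Real.arccos_cos hz.1.1 hz.1.2]
    rw [ofRect, e]
    refine Prod.ext rfl ?_
    simp only [toRect]
    field_simp
    ring
  right v hv := by
    obtain ⟨h1, h2⟩ := p.arg_mem hv.1
    have h := sub_pos.2 (p.lt_one (Real.arccos (2 * p.τ * v.1 - p.τ)))
    have := p.τ_pos
    simp only [toRect, ofRect]
    rw [Real.cos_arccos h1 h2]
    refine Prod.ext ?_ ?_
    · simp only
      field_simp
      ring
    · simp only
      rw [add_sub_cancel_left, mul_div_cancel_left₀ _ h.ne']
  cont := by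
    have hg := p.cont
    have hc : Continuous p.toRect := by
      unfold toRect
      exact (by fun_prop : Continuous fun z : ℝ × ℝ => (Real.cos z.1 + p.τ) / (2 * p.τ)).prodMk
        (Continuous.div (by fun_prop) (by fun_prop) fun z => (sub_pos.2 (p.lt_one z.1)).ne')
    exact hc.continuousOn
  cont' := by
    have hg := p.cont
    have := Real.continuous_arccos
    unfold ofRect
    fun_prop

lemma toRect_boundary {z : ℝ × ℝ} (hz : z ∈ p.M) :
    ((p.toRect z).1 = -p.m ∨ (p.toRect z).1 = 1 + p.m ∨ (p.toRect z).2 = 0 ∨ (p.toRect z).2 = 1) ↔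
      (z.1 = Real.pi ∨ z.1 = 0 ∨ z.2 = p.g z.1 ∨ z.2 = 1) := by
  obtain ⟨a, b, c⟩ := hz
  have h0 := p.τ_pos
  have h1 := sub_pos.2 (p.lt_one z.1)
  have e1 : (p.toRect z).1 = -p.m ↔ z.1 = Real.pi := by
    rw [toRect, m, ← neg_div, div_left_inj' (by positivity)]
    constructor
    · intro h
      exact Real.injOn_cos a ⟨Real.pi_pos.le, le_rfl⟩ (by rw [Real.cos_pi]; linarith)
    · intro h
      rw [h, Real.cos_pi]; ring
  have e2 : (p.toRect z).1 = 1 + p.m ↔ z.1 = 0 := by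
    have : 1 + p.m = (1 + p.τ) / (2 * p.τ) := by rw [m]; field_simp; ring
    rw [this, toRect, div_left_inj' (by positivity)]
    constructor
    · intro h
      exact Real.injOn_cos a ⟨le_rfl, Real.pi_pos.le⟩ (by rw [Real.cos_zero]; linarith)
    · intro h
      rw [h, Real.cos_zero]
  have e3 : (p.toRect z).2 = 0 ↔ z.2 = p.g z.1 := by
    rw [toRect, div_eq_zero_iff, or_iff_left h1.ne', sub_eq_zero]
  have e4 : (p.toRect z).2 = 1 ↔ z.2 = 1 := by
    rw [toRect, div_eq_one_iff_eq h1.ne', sub_left_inj]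
  rw [e1, e2, e3, e4]

def toHalf (z : ℝ × ℝ) : ℝ × ℝ := sqToHalf (pinch p.m (p.toRect z))

def ofHalf (v : ℝ × ℝ) : ℝ × ℝ := p.ofRect (unpinch p.m (halfToSq v))

lemma homeoOn_toHalf (hF : F ⊆ Icc 0 1) (h0 : (0:ℝ) ∈ F) (h1 : (1:ℝ) ∈ F) :
    HomeoOn p.toHalf p.ofHalf p.M (halfDom F) :=
  (p.homeoOn_toRect.trans (homeoOn_pinch p.m_pos h0 h1)).trans (homeoOn_sqToHalf hF h0)

lemma toHalf_boundary (h0 : (0:ℝ) ∈ F) (h1 : (1:ℝ) ∈ F) {z : ℝ × ℝ}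
    (hz : z ∈ p.M) :
    (p.toHalf z).2 = 0 ↔ (z.1 = Real.pi ∨ z.1 = 0 ∨ z.2 = p.g z.1 ∨ z.2 = 1) := by
  have h2 := p.homeoOn_toRect.mapsTo z hz
  rw [toHalf, sqToHalf_snd_eq_zero h0 ((homeoOn_pinch p.m_pos h0 h1).mapsTo _ h2),
    pinch_boundary p.m_pos h2, p.toRect_boundary hz]

end Profile

/-- The Cayley transform from the upper half-plane to the disk. -/
def cay (z : ℝ × ℝ) : E2 :=
  !₂[(z.1 ^ 2 + z.2 ^ 2 - 1) / (z.1 ^ 2 + (z.2 + 1) ^ 2), -2 * z.1 / (z.1 ^ 2 + (z.2 + 1) ^ 2)]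

def cayDen (p : E2) : ℝ := (1 - p 0) ^ 2 + p 1 ^ 2

/-- The inverse Cayley transform. -/
def cayInv (p : E2) : ℝ × ℝ := (-2 * p 1 / cayDen p, (1 - p 0 ^ 2 - p 1 ^ 2) / cayDen p)

lemma norm_sq_E2 (p : E2) : ‖p‖ ^ 2 = p 0 ^ 2 + p 1 ^ 2 := by
  rw [EuclideanSpace.norm_sq_eq]
  simp

lemma mem_Disk {p : E2} : p ∈ Disk ↔ p 0 ^ 2 + p 1 ^ 2 < 1 := by
  rw [← norm_sq_E2, sq_lt_one_iff₀ (norm_nonneg _)]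
  rfl

lemma isOpen_Disk : IsOpen Disk := isOpen_lt continuous_norm continuous_const

lemma cayDen_pos {p : E2} (hp : p ∈ Disk) : 0 < cayDen p := by
  rw [mem_Disk] at hp
  have : p 0 < 1 := by nlinarith [sq_nonneg (p 1)]
  unfold cayDen
  have : 0 < 1 - p 0 := by linarith
  positivity

lemma cayInv_snd_pos {p : E2} (hp : p ∈ Disk) : 0 < (cayInv p).2 :=
  div_pos (by rw [mem_Disk] at hp; linarith) (cayDen_pos hp)

lemma continuousAt_cayInv {p : E2} (hp : cayDen p ≠ 0) : ContinuousAt cayInv p := by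
  have : Continuous cayDen := by unfold cayDen; fun_prop
  have h1 : ContinuousAt (fun p : E2 => -2 * p 1 / cayDen p) p :=
    ContinuousAt.div (by fun_prop) this.continuousAt hp
  have h2 : ContinuousAt (fun p : E2 => (1 - p 0 ^ 2 - p 1 ^ 2) / cayDen p) p :=
    ContinuousAt.div (by fun_prop) this.continuousAt hp
  exact h1.prodMk h2

lemma cay_den_pos {z : ℝ × ℝ} (hz : 0 ≤ z.2) : 0 < z.1 ^ 2 + (z.2 + 1) ^ 2 := by positivity

lemma continuousAt_cay {z : ℝ × ℝ} (hz : 0 ≤ z.2) : ContinuousAt cay z := by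
  have h := (cay_den_pos hz).ne'
  have h1 : ContinuousAt (fun z : ℝ × ℝ =>
      (z.1 ^ 2 + z.2 ^ 2 - 1) / (z.1 ^ 2 + (z.2 + 1) ^ 2)) z :=
    ContinuousAt.div (by fun_prop) (by fun_prop) h
  have h2 : ContinuousAt (fun z : ℝ × ℝ => -2 * z.1 / (z.1 ^ 2 + (z.2 + 1) ^ 2)) z :=
    ContinuousAt.div (by fun_prop) (by fun_prop) h
  refine (PiLp.continuous_toLp 2 _).continuousAt.comp (continuousAt_pi.2 fun i => ?_)
  fin_cases i
  · exact h1
  · exact h2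

lemma cayDen_cay {z : ℝ × ℝ} (hz : 0 ≤ z.2) : cayDen (cay z) = 4 / (z.1 ^ 2 + (z.2 + 1) ^ 2) := by
  have h := (cay_den_pos hz).ne'
  simp only [cayDen, cay, PiLp.toLp_apply, Matrix.cons_val_zero, Matrix.cons_val_one]
  field_simp
  ring

lemma cayDen_cay_pos {z : ℝ × ℝ} (hz : 0 ≤ z.2) : 0 < cayDen (cay z) := by
  rw [cayDen_cay hz]
  have := cay_den_pos hz
  positivity

lemma cayInv_cay {z : ℝ × ℝ} (hz : 0 ≤ z.2) : cayInv (cay z) = z := by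
  have h := (cay_den_pos hz).ne'
  rw [cayInv, cayDen_cay hz]
  simp only [cay, PiLp.toLp_apply, Matrix.cons_val_zero, Matrix.cons_val_one]
  refine Prod.ext ?_ ?_
  · simp only
    field_simp
    ring
  · simp only
    field_simp
    ring

lemma norm_cay_sq {z : ℝ × ℝ} (hz : 0 ≤ z.2) :
    ‖cay z‖ ^ 2 = 1 - 4 * z.2 / (z.1 ^ 2 + (z.2 + 1) ^ 2) := by
  have h := (cay_den_pos hz).ne'
  rw [norm_sq_E2]
  simp only [cay, PiLp.toLp_apply, Matrix.cons_val_zero, Matrix.cons_val_one]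
  field_simp
  ring

lemma cay_mem_Disk {z : ℝ × ℝ} (hz : 0 < z.2) : cay z ∈ Disk := by
  have h := cay_den_pos hz.le
  have h2 : ‖cay z‖ ^ 2 < 1 := by
    rw [norm_cay_sq hz.le]
    have : 0 < 4 * z.2 / (z.1 ^ 2 + (z.2 + 1) ^ 2) := by positivity
    linarith
  exact (sq_lt_one_iff₀ (norm_nonneg _)).1 h2

lemma cay_cayInv {p : E2} (hp : p ∈ Disk) : cay (cayInv p) = p := by
  have h := (cayDen_pos hp).ne'
  have h2 := cay_den_pos (cayInv_snd_pos hp).le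
  have h3 : (cayInv p).1 ^ 2 + ((cayInv p).2 + 1) ^ 2 = 4 / cayDen p := by
    simp only [cayInv]
    field_simp
    simp only [cayDen]
    ring
  have key : ∀ i, cay (cayInv p) i = p i := by
    intro i
    fin_cases i
    · change ((cayInv p).1 ^ 2 + (cayInv p).2 ^ 2 - 1) / _ = p 0
      rw [h3]
      simp only [cayInv]
      field_simp
      simp only [cayDen]
      ring
    · change -2 * (cayInv p).1 / _ = p 1
      rw [h3]
      simp only [cayInv]
      field_simp
      ring
  exact PiLp.ext key

def eform (a b : ℝ) : E2 →L[ℝ] ℝ :=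
  a • EuclideanSpace.proj (𝕜 := ℝ) (0 : Fin 2) + b • EuclideanSpace.proj (𝕜 := ℝ) (1 : Fin 2)

lemma eform_apply (a b : ℝ) (v : E2) : eform a b v = a * v 0 + b * v 1 := by simp [eform]

lemma eform_single_zero (a b : ℝ) : eform a b (EuclideanSpace.single 0 1) = a := by
  simp [eform_apply]

lemma eform_single_one (a b : ℝ) : eform a b (EuclideanSpace.single 1 1) = b := by
  simp [eform_apply]

lemma gradient_of_eform {f : E2 → ℝ} {a b : ℝ} {p : E2} (h : HasFDerivAt f (eform a b) p) :
    gradient f p = !₂[a, b] := by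
  refine HasGradientAt.gradient ?_
  rw [hasGradientAt_iff_hasFDerivAt]
  refine h.congr_fderiv ?_
  ext v
  simp [eform_apply, PiLp.inner_apply, Fin.sum_univ_two]
  ring

lemma div0_of_eform {X : E2 → E2} {p : E2} {a b c d : ℝ}
    (h0 : HasFDerivAt (fun q => X q 0) (eform a b) p)
    (h1 : HasFDerivAt (fun q => X q 1) (eform c d) p) : div0 X p = a + d := by
  have hX : DifferentiableAt ℝ X p := by
    rw [differentiableAt_euclidean]
    intro i
    fin_cases i
    · exact h0.differentiableAt
    · exact h1.differentiableAt
  have key : ∀ i : Fin 2, ∀ v, fderiv ℝ X p v i = fderiv ℝ (fun q => X q i) p v := by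
    intro i v
    have := ((EuclideanSpace.proj (𝕜 := ℝ) i : E2 →L[ℝ] ℝ).hasFDerivAt.comp p hX.hasFDerivAt).fderiv
    change fderiv ℝ (fun q => X q i) p = _ at this
    rw [this]
    simp
  rw [div0, Fin.sum_univ_two, key, key, h0.fderiv, h1.fderiv, eform_single_zero, eform_single_one]

def cayR (p : E2) : ℝ := 2 * ((1 - p 0) ^ 2 - p 1 ^ 2) / cayDen p ^ 2

def cayI (p : E2) : ℝ := 4 * (1 - p 0) * p 1 / cayDen p ^ 2

lemma hasFDerivAt_coord_zero (p : E2) : HasFDerivAt (fun q : E2 => q 0) (eform 1 0) p :=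
  (EuclideanSpace.proj (𝕜 := ℝ) (0 : Fin 2) : E2 →L[ℝ] ℝ).hasFDerivAt.congr_fderiv (by simp [eform])

lemma hasFDerivAt_coord_one (p : E2) : HasFDerivAt (fun q : E2 => q 1) (eform 0 1) p :=
  (EuclideanSpace.proj (𝕜 := ℝ) (1 : Fin 2) : E2 →L[ℝ] ℝ).hasFDerivAt.congr_fderiv (by simp [eform])

section calculus

variable {f g : E2 → ℝ} {p : E2} {a b c d : ℝ}

lemma eform_mul (hf : HasFDerivAt f (eform a b) p) (hg : HasFDerivAt g (eform c d) p) :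
    HasFDerivAt (fun q => f q * g q) (eform (f p * c + g p * a) (f p * d + g p * b)) p :=
  (hf.mul hg).congr_fderiv (by ext v; simp [eform_apply]; ring)

lemma eform_add (hf : HasFDerivAt f (eform a b) p) (hg : HasFDerivAt g (eform c d) p) :
    HasFDerivAt (fun q => f q + g q) (eform (a + c) (b + d)) p :=
  (hf.add hg).congr_fderiv (by ext v; simp [eform_apply]; ring)

lemma eform_div (hf : HasFDerivAt f (eform a b) p) (hg : HasFDerivAt g (eform c d) p)
    (h : g p ≠ 0) : HasFDerivAt (fun q => f q / g q)
      (eform ((a * g p - f p * c) / g p ^ 2) ((b * g p - f p * d) / g p ^ 2)) p := by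
  have := eform_mul hf (((hasDerivAt_inv h).comp_hasFDerivAt p hg).congr_fderiv
    (f' := _) (g' := eform (-(g p ^ 2)⁻¹ * c) (-(g p ^ 2)⁻¹ * d))
    (by ext v; simp [eform_apply]; ring))
  simp only [Function.comp_def] at this
  simp only [div_eq_mul_inv (f _)]
  refine this.congr_fderiv ?_
  congr 1 <;> (field_simp; ring)

lemma eform_comp {F : ℝ × ℝ → ℝ} {P Q : ℝ} {G : E2 → ℝ × ℝ}
    (hF : HasFDerivAt F (Series.form P Q) (G p)) (h1 : HasFDerivAt (fun q => (G q).1) (eform a b) p)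
    (h2 : HasFDerivAt (fun q => (G q).2) (eform c d) p) :
    HasFDerivAt (fun q => F (G q)) (eform (P * a + Q * c) (P * b + Q * d)) p := by
  have := hF.comp p (h1.prodMk h2)
  exact this.congr_fderiv (by ext v; simp [eform_apply, Series.form]; ring)

end calculus

lemma hasFDerivAt_cayDen (p : E2) :
    HasFDerivAt cayDen (eform (-2 * (1 - p 0)) (2 * p 1)) p := by
  have h1 : HasFDerivAt (fun q : E2 => 1 - q 0) (eform (-1) 0) p :=
    ((hasFDerivAt_coord_zero p).const_sub 1).congr_fderiv (by ext v; simp [eform_apply])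
  have h2 := hasFDerivAt_coord_one p
  have := eform_add (eform_mul h1 h1) (eform_mul h2 h2)
  refine (this.congr_fderiv ?_).congr_of_eventuallyEq (Eventually.of_forall fun q => ?_)
  · congr 1 <;> ring
  · simp only [cayDen]; ring

lemma hasFDerivAt_cayInv_fst {p : E2} (hp : cayDen p ≠ 0) :
    HasFDerivAt (fun q => (cayInv q).1) (eform (-cayI p) (-cayR p)) p := by
  have h1 : HasFDerivAt (fun q : E2 => -2 * q 1) (eform 0 (-2)) p :=
    ((hasFDerivAt_coord_one p).const_mul (-2)).congr_fderiv (by ext v; simp [eform_apply])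
  refine (eform_div h1 (hasFDerivAt_cayDen p) hp).congr_fderiv ?_
  simp only [cayI, cayR]
  congr 1
  · field_simp; ring
  · field_simp; simp only [cayDen]; ring

lemma hasFDerivAt_cayInv_snd {p : E2} (hp : cayDen p ≠ 0) :
    HasFDerivAt (fun q => (cayInv q).2) (eform (cayR p) (-cayI p)) p := by
  have h1 : HasFDerivAt (fun q : E2 => 1 - q 0 ^ 2 - q 1 ^ 2) (eform (-2 * p 0) (-2 * p 1)) p := by
    have := ((eform_add (eform_mul (hasFDerivAt_coord_zero p) (hasFDerivAt_coord_zero p))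
      (eform_mul (hasFDerivAt_coord_one p) (hasFDerivAt_coord_one p))).const_sub 1).congr_fderiv
        (g' := eform (-2 * p 0) (-2 * p 1)) (by ext v; simp [eform_apply]; ring)
    exact this.congr_of_eventuallyEq (Eventually.of_forall fun q => by simp only; ring)
  refine (eform_div h1 (hasFDerivAt_cayDen p) hp).congr_fderiv ?_
  simp only [cayI, cayR]
  congr 1
  · field_simp; simp only [cayDen]; ring
  · field_simp; simp only [cayDen]; ring

lemma exists_hasFDerivAt_cayR {p : E2} (hp : cayDen p ≠ 0) : ∃ r s,
    HasFDerivAt cayR (eform r s) p ∧ HasFDerivAt cayI (eform (-s) r) p := by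
  have hN := hasFDerivAt_cayDen p
  have hN2 := eform_mul hN hN
  have h1 : HasFDerivAt (fun q : E2 => 1 - q 0) (eform (-1) 0) p :=
    ((hasFDerivAt_coord_zero p).const_sub 1).congr_fderiv (by ext v; simp [eform_apply])
  have h2 := hasFDerivAt_coord_one p
  have h3 : HasFDerivAt (fun q : E2 => 2 * ((1 - q 0) ^ 2 - q 1 ^ 2))
      (eform (-4 * (1 - p 0)) (-4 * p 1)) p := by
    have := (((eform_mul h1 h1).sub (eform_mul h2 h2)).const_mul 2).congr_fderiv
        (g' := eform (-4 * (1 - p 0)) (-4 * p 1)) (by ext v; simp [eform_apply]; ring)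
    exact this.congr_of_eventuallyEq (Eventually.of_forall fun q => by simp only [Pi.sub_apply]; ring)
  have h4 : HasFDerivAt (fun q : E2 => 4 * (1 - q 0) * q 1)
      (eform (-4 * p 1) (4 * (1 - p 0))) p := by
    have := ((eform_mul h1 h2).const_mul 4).congr_fderiv
        (g' := eform (-4 * p 1) (4 * (1 - p 0))) (by ext v; simp [eform_apply]; ring)
    exact this.congr_of_eventuallyEq (Eventually.of_forall fun q => by simp only; ring)
  have hne : cayDen p * cayDen p ≠ 0 := mul_ne_zero hp hp
  have e3 := eform_div h3 hN2 hne
  have e4 := eform_div h4 hN2 hne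
  refine ⟨_, _, e3.congr_of_eventuallyEq (Eventually.of_forall fun q => by simp only [cayR]; ring),
    (e4.congr_of_eventuallyEq
      (Eventually.of_forall fun q => by simp only [cayI]; ring)).congr_fderiv ?_⟩
  congr 1
  · field_simp; simp only [cayDen]; ring
  · field_simp; simp only [cayDen]; ring

lemma cayR_sq_add {p : E2} (hp : cayDen p ≠ 0) : cayR p ^ 2 + cayI p ^ 2 = 4 / cayDen p ^ 2 := by
  simp only [cayI, cayR]
  field_simp
  simp only [cayDen]
  ring

/-- The minimal surface equation in the half-plane model transfers to the disk model. -/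
theorem div0_Xfield_comp_cayInv {U P Q A B C : ℝ × ℝ → ℝ} {O : Set (ℝ × ℝ)} (hO : IsOpen O)
    (hU : ∀ z ∈ O, HasFDerivAt U (Series.form (P z) (Q z)) z)
    (hP : ∀ z ∈ O, HasFDerivAt P (Series.form (A z) (B z)) z)
    (hQ : ∀ z ∈ O, HasFDerivAt Q (Series.form (B z) (C z)) z)
    (hpde : ∀ z ∈ O, A z + C z = z.2 * (Q z * (P z ^ 2 + Q z ^ 2)) -
      z.2 ^ 2 * (Q z ^ 2 * A z + P z ^ 2 * C z - 2 * P z * Q z * B z))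
    {p : E2} (hp : p ∈ Disk) (hpO : cayInv p ∈ O) : div0 (Xfield fun q => U (cayInv q)) p = 0 := by
  have hN := (cayDen_pos hp).ne'
  set W : ℝ × ℝ → ℝ := fun z => 1 + z.2 ^ 2 * (P z ^ 2 + Q z ^ 2) with hW
  have hWpos : ∀ z, 0 < W z := fun z => by simp only [hW]; positivity
  set a : E2 → ℝ := fun q => (√(W (cayInv q)))⁻¹ *
    (P (cayInv q) * -cayI q + Q (cayInv q) * cayR q) with ha
  set b : E2 → ℝ := fun q => (√(W (cayInv q)))⁻¹ *
    (P (cayInv q) * -cayR q + Q (cayInv q) * -cayI q) with hb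
  have hev : ∀ᶠ q in 𝓝 p, Xfield (fun q => U (cayInv q)) q = !₂[a q, b q] := by
    filter_upwards [isOpen_Disk.mem_nhds hp, (continuousAt_cayInv hN).eventually_mem
      (hO.mem_nhds hpO)] with q hq hqO
    have hq0 := (cayDen_pos hq).ne'
    have hgr := gradient_of_eform (eform_comp (hU _ hqO) (hasFDerivAt_cayInv_fst hq0)
      (hasFDerivAt_cayInv_snd hq0))
    have hw : 1 + ((lam q)⁻¹) ^ 2 * ‖gradient (fun q => U (cayInv q)) q‖ ^ 2 = W (cayInv q) := by
      rw [hgr, norm_sq_E2, lam, norm_sq_E2]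
      simp only [Matrix.cons_val_zero, Matrix.cons_val_one]
      have e : (P (cayInv q) * -cayI q + Q (cayInv q) * cayR q) ^ 2 +
          (P (cayInv q) * -cayR q + Q (cayInv q) * -cayI q) ^ 2 =
          (P (cayInv q) ^ 2 + Q (cayInv q) ^ 2) * (4 / cayDen q ^ 2) := by
        rw [← cayR_sq_add hq0]; ring
      rw [e, hW]
      simp only [cayInv]
      field_simp
      ring
    rw [Xfield, hw, hgr]
    refine PiLp.ext fun i => ?_
    fin_cases i
    · simp [ha]
    · simp [hb]
  set z := cayInv p with hz
  obtain ⟨r, s, hR, hI⟩ := exists_hasFDerivAt_cayR hN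
  have h1 := hasFDerivAt_cayInv_fst hN
  have h2 := hasFDerivAt_cayInv_snd hN
  have hPc := eform_comp (hP z hpO) h1 h2
  have hQc := eform_comp (hQ z hpO) h1 h2
  obtain ⟨w₁, hw₁⟩ : ∃ w, w = 2 * z.2 ^ 2 * (P z * A z + Q z * B z) := ⟨_, rfl⟩
  obtain ⟨w₂, hw₂⟩ : ∃ w, w = 2 * z.2 * (P z ^ 2 + Q z ^ 2) + 2 * z.2 ^ 2 * (P z * B z + Q z * C z) :=
    ⟨_, rfl⟩
  have hWd : HasFDerivAt W (Series.form w₁ w₂) z := by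
    have hs : HasFDerivAt (fun z : ℝ × ℝ => z.2) (Series.form 0 1) z :=
      hasFDerivAt_snd.congr_fderiv (by ext <;> simp [Series.form])
    have := ((hs.mul hs).mul (((hP z hpO).mul (hP z hpO)).add ((hQ z hpO).mul (hQ z hpO)))).const_add 1
    refine (this.congr_fderiv ?_).congr_of_eventuallyEq (Eventually.of_forall fun q => ?_)
    · ext
      · simp [Series.form, hw₁]; ring
      · simp [Series.form, hw₂]; ring
    · simp [hW]; ring
  set σ := √(W z) with hσ
  have hσ0 : 0 < σ := Real.sqrt_pos.2 (hWpos z)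
  have hσ2 : σ ^ 2 = W z := Real.sq_sqrt (hWpos z).le
  have hω : HasFDerivAt (fun z => (√(W z))⁻¹)
      (Series.form (-w₁ / (2 * σ ^ 3)) (-w₂ / (2 * σ ^ 3))) z := by
    have := (hasDerivAt_inv hσ0.ne').comp_hasFDerivAt z (hWd.sqrt (hWpos z).ne')
    refine this.congr_fderiv ?_
    ext
    · simp [Series.form, ← hσ]; field_simp
    · simp [Series.form, ← hσ]; field_simp
  have hωc := eform_comp hω h1 h2
  have hIn : HasFDerivAt (fun q => -cayI q) (eform s (-r)) p :=
    hI.neg.congr_fderiv (by ext v; simp [eform_apply]; ring)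
  have hRn : HasFDerivAt (fun q => -cayR q) (eform (-r) (-s)) p :=
    hR.neg.congr_fderiv (by ext v; simp [eform_apply]; ring)
  have hda := eform_mul hωc (eform_add (eform_mul hPc hIn) (eform_mul hQc hR))
  have hdb := eform_mul hωc (eform_add (eform_mul hPc hRn) (eform_mul hQc hIn))
  rw [div0_of_eform (hda.congr_of_eventuallyEq (hev.mono fun q hq => by beta_reduce; rw [hq]; rfl))
    (hdb.congr_of_eventuallyEq (hev.mono fun q hq => by beta_reduce; rw [hq]; rfl))]
  have hp1 := hpde z hpO
  rw [← hz, ← hσ]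
  have key : σ ^ 2 * (2 * (A z + C z)) = w₁ * P z + w₂ * Q z := by
    rw [hσ2, hw₁, hw₂, hW]
    linear_combination 2 * hp1
  have hω3 : σ⁻¹ = σ ^ 2 / σ ^ 3 := by field_simp
  have e : (cayR p ^ 2 + cayI p ^ 2) / (2 * σ ^ 3) *
      (σ ^ 2 * (2 * (A z + C z)) - (w₁ * P z + w₂ * Q z)) = 0 := by rw [key]; ring
  rw [← e]
  field_simp
  ring

lemma abs_sign_mul {t x : ℝ} (hx : 0 ≤ x) (h : t = 0 → x = 0) : |Real.sign t * x| = x := by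
  rcases lt_trichotomy t 0 with h1 | h1 | h1
  · rw [Real.sign_of_neg h1, neg_one_mul, abs_neg, abs_of_nonneg hx]
  · simp [h h1]
  · rw [Real.sign_of_pos h1, one_mul, abs_of_nonneg hx]

lemma sign_sign_mul_mul_abs {t x : ℝ} (hx : 0 ≤ x) (h : x = 0 → t = 0) :
    Real.sign (Real.sign t * x) * |t| = t := by
  rcases lt_trichotomy t 0 with h1 | h1 | h1
  · have : 0 < x := hx.lt_of_ne' fun h2 => h1.ne (h h2)
    rw [Real.sign_of_neg h1, Real.sign_of_neg (by linarith), abs_of_neg h1]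
    ring
  · simp [h1]
  · have : 0 < x := hx.lt_of_ne' fun h2 => h1.ne' (h h2)
    rw [Real.sign_of_pos h1, Real.sign_of_pos (by linarith), abs_of_pos h1]
    ring

lemma continuousOn_sign_mul {X : Type*} [TopologicalSpace X] {h k : X → ℝ} {s : Set X}
    (hh : ContinuousOn h s) (hk : ContinuousOn k s) (hz : ∀ x ∈ s, h x = 0 → k x = 0) :
    ContinuousOn (fun x => Real.sign (h x) * k x) s := by
  intro x hx
  rcases lt_trichotomy (h x) 0 with h1 | h1 | h1
  · have h2 : ∀ᶠ y in 𝓝[s] x, h y < 0 := (hh x hx).eventually_lt_const h1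
    refine ((hk x hx).const_smul (-1 : ℝ)).congr_of_eventuallyEq
      (h2.mono fun y hy => ?_) ?_
    · change Real.sign (h y) * k y = _
      rw [Real.sign_of_neg hy]; rfl
    · rw [Real.sign_of_neg h1]; rfl
  · have h2 := hz x hx h1
    change Tendsto _ _ (𝓝 (Real.sign (h x) * k x))
    rw [h2, mul_zero]
    have h3 : Tendsto (fun y => |k y|) (𝓝[s] x) (𝓝 0) := by
      have := (hk x hx).abs
      rwa [ContinuousWithinAt, h2, abs_zero] at this
    refine squeeze_zero_norm (fun y => ?_) h3
    rw [norm_mul, Real.norm_eq_abs, Real.norm_eq_abs]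
    refine mul_le_of_le_one_left (abs_nonneg _) ?_
    rcases Real.sign_apply_eq (h y) with h4 | h4 | h4 <;> rw [h4] <;> simp
  · have h2 : ∀ᶠ y in 𝓝[s] x, 0 < h y := (hh x hx).eventually_const_lt h1
    refine ((hk x hx).const_smul (1 : ℝ)).congr_of_eventuallyEq
      (h2.mono fun y hy => ?_) ?_
    · change Real.sign (h y) * k y = _
      rw [Real.sign_of_pos hy]; rfl
    · rw [Real.sign_of_pos h1]; rfl

namespace Profile

variable {F : Set ℝ} (p : Profile F)

/-- The height function, extended continuously to the plane. -/
def ht (z : ℝ × ℝ) : ℝ := Series.S 0 p.s.U (z.1, clampI z.2)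

/-- The open domain of the profile in the half-plane. -/
def O : Set (ℝ × ℝ) := {z | z.1 ∈ Ioo 0 Real.pi ∧ p.g z.1 < z.2 ∧ z.2 < 1}

def Om : Set E2 := {w | w ∈ Disk ∧ cayInv w ∈ p.O}

def htD (w : E2) : ℝ := p.ht (cayInv w)

lemma continuous_ht : Continuous p.ht := by
  have h := continuous_clampI
  exact p.contu.comp_continuous (by fun_prop) fun z =>
    ⟨mem_univ _, le_max_left _ _, max_le zero_le_one (min_le_right _ _)⟩

lemma ht_eq {z : ℝ × ℝ} (h : z.2 ∈ Icc (0:ℝ) 1) : p.ht z = Series.S 0 p.s.U z := by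
  rw [ht, clampI_of_mem h.1 h.2]

lemma isOpen_O : IsOpen p.O := by
  have := p.cont
  have h1 : IsOpen {z : ℝ × ℝ | p.g z.1 < z.2} := isOpen_lt (by fun_prop) (by fun_prop)
  have h2 : IsOpen {z : ℝ × ℝ | z.2 < 1} := isOpen_lt (by fun_prop) (by fun_prop)
  exact (isOpen_Ioo.preimage continuous_fst).inter (h1.inter h2)

lemma mem_strip {z : ℝ × ℝ} (h : z ∈ p.O) : z.2 ∈ Ioo (0:ℝ) 1 :=
  ⟨(p.nonneg _).trans_lt h.2.1, h.2.2⟩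

lemma O_subset_M {z : ℝ × ℝ} (h : z ∈ p.O) : z ∈ p.M :=
  ⟨Ioo_subset_Icc_self h.1, ⟨h.2.1.le, h.2.2.le⟩, (p.mem_strip h).1⟩

lemma ht_pos {z : ℝ × ℝ} (h : z ∈ p.O) : 0 < p.ht z := by
  rw [p.ht_eq (Ioo_subset_Icc_self (p.mem_strip h))]
  exact (p.sgn z.1 h.1 z.2 (p.mem_strip h)).2 h.2.1

lemma ht_eq_zero {z : ℝ × ℝ} (h : z ∈ p.M)
    (hb : z.1 = Real.pi ∨ z.1 = 0 ∨ z.2 = p.g z.1 ∨ z.2 = 1) : p.ht z = 0 := by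
  rw [p.ht_eq ⟨h.2.2.le, h.2.1.2⟩]
  obtain ⟨x, y⟩ := z
  obtain ⟨h1, h2, h3⟩ := h
  simp only at hb h1 h2 h3
  rcases hb with rfl | rfl | rfl | rfl
  · exact p.right _
  · exact p.left _
  · exact p.bot _ h3
  · exact p.top _

lemma mem_O_of_mem_M {z : ℝ × ℝ} (h : z ∈ p.M)
    (hb : ¬ (z.1 = Real.pi ∨ z.1 = 0 ∨ z.2 = p.g z.1 ∨ z.2 = 1)) : z ∈ p.O := by
  push Not at hb
  exact ⟨⟨h.1.1.lt_of_ne' hb.2.1, h.1.2.lt_of_ne hb.1⟩, h.2.1.1.lt_of_ne' hb.2.2.1,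
    h.2.1.2.lt_of_ne hb.2.2.2⟩

lemma ht_nonneg {z : ℝ × ℝ} (h : z ∈ p.M) : 0 ≤ p.ht z := by
  by_cases hb : z.1 = Real.pi ∨ z.1 = 0 ∨ z.2 = p.g z.1 ∨ z.2 = 1
  · exact (p.ht_eq_zero h hb).ge
  · exact (p.ht_pos (p.mem_O_of_mem_M h hb)).le

lemma mem_O_of_ht_pos {z : ℝ × ℝ} (h : z ∈ p.M) (h' : 0 < p.ht z) : z ∈ p.O :=
  p.mem_O_of_mem_M h fun hb => h'.ne' (p.ht_eq_zero h hb)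

lemma ht_eq_zero_iff (h0 : (0:ℝ) ∈ F) (h1 : (1:ℝ) ∈ F) {z : ℝ × ℝ} (h : z ∈ p.M) :
    p.ht z = 0 ↔ (p.toHalf z).2 = 0 := by
  rw [p.toHalf_boundary h0 h1 h]
  exact ⟨fun h2 => by_contra fun hb => (p.ht_pos (p.mem_O_of_mem_M h hb)).ne' h2, p.ht_eq_zero h⟩

lemma isOpen_Om : IsOpen p.Om := by
  have : ContinuousOn cayInv Disk := fun w hw =>
    (continuousAt_cayInv (cayDen_pos hw).ne').continuousWithinAt
  exact this.isOpen_inter_preimage isOpen_Disk p.isOpen_O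

lemma isMinimalGraph_htD : IsMinimalGraph p.Om p.htD := by
  constructor
  · have h1 : ContDiffOn ℝ (⊤ : ℕ∞) p.ht p.O :=
      (p.s.contDiffOn.mono fun z hz => p.mem_strip hz).congr fun z hz =>
        p.ht_eq (Ioo_subset_Icc_self (p.mem_strip hz))
    have h2 : ContDiffOn ℝ (⊤ : ℕ∞) cayInv p.Om := by
      have h3 : ContDiff ℝ (⊤ : ℕ∞) cayDen := by unfold cayDen; fun_prop
      have h4 : ContDiffOn ℝ (⊤ : ℕ∞) (fun p : E2 => -2 * p 1 / cayDen p) p.Om :=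
        ContDiffOn.div (by fun_prop) h3.contDiffOn fun w hw => (cayDen_pos hw.1).ne'
      have h5 : ContDiffOn ℝ (⊤ : ℕ∞) (fun p : E2 => (1 - p 0 ^ 2 - p 1 ^ 2) / cayDen p) p.Om :=
        ContDiffOn.div (by fun_prop) h3.contDiffOn fun w hw => (cayDen_pos hw.1).ne'
      exact h4.prodMk h5
    exact h1.comp h2 fun w hw => hw.2
  · intro w hw
    have hd := fun (a : ℕ) {V V' : ℤ → ℝ → ℝ} {B : ℤ → ℝ} (h : Series.Bdd B V)
      (h' : Series.Bdd B V') (hd : ∀ k y, HasDerivAt (V k) (V' k y) y) (z) (hz : z ∈ p.O) =>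
        Series.hasFDerivAt_S h h' hd a (p.mem_strip hz)
    refine div0_Xfield_comp_cayInv (P := Series.S 1 p.s.U) (Q := Series.S 0 p.s.U')
      (A := Series.S 2 p.s.U) (B := Series.S 1 p.s.U') (C := Series.S 0 p.s.U'') p.isOpen_O
      (fun z hz => ?_) ?_ ?_ (fun z hz => p.s.pde z (p.mem_strip hz)) hw.1 hw.2
    · refine (hd 0 p.s.bU p.s.bU' p.s.hU z hz).congr_of_eventuallyEq ?_
      filter_upwards [p.isOpen_O.mem_nhds hz] with z' hz'
      exact p.ht_eq (Ioo_subset_Icc_self (p.mem_strip hz'))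
    · exact hd 1 p.s.bU p.s.bU' p.s.hU
    · exact hd 0 p.s.bU' p.s.bU'' p.s.hU'

/-- The doubled surface over the closed domain. -/
def surf : Set (E2 × ℝ) := {z | z.1 ∈ Disk ∧ cayInv z.1 ∈ p.M ∧ |z.2| = p.ht (cayInv z.1)}

lemma cay_mem_surf {q : ℝ × ℝ} (hq : q ∈ p.M) {t : ℝ} (ht : |t| = p.ht q) : (cay q, t) ∈ p.surf := by
  have := cayInv_cay hq.2.2.le
  exact ⟨cay_mem_Disk hq.2.2, by rwa [this], by rwa [this]⟩

lemma isClosed_graph_aux : IsClosed {z : (ℝ × ℝ) × ℝ | (z.1.1 ∈ Icc 0 Real.pi ∧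
    p.g z.1.1 ≤ z.1.2 ∧ z.1.2 ≤ 1) ∧ |z.2| = p.ht z.1} := by
  have := p.cont
  have := p.continuous_ht
  have h1 : IsClosed {z : (ℝ × ℝ) × ℝ | p.g z.1.1 ≤ z.1.2} :=
    isClosed_le (by fun_prop) (by fun_prop)
  have h2 : IsClosed {z : (ℝ × ℝ) × ℝ | z.1.2 ≤ 1} := isClosed_le (by fun_prop) (by fun_prop)
  have h3 : IsClosed {z : (ℝ × ℝ) × ℝ | |z.2| = p.ht z.1} :=
    isClosed_eq (by fun_prop) (by fun_prop)
  exact ((isClosed_Icc.preimage (continuous_fst.comp continuous_fst)).inter (h1.inter h2)).inter h3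

lemma mem_closure_O (hF : F ⊆ Icc 0 1) (h0 : (0:ℝ) ∈ F) (h1 : (1:ℝ) ∈ F)
    {q : ℝ × ℝ} (hq : q ∈ p.M) : q ∈ closure p.O := by
  have hH := p.homeoOn_toHalf hF h0 h1
  have hv := hH.mapsTo q hq
  set v := p.toHalf q with hvdef
  have hmem : ∀ ε > 0, (v.1, v.2 + ε) ∈ halfDom F := fun ε hε =>
    ⟨by simp only; linarith [hv.1], fun h => by have := h.1; simp only at this; linarith [hv.1]⟩
  have hO : ∀ ε > 0, p.ofHalf (v.1, v.2 + ε) ∈ p.O := fun ε hε => by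
    have h2 := hH.mapsTo' _ (hmem ε hε)
    refine p.mem_O_of_mem_M h2 ?_
    rw [← p.toHalf_boundary h0 h1 h2, hH.right _ (hmem ε hε)]
    simp only
    linarith [hv.1]
  have hlim : Tendsto (fun ε : ℝ => (v.1, v.2 + ε)) (𝓝[>] 0) (𝓝[halfDom F] v) := by
    refine tendsto_nhdsWithin_iff.2 ⟨?_, eventually_mem_nhdsWithin.mono fun ε hε => hmem ε hε⟩
    have : Continuous (fun ε : ℝ => (v.1, v.2 + ε)) := by fun_prop
    have := this.tendsto 0
    rw [add_zero] at this
    exact this.mono_left nhdsWithin_le_nhds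
  have h3 := (hH.cont' v hv).tendsto.comp hlim
  rw [hvdef, hH.left q hq] at h3
  exact mem_closure_of_tendsto h3 (eventually_mem_nhdsWithin.mono fun ε hε => hO ε hε)

lemma bigraphS_eq (hF : F ⊆ Icc 0 1) (h0 : (0:ℝ) ∈ F) (h1 : (1:ℝ) ∈ F) :
    bigraphS p.Om p.htD = p.surf := by
  apply Subset.antisymm
  · rintro ⟨w, t⟩ ⟨hz, hw, -⟩
    have hw : w ∈ Disk := hw
    have hc : ContinuousAt (fun z : E2 × ℝ => (cayInv z.1, z.2)) (w, t) :=
      (ContinuousAt.comp (g := cayInv) (f := fun z : E2 × ℝ => z.1) (x := (w, t))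
        (continuousAt_cayInv (cayDen_pos hw).ne') continuousAt_fst).prodMk continuousAt_snd
    have h3 := (mem_closure_iff_frequently.1 hz).mono (q := fun z : E2 × ℝ =>
      (cayInv z.1, z.2) ∈ {z : (ℝ × ℝ) × ℝ | (z.1.1 ∈ Icc 0 Real.pi ∧
        p.g z.1.1 ≤ z.1.2 ∧ z.1.2 ≤ 1) ∧ |z.2| = p.ht z.1}) (by
      rintro ⟨w', t'⟩ ⟨hw', ht'⟩
      have h4 := p.O_subset_M hw'.2
      refine ⟨⟨h4.1, h4.2.1⟩, ?_⟩
      have h5 : 0 < p.htD w' := p.ht_pos hw'.2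
      change |t'| = p.htD w'
      rcases ht' with ht' | ht' <;> simp only at ht' <;> rw [ht']
      · exact abs_of_pos h5
      · rw [abs_neg, abs_of_pos h5])
    obtain ⟨h4, h5⟩ := p.isClosed_graph_aux.mem_of_frequently_of_tendsto h3 hc
    exact ⟨hw, ⟨h4.1, h4.2, cayInv_snd_pos hw⟩, h5⟩
  · rintro ⟨w, t⟩ ⟨hw, hM, ht⟩
    simp only at hw hM ht
    refine ⟨?_, hw, mem_univ _⟩
    rcases (p.ht_nonneg hM).lt_or_eq with h | h
    · refine subset_closure ⟨⟨hw, p.mem_O_of_ht_pos hM h⟩, ?_⟩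
      exact eq_or_eq_neg_of_abs_eq ht
    · have ht0 : t = 0 := by rw [← h] at ht; exact abs_eq_zero.1 ht
      have h2 := p.mem_closure_O hF h0 h1 hM
      have hc : ContinuousAt (fun q => (cay q, p.ht q)) (cayInv w) :=
        (continuousAt_cay hM.2.2.le).prodMk p.continuous_ht.continuousAt
      have h3 := mem_closure_image hc h2
      rw [cay_cayInv hw, ← h, ← ht0] at h3
      refine closure_mono ?_ h3
      rintro _ ⟨q, hq, rfl⟩
      have hq2 := (p.mem_strip hq).1
      have h4 := cayInv_cay hq2.le
      exact ⟨⟨cay_mem_Disk hq2, by rwa [h4]⟩, Or.inl (by simp only [htD]; rw [h4])⟩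

def toPlane (z : E2 × ℝ) : ℝ × ℝ :=
  ((p.toHalf (cayInv z.1)).1, Real.sign z.2 * (p.toHalf (cayInv z.1)).2)

def ofPlane (v : ℝ × ℝ) : E2 × ℝ :=
  (cay (p.ofHalf (v.1, |v.2|)), Real.sign v.2 * p.ht (p.ofHalf (v.1, |v.2|)))

lemma homeoOn_toPlane (hF : F ⊆ Icc 0 1) (h0 : (0:ℝ) ∈ F) (h1 : (1:ℝ) ∈ F) :
    HomeoOn p.toPlane p.ofPlane p.surf
    {v : ℝ × ℝ | ¬ (v.2 = 0 ∧ v.1 ≠ 0 ∧ v.1⁻¹ ∈ F)} := by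
  have hH := p.homeoOn_toHalf hF h0 h1
  have hz0 : ∀ z ∈ p.surf, z.2 = 0 ↔ (p.toHalf (cayInv z.1)).2 = 0 := fun z hz => by
    rw [← p.ht_eq_zero_iff h0 h1 hz.2.1, ← hz.2.2, abs_eq_zero]
  have habs : ∀ z ∈ p.surf, |(p.toPlane z).2| = (p.toHalf (cayInv z.1)).2 := fun z hz =>
    abs_sign_mul (hH.mapsTo _ hz.2.1).1 (hz0 z hz).1
  have hmem : ∀ v ∈ {v : ℝ × ℝ | ¬ (v.2 = 0 ∧ v.1 ≠ 0 ∧ v.1⁻¹ ∈ F)}, (v.1, |v.2|) ∈ halfDom F :=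
    fun v hv => ⟨abs_nonneg _, fun h => hv ⟨abs_eq_zero.1 h.1, h.2⟩⟩
  have hv0 : ∀ v ∈ {v : ℝ × ℝ | ¬ (v.2 = 0 ∧ v.1 ≠ 0 ∧ v.1⁻¹ ∈ F)},
      v.2 = 0 ↔ p.ht (p.ofHalf (v.1, |v.2|)) = 0 := fun v hv => by
    rw [p.ht_eq_zero_iff h0 h1 (hH.mapsTo' _ (hmem v hv)), hH.right _ (hmem v hv), abs_eq_zero]
  have hinv : ∀ v ∈ {v : ℝ × ℝ | ¬ (v.2 = 0 ∧ v.1 ≠ 0 ∧ v.1⁻¹ ∈ F)},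
      cayInv (p.ofPlane v).1 = p.ofHalf (v.1, |v.2|) := fun v hv =>
    cayInv_cay (hH.mapsTo' _ (hmem v hv)).2.2.le
  have hcI : ContinuousOn (fun z : E2 × ℝ => cayInv z.1) p.surf := fun z hz =>
    (ContinuousAt.comp (g := cayInv) (f := fun z : E2 × ℝ => z.1) (x := z)
      (continuousAt_cayInv (cayDen_pos hz.1).ne') continuousAt_fst).continuousWithinAt
  have hcT : ContinuousOn (fun z : E2 × ℝ => p.toHalf (cayInv z.1)) p.surf :=
    hH.cont.comp hcI fun z hz => hz.2.1
  have hcO : ContinuousOn (fun v : ℝ × ℝ => p.ofHalf (v.1, |v.2|))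
      {v : ℝ × ℝ | ¬ (v.2 = 0 ∧ v.1 ≠ 0 ∧ v.1⁻¹ ∈ F)} :=
    hH.cont'.comp (by fun_prop) hmem
  refine ⟨fun z hz => ?_, fun v hv => ?_, fun z hz => ?_, fun v hv => ?_, ?_, ?_⟩
  · rintro ⟨a, b⟩
    refine (hH.mapsTo _ hz.2.1).2 ⟨?_, b⟩
    rw [← habs z hz, a, abs_zero]
  · have h2 := hH.mapsTo' _ (hmem v hv)
    exact p.cay_mem_surf h2 (abs_sign_mul (p.ht_nonneg h2) (hv0 v hv).1)
  · have h2 : p.ofHalf ((p.toPlane z).1, |(p.toPlane z).2|) = cayInv z.1 := by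
      rw [habs z hz]
      exact hH.left _ hz.2.1
    refine Prod.ext ?_ ?_
    · change cay (p.ofHalf ((p.toPlane z).1, |(p.toPlane z).2|)) = _
      rw [h2, cay_cayInv hz.1]
    · change Real.sign (p.toPlane z).2 * p.ht (p.ofHalf ((p.toPlane z).1, |(p.toPlane z).2|)) = _
      rw [h2, ← hz.2.2]
      exact sign_sign_mul_mul_abs (hH.mapsTo _ hz.2.1).1 (hz0 z hz).2
  · have h2 := hH.mapsTo' _ (hmem v hv)
    have h3 : p.toHalf (cayInv (p.ofPlane v).1) = (v.1, |v.2|) := by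
      rw [hinv v hv, hH.right _ (hmem v hv)]
    refine Prod.ext ?_ ?_
    · change (p.toHalf (cayInv (p.ofPlane v).1)).1 = _
      rw [h3]
    · change Real.sign (p.ofPlane v).2 * (p.toHalf (cayInv (p.ofPlane v).1)).2 = _
      rw [h3]
      exact sign_sign_mul_mul_abs (p.ht_nonneg h2) (hv0 v hv).2
  · exact (continuous_fst.comp_continuousOn hcT).prodMk (continuousOn_sign_mul
      continuousOn_snd (continuous_snd.comp_continuousOn hcT) fun z hz => (hz0 z hz).1)
  · refine ContinuousOn.prodMk (fun v hv => ?_) (continuousOn_sign_mul continuousOn_snd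
      (p.continuous_ht.comp_continuousOn hcO) fun v hv => (hv0 v hv).1)
    exact ContinuousAt.comp_continuousWithinAt (g := cay)
      (f := fun v : ℝ × ℝ => p.ofHalf (v.1, |v.2|))
      (continuousAt_cay (hH.mapsTo' _ (hmem v hv)).2.2.le) (hcO v hv)

lemma surf_inter : p.surf ∩ (Disk ×ˢ Ioi (0:ℝ)) = {z : E2 × ℝ | z.1 ∈ p.Om ∧ z.2 = p.htD z.1} := by
  ext ⟨w, t⟩
  constructor
  · rintro ⟨⟨hw, hM, ht⟩, -, h⟩
    have h : 0 < t := h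
    simp only at hw hM ht
    rw [abs_of_pos h] at ht
    exact ⟨⟨hw, p.mem_O_of_ht_pos hM (ht ▸ h)⟩, ht⟩
  · rintro ⟨⟨hw, hO⟩, ht⟩
    have h := p.ht_pos hO
    simp only at hw hO ht
    have h2 : 0 < t := by rw [ht]; exact h
    exact ⟨⟨hw, p.O_subset_M hO, by simp only; rw [abs_of_pos h2]; exact ht⟩, hw, h2⟩

end Profile

namespace Profile

variable {F : Set ℝ} (p : Profile F)

/-- The part of the closed domain over `J` below the height `c`. -/
def slab (J : Set ℝ) (c : ℝ) : Set (ℝ × ℝ) := {z | z.1 ∈ J ∧ p.g z.1 ≤ z.2 ∧ 0 < z.2 ∧ z.2 < c}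

lemma slab_subset_M {J : Set ℝ} {c : ℝ} (hJ : J ⊆ Icc 0 Real.pi) (hc : c ≤ 1) :
    p.slab J c ⊆ p.M := fun _ hz => ⟨hJ hz.1, ⟨hz.2.1, hz.2.2.2.le.trans hc⟩, hz.2.2.1⟩

lemma isPreconnected_slab {J : Set ℝ} {c : ℝ} (hJ : J.OrdConnected) (hc : 0 < c)
    (hg : ∀ x ∈ J, p.g x < c / 2) : IsPreconnected (p.slab J c) := by
  rcases J.eq_empty_or_nonempty with rfl | ⟨x₀, hx₀⟩
  · convert isPreconnected_empty
    ext z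
    simp [slab]
  refine isPreconnected_of_forall (x₀, c / 2) fun z hz => ?_
  obtain ⟨hz1, hz2, hz3, hz4⟩ := hz
  refine ⟨({z.1} ×ˢ uIcc z.2 (c / 2)) ∪ (J ×ˢ {c / 2}), ?_, Or.inr ⟨hx₀, rfl⟩,
    Or.inl ⟨rfl, left_mem_uIcc⟩, ?_⟩
  · rintro ⟨x, y⟩ (⟨h1, h2⟩ | ⟨h1, h2⟩)
    · have h1 : x = z.1 := h1
      have h2 : y ∈ Icc (min z.2 (c / 2)) (max z.2 (c / 2)) := h2
      subst h1
      have h3 := hg _ hz1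
      exact ⟨hz1, (le_min hz2 h3.le).trans h2.1, (lt_min hz3 (half_pos hc)).trans_le h2.1,
        h2.2.trans_lt (max_lt hz4 (half_lt_self hc))⟩
    · have h2 : y = c / 2 := h2
      subst h2
      exact ⟨h1, (hg _ h1).le, half_pos hc, half_lt_self hc⟩
  · exact IsPreconnected.union (z.1, c / 2) ⟨rfl, right_mem_uIcc⟩ ⟨hz1, rfl⟩
      (isPreconnected_singleton.prod isPreconnected_uIcc)
      (hJ.isPreconnected.prod isPreconnected_singleton)

lemma isPreconnected_surf_slab {J : Set ℝ} {c : ℝ} (hJ : J.OrdConnected)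
    (hJ' : J ⊆ Icc 0 Real.pi) (hc : 0 < c) (hc' : c ≤ 1) (hg : ∀ x ∈ J, p.g x < c / 2)
    (hq : ∃ q ∈ p.slab J c, p.ht q = 0) :
    IsPreconnected {z : E2 × ℝ | z ∈ p.surf ∧ cayInv z.1 ∈ p.slab J c} := by
  have hN := p.isPreconnected_slab hJ hc hg
  have hcont : ∀ σ : ℝ, ContinuousOn (fun q : ℝ × ℝ => (cay q, σ * p.ht q)) (p.slab J c) :=
    fun σ q hq => ((continuousAt_cay hq.2.2.1.le).prodMk
      (p.continuous_ht.continuousAt.const_mul σ)).continuousWithinAt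
  obtain ⟨q, hq, hq0⟩ := hq
  have hmem : ∀ σ : ℝ, (cay q, (0:ℝ)) ∈ (fun q => (cay q, σ * p.ht q)) '' p.slab J c :=
    fun σ => ⟨q, hq, by simp [hq0]⟩
  have h1 := IsPreconnected.union (cay q, 0) (hmem 1) (hmem (-1))
    (hN.image _ (hcont 1)) (hN.image _ (hcont (-1)))
  convert h1
  ext ⟨w, t⟩
  constructor
  · rintro ⟨⟨hw, hM, ht⟩, hz⟩
    simp only at hw hM ht hz
    rcases eq_or_eq_neg_of_abs_eq ht with h | h
    · exact Or.inl ⟨_, hz, Prod.ext (cay_cayInv hw) (by simp [h])⟩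
    · exact Or.inr ⟨_, hz, Prod.ext (cay_cayInv hw) (by simp [h])⟩
  · have h2 : ∀ σ : ℝ, |σ| = 1 → ∀ q' ∈ p.slab J c,
        (cay q', σ * p.ht q') ∈ {z : E2 × ℝ | z ∈ p.surf ∧ cayInv z.1 ∈ p.slab J c} :=
      fun σ hσ q' hq' => by
        have h3 := p.slab_subset_M hJ' hc' hq'
        refine ⟨p.cay_mem_surf h3 ?_, ?_⟩
        · rw [abs_mul, hσ, one_mul, abs_of_nonneg (p.ht_nonneg h3)]
        · change cayInv (cay q') ∈ _
          rwa [cayInv_cay hq'.2.2.1.le]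
    rintro (⟨q', hq', h⟩ | ⟨q', hq', h⟩)
    · rw [← h]; exact h2 1 (by simp) q' hq'
    · rw [← h]; exact h2 (-1) (by simp) q' hq'

lemma exists_slab (hF : interior F = ∅) {x₀ c : ℝ} (hx : x₀ ∈ Icc 0 Real.pi) (hg : p.g x₀ = 0)
    (hc : 0 < c) (hc' : c ≤ 1) : ∃ J ∈ 𝓝 x₀, J.OrdConnected ∧ (∀ x ∈ J, p.g x < c / 2) ∧
      ∃ q ∈ p.slab (J ∩ Icc 0 Real.pi) c, p.ht q = 0 := by
  have hnh : {x | p.g x < c / 2} ∈ 𝓝 x₀ :=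
    (isOpen_lt p.cont continuous_const).mem_nhds (by change p.g x₀ < c / 2; rw [hg]; linarith)
  have hJn : ordConnectedComponent {x | p.g x < c / 2} x₀ ∈ 𝓝 x₀ :=
    ordConnectedComponent_mem_nhds.2 hnh
  have hJs : ∀ x ∈ ordConnectedComponent {x | p.g x < c / 2} x₀, p.g x < c / 2 := fun x h => by
    have h1 : x ∈ {x | p.g x < c / 2} := ordConnectedComponent_subset h
    exact h1
  refine ⟨_, hJn, inferInstance, hJs, ?_⟩
  have hend : ∀ e : ℝ, e ∈ Icc 0 Real.pi → (e = Real.pi ∨ e = 0) →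
      (∀ x ∈ uIcc x₀ e, p.g x ≤ 0) →
      ∃ q ∈ p.slab (ordConnectedComponent {x | p.g x < c / 2} x₀ ∩ Icc 0 Real.pi) c,
        p.ht q = 0 := fun e he hb hx => by
    have h1 : (e, c / 2) ∈
        p.slab (ordConnectedComponent {x | p.g x < c / 2} x₀ ∩ Icc 0 Real.pi) c :=
      ⟨⟨fun x hx' => (hx x hx').trans_lt (half_pos hc), he⟩,
        (hx e right_mem_uIcc).trans (half_pos hc).le, half_pos hc, half_lt_self hc⟩
    refine ⟨_, h1, p.ht_eq_zero (p.slab_subset_M inter_subset_right hc' h1) ?_⟩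
    rcases hb with h | h
    · exact Or.inl h
    · exact Or.inr (Or.inl h)
  have hτ := p.τ_pos
  rcases le_or_gt 1 ((Real.cos x₀ + p.τ) / (2 * p.τ)) with ha | ha
  · refine hend 0 ⟨le_rfl, Real.pi_pos.le⟩ (Or.inr rfl) fun x hx' => ?_
    rw [uIcc_of_ge hx.1] at hx'
    refine not_lt.1 fun h => ?_
    have h2 := ((p.g_pos_iff ⟨hx'.1, hx'.2.trans hx.2⟩).1 h).1.2
    have h3 := Real.cos_le_cos_of_nonneg_of_le_pi hx'.1 hx.2 hx'.2
    have h4 : (Real.cos x₀ + p.τ) / (2 * p.τ) ≤ (Real.cos x + p.τ) / (2 * p.τ) := by gcongr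
    linarith
  rcases le_or_gt ((Real.cos x₀ + p.τ) / (2 * p.τ)) 0 with hb | hb
  · refine hend Real.pi ⟨Real.pi_pos.le, le_rfl⟩ (Or.inl rfl) fun x hx' => ?_
    rw [uIcc_of_le hx.2] at hx'
    refine not_lt.1 fun h => ?_
    have h2 := ((p.g_pos_iff ⟨hx.1.trans hx'.1, hx'.2⟩).1 h).1.1
    have h3 := Real.cos_le_cos_of_nonneg_of_le_pi hx.1 hx'.2 hx'.1
    have h4 : (Real.cos x + p.τ) / (2 * p.τ) ≤ (Real.cos x₀ + p.τ) / (2 * p.τ) := by gcongr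
    linarith
  set a₀ := (Real.cos x₀ + p.τ) / (2 * p.τ) with ha₀
  have h1 : Real.arccos (2 * p.τ * a₀ - p.τ) = x₀ := by
    have : 2 * p.τ * a₀ - p.τ = Real.cos x₀ := by rw [ha₀]; field_simp; ring
    rw [this, Real.arccos_cos hx.1 hx.2]
  have hcon : ContinuousAt (fun a => Real.arccos (2 * p.τ * a - p.τ)) a₀ := by
    have : Continuous (fun a => Real.arccos (2 * p.τ * a - p.τ)) :=
      Real.continuous_arccos.comp (by fun_prop)
    exact this.continuousAt
  have h2 := inter_mem (hcon.preimage_mem_nhds (by simp only [h1]; exact hJn))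
    (Ioo_mem_nhds hb ha)
  obtain ⟨a, ⟨haJ, ha1⟩, haF⟩ : ∃ a ∈ ((fun a => Real.arccos (2 * p.τ * a - p.τ)) ⁻¹'
      (ordConnectedComponent {x | p.g x < c / 2} x₀)) ∩ Ioo 0 1, a ∉ F := by
    by_contra! hsub
    have : a₀ ∈ interior F := mem_interior_iff_mem_nhds.2 (mem_of_superset h2 hsub)
    rw [hF] at this
    exact this
  have hτ1 := p.τ_lt
  set x := Real.arccos (2 * p.τ * a - p.τ) with hxdef
  have hxI : x ∈ Icc 0 Real.pi := ⟨Real.arccos_nonneg _, Real.arccos_le_pi _⟩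
  have hcos : (Real.cos x + p.τ) / (2 * p.τ) = a := by
    rw [hxdef, Real.cos_arccos (by nlinarith [ha1.1]) (by nlinarith [ha1.2])]
    field_simp
    ring
  have hgx : 0 < p.g x := (p.g_pos_iff hxI).2 (by rw [hcos]; exact ⟨ha1, haF⟩)
  have hgx' : p.g x < c / 2 := hJs x haJ
  have hs : (x, p.g x) ∈ p.slab (ordConnectedComponent {x | p.g x < c / 2} x₀ ∩ Icc 0 Real.pi) c :=
    ⟨⟨haJ, hxI⟩, le_rfl, hgx, by simp only; linarith⟩
  exact ⟨_, hs, p.ht_eq_zero (p.slab_subset_M inter_subset_right hc' hs) (Or.inr (Or.inr (Or.inl rfl)))⟩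

lemma exists_height_le {K : Set (E2 × ℝ)} (hK : IsCompact K) (hKS : K ⊆ p.surf) :
    ∃ c, 0 < c ∧ c ≤ 1 ∧ ∀ z ∈ K, c ≤ (cayInv z.1).2 := by
  rcases K.eq_empty_or_nonempty with rfl | hne
  · exact ⟨1, one_pos, le_rfl, fun z hz => hz.elim⟩
  have hc : ContinuousOn (fun z : E2 × ℝ => (cayInv z.1).2) K := fun z hz =>
    (continuousAt_snd.comp (ContinuousAt.comp (g := cayInv) (f := fun z : E2 × ℝ => z.1) (x := z)
      (continuousAt_cayInv (cayDen_pos (hKS hz).1).ne') continuousAt_fst)).continuousWithinAt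
  obtain ⟨z₀, hz₀, hmin⟩ := hK.exists_isMinOn hne hc
  have h := (hKS hz₀).2.1
  exact ⟨_, h.2.2, h.2.1.2, fun z hz => hmin hz⟩

lemma exists_of_mem_closure {w : E2 × EReal} (hw : w ∈ closure (toBar '' p.surf))
    (hw' : w ∈ idealBoundary) : ∃ x ∈ Icc 0 Real.pi, p.g x = 0 ∧ w.1 = cay (x, 0) := by
  have hcp : IsCompact {z : ℝ × ℝ | z ∈ Icc (0:ℝ) Real.pi ×ˢ Icc (0:ℝ) 1 ∧ p.g z.1 ≤ z.2} :=
    (isCompact_Icc.prod isCompact_Icc).inter_right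
      (isClosed_le (p.cont.comp continuous_fst) continuous_snd)
  obtain ⟨B, hB⟩ := hcp.exists_bound_of_continuousOn p.continuous_ht.continuousOn
  have hcl : IsClosed ((cay '' {z : ℝ × ℝ | z ∈ Icc (0:ℝ) Real.pi ×ˢ Icc (0:ℝ) 1 ∧
      p.g z.1 ≤ z.2}) ×ˢ Icc (((-B : ℝ) : EReal)) (B : EReal)) := by
    refine IsClosed.prod (hcp.image_of_continuousOn fun z hz => ?_).isClosed isClosed_Icc
    exact (continuousAt_cay hz.1.2.1).continuousWithinAt
  obtain ⟨⟨q, hq, hqw⟩, hw2⟩ := closure_minimal (by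
    rintro _ ⟨z, ⟨hz1, hz2, hz3⟩, rfl⟩
    have h4 : cayInv z.1 ∈ {z : ℝ × ℝ | z ∈ Icc (0:ℝ) Real.pi ×ˢ Icc (0:ℝ) 1 ∧
        p.g z.1 ≤ z.2} := ⟨⟨hz2.1, hz2.2.2.le, hz2.2.1.2⟩, hz2.2.1.1⟩
    have h5 := hB _ h4
    rw [← hz3, Real.norm_eq_abs, abs_abs, abs_le] at h5
    exact ⟨⟨_, h4, cay_cayInv hz1⟩, EReal.coe_le_coe_iff.2 h5.1, EReal.coe_le_coe_iff.2 h5.2⟩)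
    hcl hw
  have h6 : ¬ ‖w.1‖ < 1 := fun h => hw'.2 ⟨h,
    (hw2.2.trans_lt (EReal.coe_lt_top B)).ne, ((EReal.bot_lt_coe (-B)).trans_le hw2.1).ne'⟩
  have h7 : q.2 = 0 := le_antisymm (not_lt.1 fun h => h6 (by
    rw [← hqw]; exact cay_mem_Disk h)) hq.1.2.1
  refine ⟨q.1, hq.1.1, le_antisymm (h7 ▸ hq.2) (p.nonneg _), ?_⟩
  rw [← hqw, ← h7]

lemma disjoint_limitSet (hF : interior F = ∅) (E₁ E₂ : SetEnd p.surf)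
    (h : ∃ K : Set (E2 × ℝ), IsCompact K ∧ K ⊆ p.surf ∧ E₁.sel K ≠ E₂.sel K) :
    Disjoint (limitSet E₁) (limitSet E₂) := by
  obtain ⟨K, hK, hKS, hne⟩ := h
  refine Set.disjoint_left.2 fun w hw₁ hw₂ => hne ?_
  have hcl : ∀ E : SetEnd p.surf, w ∈ limitSet E → w ∈ closure (toBar '' E.sel K) := fun E hE =>
    mem_iInter₂.1 hE.1 K ⟨hK, hKS⟩
  have hsub : ∀ E : SetEnd p.surf, E.sel K ⊆ p.surf \ K := fun E => by
    obtain ⟨x, -, h⟩ := E.isCC K hK hKS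
    rw [h]
    exact connectedComponentIn_subset _ _
  obtain ⟨c, hc, hc1, hcK⟩ := p.exists_height_le hK hKS
  obtain ⟨x₀, hx₀, hg, hwx⟩ := p.exists_of_mem_closure
    (closure_mono (image_mono ((hsub E₁).trans sdiff_subset)) (hcl E₁ hw₁)) hw₁.2
  obtain ⟨J, hJn, hJo, hJg, hJq⟩ := p.exists_slab hF hx₀ hg hc hc1
  have hpre := p.isPreconnected_surf_slab (hJo.inter ordConnected_Icc) inter_subset_right hc hc1
    (fun x hx => hJg x hx.1) hJq
  have hD : {z : E2 × ℝ | z ∈ p.surf ∧ cayInv z.1 ∈ p.slab (J ∩ Icc 0 Real.pi) c} ⊆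
      p.surf \ K := fun z hz => ⟨hz.1, fun hzK => (hcK z hzK).not_gt hz.2.2.2.2⟩
  have hW : {w' : E2 × EReal | cayInv w'.1 ∈ J ×ˢ Iio c} ∈ 𝓝 w := by
    have h1 : ContinuousAt (fun w' : E2 × EReal => cayInv w'.1) w :=
      ContinuousAt.comp (g := cayInv) (f := fun w' : E2 × EReal => w'.1) (x := w)
        (continuousAt_cayInv (by rw [hwx]; exact (cayDen_cay_pos le_rfl).ne')) continuousAt_fst
    refine h1.preimage_mem_nhds ?_
    rw [hwx, cayInv_cay le_rfl]
    exact prod_mem_nhds hJn (Iio_mem_nhds hc)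
  have hz : ∀ E : SetEnd p.surf, w ∈ limitSet E → ∃ z ∈ E.sel K,
      z ∈ p.surf ∧ cayInv z.1 ∈ p.slab (J ∩ Icc 0 Real.pi) c := fun E hE => by
    obtain ⟨_, hw', z, hz, rfl⟩ := mem_closure_iff_nhds.1 (hcl E hE) _ hW
    have h1 := (hsub E hz).1
    exact ⟨z, hz, h1, ⟨hw'.1, h1.2.1.1⟩, h1.2.1.2.1.1, h1.2.1.2.2, hw'.2⟩
  obtain ⟨z₁, hz₁, hd₁⟩ := hz E₁ hw₁
  obtain ⟨z₂, hz₂, hd₂⟩ := hz E₂ hw₂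
  obtain ⟨x₁, -, he₁⟩ := E₁.isCC K hK hKS
  obtain ⟨x₂, -, he₂⟩ := E₂.isCC K hK hKS
  rw [he₁] at hz₁ ⊢
  rw [he₂] at hz₂ ⊢
  rw [connectedComponentIn_eq hz₁, connectedComponentIn_eq hz₂]
  exact connectedComponentIn_eq (hpre.subset_connectedComponentIn hd₁ hD hd₂)

end Profile

/-- **Main theorem, items (1) and (3)** (Theorem `th:main`): every non-simply connected
planar domain can be properly minimally embedded in `𝔻 × ℝ` as a symmetric vertical
bigraph, in such a way that distinct ends have disjoint limit sets in
`∂∞(𝔻 × ℝ)`. -/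
theorem planar_domain_minimal_bigraph_disjoint_limit_sets (Sg : Set (ℝ × ℝ))
    (hne : Sg.Nonempty) (hop : IsOpen Sg) (hconn : IsConnected Sg)
    (hnsc : ¬ SimplyConnectedSpace Sg) :
    ∃ (Ω : Set E2) (u : E2 → ℝ), IsOpen Ω ∧ Ω ⊆ Disk ∧ IsMinimalGraph Ω u ∧
      (∀ x ∈ Ω, 0 < u x) ∧
      Nonempty (↥(bigraphS Ω u) ≃ₜ ↥Sg) ∧
      bigraphS Ω u ∩ (Disk ×ˢ Ioi (0:ℝ)) = {z : E2 × ℝ | z.1 ∈ Ω ∧ z.2 = u z.1} ∧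
      (∀ z : E2 × ℝ, z ∈ bigraphS Ω u → (z.1, -z.2) ∈ bigraphS Ω u) ∧
      (∀ E₁ E₂ : SetEnd (bigraphS Ω u),
        (∃ K : Set (E2 × ℝ), IsCompact K ∧ K ⊆ bigraphS Ω u ∧ E₁.sel K ≠ E₂.sel K) →
        Disjoint (limitSet E₁) (limitSet E₂)) := by
  obtain ⟨F, hF, hF01, h0, h1, hFi, ⟨φ⟩⟩ := planar_domain_homeo Sg hne hop hconn hnsc
  obtain ⟨p⟩ := exists_profile hF.isClosed h0 h1
  refine ⟨p.Om, p.htD, p.isOpen_Om, fun w hw => hw.1, p.isMinimalGraph_htD,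
    fun w hw => p.ht_pos hw.2, ?_⟩
  rw [p.bigraphS_eq hF01 h0 h1]
  exact ⟨⟨(p.homeoOn_toPlane hF01 h0 h1).toHomeomorph.trans φ.symm⟩, p.surf_inter,
    fun z hz => ⟨hz.1, hz.2.1, (abs_neg z.2).trans hz.2.2⟩, p.disjoint_limitSet hFi⟩

end
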